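/- Let D be a bounded open connected subset of R^d, a ∈ (0,|D|), and let Ω* be any solution of the problem: minimize λ₁(Ω) over open Ω ⊂ D with |Ω| = a. Then there exists a constant Λ > 0 such that, in the sense of distributions in D, Δu_{Ω*} + λ₁(Ω*)·u_{Ω*} = √Λ · H^{d−1}⌊∂Ω*, where H^{d−1}⌊∂Ω* denotes the restriction of the (d−1)-dimensional Hausdorff measure to ∂Ω*. -/

import Mathlib

open MeasureTheory Filter Metric Set
open scoped RealInnerProductSpace ENNReal Topology NNReal

noncomputable section

abbrev Euc (d : ℕ) := EuclideanSpace ℝ (Fin d)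

variable {d : ℕ}

/-- Real-valued Lebesgue volume of a set. -/
def mvol (s : Set (Euc d)) : ℝ := (volume s).toReal

/-- Smooth scalar test function compactly supported in `Ω`. -/
def TestFun (Ω : Set (Euc d)) (φ : Euc d → ℝ) : Prop :=
  ContDiff ℝ (⊤ : ℕ∞) φ ∧ HasCompactSupport φ ∧ tsupport φ ⊆ Ω

/-- Smooth vector field compactly supported in `Ω`. -/
def VecTestFun (Ω : Set (Euc d)) (Φ : Euc d → Euc d) : Prop :=
  ContDiff ℝ (⊤ : ℕ∞) Φ ∧ HasCompactSupport Φ ∧ tsupport Φ ⊆ Ω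

/-- Membership in `H¹₀(Ω)`, encoded through `L²` integrability of the function and of its
(a.e. defined) gradient, together with approximation in the `H¹` norm by smooth functions
compactly supported in `Ω`. -/
def MemH10 (Ω : Set (Euc d)) (v : Euc d → ℝ) : Prop :=
  MemLp v 2 (volume : Measure (Euc d)) ∧
  MemLp (fun x => gradient v x) 2 (volume : Measure (Euc d)) ∧
  ∃ φ : ℕ → Euc d → ℝ, (∀ n, TestFun Ω (φ n)) ∧
    Tendsto (fun n => ∫ x, ((v x - φ n x) ^ 2 + ‖gradient v x - gradient (φ n) x‖ ^ 2))
      atTop (nhds 0)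

/-- First Dirichlet eigenvalue of `Ω`, via the Rayleigh quotient variational characterization. -/
def lam1 (Ω : Set (Euc d)) : ℝ :=
  sInf {t : ℝ | ∃ v : Euc d → ℝ, MemH10 Ω v ∧ (∫ x, (v x) ^ 2) = 1 ∧
    t = ∫ x, ‖gradient v x‖ ^ 2}

/-- `u` is a normalized first Dirichlet eigenfunction of `Ω`. -/
def IsFirstEigenfun (Ω : Set (Euc d)) (u : Euc d → ℝ) : Prop :=
  MemH10 Ω u ∧ (∫ x, (u x) ^ 2) = 1 ∧ (∫ x, ‖gradient u x‖ ^ 2) = lam1 Ω ∧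
  ∀ φ : Euc d → ℝ, TestFun Ω φ →
    (∫ x, ⟪gradient u x, gradient φ x⟫) = lam1 Ω * ∫ x, u x * φ x

/-- `Ω` solves the shape optimization problem: it minimizes `λ₁` among open subsets of `D` of
measure `a`. -/
structure IsOptimalShape (D : Set (Euc d)) (a : ℝ) (Ω : Set (Euc d)) : Prop where
  isOpen : IsOpen Ω
  subset : Ω ⊆ D
  meas : mvol Ω = a
  minim : ∀ Ω' : Set (Euc d), IsOpen Ω' → Ω' ⊆ D → mvol Ω' = a → lam1 Ω ≤ lam1 Ω'

/-- `u` is locally Lipschitz continuous in `s`. -/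
def LocLipOn (s : Set (Euc d)) (u : Euc d → ℝ) : Prop :=
  ∀ x ∈ s, ∃ t, t ∈ 𝓝 x ∧ t ⊆ s ∧ ∃ K : ℝ≥0, LipschitzOnWith K u t

/-- Divergence of a vector field. -/
def divg (Φ : Euc d → Euc d) (x : Euc d) : ℝ :=
  ∑ i, fderiv ℝ Φ x (EuclideanSpace.single i 1) i

/-- `Ω` has locally finite perimeter in `D` (its characteristic function has locally bounded
variation in `D`). -/
def HasLocFinPerimeterIn (D Ω : Set (Euc d)) : Prop :=
  ∀ K : Set (Euc d), IsCompact K → K ⊆ D → ∃ C : ℝ,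
    ∀ Φ : Euc d → Euc d, VecTestFun K Φ → (∀ x, ‖Φ x‖ ≤ 1) →
      (∫ x in Ω, divg Φ x) ≤ C

/-- The reduced boundary of `Ω`: points where `Ω` blows up to a half space, in the sense that the
symmetric difference with a half space is of vanishing density. -/
def reducedBoundary (Ω : Set (Euc d)) : Set (Euc d) :=
  {x | ∃ ν : Euc d, ‖ν‖ = 1 ∧
    Tendsto (fun r : ℝ =>
        volume (symmDiff (Ω ∩ ball x r) ({y | ⟪y - x, ν⟫ ≤ 0} ∩ ball x r)) /
          ENNReal.ofReal (r ^ d))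
      (𝓝[>] 0) (𝓝 0)}

/-- `S` is an analytic hypersurface in `D`: near each of its points in `D` it is the zero set of
an analytic function with nonvanishing gradient. -/
def IsAnalyticHypersurfaceIn (D S : Set (Euc d)) : Prop :=
  ∀ x ∈ S ∩ D, ∃ U : Set (Euc d), IsOpen U ∧ x ∈ U ∧ U ⊆ D ∧
    ∃ f : Euc d → ℝ, AnalyticOn ℝ f U ∧ (∀ y ∈ U, fderiv ℝ f y ≠ 0) ∧
      S ∩ U = {y ∈ U | f y = 0}

/-- The functional `J(v) = ∫ |∇v|² - λ ∫ v²`. -/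
def Jfun (lam : ℝ) (v : Euc d → ℝ) : ℝ :=
  (∫ x, ‖gradient v x‖ ^ 2) - lam * ∫ x, (v x) ^ 2

/-- `Ω_v = {x ∈ D : v(x) ≠ 0}`. -/
def Om (D : Set (Euc d)) (v : Euc d → ℝ) : Set (Euc d) := {x ∈ D | v x ≠ 0}

/-- The optimal value `λ_a` of `λ₁` among open subsets of `D` of measure `a`. -/
def lamOpt (D : Set (Euc d)) (a : ℝ) : ℝ :=
  sInf {t : ℝ | ∃ Ω : Set (Euc d), IsOpen Ω ∧ Ω ⊆ D ∧ mvol Ω = a ∧ t = lam1 Ω}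

/-- `u` minimizes `J` among functions of `H¹₀(D)` with `|Ω_w| ≤ a`. -/
def IsJMinimizer (D : Set (Euc d)) (a lam : ℝ) (u : Euc d → ℝ) : Prop :=
  MemH10 D u ∧ mvol (Om D u) ≤ a ∧
  ∀ w : Euc d → ℝ, MemH10 D w → mvol (Om D w) ≤ a → Jfun lam u ≤ Jfun lam w

/-- The class `F` of perturbations of `u` supported in `B`. -/
def Fcal (D B : Set (Euc d)) (u v : Euc d → ℝ) : Prop :=
  MemH10 D v ∧ MemH10 B (fun x => u x - v x)

/-- The set of penalization constants `μ₋` admissible for `h` (inward perturbations). -/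
def Mminus (D : Set (Euc d)) (a lam : ℝ) (u : Euc d → ℝ) (B : Set (Euc d)) (h : ℝ) :
    Set ℝ :=
  {μ : ℝ | 0 ≤ μ ∧ ∀ v : Euc d → ℝ, Fcal D B u v →
    a - h ≤ mvol (Om D v) → mvol (Om D v) ≤ a →
    Jfun lam u + μ * mvol (Om D u) ≤ Jfun lam v + μ * mvol (Om D v)}

/-- The set of penalization constants `μ₊` admissible for `h` (outward perturbations). -/
def Mplus (D : Set (Euc d)) (a lam : ℝ) (u : Euc d → ℝ) (B : Set (Euc d)) (h : ℝ) :
    Set ℝ :=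
  {μ : ℝ | 0 ≤ μ ∧ ∀ v : Euc d → ℝ, Fcal D B u v →
    a ≤ mvol (Om D v) → mvol (Om D v) ≤ a + h →
    Jfun lam u + μ * mvol (Om D u) ≤ Jfun lam v + μ * mvol (Om D v)}

/-- `μ₋(h)`: the biggest admissible inward penalization constant. -/
def muMinus (D : Set (Euc d)) (a lam : ℝ) (u : Euc d → ℝ) (B : Set (Euc d)) (h : ℝ) : ℝ :=
  sSup (Mminus D a lam u B h)

/-- `μ₊(h)`: the smallest admissible outward penalization constant. -/
def muPlus (D : Set (Euc d)) (a lam : ℝ) (u : Euc d → ℝ) (B : Set (Euc d)) (h : ℝ) : ℝ :=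
  sInf (Mplus D a lam u B h)

/-- Average of `u` on the sphere `∂B(x,r)`, with respect to the `(d-1)`-Hausdorff measure. -/
def sphAvg (u : Euc d → ℝ) (x : Euc d) (r : ℝ) : ℝ :=
  (∫ y in sphere x r, u y ∂(μH[(d : ℝ) - 1])) / ((μH[(d : ℝ) - 1]) (sphere x r)).toReal

variable {D Ω U V S : Set (Euc d)} {a lam q r s c C C' R M T Λ ρ ε δ r₀ : ℝ}
  {u v w φ ψ χ η f g : Euc d → ℝ} {G F X : Euc d → Euc d} {μ : Measure (Euc d)}
  {x y z e e' x₀ g₀ : Euc d} {k : ℕ}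
open ENNReal (ofReal)
local notation "Smooth" => ContDiff ℝ (⊤ : ℕ∞)

/-! ### Convergence in `L²` -/

section L2
variable {α E F : Type*} [MeasurableSpace α] {μ : Measure α}
  [NormedAddCommGroup E] [NormedAddCommGroup F]

/-- Convergence in `L²(μ)` of functions. -/
def L2Lim (μ : Measure α) (f : ℕ → α → E) (g : α → E) : Prop :=
  Tendsto (fun n => eLpNorm (f n - g) 2 μ) atTop (𝓝 0)

lemma L2Lim.of_bound {f : ℕ → α → E} {g : α → E} (h : L2Lim μ f g)
    {f' : ℕ → α → F} {g' : α → F} (C : ℝ)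
    (hb : ∀ n, ∀ᵐ x ∂μ, ‖f' n x - g' x‖ ≤ C * ‖f n x - g x‖) : L2Lim μ f' g' := by
  have h1 : Tendsto (fun n => ofReal C * eLpNorm (f n - g) 2 μ) atTop (𝓝 0) := by
    have := ENNReal.Tendsto.const_mul (a := ofReal C) h (Or.inr ENNReal.ofReal_ne_top)
    simpa using this
  exact tendsto_of_tendsto_of_tendsto_of_le_of_le tendsto_const_nhds h1 (fun _ => zero_le)
    (fun n => eLpNorm_le_mul_eLpNorm_of_ae_le_mul (hb n) 2)

lemma L2Lim.add {f f' : ℕ → α → E} {g g' : α → E} (h : L2Lim μ f g) (h' : L2Lim μ f' g')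
    (m : ∀ n, AEStronglyMeasurable (f n - g) μ) (m' : ∀ n, AEStronglyMeasurable (f' n - g') μ) :
    L2Lim μ (fun n => f n + f' n) (g + g') := by
  have h1 := Tendsto.add h h'
  rw [add_zero] at h1
  refine tendsto_of_tendsto_of_tendsto_of_le_of_le tendsto_const_nhds h1 (fun _ => zero_le)
    (fun n => ?_)
  have : f n + f' n - (g + g') = (f n - g) + (f' n - g') := by abel
  rw [this]
  exact eLpNorm_add_le (m n) (m' n) (by norm_num)

lemma tendsto_integral_inner_of_L2Lim [InnerProductSpace ℝ E]
    {f f' : ℕ → α → E} {g g' : α → E} (h : L2Lim μ f g) (h' : L2Lim μ f' g')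
    (mf : ∀ n, MemLp (f n) 2 μ) (mf' : ∀ n, MemLp (f' n) 2 μ)
    (mg : MemLp g 2 μ) (mg' : MemLp g' 2 μ) :
    Tendsto (fun n => ∫ x, ⟪f n x, f' n x⟫ ∂μ) atTop (𝓝 (∫ x, ⟪g x, g' x⟫ ∂μ)) := by
  have key : ∀ {a b : α → E} (ha : MemLp a 2 μ) (hb : MemLp b 2 μ),
      ∫ x, ⟪a x, b x⟫ ∂μ = ⟪ha.toLp a, hb.toLp b⟫ := by
    intro a b ha hb
    rw [L2.inner_def]
    refine integral_congr_ae ?_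
    filter_upwards [ha.coeFn_toLp, hb.coeFn_toLp] with x h1 h2
    rw [h1, h2]
  have t1 := (Lp.tendsto_Lp_iff_tendsto_eLpNorm'' f mf g mg).2 h
  have t2 := (Lp.tendsto_Lp_iff_tendsto_eLpNorm'' f' mf' g' mg').2 h'
  rw [key mg mg']
  simp_rw [fun n => key (mf n) (mf' n)]
  exact t1.inner t2

lemma L2Lim.subseq {f : ℕ → α → E} {g : α → E} (h : L2Lim μ f g) {ns : ℕ → ℕ}
    (hns : StrictMono ns) : L2Lim μ (fun n => f (ns n)) g :=
  h.comp hns.tendsto_atTop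

lemma L2Lim.exists_ae {f : ℕ → α → E} {g : α → E} (h : L2Lim μ f g)
    (mf : ∀ n, AEStronglyMeasurable (f n) μ) (mg : AEStronglyMeasurable g μ) :
    ∃ ns : ℕ → ℕ, StrictMono ns ∧ ∀ᵐ x ∂μ, Tendsto (fun n => f (ns n) x) atTop (𝓝 (g x)) :=
  (tendstoInMeasure_of_tendsto_eLpNorm (by norm_num) mf mg h).exists_seq_tendsto_ae

lemma eLpNorm_two_eq_sqrt {f : α → E} (hf : MemLp f 2 μ) :
    eLpNorm f 2 μ = ofReal (Real.sqrt (∫ x, ‖f x‖ ^ 2 ∂μ)) := by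
  rw [hf.eLpNorm_eq_integral_rpow_norm (by norm_num) (by norm_num)]
  simp [Real.sqrt_eq_rpow]

lemma l2Lim_of_integral {f : ℕ → α → E} {g : α → E} (mf : ∀ n, MemLp (f n) 2 μ) (mg : MemLp g 2 μ)
    (h : Tendsto (fun n => ∫ x, ‖f n x - g x‖ ^ 2 ∂μ) atTop (𝓝 0)) : L2Lim μ f g := by
  have h1 : ∀ n, eLpNorm (f n - g) 2 μ = ofReal (Real.sqrt (∫ x, ‖f n x - g x‖ ^ 2 ∂μ)) := fun n =>
    eLpNorm_two_eq_sqrt ((mf n).sub mg)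
  unfold L2Lim
  simp_rw [h1]
  have := (ENNReal.continuous_ofReal.comp Real.continuous_sqrt).continuousAt.tendsto.comp h
  simpa [Function.comp_def] using this

lemma L2Lim.tendsto_integral_sq {f : ℕ → α → E} {g : α → E} (h : L2Lim μ f g)
    (mf : ∀ n, MemLp (f n) 2 μ) (mg : MemLp g 2 μ) :
    Tendsto (fun n => ∫ x, ‖f n x - g x‖ ^ 2 ∂μ) atTop (𝓝 0) := by
  have h1 : ∀ n, ∫ x, ‖f n x - g x‖ ^ 2 ∂μ = (eLpNorm (f n - g) 2 μ).toReal ^ 2 := fun n => by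
    have h0 : 0 ≤ ∫ x, ‖f n x - g x‖ ^ 2 ∂μ := by positivity
    rw [eLpNorm_two_eq_sqrt ((mf n).sub mg), ENNReal.toReal_ofReal (Real.sqrt_nonneg _)]
    exact (Real.sq_sqrt h0).symm
  simp_rw [h1]
  have := ((ENNReal.tendsto_toReal ENNReal.zero_ne_top).comp h).pow 2
  simpa [Function.comp_def] using this

lemma integrable_inner_of_memLp_two [InnerProductSpace ℝ E] {f g : α → E}
    (hf : MemLp f 2 μ) (hg : MemLp g 2 μ) : Integrable (fun x => ⟪f x, g x⟫) μ := by
  refine Integrable.mono' (hf.norm.integrable_mul hg.norm)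
    (hf.1.inner hg.1) (.of_forall fun x => ?_)
  simpa using norm_inner_le_norm (𝕜 := ℝ) (f x) (g x)

end L2

/-! ### Gradients and divergences of smooth functions -/

lemma gradient_apply (f : Euc d → ℝ) (x : Euc d) (i : Fin d) :
    gradient f x i = fderiv ℝ f x (EuclideanSpace.single i 1) := by
  rw [← inner_gradient_left, EuclideanSpace.inner_single_right]
  simp only [one_mul, conj_trivial]

lemma contDiff_gradient (hf : Smooth f) : Smooth (fun x => gradient f x) := by
  rw [contDiff_euclidean]
  intro i
  simp_rw [gradient_apply]
  exact (hf.fderiv_right (m := (⊤ : ℕ∞)) (by simp)).clm_apply contDiff_const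

lemma gradient_mul (hf : DifferentiableAt ℝ f x) (hg : DifferentiableAt ℝ g x) :
    gradient (fun y => f y * g y) x = f x • gradient g x + g x • gradient f x := by
  refine ext_inner_right ℝ fun v => ?_
  rw [inner_gradient_left, inner_add_left, inner_smul_left, inner_smul_left,
    inner_gradient_left, inner_gradient_left, fderiv_fun_mul hf hg]
  simp

lemma gradient_add (hf : DifferentiableAt ℝ f x) (hg : DifferentiableAt ℝ g x) :
    gradient (fun y => f y + g y) x = gradient f x + gradient g x := by
  refine ext_inner_right ℝ fun v => ?_
  rw [inner_gradient_left, inner_add_left,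
    inner_gradient_left, inner_gradient_left, fderiv_fun_add hf hg]
  simp

lemma gradient_const_mul (c : ℝ) (hf : DifferentiableAt ℝ f x) :
    gradient (fun y => c * f y) x = c • gradient f x := by
  refine ext_inner_right ℝ fun v => ?_
  rw [inner_gradient_left, inner_smul_left, inner_gradient_left, fderiv_const_mul hf]
  simp

lemma gradient_comp {S : ℝ → ℝ} (hS : DifferentiableAt ℝ S (f x)) (hf : DifferentiableAt ℝ f x) :
    gradient (fun y => S (f y)) x = deriv S (f x) • gradient f x := by
  refine ext_inner_right ℝ fun v => ?_
  rw [inner_gradient_left, inner_smul_left, inner_gradient_left,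
    show fderiv ℝ (fun y => S (f y)) x = _ from
      (hS.hasDerivAt.comp_hasFDerivAt x hf.hasFDerivAt).fderiv]
  simp

lemma gradient_eq_zero_of_notMem_tsupport (hx : x ∉ tsupport f) : gradient f x = 0 := by
  refine ext_inner_right ℝ fun v => ?_
  rw [inner_gradient_left, fderiv_of_notMem_tsupport ℝ hx]
  simp

lemma HasCompactSupport.gradient (hf : HasCompactSupport f) :
    HasCompactSupport (fun x => gradient f x) :=
  HasCompactSupport.intro hf fun _ hx => gradient_eq_zero_of_notMem_tsupport hx

lemma smooth_differentiable {E F : Type*} [NormedAddCommGroup E] [NormedSpace ℝ E]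
    [NormedAddCommGroup F] [NormedSpace ℝ F] {f : E → F} (hf : Smooth f) :
    Differentiable ℝ f := hf.differentiable (by simp)

lemma divg_smul (hf : DifferentiableAt ℝ f x) (hX : DifferentiableAt ℝ X x) :
    divg (fun y => f y • X y) x = f x * divg X x + ⟪gradient f x, X x⟫ := by
  unfold divg
  rw [fderiv_fun_smul hf hX, PiLp.inner_apply, Finset.mul_sum, ← Finset.sum_add_distrib]
  refine Finset.sum_congr rfl fun i _ => ?_
  simp [gradient_apply]
  ring

lemma divg_smul_const (hf : DifferentiableAt ℝ f x) (v : Euc d) :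
    divg (fun y => f y • v) x = ⟪gradient f x, v⟫ := by
  rw [divg_smul hf (differentiableAt_const v)]
  simp [divg]

lemma continuous_divg (hX : Smooth X) : Continuous (divg X) := by
  unfold divg
  have : Continuous (fderiv ℝ X) := hX.continuous_fderiv (by simp)
  refine continuous_finsetSum _ fun i _ => ?_
  have h : Continuous fun x => fderiv ℝ X x (EuclideanSpace.single i 1) :=
    this.clm_apply continuous_const
  exact (EuclideanSpace.proj i : Euc d →L[ℝ] ℝ).continuous.comp h

lemma divg_eq_zero_of_notMem_tsupport (hx : x ∉ tsupport X) : divg X x = 0 := by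
  simp [divg, fderiv_of_notMem_tsupport ℝ hx]

lemma HasCompactSupport.divg (hX : HasCompactSupport X) : HasCompactSupport (divg X) :=
  HasCompactSupport.intro hX fun _ hx => divg_eq_zero_of_notMem_tsupport hx

/-- Integration by parts for a Lipschitz function whose directional derivatives are given by `G`. -/
lemma LipschitzWith.integral_mul_divg {L : ℝ≥0} (hf : LipschitzWith L f)
    (hG : ∀ w, ∀ᵐ y, lineDeriv ℝ f y w = ⟪G y, w⟫) (hX : Smooth X)
    (hc : HasCompactSupport X) : ∫ x, f x * divg X x = -∫ x, ⟪G x, X x⟫ := by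
  have hXi : ∀ i, Smooth fun x => X x i := fun i => contDiff_euclidean.1 hX i
  have hci : ∀ i, HasCompactSupport fun x => X x i := fun i =>
    hc.comp_left (g := fun v : Euc d => v i) rfl
  have hl : ∀ i x, fderiv ℝ X x (.single i 1) i = lineDeriv ℝ (fun y => X y i) x (.single i 1) :=
    fun i x => (((EuclideanSpace.proj i : Euc d →L[ℝ] ℝ).hasFDerivAt.comp x
      (smooth_differentiable hX x).hasFDerivAt).hasLineDerivAt _).lineDeriv.symm
  have hi : ∀ i, (fun y => lineDeriv ℝ f y (.single i 1) * X y i) =ᵐ[volume]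
      fun y => ⟪G y, .single i 1⟫ * X y i := fun i => by
    filter_upwards [hG (.single i 1)] with y hy
    rw [hy]
  choose K hK using fun i => (hXi i).lipschitzWith_of_hasCompactSupport (hci i) (by simp)
  have hgx : ∀ x, ⟪G x, X x⟫ = ∑ i, ⟪G x, .single i 1⟫ * X x i := fun x => by
    simp [PiLp.inner_apply, mul_comm]
  simp_rw [divg, Finset.mul_sum, hl, hgx]
  rw [integral_finsetSum, integral_finsetSum, ← Finset.sum_neg_distrib]
  · refine Finset.sum_congr rfl fun i _ => ?_
    rw [← integral_congr_ae (hi i), hf.integral_lineDeriv_mul_eq (hK i) (hci i), ← integral_neg]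
    simp_rw [lineDeriv_neg, neg_mul, neg_neg, mul_comm]
  · exact fun i _ => Integrable.congr (memLp_one_iff_integrable.1
      (((hXi i).continuous.memLp_of_hasCompactSupport
      (hci i)).mul (hf.memLp_lineDeriv _) (p := ∞) (q := 1))) (hi i)
  · intro i _
    simp_rw [← hl]
    exact (hf.continuous.mul ((EuclideanSpace.proj i : Euc d →L[ℝ] ℝ).continuous.comp
      ((hX.continuous_fderiv (by simp)).clm_apply continuous_const))).integrable_of_hasCompactSupport
        (hc.mono' fun x hx => by by_contra h; simp [fderiv_of_notMem_tsupport ℝ h] at hx)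

lemma integral_mul_divg (hf : Smooth f)
    (hX : Smooth X) (hc : HasCompactSupport f ∨ HasCompactSupport X) :
    ∫ x, f x * divg X x = -∫ x, ⟪gradient f x, X x⟫ := by
  have h1 := (LipschitzWith.const (1 : ℝ)).integral_mul_divg (G := fun _ => (0 : Euc d))
    (fun w => by simp [lineDeriv]) (hf.smul hX) (hc.elim (·.smul_right) (·.smul_left))
  have h2 : ∀ x, divg (f • X) x = _ := fun x =>
    divg_smul (smooth_differentiable hf x) (smooth_differentiable hX x)
  simp only [h2, inner_zero_left, one_mul] at h1
  rw [integral_add] at h1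
  · simpa [add_eq_zero_iff_eq_neg] using h1
  · exact (hf.continuous.mul (continuous_divg hX)).integrable_of_hasCompactSupport
      (hc.elim (·.mul_right) (·.divg.mul_left))
  · refine ((contDiff_gradient hf).continuous.inner hX.continuous).integrable_of_hasCompactSupport ?_
    exact hc.elim (fun h => h.gradient.mono fun x hx hh => hx (by simp [hh]))
      (·.mono fun x hx hh => hx (by simp [hh]))

/-! ### Test functions -/

namespace TestFun

lemma continuous (h : TestFun U φ) : Continuous φ := h.1.continuous
lemma differentiable (h : TestFun U φ) : Differentiable ℝ φ := smooth_differentiable h.1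
lemma continuous_gradient (h : TestFun U φ) : Continuous fun x => gradient φ x :=
  (contDiff_gradient h.1).continuous
lemma memLp (h : TestFun U φ) (p : ℝ≥0∞) (μ : Measure (Euc d)) [IsFiniteMeasureOnCompacts μ] :
    MemLp φ p μ := h.continuous.memLp_of_hasCompactSupport h.2.1
lemma gradient_memLp (h : TestFun U φ) (p : ℝ≥0∞) :
    MemLp (fun x => gradient φ x) p (volume : Measure (Euc d)) :=
  h.continuous_gradient.memLp_of_hasCompactSupport h.2.1.gradient
lemma mono (h : TestFun U φ) (hUV : U ⊆ V) : TestFun V φ := ⟨h.1, h.2.1, h.2.2.trans hUV⟩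

lemma mul_left (h : TestFun U φ) (hχ : Smooth χ) : TestFun U (fun x => χ x * φ x) :=
  ⟨hχ.mul h.1, h.2.1.mul_left, (tsupport_mul_subset_right (f := χ) (g := φ)).trans h.2.2⟩

lemma mul_right (h : TestFun U φ) (hχ : Smooth χ) : TestFun U (fun x => φ x * χ x) := by
  simpa only [mul_comm] using h.mul_left hχ

lemma add (h : TestFun U φ) (h' : TestFun U ψ) : TestFun U (fun x => φ x + ψ x) :=
  ⟨h.1.add h'.1, h.2.1.add h'.2.1, (tsupport_add φ ψ).trans (union_subset h.2.2 h'.2.2)⟩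

lemma comp {S : ℝ → ℝ} (hS : Smooth S) (S0 : S 0 = 0) (h : TestFun U φ) :
    TestFun U (fun x => S (φ x)) :=
  ⟨hS.comp h.1, h.2.1.comp_left S0, (closure_mono (Function.support_comp_subset S0 φ)).trans h.2.2⟩

lemma zero : TestFun U (fun _ => 0) := ⟨contDiff_const, HasCompactSupport.zero, by simp [tsupport]⟩

lemma bounded (h : TestFun U φ) : ∃ C, 0 ≤ C ∧ ∀ x, |φ x| ≤ C := by
  obtain ⟨C, hC⟩ := h.continuous.bounded_above_of_compact_support h.2.1
  exact ⟨C, (norm_nonneg _).trans (hC 0), hC⟩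

lemma bounded_gradient (h : TestFun U φ) : ∃ C, 0 ≤ C ∧ ∀ x, ‖gradient φ x‖ ≤ C := by
  obtain ⟨C, hC⟩ := h.continuous_gradient.bounded_above_of_compact_support h.2.1.gradient
  exact ⟨C, (norm_nonneg _).trans (hC 0), hC⟩

lemma integral_sq_le_of_lam1 (h : TestFun U φ) :
    lam1 U * ∫ x, (φ x) ^ 2 ≤ ∫ x, ‖gradient φ x‖ ^ 2 := by
  have h0 : 0 ≤ ∫ x, (φ x) ^ 2 := by positivity
  have h1 : 0 ≤ ∫ x, ‖gradient φ x‖ ^ 2 := by positivity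
  rcases h0.eq_or_lt with h2 | h2
  · rw [← h2]; simpa using h1
  set N := ∫ x, (φ x) ^ 2
  set c := (Real.sqrt N)⁻¹ with hc
  have hcN : c ^ 2 = N⁻¹ := by rw [hc, inv_pow, Real.sq_sqrt h0]
  have ht : TestFun U (fun x => c * φ x) := h.mul_left contDiff_const
  have hg : ∀ x, gradient (fun x => c * φ x) x = c • gradient φ x := fun x =>
    gradient_const_mul c (h.differentiable x)
  have hle : lam1 U ≤ ∫ x, ‖gradient (fun x => c * φ x) x‖ ^ 2 := by
    refine csInf_le ⟨0, ?_⟩ ⟨fun x => c * φ x, ⟨ht.memLp 2 volume, ht.gradient_memLp 2,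
      fun _ => fun x => c * φ x, fun _ => ht, by simp⟩, ?_, rfl⟩
    · rintro t ⟨v, -, -, rfl⟩; positivity
    · simp_rw [mul_pow]
      rw [integral_const_mul, hcN, inv_mul_cancel₀ h2.ne']
  simp_rw [hg, norm_smul, mul_pow] at hle
  rw [integral_const_mul, Real.norm_eq_abs, sq_abs, hcN] at hle
  rw [inv_mul_eq_div, le_div_iff₀ h2] at hle
  exact hle

end TestFun

/-! ### The closure of test functions in the energy norm -/

/-- The pair `(v, G)` belongs to the closure of `{(φ, ∇φ)}`, `φ` a test function in `U`, in
`L² × L²`. -/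
structure InH (U : Set (Euc d)) (v : Euc d → ℝ) (G : Euc d → Euc d) : Prop where
  memV : MemLp v 2 (volume : Measure (Euc d))
  memG : MemLp G 2 (volume : Measure (Euc d))
  approx : ∃ φ : ℕ → Euc d → ℝ, (∀ n, TestFun U (φ n)) ∧ L2Lim volume φ v ∧
    L2Lim volume (fun n x => gradient (φ n) x) G

lemma MemH10.inH (h : MemH10 U v) : InH U v (fun x => gradient v x) := by
  obtain ⟨h1, h2, φ, hφ, hlim⟩ := h
  have i1 : ∀ n, Integrable fun x => (v x - φ n x) ^ 2 := fun n => by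
    simpa using (h1.sub ((hφ n).memLp 2 volume)).integrable_norm_pow (by norm_num)
  have i2 : ∀ n, Integrable fun x => ‖gradient v x - gradient (φ n) x‖ ^ 2 := fun n => by
    simpa using (h2.sub ((hφ n).gradient_memLp 2)).integrable_norm_pow (by norm_num)
  simp_rw [fun n => integral_add (i1 n) (i2 n)] at hlim
  refine ⟨h1, h2, φ, hφ, ?_, ?_⟩
  · refine l2Lim_of_integral (fun n => (hφ n).memLp 2 volume) h1 ?_
    refine tendsto_of_tendsto_of_tendsto_of_le_of_le tendsto_const_nhds hlim
      (fun n => by positivity) (fun n => ?_)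
    have h3 : 0 ≤ ∫ x, ‖gradient v x - gradient (φ n) x‖ ^ 2 := by positivity
    have h4 : ∫ x, ‖φ n x - v x‖ ^ 2 = ∫ x, (v x - φ n x) ^ 2 := by
      congr 1; ext x; rw [Real.norm_eq_abs, sq_abs]; ring
    simp only [h4]; linarith
  · refine l2Lim_of_integral (fun n => (hφ n).gradient_memLp 2) h2 ?_
    refine tendsto_of_tendsto_of_tendsto_of_le_of_le tendsto_const_nhds hlim
      (fun n => by positivity) (fun n => ?_)
    have h3 : 0 ≤ ∫ x, (v x - φ n x) ^ 2 := by positivity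
    have h4 : ∫ x, ‖gradient (φ n) x - gradient v x‖ ^ 2 =
        ∫ x, ‖gradient v x - gradient (φ n) x‖ ^ 2 := by
      congr 1; ext x; rw [norm_sub_rev]
    simp only [h4]; linarith

lemma TestFun.inH (h : TestFun U φ) : InH U φ (fun x => gradient φ x) :=
  ⟨h.memLp 2 volume, h.gradient_memLp 2, fun _ => φ, fun _ => h, by simp [L2Lim], by simp [L2Lim]⟩

namespace InH

lemma mono (h : InH U v G) (hUV : U ⊆ V) : InH V v G :=
  let ⟨φ, hφ, h1, h2⟩ := h.approx
  ⟨h.memV, h.memG, φ, fun n => (hφ n).mono hUV, h1, h2⟩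

lemma congr (h : InH U v G) (hv : v =ᵐ[volume] w) (hG : G =ᵐ[volume] F) : InH U w F := by
  obtain ⟨φ, hφ, h1, h2⟩ := h.approx
  refine ⟨h.memV.ae_eq hv, h.memG.ae_eq hG, φ, hφ, ?_, ?_⟩
  · refine h1.of_bound 1 fun n => ?_
    filter_upwards [hv] with x hx
    rw [hx, one_mul]
  · refine h2.of_bound 1 fun n => ?_
    filter_upwards [hG] with x hx
    rw [hx, one_mul]

lemma add (h : InH U v G) (h' : InH U w F) : InH U (fun x => v x + w x) (fun x => G x + F x) := by
  obtain ⟨φ, hφ, h1, h2⟩ := h.approx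
  obtain ⟨ψ, hψ, h1', h2'⟩ := h'.approx
  refine ⟨h.memV.add h'.memV, h.memG.add h'.memG, fun n x => φ n x + ψ n x,
    fun n => (hφ n).add (hψ n), ?_, ?_⟩
  · exact h1.add h1' (fun n => (((hφ n).memLp 2 volume).sub h.memV).1)
      (fun n => (((hψ n).memLp 2 volume).sub h'.memV).1)
  · have e : (fun n x => gradient (fun x => φ n x + ψ n x) x) =
        fun n => (fun x => gradient (φ n) x) + fun x => gradient (ψ n) x := by
      ext1 n; ext1 x
      exact gradient_add ((hφ n).differentiable x) ((hψ n).differentiable x)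
    rw [e]
    exact h2.add h2' (fun n => (((hφ n).gradient_memLp 2).sub h.memG).1)
      (fun n => (((hψ n).gradient_memLp 2).sub h'.memG).1)

lemma mul_smooth (h : InH U v G) (hχ : Smooth χ)
    (hb : ∀ x, |χ x| ≤ C) (hb' : ∀ x, ‖gradient χ x‖ ≤ C)
    (hV : ∀ φ, TestFun U φ → TestFun V (fun x => χ x * φ x)) :
    InH V (fun x => χ x * v x) (fun x => χ x • G x + v x • gradient χ x) := by
  obtain ⟨φ, hφ, h1, h2⟩ := h.approx
  have mχ := hχ.continuous.aestronglyMeasurable (μ := (volume : Measure (Euc d)))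
  have mχ' := (contDiff_gradient hχ).continuous.aestronglyMeasurable
    (μ := (volume : Measure (Euc d)))
  have mem1 : ∀ {f : Euc d → ℝ}, MemLp f 2 (volume : Measure (Euc d)) →
      MemLp (fun x => f x • gradient χ x) 2 (volume : Measure (Euc d)) := fun {f} hf =>
    hf.of_le_mul (c := C) (hf.1.smul mχ') (.of_forall fun x => by
      rw [norm_smul, mul_comm]
      exact mul_le_mul_of_nonneg_right (hb' x) (norm_nonneg _))
  have mem2 : ∀ {f : Euc d → Euc d}, MemLp f 2 (volume : Measure (Euc d)) →
      MemLp (fun x => χ x • f x) 2 (volume : Measure (Euc d)) := fun {f} hf =>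
    hf.of_le_mul (c := C) (mχ.smul hf.1) (.of_forall fun x => by
      rw [norm_smul]
      exact mul_le_mul_of_nonneg_right (hb x) (norm_nonneg _))
  have mem3 : ∀ {f : Euc d → ℝ}, MemLp f 2 (volume : Measure (Euc d)) →
      MemLp (fun x => χ x * f x) 2 (volume : Measure (Euc d)) := fun {f} hf =>
    hf.of_le_mul (c := C) (mχ.mul hf.1) (.of_forall fun x => by
      rw [norm_mul]
      exact mul_le_mul_of_nonneg_right (hb x) (norm_nonneg _))
  refine ⟨mem3 h.memV, (mem2 h.memG).add (mem1 h.memV), fun n x => χ x * φ n x,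
    fun n => hV _ (hφ n), ?_, ?_⟩
  · refine h1.of_bound C fun n => .of_forall fun x => ?_
    rw [← mul_sub, norm_mul]
    exact mul_le_mul_of_nonneg_right (hb x) (norm_nonneg _)
  · have e : (fun n x => gradient (fun x => χ x * φ n x) x) =
        fun n => (fun x => χ x • gradient (φ n) x) + fun x => φ n x • gradient χ x := by
      ext1 n; ext1 x
      exact gradient_mul (smooth_differentiable hχ x) ((hφ n).differentiable x)
    rw [e]
    refine L2Lim.add (h2.of_bound C fun n => .of_forall fun x => ?_)
      (h1.of_bound C fun n => .of_forall fun x => ?_)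
      (fun n => ((mem2 ((hφ n).gradient_memLp 2)).sub (mem2 h.memG)).1)
      (fun n => ((mem1 ((hφ n).memLp 2 volume)).sub (mem1 h.memV)).1)
    · rw [← smul_sub, norm_smul]
      exact mul_le_mul_of_nonneg_right (hb x) (norm_nonneg _)
    · rw [← sub_smul, norm_smul, mul_comm]
      exact mul_le_mul_of_nonneg_right (hb' x) (norm_nonneg _)

lemma mul_test (h : InH U v G) (hχ : TestFun V χ) :
    InH U (fun x => χ x * v x) (fun x => χ x • G x + v x • gradient χ x) := by
  obtain ⟨C, -, hC⟩ := hχ.bounded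
  obtain ⟨C', -, hC'⟩ := hχ.bounded_gradient
  exact h.mul_smooth hχ.1 (C := max C C') (fun x => (hC x).trans (le_max_left _ _))
    (fun x => (hC' x).trans (le_max_right _ _)) (fun φ hφ => hφ.mul_left hχ.1)

lemma const_mul (h : InH U v G) (c : ℝ) : InH U (fun x => c * v x) (fun x => c • G x) := by
  have := h.mul_smooth (V := U) (χ := fun _ => c) contDiff_const (C := |c|) (fun _ => le_rfl)
    (fun x => by simp [gradient_fun_const]) (fun φ hφ => hφ.mul_left contDiff_const)
  simpa [gradient_fun_const] using this

lemma comp (h : InH U v G) {S : ℝ → ℝ} (hS : Smooth S) (S0 : S 0 = 0) (hC : ∀ s, |deriv S s| ≤ C) :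
    InH U (fun x => S (v x)) (fun x => deriv S (v x) • G x) := by
  obtain ⟨φ₀, hφ₀, h1₀, h2₀⟩ := h.approx
  obtain ⟨ns, hns, hae⟩ := h1₀.exists_ae (fun n => ((hφ₀ n).memLp 2 volume).1) h.memV.1
  set φ := fun n => φ₀ (ns n)
  have hφ : ∀ n, TestFun U (φ n) := fun n => hφ₀ (ns n)
  have h1 : L2Lim volume φ v := h1₀.subseq hns
  have h2 : L2Lim volume (fun n x => gradient (φ n) x) G := h2₀.subseq hns
  have hSd := smooth_differentiable hS
  have cS' : Continuous (deriv S) := hS.continuous_deriv (by simp)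
  have lip : ∀ a b, |S a - S b| ≤ C * |a - b| := fun a b => by
    have := Convex.norm_image_sub_le_of_norm_deriv_le (f := S) (s := univ) (C := C)
      (fun x _ => hSd x) (fun x _ => hC x) convex_univ (mem_univ b) (mem_univ a)
    simpa using this
  have mS : ∀ {f : Euc d → ℝ}, MemLp f 2 →
      MemLp (fun x => S (f x)) 2 (volume : Measure (Euc d)) := fun {f} hf =>
    hf.of_le_mul (c := C) (hS.continuous.comp_aestronglyMeasurable hf.1)
      (.of_forall fun x => by simpa [S0] using lip (f x) 0)
  have mS' : ∀ {f : Euc d → ℝ} {F : Euc d → Euc d}, MemLp f 2 → MemLp F 2 →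
      MemLp (fun x => deriv S (f x) • F x) 2 (volume : Measure (Euc d)) := fun {f F} hf hF =>
    hF.of_le_mul (c := C) ((cS'.comp_aestronglyMeasurable hf.1).smul hF.1) (.of_forall fun x => by
        rw [norm_smul]; exact mul_le_mul_of_nonneg_right (hC _) (norm_nonneg _))
  refine ⟨mS h.memV, mS' h.memV h.memG, fun n x => S (φ n x), fun n => (hφ n).comp hS S0, ?_, ?_⟩
  · exact h1.of_bound C fun n => .of_forall fun x => lip _ _
  · have e1 : (fun n x => gradient (fun x => S (φ n x)) x) =
        fun n x => deriv S (φ n x) • gradient (φ n) x := by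
      ext1 n; ext1 x
      exact gradient_comp (hSd _) ((hφ n).differentiable x)
    have l1 : L2Lim volume (fun n x => deriv S (φ n x) • (gradient (φ n) x - G x))
        (fun _ => (0 : Euc d)) := h2.of_bound C fun n => .of_forall fun x => by
      rw [sub_zero, norm_smul]
      exact mul_le_mul_of_nonneg_right (hC _) (norm_nonneg _)
    have l2 : L2Lim volume (fun n x => deriv S (φ n x) • G x) (fun x => deriv S (v x) • G x) := by
      refine l2Lim_of_integral (fun n => mS' ((hφ n).memLp 2 volume) h.memG) (mS' h.memV h.memG) ?_
      have hC0 : 0 ≤ C := (abs_nonneg _).trans (hC 0)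
      have : Tendsto (fun n => ∫ x, ‖deriv S (φ n x) • G x - deriv S (v x) • G x‖ ^ 2) atTop
          (𝓝 (∫ _ : Euc d, (0 : ℝ))) := by
        refine tendsto_integral_of_dominated_convergence (fun x => (2 * C) ^ 2 * ‖G x‖ ^ 2)
          (fun n => (((mS' ((hφ n).memLp 2 volume) h.memG).sub
            (mS' h.memV h.memG)).norm.1.pow 2)) ?_ ?_ ?_
        · exact (h.memG.integrable_norm_pow (by norm_num)).const_mul _
        · intro n
          refine .of_forall fun x => ?_
          rw [Real.norm_eq_abs, abs_of_nonneg (by positivity), ← sub_smul, norm_smul, mul_pow]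
          gcongr
          calc ‖deriv S (φ n x) - deriv S (v x)‖ ≤ |deriv S (φ n x)| + |deriv S (v x)| :=
                norm_sub_le _ _
            _ ≤ 2 * C := by linarith [hC (φ n x), hC (v x)]
        · filter_upwards [hae] with x hx
          have t1 : Tendsto (fun n => deriv S (φ n x) • G x) atTop (𝓝 (deriv S (v x) • G x)) :=
            ((cS'.tendsto _).comp hx).smul_const _
          have t2 := ((t1.sub_const (deriv S (v x) • G x)).norm).pow 2
          simpa using t2
      simpa using this
    rw [e1]
    have := l1.add l2
      (fun n => by
        have := (mS' ((hφ n).memLp 2 volume) (((hφ n).gradient_memLp 2).sub h.memG)).1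
        exact this.sub aestronglyMeasurable_const)
      (fun n => ((mS' ((hφ n).memLp 2 volume) h.memG).sub (mS' h.memV h.memG)).1)
    refine this.of_bound 1 fun n => .of_forall fun x => ?_
    simp [smul_sub]

lemma tendsto_weighted (h : InH U v G) {φ : ℕ → Euc d → ℝ} (hφ : ∀ n, TestFun U (φ n))
    (h1 : L2Lim volume φ v) {b : Euc d → ℝ} (hb : Continuous b) (hC : ∀ x, |b x| ≤ C) :
    Tendsto (fun n => ∫ x, b x * (φ n x) ^ 2) atTop (𝓝 (∫ x, b x * (v x) ^ 2)) := by
  have m : ∀ {f : Euc d → ℝ}, MemLp f 2 →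
      MemLp (fun x => b x * f x) 2 (volume : Measure (Euc d)) := fun {f} hf =>
    hf.of_le_mul (c := C) (hb.aestronglyMeasurable.mul hf.1) (.of_forall fun x => by
      rw [norm_mul]
      exact mul_le_mul_of_nonneg_right (hC x) (norm_nonneg _))
  have hl : L2Lim volume (fun n x => b x * φ n x) (fun x => b x * v x) :=
    h1.of_bound C fun n => .of_forall fun x => by
      rw [← mul_sub, norm_mul]
      exact mul_le_mul_of_nonneg_right (hC x) (norm_nonneg _)
  have := tendsto_integral_inner_of_L2Lim h1 hl (fun n => (hφ n).memLp 2 volume)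
    (fun n => m ((hφ n).memLp 2 volume)) h.memV (m h.memV)
  refine (this.congr fun n => integral_congr_ae (.of_forall fun x => ?_)).trans
    (le_of_eq (congrArg 𝓝 (integral_congr_ae (.of_forall fun x => ?_))))
  · simp; ring
  · simp; ring

lemma tendsto_weighted_grad (h : InH U v G) {φ : ℕ → Euc d → ℝ} (hφ : ∀ n, TestFun U (φ n))
    (h2 : L2Lim volume (fun n x => gradient (φ n) x) G) {L : Euc d → Euc d →L[ℝ] Euc d}
    (hL : Continuous L) (hC : ∀ x, ‖L x‖ ≤ C) :
    Tendsto (fun n => ∫ x, ⟪L x (gradient (φ n) x), gradient (φ n) x⟫) atTop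
      (𝓝 (∫ x, ⟪L x (G x), G x⟫)) := by
  have m : ∀ {f : Euc d → Euc d}, MemLp f 2 →
      MemLp (fun x => L x (f x)) 2 (volume : Measure (Euc d)) := fun {f} hf =>
    hf.of_le_mul (c := C) ((ContinuousLinearMap.id ℝ (Euc d →L[ℝ] Euc d)).aestronglyMeasurable_comp₂
      hL.aestronglyMeasurable hf.1)
      (.of_forall fun x =>
        ((L x).le_opNorm _).trans (mul_le_mul_of_nonneg_right (hC x) (norm_nonneg _)))
  have hl : L2Lim volume (fun n x => L x (gradient (φ n) x)) (fun x => L x (G x)) :=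
    h2.of_bound C fun n => .of_forall fun x => by
      rw [← map_sub]
      exact ((L x).le_opNorm _).trans (mul_le_mul_of_nonneg_right (hC x) (norm_nonneg _))
  exact tendsto_integral_inner_of_L2Lim hl h2 (fun n => m ((hφ n).gradient_memLp 2))
    (fun n => (hφ n).gradient_memLp 2) (m h.memG) h.memG

lemma integral_mul_divg (h : InH U v G) (hX : Smooth X)
    (hc : HasCompactSupport X) : ∫ x, v x * divg X x = -∫ x, ⟪G x, X x⟫ := by
  obtain ⟨φ, hφ, h1, h2⟩ := h.approx
  have mX : MemLp X 2 (volume : Measure (Euc d)) := hX.continuous.memLp_of_hasCompactSupport hc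
  have mdX : MemLp (divg X) 2 (volume : Measure (Euc d)) :=
    (continuous_divg hX).memLp_of_hasCompactSupport hc.divg
  have t1 := tendsto_integral_inner_of_L2Lim (f' := fun _ => divg X) (g' := divg X) h1
    (by simp [L2Lim]) (fun n => (hφ n).memLp 2 volume) (fun _ => mdX) h.memV mdX
  have t2 := tendsto_integral_inner_of_L2Lim (f' := fun _ => X) (g' := X) h2
    (by simp [L2Lim]) (fun n => (hφ n).gradient_memLp 2) (fun _ => mX) h.memG mX
  have e : ∀ n, ∫ x, ⟪φ n x, divg X x⟫ = -∫ x, ⟪gradient (φ n) x, X x⟫ := fun n => by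
    rw [← _root_.integral_mul_divg (hφ n).1 hX (Or.inr hc)]
    congr 1; ext x; simp [mul_comm]
  simp_rw [e] at t1
  rw [← tendsto_nhds_unique t1 t2.neg]
  congr 1; ext x; simp [mul_comm]

lemma integral_sq_mul_divg (h : InH U v G) (hX : Smooth X) (hc : HasCompactSupport X) :
    ∫ x, (v x) ^ 2 * divg X x = -2 * ∫ x, v x * ⟪G x, X x⟫ := by
  obtain ⟨φ, hφ, h1, h2⟩ := h.approx
  obtain ⟨C, hC⟩ := hX.continuous.bounded_above_of_compact_support hc
  obtain ⟨C', hC'⟩ := (continuous_divg hX).bounded_above_of_compact_support hc.divg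
  have t1 := h.tendsto_weighted hφ h1 (continuous_divg hX) hC'
  have m : ∀ {f : Euc d → ℝ}, MemLp f 2 (volume : Measure (Euc d)) →
      MemLp (fun x => f x • X x) 2 (volume : Measure (Euc d)) := fun {f} hf =>
    hf.of_le_mul (c := C) (hf.1.smul hX.continuous.aestronglyMeasurable)
      (.of_forall fun x => by
        rw [norm_smul, mul_comm]
        exact mul_le_mul_of_nonneg_right (hC x) (norm_nonneg _))
  have hl : L2Lim volume (fun n x => φ n x • X x) (fun x => v x • X x) :=
    h1.of_bound C fun n => .of_forall fun x => by
      rw [← sub_smul, norm_smul, mul_comm]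
      exact mul_le_mul_of_nonneg_right (hC x) (norm_nonneg _)
  have t2 := tendsto_integral_inner_of_L2Lim h2 hl (fun n => (hφ n).gradient_memLp 2)
    (fun n => m ((hφ n).memLp 2 volume)) h.memG (m h.memV)
  have e : ∀ n, ∫ x, divg X x * (φ n x) ^ 2 = -2 * ∫ x, ⟪gradient (φ n) x, φ n x • X x⟫ := fun n => by
    have h3 := _root_.integral_mul_divg ((hφ n).1.mul (hφ n).1) hX (Or.inr hc)
    have h4 : ∀ x, ⟪gradient (fun y => φ n y * φ n y) x, X x⟫ =
        2 * ⟪gradient (φ n) x, φ n x • X x⟫ := fun x => by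
      rw [gradient_mul ((hφ n).differentiable x) ((hφ n).differentiable x), inner_add_left,
        inner_smul_left, inner_smul_right]
      simp; ring
    simp_rw [h4] at h3
    rw [integral_const_mul] at h3
    rw [neg_mul, ← h3]
    congr 1; ext x; ring
  simp_rw [e] at t1
  have := tendsto_nhds_unique t1 (t2.const_mul (-2))
  calc ∫ x, (v x) ^ 2 * divg X x = ∫ x, divg X x * (v x) ^ 2 := by simp_rw [mul_comm]
    _ = _ := by rw [this]; congr 2; ext x; rw [inner_smul_right]

lemma integral_sq_le (h : InH U v G) (hl : lam ≤ lam1 U) :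
    lam * ∫ x, (v x) ^ 2 ≤ ∫ x, ‖G x‖ ^ 2 := by
  obtain ⟨φ, hφ, h1, h2⟩ := h.approx
  have t1 := h.tendsto_weighted hφ h1 (b := fun _ => 1) continuous_const (C := 1) (by simp)
  have t2 := h.tendsto_weighted_grad hφ h2 (L := fun _ => ContinuousLinearMap.id ℝ _)
    continuous_const (C := 1) (fun _ => ContinuousLinearMap.norm_id_le)
  simp only [one_mul, ContinuousLinearMap.id_apply, real_inner_self_eq_norm_sq] at t1 t2
  refine le_of_tendsto_of_tendsto' (t1.const_mul lam) t2 fun n => ?_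
  have h0 : 0 ≤ ∫ x, (φ n x) ^ 2 := by positivity
  exact (mul_le_mul_of_nonneg_right hl h0).trans (hφ n).integral_sq_le_of_lam1

lemma ae_eq_zero (h : InH U v G) : ∀ᵐ x, x ∉ U → v x = 0 := by
  obtain ⟨φ, hφ, h1, -⟩ := h.approx
  obtain ⟨ns, -, hae⟩ := h1.exists_ae (fun n => ((hφ n).memLp 2 volume).1) h.memV.1
  filter_upwards [hae] with x hx hxU
  refine tendsto_nhds_unique hx (tendsto_const_nhds.congr fun n => ?_)
  exact (image_eq_zero_of_notMem_tsupport fun h => hxU ((hφ _).2.2 h)).symm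

end InH

/-! ### Smooth truncation -/

/-- A smooth approximation, as `ε → 0`, of the indicator function of `(0, ∞)`. -/
def trunc (ε s : ℝ) : ℝ := Real.smoothTransition (s / ε)

lemma contDiff_trunc (ε : ℝ) : Smooth (trunc ε) :=
  Real.smoothTransition.contDiff.comp (contDiff_id.div_const ε)

lemma trunc_zero (ε : ℝ) : trunc ε 0 = 0 := by simp [trunc]

lemma trunc_nonneg (ε s : ℝ) : 0 ≤ trunc ε s := Real.smoothTransition.nonneg _

lemma trunc_le_one (ε s : ℝ) : trunc ε s ≤ 1 := Real.smoothTransition.le_one _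

lemma trunc_eq_one (hε : 0 < ε) (h : ε ≤ s) : trunc ε s = 1 :=
  Real.smoothTransition.one_of_one_le ((one_le_div hε).2 h)

lemma deriv_trunc (ε s : ℝ) : deriv (trunc ε) s = deriv Real.smoothTransition (s / ε) / ε := by
  have h := (smooth_differentiable Real.smoothTransition.contDiff (s / ε)).hasDerivAt.comp s
    ((hasDerivAt_id s).div_const ε)
  refine (HasDerivAt.deriv (f := trunc ε) h).trans ?_
  simp [div_eq_mul_inv]

lemma deriv_smoothTransition_nonneg (s : ℝ) : 0 ≤ deriv Real.smoothTransition s :=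
  Real.smoothTransition.monotone.deriv_nonneg

lemma deriv_smoothTransition_of_one_le (h : 1 ≤ s) : deriv Real.smoothTransition s = 0 := by
  have : IsLocalMax Real.smoothTransition s := by
    refine .of_forall fun y => ?_
    rw [Real.smoothTransition.one_of_one_le h]
    exact Real.smoothTransition.le_one y
  exact this.deriv_eq_zero

lemma deriv_smoothTransition_of_nonpos (h : s ≤ 0) : deriv Real.smoothTransition s = 0 := by
  have : IsLocalMin Real.smoothTransition s := by
    refine .of_forall fun y => ?_
    rw [Real.smoothTransition.zero_of_nonpos h]
    exact Real.smoothTransition.nonneg y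
  exact this.deriv_eq_zero

lemma exists_deriv_smoothTransition_bound :
    ∃ C, 0 < C ∧ ∀ s, |deriv Real.smoothTransition s| ≤ C := by
  have hc : Continuous (deriv Real.smoothTransition) :=
    (Real.smoothTransition.contDiff (n := (⊤ : ℕ∞))).continuous_deriv (by simp)
  obtain ⟨C, hC⟩ := (isCompact_Icc (a := (0 : ℝ)) (b := 1)).exists_bound_of_continuousOn
    hc.continuousOn
  refine ⟨max C 1, by positivity, fun s => ?_⟩
  by_cases h : s ∈ Icc (0 : ℝ) 1
  · exact (hC s h).trans (le_max_left _ _)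
  · have : deriv Real.smoothTransition s = 0 := by
      rcases le_or_gt s 0 with h1 | h1
      · exact deriv_smoothTransition_of_nonpos h1
      · exact deriv_smoothTransition_of_one_le (by
          by_contra h2
          exact h ⟨h1.le, (not_le.1 h2).le⟩)
    rw [this]; simp

lemma deriv_trunc_nonneg (hε : 0 < ε) (s : ℝ) : 0 ≤ deriv (trunc ε) s := by
  rw [deriv_trunc]; exact div_nonneg (deriv_smoothTransition_nonneg _) hε.le

lemma deriv_trunc_eq_zero (hε : 0 < ε) (h : ε ≤ s) : deriv (trunc ε) s = 0 := by
  rw [deriv_trunc, deriv_smoothTransition_of_one_le ((one_le_div hε).2 h), zero_div]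

lemma deriv_trunc_zero (ε : ℝ) : deriv (trunc ε) 0 = 0 := by
  rw [deriv_trunc, zero_div, deriv_smoothTransition_of_nonpos le_rfl, zero_div]

lemma exists_deriv_trunc_bound : ∃ C, 0 < C ∧ ∀ ε > 0, ∀ s, |deriv (trunc ε) s| ≤ C / ε := by
  obtain ⟨C, hC0, hC⟩ := exists_deriv_smoothTransition_bound
  refine ⟨C, hC0, fun ε hε s => ?_⟩
  rw [deriv_trunc, abs_div, abs_of_pos hε]
  gcongr
  exact hC _

lemma tendsto_trunc (hs : 0 < s) : Tendsto (fun ε => trunc ε s) (𝓝[>] 0) (𝓝 1) := by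
  refine tendsto_const_nhds.congr' ?_
  filter_upwards [Ioo_mem_nhdsGT hs] with ε hε
  exact (trunc_eq_one hε.1 hε.2.le).symm

/-! ### Nonnegative solutions and the measure `Δu + λu` -/

/-- `u ≥ 0` is a normalized solution of `-Δu = λu` in `Ω`, in the closure of the test functions of
`Ω`, with weak gradient `G`. -/
structure GroundState (Ω : Set (Euc d)) (lam : ℝ) (u : Euc d → ℝ) (G : Euc d → Euc d) :
    Prop where
  inH : InH Ω u G
  nonneg : ∀ x, 0 ≤ u x
  grad_zero : ∀ᵐ x, u x = 0 → G x = 0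
  weak : ∀ φ, TestFun Ω φ → ∫ x, ⟪G x, gradient φ x⟫ = lam * ∫ x, u x * φ x
  norm_one : ∫ x, (u x) ^ 2 = 1
  energy : ∫ x, ‖G x‖ ^ 2 = lam

lemma IsFirstEigenfun.groundState (h : IsFirstEigenfun Ω u)
    (hnn : ∀ x, 0 ≤ u x) : GroundState Ω (lam1 Ω) u (fun x => gradient u x) where
  inH := h.1.inH
  nonneg := hnn
  grad_zero := .of_forall fun x hx => by
    have : IsLocalMin u x := .of_forall fun y => by rw [hx]; exact hnn y
    simp [gradient, this.fderiv_eq_zero]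
  weak := h.2.2.2
  norm_one := h.2.1
  energy := h.2.2.1

/-- The distribution `Δu + λu`. -/
def dist_lap (lam : ℝ) (u : Euc d → ℝ) (G : Euc d → Euc d) (φ : Euc d → ℝ) : ℝ :=
  lam * (∫ x, u x * φ x) - ∫ x, ⟪G x, gradient φ x⟫

namespace GroundState

lemma lam_nonneg (h : GroundState Ω lam u G) : 0 ≤ lam := by rw [← h.energy]; positivity

lemma weakH (h : GroundState Ω lam u G) (hw : InH Ω w F) :
    ∫ x, ⟪G x, F x⟫ = lam * ∫ x, u x * w x := by
  obtain ⟨φ, hφ, h1, h2⟩ := hw.approx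
  have t1 := tendsto_integral_inner_of_L2Lim (f := fun _ => G) (g := G) (by simp [L2Lim]) h2
    (fun _ => h.inH.memG) (fun n => (hφ n).gradient_memLp 2) h.inH.memG hw.memG
  have t2 := tendsto_integral_inner_of_L2Lim (f := fun _ => u) (g := u) (by simp [L2Lim]) h1
    (fun _ => h.inH.memV) (fun n => (hφ n).memLp 2 volume) h.inH.memV hw.memV
  have e1 : ∀ n, ∫ x, ⟪u x, φ n x⟫ = ∫ x, u x * φ n x := fun n => by congr 1; ext x; simp [mul_comm]
  have e2 : ∫ x, ⟪u x, w x⟫ = ∫ x, u x * w x := by congr 1; ext x; simp [mul_comm]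
  simp_rw [e1] at t2
  rw [e2] at t2
  simp_rw [fun n => h.weak (φ n) (hφ n)] at t1
  exact tendsto_nhds_unique t1 (t2.const_mul lam)

lemma integrable_mul (h : GroundState Ω lam u G) (hφ : MemLp φ 2) : Integrable fun x => u x * φ x :=
  h.inH.memV.integrable_mul hφ

lemma integrable_inner (h : GroundState Ω lam u G)
    (hF : MemLp F 2) : Integrable fun x => ⟪G x, F x⟫ :=
  integrable_inner_of_memLp_two h.inH.memG hF

lemma trunc_identity (h : GroundState Ω lam u G) (hφ : TestFun univ φ) (hε : 0 < ε) :
    ∫ x, deriv (trunc ε) (u x) * ‖G x‖ ^ 2 * φ x =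
      dist_lap lam u G φ - (lam * (∫ x, u x * ((1 - trunc ε (u x)) * φ x)) -
        ∫ x, ⟪G x, (1 - trunc ε (u x)) • gradient φ x⟫) := by
  obtain ⟨C, hC0, hC⟩ := exists_deriv_trunc_bound
  have hS := h.inH.comp (contDiff_trunc ε) (trunc_zero ε) (hC ε hε)
  have hw := h.weakH (hS.mul_test hφ)
  have mt : AEStronglyMeasurable (fun x => trunc ε (u x)) volume :=
    (contDiff_trunc ε).continuous.comp_aestronglyMeasurable h.inH.memV.1
  have m1 : MemLp (fun x => (1 - trunc ε (u x)) * φ x) 2 (volume : Measure (Euc d)) :=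
    (hφ.memLp 2 volume).of_le ((aestronglyMeasurable_const.sub mt).mul hφ.continuous.aestronglyMeasurable)
      (.of_forall fun x => by
        rw [norm_mul, Real.norm_eq_abs, abs_of_nonneg (by linarith [trunc_le_one ε (u x)])]
        exact mul_le_of_le_one_left (norm_nonneg _) (by linarith [trunc_nonneg ε (u x)]))
  have m2 : MemLp (fun x => (1 - trunc ε (u x)) • gradient φ x) 2 (volume : Measure (Euc d)) :=
    (hφ.gradient_memLp 2).of_le ((aestronglyMeasurable_const.sub mt).smul
        hφ.continuous_gradient.aestronglyMeasurable)
      (.of_forall fun x => by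
        rw [norm_smul, Real.norm_eq_abs, abs_of_nonneg (by linarith [trunc_le_one ε (u x)])]
        exact mul_le_of_le_one_left (norm_nonneg _) (by linarith [trunc_nonneg ε (u x)]))
  have mg := (hS.mul_test hφ).memG
  have e1 : ∫ x, u x * (φ x * trunc ε (u x)) =
      (∫ x, u x * φ x) - ∫ x, u x * ((1 - trunc ε (u x)) * φ x) := by
    rw [← integral_sub (h.integrable_mul (hφ.memLp 2 volume)) (h.integrable_mul m1)]
    congr 1; ext x; ring
  have e2 : ∫ x, deriv (trunc ε) (u x) * ‖G x‖ ^ 2 * φ x =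
      (∫ x, ⟪G x, φ x • deriv (trunc ε) (u x) • G x + trunc ε (u x) • gradient φ x⟫) -
      ((∫ x, ⟪G x, gradient φ x⟫) - ∫ x, ⟪G x, (1 - trunc ε (u x)) • gradient φ x⟫) := by
    rw [← integral_sub (h.integrable_inner (hφ.gradient_memLp 2)) (h.integrable_inner m2),
      ← integral_sub (g := fun x => ⟪G x, gradient φ x⟫ - ⟪G x, (1 - trunc ε (u x)) • gradient φ x⟫)
        (h.integrable_inner mg)
        ((h.integrable_inner (hφ.gradient_memLp 2)).sub (h.integrable_inner m2))]
    congr 1; ext x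
    simp only [inner_add_right, inner_smul_right, real_inner_self_eq_norm_sq]
    ring
  rw [e2, hw, e1, dist_lap]; ring

lemma tendsto_trunc_integral (h : GroundState Ω lam u G) (hφ : TestFun univ φ) :
    Tendsto (fun ε => ∫ x, deriv (trunc ε) (u x) * ‖G x‖ ^ 2 * φ x) (𝓝[>] 0)
      (𝓝 (dist_lap lam u G φ)) := by
  have mt : ∀ ε, AEStronglyMeasurable (fun x => trunc ε (u x)) volume := fun ε =>
    (contDiff_trunc ε).continuous.comp_aestronglyMeasurable h.inH.memV.1
  have b : ∀ ε x, ‖1 - trunc ε (u x)‖ ≤ 1 := fun ε x => by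
    rw [Real.norm_eq_abs, abs_of_nonneg (by linarith [trunc_le_one ε (u x)])]
    linarith [trunc_nonneg ε (u x)]
  have t1 : Tendsto (fun ε => ∫ x, u x * ((1 - trunc ε (u x)) * φ x)) (𝓝[>] 0)
      (𝓝 (∫ _ : Euc d, (0 : ℝ))) := by
    refine tendsto_integral_filter_of_dominated_convergence (fun x => ‖u x * φ x‖) ?_ ?_
      (h.integrable_mul (hφ.memLp 2 volume)).norm ?_
    · exact .of_forall fun ε => h.inH.memV.1.mul ((aestronglyMeasurable_const.sub
        (mt ε)).mul hφ.continuous.aestronglyMeasurable)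
    · refine .of_forall fun ε => .of_forall fun x => ?_
      rw [norm_mul, norm_mul, norm_mul]
      exact mul_le_mul_of_nonneg_left (mul_le_of_le_one_left (norm_nonneg _) (b ε x))
        (norm_nonneg _)
    · refine .of_forall fun x => ?_
      rcases (h.nonneg x).eq_or_lt with h0 | h0
      · simp [← h0]
      · have := (((tendsto_trunc h0).const_sub 1).mul_const (φ x)).const_mul (u x)
        simpa using this
  have t2 : Tendsto (fun ε => ∫ x, ⟪G x, (1 - trunc ε (u x)) • gradient φ x⟫) (𝓝[>] 0)
      (𝓝 (∫ _ : Euc d, (0 : ℝ))) := by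
    refine tendsto_integral_filter_of_dominated_convergence (fun x => ‖G x‖ * ‖gradient φ x‖) ?_ ?_
      (h.inH.memG.norm.integrable_mul (hφ.gradient_memLp 2).norm) ?_
    · exact .of_forall fun ε => h.inH.memG.1.inner ((aestronglyMeasurable_const.sub
        (mt ε)).smul hφ.continuous_gradient.aestronglyMeasurable)
    · refine .of_forall fun ε => .of_forall fun x => ?_
      refine (norm_inner_le_norm (𝕜 := ℝ) _ _).trans ?_
      rw [norm_smul]
      exact mul_le_mul_of_nonneg_left (mul_le_of_le_one_left (norm_nonneg _) (b ε x))
        (norm_nonneg _)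
    · filter_upwards [h.grad_zero] with x hx
      rcases (h.nonneg x).eq_or_lt with h0 | h0
      · simp [hx h0.symm]
      · have := ((tendsto_trunc h0).const_sub 1).mul_const (⟪G x, gradient φ x⟫)
        simpa [inner_smul_right] using this
  have t3 := ((t1.const_mul lam).sub t2).const_sub (dist_lap lam u G φ)
  simp only [integral_zero, mul_zero, sub_zero] at t3
  refine t3.congr' ?_
  filter_upwards [self_mem_nhdsWithin] with ε hε
  exact (h.trunc_identity hφ hε).symm

lemma dist_lap_nonneg (h : GroundState Ω lam u G) (hφ : TestFun univ φ)
    (h0 : ∀ x, 0 ≤ φ x) : 0 ≤ dist_lap lam u G φ := by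
  refine ge_of_tendsto (h.tendsto_trunc_integral hφ) ?_
  filter_upwards [self_mem_nhdsWithin] with ε hε
  exact integral_nonneg fun x => mul_nonneg (mul_nonneg (deriv_trunc_nonneg hε _) (by positivity))
    (h0 x)

lemma dist_lap_add (h : GroundState Ω lam u G) (hφ : TestFun univ φ) (hψ : TestFun univ ψ) :
    dist_lap lam u G (fun x => φ x + ψ x) = dist_lap lam u G φ + dist_lap lam u G ψ := by
  unfold dist_lap
  have e1 : ∫ x, u x * (φ x + ψ x) = (∫ x, u x * φ x) + ∫ x, u x * ψ x := by
    rw [← integral_add (h.integrable_mul (hφ.memLp 2 volume)) (h.integrable_mul (hψ.memLp 2 volume))]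
    simp_rw [mul_add]
  have e2 : ∫ x, ⟪G x, gradient (fun x => φ x + ψ x) x⟫ =
      (∫ x, ⟪G x, gradient φ x⟫) + ∫ x, ⟪G x, gradient ψ x⟫ := by
    rw [← integral_add (h.integrable_inner (hφ.gradient_memLp 2))
      (h.integrable_inner (hψ.gradient_memLp 2))]
    congr 1; ext x
    rw [gradient_add (hφ.differentiable x) (hψ.differentiable x), inner_add_right]
  rw [e1, e2]; ring

lemma dist_lap_smul (hφ : TestFun univ φ) (c : ℝ) :
    dist_lap lam u G (fun x => c * φ x) = c * dist_lap lam u G φ := by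
  unfold dist_lap
  have e1 : ∫ x, u x * (c * φ x) = c * ∫ x, u x * φ x := by
    rw [← integral_const_mul]; congr 1; ext x; ring
  have e2 : ∫ x, ⟪G x, gradient (fun x => c * φ x) x⟫ = c * ∫ x, ⟪G x, gradient φ x⟫ := by
    rw [← integral_const_mul]; congr 1; ext x
    rw [gradient_const_mul c (hφ.differentiable x), inner_smul_right]
  rw [e1, e2]; ring

open CompactlySupported in
theorem exists_measure (h : GroundState Ω lam u G) :
    ∃ μ : Measure (Euc d), IsFiniteMeasureOnCompacts μ ∧
      ∀ φ, TestFun univ φ → ∫ x, φ x ∂μ = dist_lap lam u G φ := by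
  have test : ∀ f : C_c(Euc d, ℝ), Smooth f → TestFun univ f := fun f hf =>
    ⟨hf, f.hasCompactSupport, subset_univ _⟩
  let p : Submodule ℝ C_c(Euc d, ℝ) :=
    { carrier := {f | Smooth f}
      add_mem' := fun {a b} ha hb => by
        change Smooth (fun x => a x + b x)
        exact ContDiff.add ha hb
      zero_mem' := by
        change Smooth (fun _ => (0 : ℝ))
        exact contDiff_const
      smul_mem' := fun c f hf => by
        change Smooth (fun x => c * f x)
        exact contDiff_const.mul hf }
  let L : C_c(Euc d, ℝ) →ₗ.[ℝ] ℝ :=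
    { domain := p
      toFun :=
        { toFun := fun f => dist_lap lam u G f.1
          map_add' := fun a b => h.dist_lap_add (test _ a.2) (test _ b.2)
          map_smul' := fun c a => dist_lap_smul (test _ a.2) c } }
  let s : PointedCone ℝ C_c(Euc d, ℝ) :=
    { carrier := {f | ∀ x, 0 ≤ f x}
      add_mem' := fun {a b} ha hb x => add_nonneg (ha x) (hb x)
      zero_mem' := fun x => le_rfl
      smul_mem' := fun c f hf x => by
        change 0 ≤ (c : ℝ) * f x
        exact mul_nonneg c.2 (hf x) }
  obtain ⟨g, hg1, hg2⟩ := riesz_extension s L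
    (fun x hx => h.dist_lap_nonneg (test _ x.2) hx) (fun y => by
      obtain ⟨C, hC⟩ := y.continuous.bounded_above_of_compact_support y.hasCompactSupport
      obtain ⟨R, hR⟩ := y.hasCompactSupport.isCompact.isBounded.subset_closedBall 0
      let b : ContDiffBump (0 : Euc d) := ⟨max R 1, max R 1 + 1, by positivity, by linarith⟩
      refine ⟨⟨⟨⟨fun x => C * b x, continuous_const.mul b.continuous⟩,
          b.hasCompactSupport.mul_left⟩, ?_⟩, ?_⟩
      · change Smooth fun x => C * b x
        exact contDiff_const.mul b.contDiff
      · intro x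
        change 0 ≤ C * b x + y x
        by_cases hx : x ∈ tsupport y
        · rw [b.one_of_mem_closedBall (closedBall_subset_closedBall (le_max_left _ _) (hR hx))]
          have h1 : |y x| ≤ C := hC x
          linarith [neg_abs_le (y x)]
        · rw [image_eq_zero_of_notMem_tsupport hx, add_zero]
          exact mul_nonneg ((norm_nonneg _).trans (hC 0)) b.nonneg)
  let Λ : C_c(Euc d, ℝ) →ₚ[ℝ] ℝ := PositiveLinearMap.mk₀ g fun f hf => hg2 f hf
  refine ⟨RealRMK.rieszMeasure Λ, inferInstance, fun φ hφ => ?_⟩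
  have := RealRMK.integral_rieszMeasure Λ ⟨⟨φ, hφ.continuous⟩, hφ.2.1⟩
  refine this.trans ?_
  exact hg1 ⟨⟨⟨φ, hφ.continuous⟩, hφ.2.1⟩, hφ.1⟩

end GroundState

/-! ### The radial kernels -/

lemma deriv_expNegInvGlue (x : ℝ) : deriv expNegInvGlue x = x⁻¹ ^ 2 * expNegInvGlue x := by
  have := expNegInvGlue.hasDerivAt_polynomial_eval_inv_mul 1 x
  simpa using this.deriv

lemma expNegInvGlue_le_one (x : ℝ) : expNegInvGlue x ≤ 1 := by
  unfold expNegInvGlue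
  split_ifs with h
  · exact zero_le_one
  · rw [Real.exp_le_one_iff]
    simpa using (not_le.1 h).le

/-- A smooth radial bump function on the unit ball. -/
def kerK (z : Euc d) : ℝ := expNegInvGlue (1 - ‖z‖ ^ 2)

/-- The radial kernel with `∇K(z) = - k(z) z`. -/
def kerk (z : Euc d) : ℝ := 2 * deriv expNegInvGlue (1 - ‖z‖ ^ 2)

lemma contDiff_kerK : Smooth (kerK : Euc d → ℝ) :=
  expNegInvGlue.contDiff.comp (contDiff_const.sub (contDiff_norm_sq ℝ))

lemma contDiff_kerk : Smooth (kerk : Euc d → ℝ) := by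
  have h : Smooth (deriv expNegInvGlue) :=
    (contDiff_infty_iff_deriv.1 expNegInvGlue.contDiff).2
  exact contDiff_const.mul (h.comp (contDiff_const.sub (contDiff_norm_sq ℝ)))

lemma kerK_nonneg (z : Euc d) : 0 ≤ kerK z := expNegInvGlue.nonneg _

lemma kerK_le_one (z : Euc d) : kerK z ≤ 1 := expNegInvGlue_le_one _

lemma kerK_eq_zero (h : 1 ≤ ‖z‖) : kerK z = 0 :=
  expNegInvGlue.zero_of_nonpos (by nlinarith [norm_nonneg z])

lemma kerk_eq (z : Euc d) : kerk z = 2 * ((1 - ‖z‖ ^ 2)⁻¹) ^ 2 * kerK z := by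
  rw [kerk, deriv_expNegInvGlue, kerK]; ring

lemma kerk_eq_zero (h : 1 ≤ ‖z‖) : kerk z = 0 := by rw [kerk_eq, kerK_eq_zero h, mul_zero]

lemma two_kerK_le_kerk (z : Euc d) : 2 * kerK z ≤ kerk z := by
  rcases le_or_gt 1 ‖z‖ with h | h
  · rw [kerK_eq_zero h, kerk_eq_zero h, mul_zero]
  · rw [kerk_eq]
    have h1 : 0 < 1 - ‖z‖ ^ 2 := by nlinarith [norm_nonneg z]
    have h2 : 1 ≤ (1 - ‖z‖ ^ 2)⁻¹ := (one_le_inv₀ h1).2 (by nlinarith [norm_nonneg z])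
    have h3 : 1 ≤ ((1 - ‖z‖ ^ 2)⁻¹) ^ 2 := one_le_pow₀ h2
    nlinarith [kerK_nonneg z]

lemma kerk_nonneg (z : Euc d) : 0 ≤ kerk z :=
  (mul_nonneg zero_le_two (kerK_nonneg z)).trans (two_kerK_le_kerk z)

lemma kerk_neg (z : Euc d) : kerk (-z) = kerk z := by simp [kerk]

lemma exists_kerK_lower : ∃ c, 0 < c ∧ c ≤ 1 ∧ ∀ z : Euc d, ‖z‖ ≤ 1 / 2 → c ≤ kerK z := by
  refine ⟨Real.exp (-(4 / 3)), Real.exp_pos _, by rw [Real.exp_le_one_iff]; norm_num,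
    fun z hz => ?_⟩
  have h1 : 3 / 4 ≤ 1 - ‖z‖ ^ 2 := by nlinarith [norm_nonneg z]
  rw [kerK, expNegInvGlue, if_neg (by linarith)]
  refine Real.exp_le_exp.2 (neg_le_neg ?_)
  rw [inv_le_comm₀ (by linarith) (by norm_num)]
  norm_num; linarith

lemma hasCompactSupport_kerk : HasCompactSupport (kerk : Euc d → ℝ) :=
  HasCompactSupport.intro (isCompact_closedBall (0 : Euc d) 1) fun z hz => kerk_eq_zero (by
    simpa using (not_le.1 (by simpa using hz)).le)

lemma gradient_kerK (z : Euc d) : gradient kerK z = -(kerk z) • z := by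
  refine ext_inner_right ℝ fun v => ?_
  rw [inner_gradient_left]
  have h1 : HasFDerivAt (fun z : Euc d => 1 - ‖z‖ ^ 2) (-(2 • (innerSL ℝ z))) z := by
    simpa using (hasStrictFDerivAt_norm_sq z).hasFDerivAt.const_sub 1
  have h2 : HasDerivAt expNegInvGlue (deriv expNegInvGlue (1 - ‖z‖ ^ 2)) (1 - ‖z‖ ^ 2) :=
    (smooth_differentiable expNegInvGlue.contDiff _).hasDerivAt
  have h3 : HasFDerivAt kerK _ z := h2.comp_hasFDerivAt z h1
  rw [h3.fderiv, inner_smul_left, kerk]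
  simp
  ring

lemma exists_kerk_bound : ∃ C, 0 < C ∧ ∀ z : Euc d, kerk z ≤ C := by
  obtain ⟨C, hC⟩ := (contDiff_kerk (d := d)).continuous.bounded_above_of_compact_support
    hasCompactSupport_kerk
  exact ⟨max C 1, by positivity, fun z => (le_abs_self _).trans ((hC z).trans (le_max_left _ _))⟩

/-- The mass of the kernel `kerk`. -/
def massk (d : ℕ) : ℝ := ∫ z : Euc d, kerk z

lemma integrable_kerk : Integrable (kerk : Euc d → ℝ) :=
  contDiff_kerk.continuous.integrable_of_hasCompactSupport hasCompactSupport_kerk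

lemma massk_pos : 0 < massk d := by
  rw [massk, integral_pos_iff_support_of_nonneg kerk_nonneg integrable_kerk]
  refine lt_of_lt_of_le (measure_ball_pos volume (0 : Euc d) one_half_pos)
    (measure_mono fun z hz => ?_)
  obtain ⟨c, hc, -, h⟩ := exists_kerK_lower (d := d)
  have h1 := h z (by simpa using (mem_ball_zero_iff.1 hz).le)
  have h2 := two_kerK_le_kerk z
  exact ne_of_gt (by linarith)

/-! ### Scaling and volumes of balls -/

lemma integral_comp_scale {E : Type*} [NormedAddCommGroup E] [NormedSpace ℝ E] (f : Euc d → E)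
    (x : Euc d) (hr : 0 < r) : ∫ y, f (r⁻¹ • (y - x)) = r ^ d • ∫ z, f z := by
  rw [integral_sub_right_eq_self (fun y => f (r⁻¹ • y)) x, Measure.integral_comp_smul]
  simp [abs_of_pos hr]

/-- The volume of the unit ball. -/
def omd (d : ℕ) : ℝ := mvol (ball (0 : Euc d) 1)

lemma omd_pos : 0 < omd d :=
  ENNReal.toReal_pos (measure_ball_pos volume _ one_pos).ne' measure_ball_lt_top.ne

lemma mvol_closedBall (x : Euc d) (hr : 0 ≤ r) : mvol (closedBall x r) = r ^ d * omd d := by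
  rw [mvol, Measure.addHaar_closedBall _ _ hr, ENNReal.toReal_mul, omd, mvol,
    ENNReal.toReal_ofReal (by positivity)]
  simp

lemma mvol_ball (x : Euc d) (hr : 0 < r) : mvol (ball x r) = r ^ d * omd d := by
  rw [mvol, Measure.addHaar_ball_of_pos _ _ hr, ENNReal.toReal_mul, omd, mvol,
    ENNReal.toReal_ofReal (by positivity)]
  simp

lemma mvol_mono {s t : Set (Euc d)} (h : s ⊆ t) (ht : volume t ≠ ∞) : mvol s ≤ mvol t :=
  ENNReal.toReal_mono ht (measure_mono h)

lemma mvol_nonneg (s : Set (Euc d)) : 0 ≤ mvol s := ENNReal.toReal_nonneg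

/-! ### Scaled kernels -/

/-- The bump function `K` transported to the ball of centre `x` and radius `r`. -/
def bumpK (x : Euc d) (r : ℝ) (y : Euc d) : ℝ := kerK (r⁻¹ • (y - x))

lemma contDiff_scale (x : Euc d) (r : ℝ) : Smooth (fun y : Euc d => r⁻¹ • (y - x)) :=
  (contDiff_id.sub contDiff_const).const_smul r⁻¹

lemma norm_scale (hr : 0 < r) : ‖r⁻¹ • (y - x)‖ = r⁻¹ * dist y x := by
  rw [norm_smul, dist_eq_norm, norm_inv, Real.norm_of_nonneg hr.le]

lemma bumpK_nonneg (x : Euc d) (r : ℝ) (y : Euc d) : 0 ≤ bumpK x r y := kerK_nonneg _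

lemma bumpK_le_one (x : Euc d) (r : ℝ) (y : Euc d) : bumpK x r y ≤ 1 := kerK_le_one _

lemma one_le_norm_scale (hr : 0 < r) (h : r ≤ dist y x) :
    1 ≤ ‖r⁻¹ • (y - x)‖ := by
  rw [norm_scale hr, ← div_eq_inv_mul]; exact (one_le_div hr).2 h

lemma bumpK_eq_zero (hr : 0 < r) (h : r ≤ dist y x) : bumpK x r y = 0 :=
  kerK_eq_zero (one_le_norm_scale hr h)

lemma bumpK_testFun (x : Euc d) (hr : 0 < r) (hU : closedBall x r ⊆ U) :
    TestFun U (bumpK x r) := by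
  have hs : tsupport (bumpK x r) ⊆ closedBall x r :=
    closure_minimal (fun y hy => by
      by_contra hc
      exact hy (bumpK_eq_zero hr (not_le.1 (by simpa using hc)).le)) isClosed_closedBall
  exact ⟨contDiff_kerK.comp (contDiff_scale x r), (isCompact_closedBall x r).of_isClosed_subset
    (isClosed_tsupport _) hs, hs.trans hU⟩

lemma gradient_comp_scale (hf : Differentiable ℝ f) (x : Euc d) (r : ℝ)
    (y : Euc d) : gradient (fun y => f (r⁻¹ • (y - x))) y = r⁻¹ • gradient f (r⁻¹ • (y - x)) := by
  refine ext_inner_right ℝ fun v => ?_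
  have h1 : HasFDerivAt (fun y : Euc d => r⁻¹ • (y - x)) (r⁻¹ • ContinuousLinearMap.id ℝ (Euc d)) y :=
    ((hasFDerivAt_id y).sub_const x).const_smul r⁻¹
  have h2 : HasFDerivAt (fun y => f (r⁻¹ • (y - x))) _ y := (hf _).hasFDerivAt.comp y h1
  rw [inner_gradient_left, h2.fderiv, inner_smul_left, inner_gradient_left]
  simp

lemma gradient_bumpK (x : Euc d) (r : ℝ) (y : Euc d) :
    gradient (bumpK x r) y = -(r⁻¹ ^ 2 * kerk (r⁻¹ • (y - x))) • (y - x) := by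
  have := gradient_comp_scale (smooth_differentiable contDiff_kerK) x r y
  refine Eq.trans this ?_
  rw [gradient_kerK, smul_smul, smul_smul]
  congr 1; ring

/-! ### Weak gradients and averages -/

/-- `G` is the weak gradient of `v`. -/
structure WeakGrad (v : Euc d → ℝ) (G : Euc d → Euc d) : Prop where
  locV : LocallyIntegrable v
  locG : LocallyIntegrable G
  ibp : ∀ X : Euc d → Euc d, Smooth X → HasCompactSupport X → ∫ x, v x * divg X x = -∫ x, ⟪G x, X x⟫

lemma InH.weakGrad (h : InH U v G) : WeakGrad v G :=
  ⟨h.memV.locallyIntegrable (by norm_num), h.memG.locallyIntegrable (by norm_num),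
    fun _ hX hc => h.integral_mul_divg hX hc⟩

lemma weakGrad_of_contDiff (h : Smooth v) : WeakGrad v (fun x => gradient v x) :=
  ⟨h.continuous.locallyIntegrable, (contDiff_gradient h).continuous.locallyIntegrable,
    fun _ hX hc => integral_mul_divg h hX (Or.inr hc)⟩

/-- The average of `v` around `x` at scale `r` with respect to the kernel `kerk`
(which has mass `massk d`). -/
def avg (v : Euc d → ℝ) (x : Euc d) (r : ℝ) : ℝ := ∫ y, v y * (r⁻¹ ^ d * kerk (r⁻¹ • (y - x)))

lemma continuous_kerk_scale (x : Euc d) (r : ℝ) : Continuous fun y => kerk (r⁻¹ • (y - x)) :=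
  contDiff_kerk.continuous.comp (contDiff_scale x r).continuous

lemma hasCompactSupport_of_scale {E : Type*} [NormedAddCommGroup E] {f : Euc d → E}
    (hf : ∀ z, 1 ≤ ‖z‖ → f z = 0) (x : Euc d) (hr : 0 < r) :
    HasCompactSupport fun y => f (r⁻¹ • (y - x)) :=
  HasCompactSupport.intro (isCompact_closedBall x r) fun y hy =>
    hf _ (one_le_norm_scale hr (not_le.1 (by simpa using hy)).le)

lemma LocallyIntegrable.integrable_mul_cont (hv : LocallyIntegrable v)
    (hg : Continuous g) (hc : HasCompactSupport g) : Integrable fun y => v y * g y := by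
  simpa [mul_comm] using hv.integrable_smul_left_of_hasCompactSupport hg hc

lemma integrable_avg (hv : LocallyIntegrable v) (x : Euc d) (hr : 0 < r) :
    Integrable fun y => v y * (r⁻¹ ^ d * kerk (r⁻¹ • (y - x))) :=
  LocallyIntegrable.integrable_mul_cont hv (continuous_const.mul (continuous_kerk_scale x r))
    (hasCompactSupport_of_scale (fun _ => kerk_eq_zero) x hr).mul_left

lemma avg_congr (h : v =ᵐ[volume] w) (x : Euc d) (r : ℝ) : avg v x r = avg w x r :=
  integral_congr_ae (h.mono fun y hy => by simp only [hy])

lemma avg_const_one (x : Euc d) (hr : 0 < r) : ∫ y, r⁻¹ ^ d * kerk (r⁻¹ • (y - x)) = massk d := by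
  rw [integral_const_mul, integral_comp_scale kerk x hr, massk, smul_eq_mul, ← mul_assoc,
    ← mul_pow, inv_mul_cancel₀ hr.ne', one_pow, one_mul]

lemma abs_avg_sub_le (hC : ∀ z : Euc d, kerk z ≤ C)
    (hv : LocallyIntegrable v) (x : Euc d) (c : ℝ) (hr : 0 < r) :
    |avg v x r - massk d * c| ≤ C * r⁻¹ ^ d * ∫ y in closedBall x r, |v y - c| := by
  have h1 : avg v x r - massk d * c = ∫ y, (v y - c) * (r⁻¹ ^ d * kerk (r⁻¹ • (y - x))) := by
    rw [avg, ← avg_const_one x hr, ← integral_mul_const, ← integral_sub (integrable_avg hv x hr)]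
    · congr 1; ext y; ring
    · exact (((continuous_const.mul (continuous_kerk_scale x r)).integrable_of_hasCompactSupport
        (hasCompactSupport_of_scale (fun _ => kerk_eq_zero) x hr).mul_left)).mul_const c
  have hi : IntegrableOn (fun y => |v y - c|) (closedBall x r) :=
    ((hv.integrableOn_isCompact (isCompact_closedBall x r)).sub
      (integrableOn_const measure_closedBall_lt_top.ne)).abs
  rw [h1, ← integral_const_mul, ← setIntegral_eq_integral_of_forall_compl_eq_zero
    (s := closedBall x r)]
  · rw [← Real.norm_eq_abs]
    refine norm_integral_le_of_norm_le (Integrable.const_mul hi _) (.of_forall fun y => ?_)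
    rw [norm_mul, Real.norm_eq_abs, Real.norm_of_nonneg
      (mul_nonneg (by positivity) (kerk_nonneg _)), mul_comm]
    refine mul_le_mul_of_nonneg_right ?_ (abs_nonneg _)
    rw [mul_comm]
    exact mul_le_mul_of_nonneg_right (hC _) (by positivity)
  · intro y hy
    rw [kerk_eq_zero (one_le_norm_scale hr (not_le.1 (by simpa using hy)).le)]; simp

lemma tendsto_avg_of_continuousAt (hv : LocallyIntegrable v)
    (hc : ContinuousAt v x) : Tendsto (avg v x) (𝓝[>] 0) (𝓝 (massk d * v x)) := by
  obtain ⟨C, hC0, hC⟩ := exists_kerk_bound (d := d)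
  rw [Metric.tendsto_nhds]
  intro ε hε
  have hpos : 0 < C * omd d + 1 := by have := omd_pos (d := d); positivity
  obtain ⟨δ, hδ, h⟩ := Metric.continuousAt_iff.1 hc (ε / (C * omd d + 1)) (by positivity)
  filter_upwards [Ioo_mem_nhdsGT hδ] with r hr
  rw [Real.dist_eq]
  refine (abs_avg_sub_le hC hv x (v x) hr.1).trans_lt ?_
  have h1 : ∫ y in closedBall x r, |v y - v x| ≤ ε / (C * omd d + 1) * mvol (closedBall x r) := by
    have := norm_setIntegral_le_of_norm_le_const (μ := (volume : Measure (Euc d)))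
      (s := closedBall x r) (f := fun y => |v y - v x|) (C := ε / (C * omd d + 1))
      measure_closedBall_lt_top (fun y hy => by
        rw [Real.norm_eq_abs, abs_abs, ← Real.dist_eq]
        exact (h (lt_of_le_of_lt (mem_closedBall.1 hy) hr.2)).le)
    exact (le_abs_self _).trans this
  rw [mvol_closedBall x hr.1.le] at h1
  have h2 : 0 < r := hr.1
  calc C * r⁻¹ ^ d * ∫ y in closedBall x r, |v y - v x|
      ≤ C * r⁻¹ ^ d * (ε / (C * omd d + 1) * (r ^ d * omd d)) := by gcongr
    _ = ε * ((C * omd d) / (C * omd d + 1)) := by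
        rw [inv_pow]; field_simp
    _ < ε * 1 := by
        gcongr
        rw [div_lt_one hpos]; linarith
    _ = ε := mul_one _

lemma ae_tendsto_avg (hv : LocallyIntegrable v) :
    ∀ᵐ x, Tendsto (avg v x) (𝓝[>] 0) (𝓝 (massk d * v x)) := by
  obtain ⟨C, hC0, hC⟩ := exists_kerk_bound (d := d)
  filter_upwards [IsUnifLocDoublingMeasure.ae_tendsto_average_norm_sub
    (volume : Measure (Euc d)) hv 1] with x hx
  have h1 := hx (l := 𝓝[>] (0 : ℝ)) (fun _ => x) (fun r => r) tendsto_id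
    (by filter_upwards [self_mem_nhdsWithin] with r hr
        exact mem_closedBall_self (by simpa using (mem_Ioi.1 hr).le))
  rw [tendsto_iff_dist_tendsto_zero]
  have h2 := h1.const_mul (C * omd d)
  rw [mul_zero] at h2
  refine squeeze_zero' (.of_forall fun _ => dist_nonneg) ?_ h2
  filter_upwards [self_mem_nhdsWithin] with r hr
  rw [Real.dist_eq]
  refine (abs_avg_sub_le hC hv x (v x) hr).trans (le_of_eq ?_)
  have hr' : 0 < r := hr
  rw [setAverage_eq, measureReal_def, show (volume (closedBall x r)).toReal = r ^ d * omd d from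
    mvol_closedBall x hr'.le, smul_eq_mul]
  have := (omd_pos (d := d)).ne'
  simp only [Real.norm_eq_abs]
  rw [inv_pow]; field_simp

lemma continuous_avg (hv : LocallyIntegrable v) (hr : 0 < r) : Continuous fun x => avg v x r := by
  have hs := hasCompactSupport_of_scale (f := kerk (d := d)) (fun _ => kerk_eq_zero) 0 hr
  have h := HasCompactSupport.continuous_convolution_right (μ := (volume : Measure (Euc d)))
    (ContinuousLinearMap.mul ℝ ℝ) (f := v) (g := fun y : Euc d => r⁻¹ ^ d * kerk (r⁻¹ • (y - 0)))
    hs.mul_left hv (continuous_const.mul (continuous_kerk_scale 0 r))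
  refine h.congr fun x => ?_
  rw [convolution_def, avg]
  congr 1; ext y
  rw [ContinuousLinearMap.mul_apply', ← kerk_neg (r⁻¹ • (y - x)), ← smul_neg, neg_sub, sub_zero]

lemma hasDerivAt_kernel (w : Euc d) (hr : 0 < r) :
    HasDerivAt (fun r : ℝ => r⁻¹ ^ d * kerk (r⁻¹ • w))
      (-(r⁻¹ * r⁻¹ ^ d * (d * kerk (r⁻¹ • w) + fderiv ℝ kerk (r⁻¹ • w) (r⁻¹ • w)))) r := by
  have h1 : HasDerivAt (fun r : ℝ => r⁻¹) (-(r ^ 2)⁻¹) r := hasDerivAt_inv hr.ne'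
  have h2 : HasDerivAt (fun r : ℝ => r⁻¹ • w) (-(r ^ 2)⁻¹ • w) r := h1.smul_const w
  have h3 : HasDerivAt (fun r : ℝ => kerk (r⁻¹ • w)) (fderiv ℝ kerk (r⁻¹ • w) (-(r ^ 2)⁻¹ • w)) r :=
    (smooth_differentiable contDiff_kerk _).hasFDerivAt.comp_hasDerivAt r h2
  have h4 := (h1.pow d).mul h3
  refine h4.congr_deriv ?_
  rw [map_smul, map_smul, smul_eq_mul, smul_eq_mul]
  have h5 : (d : ℝ) * r⁻¹ ^ (d - 1) * r⁻¹ = d * r⁻¹ ^ d := by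
    rcases Nat.eq_zero_or_pos d with h | h
    · simp [h]
    · rw [mul_assoc, ← pow_succ, Nat.sub_add_cancel h]
  have h6 : (r ^ 2)⁻¹ = r⁻¹ * r⁻¹ := by rw [sq, mul_inv]
  rw [h6]
  simp only [Pi.pow_apply]
  linear_combination (-r⁻¹ * kerk (r⁻¹ • w)) * h5

lemma hasDerivAt_avg (h : WeakGrad v G) (x : Euc d)
    (hr : 0 < r) :
    HasDerivAt (avg v x) (-(r * r⁻¹ ^ d * ∫ y, ⟪G y, gradient (bumpK x r) y⟫)) r := by
  have cdiv : Continuous fun z : Euc d => (d : ℝ) * kerk z + fderiv ℝ kerk z z :=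
    (continuous_const.mul contDiff_kerk.continuous).add
      ((contDiff_kerk.continuous_fderiv (by simp)).clm_apply continuous_id)
  have zk : ∀ z : Euc d, 1 ≤ ‖z‖ → (d : ℝ) * kerk z + fderiv ℝ kerk z z = 0 := fun z hz => by
    have : IsLocalMin kerk z := .of_forall fun y => by
      change kerk z ≤ kerk y
      rw [kerk_eq_zero hz]; exact kerk_nonneg y
    rw [kerk_eq_zero hz, this.fderiv_eq_zero]; simp
  have sdiv : HasCompactSupport fun z : Euc d => (d : ℝ) * kerk z + fderiv ℝ kerk z z :=
    HasCompactSupport.intro (isCompact_closedBall (0 : Euc d) 1) fun z hz => zk z (by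
      simpa using (not_le.1 (by simpa using hz)).le)
  obtain ⟨C, hC⟩ := cdiv.bounded_above_of_compact_support sdiv
  have hC0 : 0 ≤ C := (norm_nonneg _).trans (hC 0)
  have key := hasDerivAt_integral_of_dominated_loc_of_deriv_le (μ := (volume : Measure (Euc d)))
    (F := fun r y => v y * (r⁻¹ ^ d * kerk (r⁻¹ • (y - x))))
    (F' := fun r y => v y * (-(r⁻¹ * r⁻¹ ^ d * (d * kerk (r⁻¹ • (y - x)) +
      fderiv ℝ kerk (r⁻¹ • (y - x)) (r⁻¹ • (y - x))))))
    (x₀ := r) (s := Ioo (r / 2) (2 * r))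
    (bound := (closedBall x (2 * r)).indicator fun y => |v y| * ((2 / r) * (2 / r) ^ d * C))
    (Ioo_mem_nhds (by linarith) (by linarith)) ?_ (integrable_avg h.locV x hr) ?_ ?_ ?_ ?_
  · have h2 := key.2
    refine h2.congr_deriv ?_
    have cX : Smooth fun y : Euc d => kerk (r⁻¹ • (y - x)) :=
      contDiff_kerk.comp (contDiff_scale x r)
    have hX : Smooth fun y : Euc d => kerk (r⁻¹ • (y - x)) • (y - x) :=
      cX.smul (contDiff_id.sub contDiff_const)
    have sX : HasCompactSupport fun y : Euc d => kerk (r⁻¹ • (y - x)) • (y - x) :=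
      (hasCompactSupport_of_scale (fun _ => kerk_eq_zero) x hr).smul_right
    have dX : ∀ y, divg (fun y : Euc d => kerk (r⁻¹ • (y - x)) • (y - x)) y =
        d * kerk (r⁻¹ • (y - x)) + fderiv ℝ kerk (r⁻¹ • (y - x)) (r⁻¹ • (y - x)) := fun y => by
      rw [divg_smul (smooth_differentiable cX y) (X := fun y => y - x) (by fun_prop),
        gradient_comp_scale (smooth_differentiable contDiff_kerk), inner_smul_left,
        inner_gradient_left, map_smul]
      have : divg (fun y : Euc d => y - x) y = d := by
        unfold divg
        simp [fderiv_sub_const]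
      simp only [this, conj_trivial, smul_eq_mul]
      ring
    have e := h.ibp _ hX sX
    simp_rw [dX] at e
    have e2 : ∀ y, v y * (-(r⁻¹ * r⁻¹ ^ d * (d * kerk (r⁻¹ • (y - x)) +
      fderiv ℝ kerk (r⁻¹ • (y - x)) (r⁻¹ • (y - x))))) = (-(r⁻¹ * r⁻¹ ^ d)) *
      (v y * (d * kerk (r⁻¹ • (y - x)) +
      fderiv ℝ kerk (r⁻¹ • (y - x)) (r⁻¹ • (y - x)))) := fun y => by ring
    simp_rw [e2]
    rw [integral_const_mul, e, ← integral_const_mul, ← integral_neg, ← integral_neg,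
      ← integral_const_mul]
    congr 1; ext y
    rw [gradient_bumpK, inner_smul_right, inner_smul_right]
    field_simp
  · refine Filter.eventually_of_mem (Ioi_mem_nhds hr) fun r' hr' => ?_
    exact (integrable_avg h.locV x hr').1
  · refine h.locV.aestronglyMeasurable.mul (Continuous.aestronglyMeasurable ?_)
    have := cdiv.comp (contDiff_scale x r).continuous
    exact (continuous_const.mul this).neg
  · refine .of_forall fun y r' hr' => ?_
    have hr'0 : 0 < r' := by have := hr'.1; linarith
    rw [Real.norm_eq_abs, abs_mul, abs_neg]
    by_cases hy : y ∈ closedBall x (2 * r)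
    · rw [indicator_of_mem hy, abs_mul, abs_of_nonneg (a := r'⁻¹ * r'⁻¹ ^ d) (by positivity)]
      have h3 : r'⁻¹ ≤ 2 / r := by
        rw [inv_le_comm₀ hr'0 (by positivity), inv_div]; exact hr'.1.le
      have := hC (r'⁻¹ • (y - x))
      rw [Real.norm_eq_abs] at this
      gcongr
    · rw [indicator_of_notMem hy, zk _ (one_le_norm_scale hr'0 _)]
      · simp
      · have : 2 * r < dist y x := by simpa using hy
        linarith [hr'.2]
  · exact IntegrableOn.integrable_indicator
      (((h.locV.integrableOn_isCompact (isCompact_closedBall x (2 * r))).abs).mul_const _)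
      measurableSet_closedBall
  · refine .of_forall fun y r' hr' => ?_
    have hr'0 : 0 < r' := by have := hr'.1; linarith
    exact (hasDerivAt_kernel (y - x) hr'0).const_mul (v y)

/-! ### Monotonicity of averages -/

lemma TestFun.integrable (h : TestFun U φ)
    (μ : Measure (Euc d)) [IsFiniteMeasureOnCompacts μ] : Integrable φ μ :=
  h.continuous.integrable_of_hasCompactSupport h.2.1

lemma le_add_mul_of_deriv_le {f f' : ℝ → ℝ} {l : ℝ} (hf : ∀ r ∈ Ioc 0 R, HasDerivAt f (f' r) r)
    (hC : ∀ r ∈ Ioc 0 R, f' r ≤ C) (hl : Tendsto f (𝓝[>] 0) (𝓝 l)) (hr : r ∈ Ioc 0 R) :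
    f r ≤ l + C * r := by
  have h1 : Tendsto (fun s => f s + C * (r - s)) (𝓝[>] 0) (𝓝 (l + C * (r - 0))) :=
    hl.add ((tendsto_const_nhds.sub (tendsto_nhdsWithin_of_tendsto_nhds tendsto_id)).const_mul C)
  rw [sub_zero] at h1
  refine ge_of_tendsto h1 ?_
  filter_upwards [Ioo_mem_nhdsGT hr.1] with s hs
  have hsub : ∀ x ∈ Icc s r, x ∈ Ioc 0 R := fun x hx => ⟨hs.1.trans_le hx.1, hx.2.trans hr.2⟩
  have := (convex_Icc s r).image_sub_le_mul_sub_of_deriv_le (f := f) (C := C)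
    (fun x hx => (hf x (hsub x hx)).continuousAt.continuousWithinAt)
    (fun x hx => (hf x (hsub x (interior_subset hx))).differentiableAt.differentiableWithinAt)
    (fun x hx => by
      rw [(hf x (hsub x (interior_subset hx))).deriv]; exact hC x (hsub x (interior_subset hx)))
    s (left_mem_Icc.2 hs.2.le) r (right_mem_Icc.2 hs.2.le) hs.2.le
  linarith

/-- A ground state together with the measure `μ = Δu + λu`. -/
structure LapState (Ω : Set (Euc d)) (lam : ℝ) (u : Euc d → ℝ) (G : Euc d → Euc d)
    (μ : Measure (Euc d)) : Prop extends GroundState Ω lam u G where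
  fin : IsFiniteMeasureOnCompacts μ
  repr : ∀ φ, TestFun univ φ → ∫ x, φ x ∂μ = dist_lap lam u G φ

local notation "𝓛" => LapState Ω lam u G μ

/-- The function is determined everywhere by its averages. -/
def Precise (u : Euc d → ℝ) : Prop := ∀ x, Tendsto (avg u x) (𝓝[>] 0) (𝓝 (massk d * u x))

namespace LapState

lemma loc (h : 𝓛) : LocallyIntegrable u := h.inH.weakGrad.locV

lemma integrableOn (h : 𝓛) (x : Euc d) (r : ℝ) : IntegrableOn u (closedBall x r) :=
  h.loc.integrableOn_isCompact (isCompact_closedBall x r)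

lemma hasDerivAt (h : 𝓛) (x : Euc d) (hr : 0 < r) : HasDerivAt (avg u x) (r * r⁻¹ ^ d *
      ((∫ y, bumpK x r y ∂μ) - lam * ∫ y, u y * bumpK x r y)) r := by
  refine (hasDerivAt_avg h.inH.weakGrad x hr).congr_deriv ?_
  rw [h.repr _ (bumpK_testFun x hr (subset_univ _)), dist_lap]
  ring

lemma avg_nonneg (h : 𝓛) (x : Euc d) (hr : 0 < r) : 0 ≤ avg u x r :=
  integral_nonneg fun y => mul_nonneg (h.nonneg y) (mul_nonneg (by positivity) (kerk_nonneg _))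

lemma bump_le_avg (h : 𝓛) (x : Euc d) (hr : 0 < r) :
    2 * r⁻¹ ^ d * ∫ y, u y * bumpK x r y ≤ avg u x r := by
  rw [avg, ← integral_const_mul]
  refine integral_mono ?_ (integrable_avg h.loc x hr) fun y => ?_
  · exact (h.integrable_mul ((bumpK_testFun x hr (subset_univ _)).memLp 2 volume)).const_mul _
  · have := two_kerK_le_kerk (r⁻¹ • (y - x))
    have h2 : 0 ≤ u y * r⁻¹ ^ d := mul_nonneg (h.nonneg y) (by positivity)
    have := mul_le_mul_of_nonneg_left this h2
    simp only [bumpK]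
    linarith

lemma integral_bump_nonneg (h : 𝓛) (x : Euc d) (r : ℝ) : 0 ≤ ∫ y, u y * bumpK x r y :=
  integral_nonneg fun y => mul_nonneg (h.nonneg y) (bumpK_nonneg _ _ _)

lemma monotoneOn (h : 𝓛) (x : Euc d) :
    MonotoneOn (fun r => avg u x r * Real.exp (lam * r ^ 2 / 4)) (Ioi 0) := by
  have hd : ∀ r ∈ Ioi (0 : ℝ), HasDerivAt (fun r => avg u x r * Real.exp (lam * r ^ 2 / 4))
      (r * r⁻¹ ^ d * ((∫ y, bumpK x r y ∂μ) - lam * ∫ y, u y * bumpK x r y) *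
        Real.exp (lam * r ^ 2 / 4) + avg u x r * (Real.exp (lam * r ^ 2 / 4) *
          (lam * (2 * r) / 4))) r := fun r hr => by
    have h1 : HasDerivAt (fun r : ℝ => lam * r ^ 2 / 4) (lam * (2 * r) / 4) r := by
      have := ((hasDerivAt_pow 2 r).const_mul lam).div_const 4
      simpa using this
    exact (h.hasDerivAt x hr).mul h1.exp
  refine monotoneOn_of_deriv_nonneg (convex_Ioi 0)
    (fun r hr => (hd r hr).continuousAt.continuousWithinAt)
    (fun r hr => (hd r (interior_subset hr)).differentiableAt.differentiableWithinAt)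
    (fun r hr => ?_)
  rw [interior_Ioi] at hr
  have hr0 : 0 < r := hr
  rw [(hd r hr).deriv]
  have h1 : 0 ≤ ∫ y, bumpK x r y ∂μ := integral_nonneg fun y => bumpK_nonneg _ _ _
  have h2 := h.bump_le_avg x hr0
  have h3 := h.lam_nonneg
  have h4 : 0 ≤ r * r⁻¹ ^ d * ∫ y, bumpK x r y ∂μ := by positivity
  have h5 : r * lam * (2 * r⁻¹ ^ d * ∫ y, u y * bumpK x r y) ≤ r * lam * avg u x r := by gcongr
  have h6 : 0 ≤ r * r⁻¹ ^ d * ((∫ y, bumpK x r y ∂μ) - lam * ∫ y, u y * bumpK x r y) +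
      avg u x r * (lam * (2 * r) / 4) := by nlinarith
  have := mul_nonneg h6 (Real.exp_pos (lam * r ^ 2 / 4)).le
  nlinarith

/-- The limit of the averages. -/
def preciseRep (lam : ℝ) (u : Euc d → ℝ) (x : Euc d) : ℝ :=
  sInf ((fun r => avg u x r * Real.exp (lam * r ^ 2 / 4)) '' Ioi 0) / massk d

lemma tendsto_preciseRep (h : 𝓛) (x : Euc d) :
    Tendsto (avg u x) (𝓝[>] 0) (𝓝 (massk d * preciseRep lam u x)) := by
  have hb : BddBelow ((fun r => avg u x r * Real.exp (lam * r ^ 2 / 4)) '' Ioi 0) := by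
    refine ⟨0, ?_⟩
    rintro _ ⟨r, hr, rfl⟩
    exact mul_nonneg (h.avg_nonneg x hr) (Real.exp_pos _).le
  have h1 := (h.monotoneOn x).tendsto_nhdsGT hb
  have h2 : Tendsto (fun r : ℝ => Real.exp (-(lam * r ^ 2 / 4))) (𝓝[>] 0) (𝓝 1) := by
    have : Continuous fun r : ℝ => Real.exp (-(lam * r ^ 2 / 4)) := by fun_prop
    have := this.tendsto 0
    simp only [ne_eq, OfNat.ofNat_ne_zero, not_false_eq_true, zero_pow, mul_zero, zero_div,
      neg_zero, Real.exp_zero] at this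
    exact tendsto_nhdsWithin_of_tendsto_nhds this
  have h3 := h1.mul h2
  rw [mul_one] at h3
  have e : massk d * preciseRep lam u x =
      sInf ((fun r => avg u x r * Real.exp (lam * r ^ 2 / 4)) '' Ioi 0) := by
    rw [preciseRep, mul_div_cancel₀ _ massk_pos.ne']
  rw [e]
  refine h3.congr fun r => ?_
  rw [mul_assoc, ← Real.exp_add, add_neg_cancel, Real.exp_zero, mul_one]

lemma ae_eq_preciseRep (h : 𝓛) : u =ᵐ[volume] preciseRep lam u := by
  filter_upwards [ae_tendsto_avg h.loc] with x hx
  exact mul_left_cancel₀ massk_pos.ne' (tendsto_nhds_unique hx (h.tendsto_preciseRep x))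

lemma congr (h : 𝓛) (hw : u =ᵐ[volume] w) (h0 : ∀ x, 0 ≤ w x) : LapState Ω lam w G μ := by
  have e : ∀ φ : Euc d → ℝ, ∫ x, u x * φ x = ∫ x, w x * φ x := fun φ =>
    integral_congr_ae (hw.mono fun x hx => by simp only [hx])
  refine ⟨⟨h.inH.congr hw (ae_eq_refl _), h0, ?_, fun φ hφ => ?_, ?_, h.energy⟩, h.fin,
    fun φ hφ => ?_⟩
  · filter_upwards [hw, h.grad_zero] with x h1 h2 h3
    exact h2 (h1.trans h3)
  · rw [h.weak φ hφ, e]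
  · rw [← h.norm_one]; exact integral_congr_ae (hw.mono fun x hx => by simp only [hx])
  · rw [h.repr φ hφ, dist_lap, dist_lap, e]

theorem exists_precise (h : 𝓛) :
    ∃ w, u =ᵐ[volume] w ∧ LapState Ω lam w G μ ∧ Precise w := by
  have h0 : ∀ x, 0 ≤ preciseRep lam u x := fun x => by
    have : 0 ≤ massk d * preciseRep lam u x :=
      ge_of_tendsto (h.tendsto_preciseRep x) (by
        filter_upwards [self_mem_nhdsWithin] with r hr
        exact h.avg_nonneg x hr)
    exact nonneg_of_mul_nonneg_right this massk_pos
  refine ⟨preciseRep lam u, h.ae_eq_preciseRep, h.congr h.ae_eq_preciseRep h0, fun x => ?_⟩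
  refine (h.tendsto_preciseRep x).congr fun r => ?_
  exact avg_congr h.ae_eq_preciseRep x r

lemma massk_mul_le (h : 𝓛) (hp : Precise u) (x : Euc d) (hr : 0 < r) :
    massk d * u x ≤ avg u x r * Real.exp (lam * r ^ 2 / 4) := by
  have h2 : Tendsto (fun r : ℝ => Real.exp (lam * r ^ 2 / 4)) (𝓝[>] 0) (𝓝 1) := by
    have : Continuous fun r : ℝ => Real.exp (lam * r ^ 2 / 4) := by fun_prop
    have := this.tendsto 0
    simp only [ne_eq, OfNat.ofNat_ne_zero, not_false_eq_true, zero_pow, mul_zero, zero_div,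
      Real.exp_zero] at this
    exact tendsto_nhdsWithin_of_tendsto_nhds this
  have h3 := (hp x).mul h2
  rw [mul_one] at h3
  refine le_of_tendsto h3 ?_
  filter_upwards [Ioo_mem_nhdsGT hr] with s hs
  exact h.monotoneOn x hs.1 hr hs.2.le

lemma avg_le (h : 𝓛) (hC : ∀ z : Euc d, kerk z ≤ C) (x : Euc d)
    (hr : 0 < r) : avg u x r ≤ C * r⁻¹ ^ d * ∫ y in closedBall x r, u y := by
  have := abs_avg_sub_le hC h.loc x 0 hr
  simp only [mul_zero, sub_zero] at this
  refine (le_abs_self _).trans (this.trans (le_of_eq ?_))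
  congr 2; ext y; exact abs_of_nonneg (h.nonneg y)

lemma le_avg (h : 𝓛) (hc : ∀ z : Euc d, ‖z‖ ≤ 1 / 2 → c ≤ kerK z) (x : Euc d) (hr : 0 < r) :
    c * r⁻¹ ^ d * ∫ y in closedBall x (r / 2), u y ≤ avg u x r := by
  refine le_trans ?_ (h.bump_le_avg x hr)
  have hi : Integrable fun y => u y * bumpK x r y :=
    h.integrable_mul ((bumpK_testFun x hr (subset_univ _)).memLp 2 volume)
  have h1 : c * ∫ y in closedBall x (r / 2), u y ≤ ∫ y, u y * bumpK x r y := by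
    rw [← integral_const_mul]
    refine le_trans (setIntegral_mono_on ((h.integrableOn x (r / 2)).const_mul c) hi.integrableOn
      measurableSet_closedBall fun y hy => ?_) (setIntegral_le_integral hi
        (.of_forall fun y => mul_nonneg (h.nonneg y) (bumpK_nonneg _ _ _)))
    rw [mul_comm]
    refine mul_le_mul_of_nonneg_left (hc _ ?_) (h.nonneg y)
    rw [norm_scale hr, inv_mul_le_iff₀ hr]
    have := mem_closedBall.1 hy
    linarith
  have h0 := h.integral_bump_nonneg x r
  have h2 : 0 ≤ r⁻¹ ^ d := by positivity
  nlinarith [mul_le_mul_of_nonneg_left h1 h2, mul_nonneg h2 h0]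

/-- The sub-mean value inequality. -/
lemma exists_sup_bound (h : 𝓛) (hp : Precise u) :
    ∃ C, 0 < C ∧ ∀ x r, 0 < r → r ≤ 1 → u x ≤ C * r⁻¹ ^ d * ∫ y in closedBall x r, u y := by
  obtain ⟨C, hC0, hC⟩ := exists_kerk_bound (d := d)
  have hm := massk_pos (d := d)
  refine ⟨C * Real.exp (lam / 4) / massk d, by positivity, fun x r hr hr1 => ?_⟩
  have h1 := h.massk_mul_le hp x hr
  have h2 := h.avg_le hC x hr
  have h3 : Real.exp (lam * r ^ 2 / 4) ≤ Real.exp (lam / 4) := by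
    refine Real.exp_le_exp.2 ?_
    have := h.lam_nonneg
    have : r ^ 2 ≤ 1 := pow_le_one₀ hr.le hr1
    nlinarith
  have h4 : massk d * u x ≤ (C * r⁻¹ ^ d * ∫ y in closedBall x r, u y) * Real.exp (lam / 4) :=
    h1.trans (mul_le_mul h2 h3 (Real.exp_pos _).le ((h.avg_nonneg x hr).trans h2))
  rw [div_mul_eq_mul_div, div_mul_eq_mul_div, le_div_iff₀ hm]
  linarith

lemma exists_bound (h : 𝓛) (hp : Precise u) : ∃ M, 0 < M ∧ ∀ x, u x ≤ M := by
  obtain ⟨C, hC0, hC⟩ := h.exists_sup_bound hp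
  have hi : Integrable fun x => (u x) ^ 2 := by
    simpa using h.inH.memV.integrable_norm_pow (by norm_num)
  refine ⟨C * (1 + omd d), by have := omd_pos (d := d); positivity, fun x => ?_⟩
  have h1 := hC x 1 one_pos le_rfl
  have h2 : ∫ y in closedBall x 1, u y ≤ ∫ y in closedBall x 1, ((u y) ^ 2 + 1) := by
    refine setIntegral_mono_on (h.integrableOn x 1) (hi.integrableOn.add
      (integrableOn_const measure_closedBall_lt_top.ne)) measurableSet_closedBall fun y _ => ?_
    nlinarith [sq_nonneg (u y - 1)]
  have h3 : ∫ y in closedBall x 1, ((u y) ^ 2 + 1) ≤ 1 + omd d := by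
    rw [integral_add hi.integrableOn (integrableOn_const measure_closedBall_lt_top.ne)]
    have h4 : ∫ y in closedBall x 1, (u y) ^ 2 ≤ 1 := by
      rw [← h.norm_one]
      exact setIntegral_le_integral hi (.of_forall fun y => sq_nonneg _)
    have h5 : ∫ _ in closedBall x (1 : ℝ), (1 : ℝ) = omd d := by
      rw [setIntegral_const, smul_eq_mul, mul_one, measureReal_def]
      have := mvol_closedBall x (zero_le_one (α := ℝ))
      simpa [mvol] using this
    rw [h5]; linarith
  simp only [inv_one, one_pow, mul_one] at h1
  exact h1.trans (mul_le_mul_of_nonneg_left (h2.trans h3) hC0.le)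

lemma integral_bumpK_le (h : 𝓛) (x : Euc d) (hr : 0 < r) :
    ∫ y, bumpK x r y ∂μ ≤ μ.real (ball x r) := by
  have := h.fin
  have hf : μ (ball x r) ≠ ∞ := (measure_mono ball_subset_closedBall).trans_lt
    (isCompact_closedBall x r).measure_lt_top |>.ne
  rw [← setIntegral_eq_integral_of_forall_compl_eq_zero (s := ball x r)]
  · refine (setIntegral_mono_on ((bumpK_testFun x hr (subset_univ _)).integrable μ).integrableOn
      (integrableOn_const (C := (1 : ℝ)) hf) measurableSet_ball
      fun y _ => bumpK_le_one _ _ _).trans (le_of_eq ?_)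
    simp
  · intro y hy
    exact bumpK_eq_zero hr (not_lt.1 (by simpa using hy))

lemma le_integral_bumpK (h : 𝓛)
    (hc : ∀ z : Euc d, ‖z‖ ≤ 1 / 2 → c ≤ kerK z) (x : Euc d) (hr : 0 < r) :
    c * μ.real (closedBall x (r / 2)) ≤ ∫ y, bumpK x r y ∂μ := by
  have := h.fin
  have hi : Integrable (bumpK x r) μ := (bumpK_testFun x hr (subset_univ _)).integrable μ
  refine le_trans ?_ (setIntegral_le_integral (s := closedBall x (r / 2)) hi
    (.of_forall fun y => bumpK_nonneg _ _ _))
  have : c * μ.real (closedBall x (r / 2)) = ∫ _ in closedBall x (r / 2), c ∂μ := by simp [mul_comm]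
  rw [this]
  refine setIntegral_mono_on (integrableOn_const (isCompact_closedBall _ _).measure_lt_top.ne)
    hi.integrableOn measurableSet_closedBall fun y hy => hc _ ?_
  rw [norm_scale hr, inv_mul_le_iff₀ hr]
  have := mem_closedBall.1 hy
  linarith

lemma avg_le_of_growth (h : 𝓛) (hp : Precise u)
    (hg : ∀ r ∈ Ioc 0 R, r * r⁻¹ ^ d * μ.real (ball x r) ≤ C) (hr : r ∈ Ioc 0 R) :
    avg u x r ≤ massk d * u x + C * r := by
  refine le_add_mul_of_deriv_le (R := R) (fun s hs => h.hasDerivAt x hs.1) (fun s hs => ?_)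
    (hp x) hr
  have hs0 : 0 < s := hs.1
  refine le_trans ?_ (hg s hs)
  refine mul_le_mul_of_nonneg_left ?_ (by positivity)
  have := mul_nonneg h.lam_nonneg (h.integral_bump_nonneg x s)
  linarith [h.integral_bumpK_le x hs0]

lemma avg_le_of_null (h : 𝓛) (hp : Precise u)
    (hR : μ (ball x R) = 0) (hr : r ∈ Ioc 0 R) : avg u x r ≤ massk d * u x := by
  have := h.avg_le_of_growth hp (x := x) (R := R) (C := 0) (fun s hs => ?_) hr
  · simpa using this
  · rw [measureReal_def, measure_mono_null (ball_subset_ball hs.2) hR]; simp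

lemma le_avg_sub (h : 𝓛) (hp : Precise u) (hM : ∀ x, u x ≤ M)
    (x : Euc d) (hr : 0 < r) : massk d * u x - massk d * M * lam / 4 * r ^ 2 ≤ avg u x r := by
  have h1 := h.massk_mul_le hp x hr
  have h2 : massk d * u x * Real.exp (-(lam * r ^ 2 / 4)) ≤ avg u x r := by
    have := mul_le_mul_of_nonneg_right h1 (Real.exp_pos (-(lam * r ^ 2 / 4))).le
    rwa [mul_assoc (avg u x r), ← Real.exp_add, add_neg_cancel, Real.exp_zero, mul_one] at this
  have h3 : 1 - lam * r ^ 2 / 4 ≤ Real.exp (-(lam * r ^ 2 / 4)) := by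
    have := Real.add_one_le_exp (-(lam * r ^ 2 / 4)); linarith
  have hm := massk_pos (d := d)
  have h4 : 0 ≤ massk d * u x := mul_nonneg hm.le (h.nonneg x)
  have h5 := mul_le_mul_of_nonneg_left h3 h4
  have h6 : massk d * u x * (lam * r ^ 2 / 4) ≤ massk d * M * (lam * r ^ 2 / 4) := by
    have := h.lam_nonneg
    have := hM x
    gcongr
  nlinarith

/-- Local growth of the measure implies continuity. -/
lemma continuousAt_of_growth (h : 𝓛) (hp : Precise u)
    (hR : 0 < R) (hg : ∀ x ∈ ball x₀ R, ∀ r ∈ Ioc 0 R, r * r⁻¹ ^ d * μ.real (ball x r) ≤ C) :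
    ContinuousAt u x₀ := by
  obtain ⟨M, hM0, hM⟩ := h.exists_bound hp
  have hm := massk_pos (d := d)
  set C' := |C| + massk d * M * lam / 4 * R with hC'
  have key : ∀ x ∈ ball x₀ R, ∀ r ∈ Ioc 0 R, |avg u x r - massk d * u x| ≤ C' * r := fun x hx r hr => by
    have h1 := h.avg_le_of_growth hp (hg x hx) hr
    have h2 := h.le_avg_sub hp hM x hr.1
    have h3 : massk d * M * lam / 4 * r ^ 2 ≤ massk d * M * lam / 4 * R * r := by
      have := h.lam_nonneg
      rw [sq, ← mul_assoc]
      have := hr.2; have := hr.1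
      gcongr
    have h4 : C * r ≤ |C| * r := mul_le_mul_of_nonneg_right (le_abs_self C) hr.1.le
    have h5 : 0 ≤ |C| * r := mul_nonneg (abs_nonneg _) hr.1.le
    have h6 : 0 ≤ massk d * M * lam / 4 * R * r := by
      have := h.lam_nonneg; have := hr.1; positivity
    rw [abs_le]
    constructor <;> rw [hC'] <;> nlinarith
  have hC'0 : 0 ≤ C' := by
    have := h.lam_nonneg; positivity
  have : ContinuousAt (fun x => massk d * u x) x₀ := by
    rw [Metric.continuousAt_iff]
    intro ε hε
    obtain ⟨r, hr0, hrR, hrC⟩ : ∃ r, 0 < r ∧ r ≤ R ∧ C' * r ≤ ε / 4 := by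
      refine ⟨min R (ε / 4 / (C' + 1)), by positivity, min_le_left _ _, ?_⟩
      calc C' * min R (ε / 4 / (C' + 1)) ≤ C' * (ε / 4 / (C' + 1)) := by
            gcongr; exact min_le_right _ _
        _ = ε / 4 * (C' / (C' + 1)) := by ring
        _ ≤ ε / 4 * 1 := by
            gcongr
            rw [div_le_one (by positivity)]; linarith
        _ = ε / 4 := mul_one _
    obtain ⟨δ, hδ, hd⟩ := continuousAt_iff.1 (continuous_avg h.loc hr0).continuousAt
      (ε / 4) (by positivity)
    refine ⟨min δ R, by positivity, fun {x} hx => ?_⟩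
    have a1 := key x (lt_of_lt_of_le hx (min_le_right _ _)) r ⟨hr0, hrR⟩
    have a2 := key x₀ (mem_ball_self hR) r ⟨hr0, hrR⟩
    have a3 := hd (lt_of_lt_of_le hx (min_le_left _ _))
    rw [Real.dist_eq] at a3 ⊢
    rw [abs_lt] at a3 ⊢
    rw [abs_le] at a1 a2
    constructor <;> linarith [a1.1, a1.2, a2.1, a2.2, a3.1, a3.2]
  have h2 := this.const_mul (massk d)⁻¹
  refine h2.congr (.of_forall fun x => ?_)
  simp only
  rw [← mul_assoc, inv_mul_cancel₀ hm.ne', one_mul]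

end LapState

/-! ### Deformations of the domain -/

/-- The deformation `y ↦ y + η(y) e + ψ(y) e'`. -/
def deform (η : Euc d → ℝ) (e : Euc d) (ψ : Euc d → ℝ) (e' : Euc d) (y : Euc d) : Euc d :=
  y + (η y • e + ψ y • e')

/-- The Jacobian determinant of `deform`. -/
def jac (η : Euc d → ℝ) (e : Euc d) (ψ : Euc d → ℝ) (e' : Euc d) (y : Euc d) : ℝ :=
  1 + ⟪gradient η y, e⟫ + ⟪gradient ψ y, e'⟫

/-- The quadratic form governing the energy of a deformed function. -/
def quadOp (η : Euc d → ℝ) (e : Euc d) (ψ : Euc d → ℝ) (e' : Euc d) (y : Euc d) :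
    Euc d →L[ℝ] Euc d :=
  (jac η e ψ e' y + 2 * ‖gradient η y‖ ^ 2 + 2 * ‖gradient ψ y‖ ^ 2) • ContinuousLinearMap.id ℝ _
    - (2 : ℝ) • ContinuousLinearMap.smulRightL ℝ _ _ (innerSL ℝ e) (gradient η y)
    - (2 : ℝ) • ContinuousLinearMap.smulRightL ℝ _ _ (innerSL ℝ e') (gradient ψ y)

/-- A pair of small deformation fields with disjoint supports. -/
structure FieldPair (D : Set (Euc d)) (η : Euc d → ℝ) (e : Euc d) (ψ : Euc d → ℝ) (e' : Euc d) :
    Prop where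
  η_test : TestFun D η
  ψ_test : TestFun D ψ
  disj : Disjoint (tsupport η) (tsupport ψ)
  e_le : ‖e‖ ≤ 1
  e'_le : ‖e'‖ ≤ 1
  η_le : ∀ y, ‖gradient η y‖ ≤ 1 / 4
  ψ_le : ∀ y, ‖gradient ψ y‖ ≤ 1 / 4

namespace FieldPair

lemma abs_inner_le (h : FieldPair D η e ψ e') (y : Euc d) : |⟪gradient η y, e⟫| ≤ 1 / 4 :=
  (abs_real_inner_le_norm _ _).trans (by
    have := h.η_le y; have := h.e_le; have := norm_nonneg e; have := norm_nonneg (gradient η y)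
    nlinarith)

lemma symm (h : FieldPair D η e ψ e') : FieldPair D ψ e' η e :=
  ⟨h.ψ_test, h.η_test, h.disj.symm, h.e'_le, h.e_le, h.ψ_le, h.η_le⟩

lemma half_le_jac (h : FieldPair D η e ψ e') (y : Euc d) : 1 / 2 ≤ jac η e ψ e' y := by
  have h1 := (abs_le.1 (h.abs_inner_le y)).1
  have h2 := (abs_le.1 (h.symm.abs_inner_le y)).1
  unfold jac; linarith

lemma grad_zero (h : FieldPair D η e ψ e') (y : Euc d) : gradient η y = 0 ∨ gradient ψ y = 0 := by
  by_cases hy : y ∈ tsupport η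
  · exact Or.inr (gradient_eq_zero_of_notMem_tsupport (h.disj.notMem_of_mem_left hy))
  · exact Or.inl (gradient_eq_zero_of_notMem_tsupport hy)

lemma continuous_jac (h : FieldPair D η e ψ e') : Continuous (jac η e ψ e') :=
  (continuous_const.add (h.η_test.continuous_gradient.inner continuous_const)).add
    (h.ψ_test.continuous_gradient.inner continuous_const)

lemma contDiff_field (h : FieldPair D η e ψ e') : Smooth (fun y => η y • e + ψ y • e') :=
  (h.η_test.1.smul contDiff_const).add (h.ψ_test.1.smul contDiff_const)

lemma hasFDerivAt_field (h : FieldPair D η e ψ e') (y : Euc d) :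
    HasFDerivAt (fun y => η y • e + ψ y • e')
      ((fderiv ℝ η y).smulRight e + (fderiv ℝ ψ y).smulRight e') y :=
  ((h.η_test.differentiable y).hasFDerivAt.smul_const e).add
    ((h.ψ_test.differentiable y).hasFDerivAt.smul_const e')

lemma norm_fderiv_field_le (h : FieldPair D η e ψ e') (y : Euc d) :
    ‖(fderiv ℝ η y).smulRight e + (fderiv ℝ ψ y).smulRight e'‖ ≤ 1 / 2 := by
  have n1 : ∀ {f : Euc d → ℝ}, ‖gradient f y‖ = ‖fderiv ℝ f y‖ := fun {f} => by simp [gradient]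
  have h1 := h.η_le y
  have h2 := h.ψ_le y
  rw [n1] at h1 h2
  refine (norm_add_le _ _).trans ?_
  rw [ContinuousLinearMap.norm_smulRight_apply, ContinuousLinearMap.norm_smulRight_apply]
  have := h.e_le; have := h.e'_le; have := norm_nonneg e; have := norm_nonneg e'
  have := norm_nonneg (fderiv ℝ η y); have := norm_nonneg (fderiv ℝ ψ y)
  nlinarith

lemma lipschitz_field (h : FieldPair D η e ψ e') :
    LipschitzWith (1 / 2) (fun y => η y • e + ψ y • e') := by
  refine lipschitzWith_of_nnnorm_fderiv_le (𝕜 := ℝ) (smooth_differentiable h.contDiff_field)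
    fun y => ?_
  rw [← NNReal.coe_le_coe, coe_nnnorm, (h.hasFDerivAt_field y).fderiv]
  simpa using h.norm_fderiv_field_le y

lemma exists_homeo (h : FieldPair D η e ψ e') :
    ∃ T : Euc d ≃ₜ Euc d, (∀ y, T y = deform η e ψ e' y) ∧ Smooth T.symm := by
  have hap : ApproximatesLinearOn (deform η e ψ e')
      ((ContinuousLinearEquiv.refl ℝ (Euc d) : Euc d ≃L[ℝ] Euc d) : Euc d →L[ℝ] Euc d) univ
      (1 / 2) := fun x _ y _ => by
    have := h.lipschitz_field.dist_le_mul x y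
    rw [dist_eq_norm, dist_eq_norm] at this
    simpa [deform, add_sub_add_comm] using this
  have hsmall : Subsingleton (Euc d) ∨ (1 / 2 : ℝ≥0) <
      ‖((ContinuousLinearEquiv.refl ℝ (Euc d)).symm : Euc d →L[ℝ] Euc d)‖₊⁻¹ := by
    rcases subsingleton_or_nontrivial (Euc d) with hs | hs
    · exact Or.inl hs
    · refine Or.inr ?_
      have : ‖((ContinuousLinearEquiv.refl ℝ (Euc d)).symm : Euc d →L[ℝ] Euc d)‖₊ = 1 := by
        rw [← NNReal.coe_inj]; simp
      rw [this, inv_one]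
      exact NNReal.half_lt_self one_ne_zero
  refine ⟨hap.toHomeomorph _ hsmall, fun y => rfl, ?_⟩
  have hd : ∀ y, HasFDerivAt (deform η e ψ e') (ContinuousLinearMap.id ℝ _ +
      ((fderiv ℝ η y).smulRight e + (fderiv ℝ ψ y).smulRight e')) y := fun y =>
    (hasFDerivAt_id y).add (h.hasFDerivAt_field y)
  have hinj : ∀ y, Function.Injective (ContinuousLinearMap.id ℝ (Euc d) +
      ((fderiv ℝ η y).smulRight e + (fderiv ℝ ψ y).smulRight e')) := fun y => by
    rw [injective_iff_map_eq_zero]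
    intro v hv
    have hl := h.norm_fderiv_field_le y
    have h1 := (((fderiv ℝ η y).smulRight e + (fderiv ℝ ψ y).smulRight e')).le_opNorm v
    have h2 : v = -(((fderiv ℝ η y).smulRight e + (fderiv ℝ ψ y).smulRight e') v) := by
      rw [eq_neg_iff_add_eq_zero]; exact hv
    have h3 : ‖v‖ ≤ 1 / 2 * ‖v‖ := by
      calc ‖v‖ = ‖((fderiv ℝ η y).smulRight e + (fderiv ℝ ψ y).smulRight e') v‖ := by
            conv_lhs => rw [h2, norm_neg]
        _ ≤ _ := h1
        _ ≤ 1 / 2 * ‖v‖ := mul_le_mul_of_nonneg_right hl (norm_nonneg _)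
    exact norm_le_zero_iff.1 (by linarith)
  let f' : Euc d → Euc d ≃L[ℝ] Euc d := fun y =>
    (LinearEquiv.ofInjectiveEndo _ (hinj y)).toContinuousLinearEquiv
  refine Homeomorph.contDiff_symm (f₀' := f') _ (fun y => ?_) (contDiff_id.add h.contDiff_field)
  have hf' : ((f' y : Euc d ≃L[ℝ] Euc d) : Euc d →L[ℝ] Euc d) = ContinuousLinearMap.id ℝ _ +
      ((fderiv ℝ η y).smulRight e + (fderiv ℝ ψ y).smulRight e') := by ext v; rfl
  rw [hf']
  exact hd y

lemma hasFDerivAt (h : FieldPair D η e ψ e') (y : Euc d) :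
    HasFDerivAt (deform η e ψ e') (ContinuousLinearMap.id ℝ _ +
      ((fderiv ℝ η y).smulRight e + (fderiv ℝ ψ y).smulRight e')) y :=
  (hasFDerivAt_id y).add (h.hasFDerivAt_field y)

lemma det_eq (h : FieldPair D η e ψ e') (y : Euc d) :
    (ContinuousLinearMap.id ℝ (Euc d) +
      ((fderiv ℝ η y).smulRight e + (fderiv ℝ ψ y).smulRight e')).det = jac η e ψ e' y := by
  have key : ∀ (f : Euc d →L[ℝ] ℝ) (w : Euc d),
      (ContinuousLinearMap.id ℝ (Euc d) + f.smulRight w).det = 1 + f w := fun f w => by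
    have := LinearMap.transvection.det (f : Euc d →ₗ[ℝ] ℝ) w
    rw [ContinuousLinearMap.det]
    refine Eq.trans (congrArg _ ?_) this
    ext v
    simp [LinearMap.transvection]
  have n0 : ∀ {f : Euc d → ℝ}, gradient f y = 0 → fderiv ℝ f y = 0 := fun {f} hf => by
    ext v; rw [← inner_gradient_left, hf]; simp
  rcases h.grad_zero y with h0 | h0
  · rw [n0 h0]
    have := key (fderiv ℝ ψ y) e'
    rw [ContinuousLinearMap.zero_smulRight, zero_add, this, jac, h0, inner_gradient_left]
    simp
  · rw [n0 h0]
    have := key (fderiv ℝ η y) e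
    rw [ContinuousLinearMap.zero_smulRight, add_zero, this, jac, h0, inner_gradient_left]
    simp

lemma integral_comp (h : FieldPair D η e ψ e') {T : Euc d ≃ₜ Euc d}
    (hT : ∀ y, T y = deform η e ψ e' y) (g : Euc d → ℝ) {s : Set (Euc d)}
    (hs : MeasurableSet s) :
    ∫ x in T '' s, g x = ∫ y in s, jac η e ψ e' y * g (T y) := by
  have hT' : (T : Euc d → Euc d) = deform η e ψ e' := funext hT
  rw [integral_image_eq_integral_abs_det_fderiv_smul volume hs
    (f' := fun y => ContinuousLinearMap.id ℝ (Euc d) +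
      ((fderiv ℝ η y).smulRight e + (fderiv ℝ ψ y).smulRight e'))
    (fun y _ => by rw [hT']; exact (h.hasFDerivAt y).hasFDerivWithinAt) T.injective.injOn]
  congr 1; ext y
  rw [h.det_eq, abs_of_nonneg (by linarith [h.half_le_jac y]), smul_eq_mul]

lemma image_subset (h : FieldPair D η e ψ e') {T : Euc d ≃ₜ Euc d}
    (hT : ∀ y, T y = deform η e ψ e' y) (hU : U ⊆ D) : T '' U ⊆ D := by
  rintro _ ⟨y, hy, rfl⟩
  by_contra hc
  have h1 : T (T y) = T y := by
    rw [hT (T y), deform, image_eq_zero_of_notMem_tsupport fun h' => hc (h.η_test.2.2 h'),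
      image_eq_zero_of_notMem_tsupport fun h' => hc (h.ψ_test.2.2 h')]
    simp
  rw [T.injective h1] at hc
  exact hc (hU hy)

lemma mvol_image (h : FieldPair D η e ψ e') {T : Euc d ≃ₜ Euc d}
    (hT : ∀ y, T y = deform η e ψ e' y) (hU : MeasurableSet U) (hf : volume U ≠ ∞) :
    mvol (T '' U) = mvol U + (∫ y in U, ⟪gradient η y, e⟫) + ∫ y in U, ⟪gradient ψ y, e'⟫ := by
  have h1 := h.integral_comp hT (fun _ => 1) hU
  have i1 : Integrable fun y => ⟪gradient η y, e⟫ :=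
    (h.η_test.continuous_gradient.inner continuous_const).integrable_of_hasCompactSupport
      (h.η_test.2.1.gradient.comp_left (g := fun v => ⟪v, e⟫) (by simp))
  have i2 : Integrable fun y => ⟪gradient ψ y, e'⟫ :=
    (h.ψ_test.continuous_gradient.inner continuous_const).integrable_of_hasCompactSupport
      (h.ψ_test.2.1.gradient.comp_left (g := fun v => ⟪v, e'⟫) (by simp))
  have i0 : IntegrableOn (fun _ : Euc d => (1 : ℝ)) U := integrableOn_const hf
  simp only [jac, mul_one] at h1
  have i01 : IntegrableOn (fun y => 1 + ⟪gradient η y, e⟫) U := i0.add i1.integrableOn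
  rw [integral_add i01 i2.integrableOn, integral_add i0 i1.integrableOn] at h1
  simpa [mvol, measureReal_def] using h1

lemma quad_apply (y p : Euc d) : ⟪quadOp η e ψ e' y p, p⟫ =
    (jac η e ψ e' y + 2 * ‖gradient η y‖ ^ 2 + 2 * ‖gradient ψ y‖ ^ 2) * ‖p‖ ^ 2
      - 2 * (⟪gradient η y, p⟫ * ⟪e, p⟫) - 2 * (⟪gradient ψ y, p⟫ * ⟪e', p⟫) := by
  simp only [quadOp, sub_apply, smul_apply,
    ContinuousLinearMap.id_apply, ContinuousLinearMap.smulRightL_apply_apply, innerSL_apply_apply,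
    ContinuousLinearMap.smulRight_apply,
    inner_sub_left, inner_smul_left, real_inner_self_eq_norm_sq, conj_trivial]
  ring

lemma continuous_quadOp (h : FieldPair D η e ψ e') : Continuous (quadOp η e ψ e') := by
  have c1 := h.η_test.continuous_gradient
  have c2 := h.ψ_test.continuous_gradient
  have c3 := h.continuous_jac
  unfold quadOp
  exact (((c3.add (continuous_const.mul (c1.norm.pow 2))).add
    (continuous_const.mul (c2.norm.pow 2))).smul continuous_const).sub
    (((ContinuousLinearMap.smulRightL ℝ _ _ (innerSL ℝ e)).continuous.comp c1).const_smul (2 : ℝ))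
    |>.sub (((ContinuousLinearMap.smulRightL ℝ _ _ (innerSL ℝ e')).continuous.comp c2).const_smul (2 : ℝ))

lemma jac_le (h : FieldPair D η e ψ e') (y : Euc d) : |jac η e ψ e' y| ≤ 2 := by
  have h1 := h.abs_inner_le y
  have h2 := h.symm.abs_inner_le y
  rw [abs_le] at h1 h2 ⊢
  unfold jac
  constructor <;> linarith [h1.1, h1.2, h2.1, h2.2]

lemma exists_quadOp_bound (h : FieldPair D η e ψ e') : ∃ C, ∀ y, ‖quadOp η e ψ e' y‖ ≤ C := by
  let A := quadOp η e ψ e'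
  have hs : HasCompactSupport fun y => quadOp η e ψ e' y - ContinuousLinearMap.id ℝ (Euc d) := by
    refine HasCompactSupport.intro (h.η_test.2.1.union h.ψ_test.2.1) fun y hy => ?_
    rw [mem_union, not_or] at hy
    rw [quadOp, jac, gradient_eq_zero_of_notMem_tsupport hy.1,
      gradient_eq_zero_of_notMem_tsupport hy.2]
    simp
  obtain ⟨C, hC⟩ := (h.continuous_quadOp.sub continuous_const).bounded_above_of_compact_support hs
  refine ⟨C + 1, fun y => ?_⟩
  calc ‖quadOp η e ψ e' y‖ = ‖(quadOp η e ψ e' y - ContinuousLinearMap.id ℝ (Euc d)) +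
        ContinuousLinearMap.id ℝ (Euc d)‖ := by rw [sub_add_cancel]
    _ ≤ C + 1 := (norm_add_le _ _).trans (add_le_add (hC y) ContinuousLinearMap.norm_id_le)

lemma pointwise_bound (h : FieldPair D η e ψ e') (y p p' : Euc d)
    (hp : p = p' + ⟪e, p'⟫ • gradient η y + ⟪e', p'⟫ • gradient ψ y) :
    jac η e ψ e' y * ‖p'‖ ^ 2 ≤ ⟪quadOp η e ψ e' y p, p⟫ := by
  have key : ∀ (g f : Euc d), ‖f‖ ≤ 1 → 1 / 2 ≤ 1 + ⟪g, f⟫ → ∀ p p' : Euc d,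
      p = p' + ⟪f, p'⟫ • g →
      (1 + ⟪g, f⟫) * ‖p'‖ ^ 2 ≤ (1 + ⟪g, f⟫ + 2 * ‖g‖ ^ 2) * ‖p‖ ^ 2 - 2 * (⟪g, p⟫ * ⟪f, p⟫) := fun g f hf hD p p' hp => by
    set b := ⟪f, p'⟫ with hb
    set J := 1 + ⟪g, f⟫ with hJ
    have h1 : ⟪f, p⟫ = b * J := by
      rw [hp, inner_add_right, inner_smul_right, ← hb, real_inner_comm, hJ]; ring
    have h2 : p' = p - b • g := by rw [hp]; abel
    have h3 : ‖p'‖ ^ 2 = ‖p‖ ^ 2 - 2 * b * ⟪g, p⟫ + b ^ 2 * ‖g‖ ^ 2 := by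
      rw [h2, norm_sub_sq_real, inner_smul_right, real_inner_comm, norm_smul, mul_pow,
        Real.norm_eq_abs, sq_abs]; ring
    have h4 : (b * J) ^ 2 ≤ ‖p‖ ^ 2 := by
      rw [← h1]
      have : |⟪f, p⟫| ≤ ‖p‖ := (abs_real_inner_le_norm _ _).trans
        (mul_le_of_le_one_left (norm_nonneg _) hf)
      rw [← sq_abs]; gcongr
    have h5 : J * b ^ 2 ≤ 2 * ‖p‖ ^ 2 := by nlinarith [sq_nonneg b, mul_nonneg (sq_nonneg b) (by linarith : (0:ℝ) ≤ J)]
    have h6 := mul_le_mul_of_nonneg_right h5 (sq_nonneg ‖g‖)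
    rw [h1, h3]
    nlinarith
  have hj := h.half_le_jac y
  rw [quad_apply]
  rcases h.grad_zero y with h0 | h0
  · rw [h0] at hp ⊢
    unfold jac at hj ⊢
    rw [h0] at hj ⊢
    simp only [inner_zero_left, add_zero, smul_zero, norm_zero] at hj hp ⊢
    have := key _ _ h.e'_le hj p p' hp
    linarith
  · rw [h0] at hp ⊢
    unfold jac at hj ⊢
    rw [h0] at hj ⊢
    simp only [inner_zero_left, add_zero, smul_zero, norm_zero] at hj hp ⊢
    have := key _ _ h.e_le hj p p' hp
    linarith

lemma test_inequality (h : FieldPair D η e ψ e')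
    (hmin : ∀ U : Set (Euc d), IsOpen U → U ⊆ D → mvol U = a → lam ≤ lam1 U)
    (hUo : IsOpen U) (hUD : U ⊆ D) (hf : volume U ≠ ∞)
    (hv : mvol U + (∫ y in U, ⟪gradient η y, e⟫) + ∫ y in U, ⟪gradient ψ y, e'⟫ = a)
    (hφ : TestFun U φ) :
    lam * ∫ y, jac η e ψ e' y * (φ y) ^ 2 ≤
      ∫ y, ⟪quadOp η e ψ e' y (gradient φ y), gradient φ y⟫ := by
  obtain ⟨T, hT, hTs⟩ := h.exists_homeo
  have hV := hmin (T '' U) (T.isOpenMap U hUo) (h.image_subset hT hUD)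
    ((h.mvol_image hT hUo.measurableSet hf).trans hv)
  have hφ' : TestFun (T '' U) (fun x => φ (T.symm x)) := by
    refine ⟨hφ.1.comp hTs, hφ.2.1.comp_homeomorph T.symm, ?_⟩
    have : tsupport (fun x => φ (T.symm x)) ⊆ T '' tsupport φ := by
      refine closure_minimal (fun x hx => ⟨T.symm x, subset_tsupport _ hx, by simp⟩)
        (T.isClosedMap _ (isClosed_tsupport _))
    exact this.trans (image_mono hφ.2.2)
  have h1 := hφ'.integral_sq_le_of_lam1
  have h0 : 0 ≤ ∫ x, (φ (T.symm x)) ^ 2 := by positivity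
  have h2 := (mul_le_mul_of_nonneg_right hV h0).trans h1
  have cv : ∀ g : Euc d → ℝ, ∫ x, g x = ∫ y, jac η e ψ e' y * g (T y) := fun g => by
    have := h.integral_comp hT g MeasurableSet.univ
    simpa [T.surjective.range_eq] using this
  rw [cv (fun x => (φ (T.symm x)) ^ 2),
    cv (fun x => ‖gradient (fun x => φ (T.symm x)) x‖ ^ 2)] at h2
  simp only [T.symm_apply_apply] at h2
  refine h2.trans (integral_mono_of_nonneg ?_ ?_ ?_)
  · exact .of_forall fun y => mul_nonneg (by linarith [h.half_le_jac y]) (by positivity)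
  · refine Continuous.integrable_of_hasCompactSupport
      ((h.continuous_quadOp.clm_apply hφ.continuous_gradient).inner hφ.continuous_gradient)
      (HasCompactSupport.intro hφ.2.1 fun y hy => ?_)
    rw [gradient_eq_zero_of_notMem_tsupport hy]; simp
  · refine .of_forall fun y => h.pointwise_bound y _ _ ?_
    refine ext_inner_right ℝ fun v => ?_
    have hc : HasFDerivAt φ ((fderiv ℝ (fun x => φ (T.symm x)) (T y)).comp
        (ContinuousLinearMap.id ℝ _ +
          ((fderiv ℝ η y).smulRight e + (fderiv ℝ ψ y).smulRight e'))) y := by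
      have h3 := (hφ'.differentiable (T y)).hasFDerivAt
      have h4 : HasFDerivAt T (ContinuousLinearMap.id ℝ _ +
          ((fderiv ℝ η y).smulRight e + (fderiv ℝ ψ y).smulRight e')) y := by
        rw [show (T : Euc d → Euc d) = deform η e ψ e' from funext hT]
        exact h.hasFDerivAt y
      have h5 := h3.comp y h4
      refine h5.congr_of_eventuallyEq (.of_forall fun z => ?_)
      simp
    rw [inner_gradient_left, hc.fderiv]
    simp only [inner_add_left, inner_smul_left, inner_gradient_left, conj_trivial,
      ContinuousLinearMap.comp_apply, add_apply, ContinuousLinearMap.id_apply,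
      ContinuousLinearMap.smulRight_apply, map_add, map_smul, smul_eq_mul]
    rw [real_inner_comm, inner_gradient_left, real_inner_comm, inner_gradient_left]
    ring

theorem quad_inequality (h : FieldPair D η e ψ e')
    (hmin : ∀ U : Set (Euc d), IsOpen U → U ⊆ D → mvol U = a → lam ≤ lam1 U)
    (hUo : IsOpen U) (hUD : U ⊆ D) (hf : volume U ≠ ∞)
    (hv : mvol U + (∫ y in U, ⟪gradient η y, e⟫) + ∫ y in U, ⟪gradient ψ y, e'⟫ = a)
    (hH : InH U v G) :
    lam * ∫ y, jac η e ψ e' y * (v y) ^ 2 ≤ ∫ y, ⟪quadOp η e ψ e' y (G y), G y⟫ := by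
  obtain ⟨φ, hφ, h1, h2⟩ := hH.approx
  obtain ⟨C, hC⟩ := h.exists_quadOp_bound
  exact le_of_tendsto_of_tendsto' ((hH.tendsto_weighted hφ h1 h.continuous_jac h.jac_le).const_mul
    lam) (hH.tendsto_weighted_grad hφ h2 h.continuous_quadOp hC)
    fun n => h.test_inequality hmin hUo hUD hf hv (hφ n)

end FieldPair

/-! ### First variations -/

/-- The energy `∫ |G|² - λ ∫ v²`. -/
def energyJ (lam : ℝ) (v : Euc d → ℝ) (G : Euc d → Euc d) : ℝ :=
  (∫ y, ‖G y‖ ^ 2) - lam * ∫ y, (v y) ^ 2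

/-- The first variation of the energy along the field `η e`. -/
def firstVar (lam : ℝ) (η : Euc d → ℝ) (e : Euc d) (v : Euc d → ℝ) (G : Euc d → Euc d) : ℝ :=
  ∫ y, (⟪gradient η y, e⟫ * ‖G y‖ ^ 2 - 2 * (⟪gradient η y, G y⟫ * ⟪e, G y⟫)
    - lam * (⟪gradient η y, e⟫ * (v y) ^ 2))

/-- The second order term of the energy along the field `η e`. -/
def secondVar (η : Euc d → ℝ) (G : Euc d → Euc d) : ℝ := ∫ y, ‖gradient η y‖ ^ 2 * ‖G y‖ ^ 2

/-- The variation of the volume of `U` along the field `η e`. -/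
def volVar (η : Euc d → ℝ) (e : Euc d) (U : Set (Euc d)) : ℝ := ∫ y in U, ⟪gradient η y, e⟫

section Variation

lemma TestFun.const_mul (h : TestFun U η) (s : ℝ) : TestFun U (fun y => s * η y) :=
  h.mul_left contDiff_const

lemma TestFun.gradient_const_mul (h : TestFun U η) (s : ℝ) (y : Euc d) :
    gradient (fun y => s * η y) y = s • gradient η y :=
  _root_.gradient_const_mul s (h.differentiable y)

lemma integrable_sq_of_memLp {α E : Type*} [MeasurableSpace α] {μ : Measure α}
    [NormedAddCommGroup E] {f : α → E} (hf : MemLp f 2 μ) : Integrable (fun y => ‖f y‖ ^ 2) μ := by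
  simpa using hf.integrable_norm_pow (by norm_num)

lemma integrable_bdd_mul (hf : Integrable f) (hg : Continuous g)
    (hC : ∀ y, |g y| ≤ C) : Integrable fun y => g y * f y :=
  hf.bdd_mul hg.aestronglyMeasurable (c := C) (.of_forall hC)

lemma integrable_firstVar (lam : ℝ) (hη : TestFun U η) (e : Euc d)
    (hv : MemLp v 2) (hG : MemLp G 2) :
    Integrable fun y => ⟪gradient η y, e⟫ * ‖G y‖ ^ 2 - 2 * (⟪gradient η y, G y⟫ * ⟪e, G y⟫)
      - lam * (⟪gradient η y, e⟫ * (v y) ^ 2) := by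
  obtain ⟨C, hC0, hC⟩ := hη.bounded_gradient
  have c1 : Continuous fun y => ⟪gradient η y, e⟫ := hη.continuous_gradient.inner continuous_const
  have b1 : ∀ y, |⟪gradient η y, e⟫| ≤ C * ‖e‖ := fun y =>
    (abs_real_inner_le_norm _ _).trans (mul_le_mul_of_nonneg_right (hC y) (norm_nonneg _))
  have iG := integrable_sq_of_memLp hG
  have iv : Integrable fun y => (v y) ^ 2 := by simpa using integrable_sq_of_memLp hv
  refine ((integrable_bdd_mul iG c1 b1).sub (Integrable.const_mul ?_ 2)).sub
    ((integrable_bdd_mul iv c1 b1).const_mul lam)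
  refine Integrable.mono' (iG.const_mul (C * ‖e‖)) ?_ (.of_forall fun y => ?_)
  · exact (hη.continuous_gradient.aestronglyMeasurable.inner hG.1).mul
      (aestronglyMeasurable_const.inner hG.1)
  · rw [norm_mul, sq]
    calc _ ≤ (C * ‖G y‖) * (‖e‖ * ‖G y‖) := by
          refine mul_le_mul ((norm_inner_le_norm _ _).trans ?_) (norm_inner_le_norm _ _)
            (norm_nonneg _) (by positivity)
          exact mul_le_mul_of_nonneg_right (hC y) (norm_nonneg _)
      _ = _ := by ring

lemma integrable_secondVar (hη : TestFun U η) (hG : MemLp G 2) :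
    Integrable fun y => ‖gradient η y‖ ^ 2 * ‖G y‖ ^ 2 := by
  obtain ⟨C, hC0, hC⟩ := hη.bounded_gradient
  refine integrable_bdd_mul (integrable_sq_of_memLp hG) (hη.continuous_gradient.norm.pow 2)
    (C := C ^ 2) fun y => ?_
  rw [abs_of_nonneg (by positivity)]
  have := hC y
  gcongr

lemma integrable_volVar (hη : TestFun U η) (e : Euc d) : Integrable fun y => ⟪gradient η y, e⟫ :=
  (hη.continuous_gradient.inner continuous_const).integrable_of_hasCompactSupport
    (hη.2.1.gradient.comp_left (g := fun v => ⟪v, e⟫) (by simp))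

lemma firstVar_const_mul (lam : ℝ) (hη : TestFun U η) (s : ℝ) :
    firstVar lam (fun y => s * η y) e v G = s * firstVar lam η e v G := by
  rw [firstVar, firstVar, ← integral_const_mul]
  congr 1; ext y
  rw [hη.gradient_const_mul, inner_smul_left, inner_smul_left]
  simp only [conj_trivial]; ring

lemma secondVar_const_mul (hη : TestFun U η) (s : ℝ) :
    secondVar (fun y => s * η y) G = s ^ 2 * secondVar η G := by
  rw [secondVar, secondVar, ← integral_const_mul]
  congr 1; ext y
  rw [hη.gradient_const_mul, norm_smul, mul_pow, Real.norm_eq_abs, sq_abs]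
  ring

lemma volVar_const_mul (hη : TestFun U η) (s : ℝ) :
    volVar (fun y => s * η y) e V = s * volVar η e V := by
  rw [volVar, volVar, ← integral_const_mul]
  congr 1; ext y
  rw [hη.gradient_const_mul, inner_smul_left, conj_trivial]

lemma secondVar_nonneg : 0 ≤ secondVar η G := by unfold secondVar; positivity

lemma FieldPair.expand (h : FieldPair D η e ψ e') (lam : ℝ) (hv : MemLp v 2) (hG : MemLp G 2)
    (hle : lam * ∫ y, jac η e ψ e' y * (v y) ^ 2 ≤ ∫ y, ⟪quadOp η e ψ e' y (G y), G y⟫) :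
    0 ≤ energyJ lam v G + firstVar lam η e v G + firstVar lam ψ e' v G + 2 * secondVar η G +
      2 * secondVar ψ G := by
  have iG := integrable_sq_of_memLp hG
  have iv : Integrable fun y => (v y) ^ 2 := by simpa using integrable_sq_of_memLp hv
  have i0 : Integrable fun y => ‖G y‖ ^ 2 - lam * (v y) ^ 2 := iG.sub (iv.const_mul lam)
  have i1 := integrable_firstVar lam h.η_test e hv hG
  have i2 := integrable_firstVar lam h.ψ_test e' hv hG
  have i3 := (integrable_secondVar h.η_test hG).const_mul 2
  have i4 := (integrable_secondVar h.ψ_test hG).const_mul 2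
  have ij := (integrable_bdd_mul iv h.continuous_jac h.jac_le).const_mul lam
  have e0 : energyJ lam v G = ∫ y, (‖G y‖ ^ 2 - lam * (v y) ^ 2) := by
    rw [integral_sub iG (iv.const_mul lam), integral_const_mul, energyJ]
  rw [e0, firstVar, firstVar, secondVar, secondVar, ← integral_const_mul, ← integral_const_mul,
    ← integral_add' i0 i1, ← integral_add' (i0.add i1) i2, ← integral_add' ((i0.add i1).add i2) i3,
    ← integral_add' (((i0.add i1).add i2).add i3) i4]
  rw [← integral_const_mul] at hle
  have iA := (((i0.add i1).add i2).add i3).add i4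
  refine le_of_add_le_add_left (a := ∫ y, lam * (jac η e ψ e' y * (v y) ^ 2)) ?_
  rw [add_zero, ← integral_add' ij iA]
  refine hle.trans_eq ?_
  congr 1; ext y
  rw [FieldPair.quad_apply, jac]
  simp only [Pi.add_apply]
  rw [jac]
  ring

end Variation

/-- An optimal shape with its ground state. -/
structure OptState (D : Set (Euc d)) (a : ℝ) (Ω : Set (Euc d)) (lam : ℝ) (u : Euc d → ℝ)
    (G : Euc d → Euc d) (μ : Measure (Euc d)) : Prop extends LapState Ω lam u G μ where
  openD : IsOpen D
  bddD : Bornology.IsBounded D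
  connD : IsConnected D
  openΩ : IsOpen Ω
  subset : Ω ⊆ D
  meas : mvol Ω = a
  lt_meas : a < mvol D
  minim : ∀ U : Set (Euc d), IsOpen U → U ⊆ D → mvol U = a → lam ≤ lam1 U

local notation "𝓞" => OptState D a Ω lam u G μ

namespace OptState

lemma volume_ne_top (h : 𝓞) (hU : U ⊆ D) : volume U ≠ ∞ := (h.bddD.subset hU).measure_lt_top.ne

lemma energy_zero (h : 𝓞) : energyJ lam u G = 0 := by rw [energyJ, h.energy, h.norm_one]; ring

/-- The inequality expressing optimality against two deformations with disjoint supports. -/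
lemma two_field_ineq (h : 𝓞) (hη : TestFun D η) (hψ : TestFun D ψ)
    (hd : Disjoint (tsupport η) (tsupport ψ)) (he : ‖e‖ ≤ 1) (he' : ‖e'‖ ≤ 1) {t : ℝ}
    (hC : ∀ y, ‖gradient η y‖ ≤ C) (hC' : ∀ y, ‖gradient ψ y‖ ≤ C) (hs : |s| * C ≤ 1 / 4)
    (ht : |t| * C ≤ 1 / 4) (hUo : IsOpen U) (hUD : U ⊆ D)
    (hv : mvol U + s * volVar η e U + t * volVar ψ e' U = a) (hH : InH U v F) :
    0 ≤ energyJ lam v F + s * firstVar lam η e v F + t * firstVar lam ψ e' v F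
      + 2 * (s ^ 2 * secondVar η F) + 2 * (t ^ 2 * secondVar ψ F) := by
  have sub : ∀ {f : Euc d → ℝ} (c : ℝ), tsupport (fun y => c * f y) ⊆ tsupport f := fun {f} c =>
    closure_mono fun y hy hz => hy (by simp [hz])
  have bd : ∀ {f : Euc d → ℝ} (_ : TestFun D f) (_ : ∀ y, ‖gradient f y‖ ≤ C) (c : ℝ)
      (_ : |c| * C ≤ 1 / 4) (y : Euc d), ‖gradient (fun y => c * f y) y‖ ≤ 1 / 4 := by
    intro f hf hC c hc y
    rw [hf.gradient_const_mul, norm_smul, Real.norm_eq_abs]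
    exact (mul_le_mul_of_nonneg_left (hC y) (abs_nonneg _)).trans hc
  have P : FieldPair D (fun y => s * η y) e (fun y => t * ψ y) e' :=
    ⟨hη.const_mul s, hψ.const_mul t, hd.mono (sub s) (sub t), he, he', bd hη hC s hs,
      bd hψ hC' t ht⟩
  have h1 := P.quad_inequality h.minim hUo hUD (h.volume_ne_top hUD)
    (by rw [← hv, ← volVar_const_mul hη, ← volVar_const_mul hψ]; rfl) hH
  have h2 := P.expand lam hH.memV hH.memG h1
  rwa [firstVar_const_mul lam hη, firstVar_const_mul lam hψ, secondVar_const_mul hη,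
    secondVar_const_mul hψ] at h2

/-- Optimality without change of volume. -/
lemma energy_nonneg (h : 𝓞) (hUo : IsOpen U) (hUD : U ⊆ D)
    (hv : mvol U = a) (hH : InH U v F) : 0 ≤ energyJ lam v F :=
  sub_nonneg.2 (hH.integral_sq_le (h.minim U hUo hUD hv))

lemma firstVar_mul_volVar (h : 𝓞) (hη : TestFun D η) (hψ : TestFun D ψ)
    (hd : Disjoint (tsupport η) (tsupport ψ)) (he : ‖e‖ ≤ 1) (he' : ‖e'‖ ≤ 1) :
    volVar ψ e' Ω * firstVar lam η e u G = volVar η e Ω * firstVar lam ψ e' u G := by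
  obtain ⟨C₁, hC₁0, hC₁⟩ := hη.bounded_gradient
  obtain ⟨C₂, hC₂0, hC₂⟩ := hψ.bounded_gradient
  set p := volVar ψ e' Ω
  set q := volVar η e Ω
  set A := p * firstVar lam η e u G - q * firstVar lam ψ e' u G with hA
  set C := C₁ + C₂ + 1
  set Q := 2 * (p ^ 2 * secondVar η G) + 2 * (q ^ 2 * secondVar ψ G)
  have hQ : 0 ≤ Q := by
    have := secondVar_nonneg (η := η) (G := G)
    have := secondVar_nonneg (η := ψ) (G := G)
    positivity
  set M := |p| + |q| + 1
  have hCp : 0 < C := by positivity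
  have hMp : 0 < M := by positivity
  have key : ∀ σ : ℝ, |σ| ≤ 1 / (4 * C * M) → 0 ≤ σ * A + σ ^ 2 * Q := fun σ hσ => by
    have hb : ∀ c, |c| ≤ M → |σ * c| * C ≤ 1 / 4 := fun c hc => by
      rw [abs_mul]
      calc |σ| * |c| * C ≤ 1 / (4 * C * M) * M * C := by gcongr
        _ = 1 / 4 := by field_simp
    have h1 := h.two_field_ineq (s := σ * p) (t := σ * (-q)) hη hψ hd he he'
      (fun y => (hC₁ y).trans (by simp only [C]; linarith))
      (fun y => (hC₂ y).trans (by simp only [C]; linarith))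
      (hb p (by simp only [M]; linarith [abs_nonneg q]))
      (hb (-q) (by rw [abs_neg]; simp only [M]; linarith [abs_nonneg p]))
      h.openΩ h.subset (by rw [h.meas]; ring) h.inH
    rw [h.energy_zero] at h1
    calc _ ≤ _ := h1
      _ = _ := by simp only [hA, Q]; ring
  by_contra hne
  have hA0 : A ≠ 0 := sub_ne_zero.2 hne
  have hA2 : 0 < |A| := abs_pos.2 hA0
  set τ := min (1 / (4 * C * M)) (|A| / (2 * (Q + 1)))
  have hτ : 0 < τ := by positivity
  have hτ2 : τ * Q ≤ |A| / 2 := by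
    calc τ * Q ≤ |A| / (2 * (Q + 1)) * (Q + 1) := by
          refine mul_le_mul (min_le_right _ _) (by linarith) hQ (by positivity)
      _ = _ := by field_simp
  rcases lt_or_gt_of_ne hA0 with hn | hn
  · have := key τ (by rw [abs_of_pos hτ]; exact min_le_left _ _)
    rw [abs_of_neg hn] at hτ2
    nlinarith
  · have := key (-τ) (by rw [abs_neg, abs_of_pos hτ]; exact min_le_left _ _)
    rw [abs_of_pos hn] at hτ2
    nlinarith

/-- The consequences of optimality used in the analysis of the free boundary: `Λ` is the Lagrange
multiplier, `ρ` the scale at which perturbations are localised. -/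
structure Multiplier (D : Set (Euc d)) (a : ℝ) (Ω : Set (Euc d)) (lam : ℝ) (u : Euc d → ℝ)
    (G : Euc d → Euc d) (Λ ρ C : ℝ) : Prop where
  ρ_pos : 0 < ρ
  C_pos : 0 < C
  cost : ∀ (z : Euc d) (U : Set (Euc d)) (v : Euc d → ℝ) (F : Euc d → Euc d), IsOpen U → U ⊆ D →
    U \ ball z ρ = Ω \ ball z ρ → |mvol U - a| ≤ ρ → InH U v F →
    (∀ᵐ y, y ∉ ball z ρ → v y = u y ∧ F y = G y) →
    0 ≤ energyJ lam v F + Λ * (mvol U - a) + C * (mvol U - a) ^ 2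
  stationary : ∀ (z : Euc d) (ψ : Euc d → ℝ) (e : Euc d), TestFun (D ∩ ball z ρ) ψ → ‖e‖ ≤ 1 →
    firstVar lam ψ e u G = -Λ * volVar ψ e Ω

lemma firstVar_congr (hη : Disjoint (tsupport η) S) (hv : ∀ᵐ y, y ∉ S → v y = u y ∧ F y = G y) :
    firstVar lam η e v F = firstVar lam η e u G ∧ secondVar η F = secondVar η G := by
  constructor <;> refine integral_congr_ae (hv.mono fun y hy => ?_) <;>
  · by_cases hs : y ∈ S
    · simp [gradient_eq_zero_of_notMem_tsupport (hη.notMem_of_mem_right hs)]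
    · simp [hy hs]

lemma volVar_congr (hη : Disjoint (tsupport η) S) (hU : U \ S = Ω \ S)
    (mU : MeasurableSet U) (mΩ : MeasurableSet Ω) :
    volVar η e U = volVar η e Ω := by
  rw [volVar, volVar, ← integral_indicator mU, ← integral_indicator mΩ]
  congr 1; ext y
  by_cases hs : y ∈ S
  · simp [indicator, gradient_eq_zero_of_notMem_tsupport (hη.notMem_of_mem_right hs)]
  · have : y ∈ U ↔ y ∈ Ω := by simpa [hs] using Set.ext_iff.1 hU y
    by_cases hy : y ∈ Ω <;> simp [indicator, this, hy]

theorem exists_multiplier_of_fields (h : 𝓞) {x₁ x₂ : Euc d}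
    {η₁ η₂ : Euc d → ℝ} {e₁ e₂ : Euc d} (hne : x₁ ≠ x₂)
    (h₁ : TestFun (D ∩ ball x₁ (dist x₁ x₂ / 4)) η₁) (h₂ : TestFun (D ∩ ball x₂ (dist x₁ x₂ / 4)) η₂)
    (he₁ : ‖e₁‖ ≤ 1) (he₂ : ‖e₂‖ ≤ 1) (hv₁ : volVar η₁ e₁ Ω ≠ 0) (hv₂ : volVar η₂ e₂ Ω ≠ 0) :
    ∃ Λ ρ C, Multiplier D a Ω lam u G Λ ρ C := by
  set δ := dist x₁ x₂ with hδ
  have hδ0 : 0 < δ := dist_pos.2 hne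
  have T₁ : TestFun D η₁ := h₁.mono inter_subset_left
  have T₂ : TestFun D η₂ := h₂.mono inter_subset_left
  have s₁ : tsupport η₁ ⊆ ball x₁ (δ / 4) := h₁.2.2.trans inter_subset_right
  have s₂ : tsupport η₂ ⊆ ball x₂ (δ / 4) := h₂.2.2.trans inter_subset_right
  set Λ := -(firstVar lam η₁ e₁ u G / volVar η₁ e₁ Ω) with hΛ
  have hΛ₁ : firstVar lam η₁ e₁ u G = -Λ * volVar η₁ e₁ Ω := by rw [hΛ]; field_simp
  have hΛ₂ : firstVar lam η₂ e₂ u G = -Λ * volVar η₂ e₂ Ω := by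
    have hd : Disjoint (tsupport η₁) (tsupport η₂) := by
      refine (ball_disjoint_ball ?_).mono s₁ s₂
      rw [← hδ]; linarith
    have := h.firstVar_mul_volVar T₁ T₂ hd he₁ he₂
    rw [hΛ]; field_simp; linarith
  obtain ⟨c₁, hc₁0, hc₁⟩ := T₁.bounded_gradient
  obtain ⟨c₂, hc₂0, hc₂⟩ := T₂.bounded_gradient
  set c := c₁ + c₂ + 1
  have hc0 : 0 < c := by positivity
  set m := min |volVar η₁ e₁ Ω| |volVar η₂ e₂ Ω| with hm
  have hm0 : 0 < m := lt_min (abs_pos.2 hv₁) (abs_pos.2 hv₂)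
  have Q₁ := secondVar_nonneg (η := η₁) (G := G)
  have Q₂ := secondVar_nonneg (η := η₂) (G := G)
  set Q := 2 * (secondVar η₁ G + secondVar η₂ G) / m ^ 2 + 1
  have hQ : 0 < Q := by positivity
  have pick : ∀ z, ∃ (η : Euc d → ℝ) (e : Euc d), TestFun D η ∧ ‖e‖ ≤ 1 ∧ m ≤ |volVar η e Ω| ∧
      firstVar lam η e u G = -Λ * volVar η e Ω ∧ (∀ y, ‖gradient η y‖ ≤ c) ∧
      secondVar η G ≤ secondVar η₁ G + secondVar η₂ G ∧
      Disjoint (tsupport η) (ball z (min (δ / 4) (m / (4 * c)))) := fun z => by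
    have hb := min_le_left (δ / 4) (m / (4 * c))
    rcases le_or_gt (δ / 2) (dist x₁ z) with hz | hz
    · exact ⟨η₁, e₁, T₁, he₁, min_le_left _ _, hΛ₁, fun y => (hc₁ y).trans (by simp only [c]; linarith),
        by linarith, (ball_disjoint_ball (by linarith)).mono_left s₁⟩
    · refine ⟨η₂, e₂, T₂, he₂, min_le_right _ _, hΛ₂, fun y => (hc₂ y).trans (by simp only [c]; linarith),
        by linarith, (ball_disjoint_ball ?_).mono_left s₂⟩
      linarith [dist_triangle_right x₁ x₂ z]
  refine ⟨Λ, min (δ / 4) (m / (4 * c)), Q, by positivity, hQ, fun z U v F hUo hUD hUS hVa hH hvF => ?_,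
    fun z ψ e' hψ he' => ?_⟩ <;> obtain ⟨η, e, hη, he, hmv, hf, hc, hQ', hS⟩ := pick z
  · replace hVa := hVa.trans (min_le_right _ _)
    have hv0 : volVar η e Ω ≠ 0 := abs_pos.1 (hm0.trans_le hmv)
    set s := (a - mvol U) / volVar η e Ω with hs
    have hsa : |s| ≤ |mvol U - a| / m := by rw [hs, abs_div, abs_sub_comm]; gcongr
    obtain ⟨f1, f2⟩ := firstVar_congr (lam := lam) (e := e) hS hvF
    have f3 := volVar_congr (e := e) hS hUS hUo.measurableSet h.openΩ.measurableSet
    have key := h.two_field_ineq (s := s) (t := 0) (C := c) (e' := 0) hη TestFun.zero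
      (by rw [show tsupport (fun _ : Euc d => (0 : ℝ)) = ∅ from tsupport_eq_empty_iff.2 rfl]
          exact disjoint_empty _) he (by simp) hc
      (fun y => by simp [gradient_fun_const, hc0.le])
      (by calc |s| * c ≤ (m / (4 * c)) / m * c := by gcongr; exact hsa.trans (by gcongr)
          _ = 1 / 4 := by field_simp)
      (by simp) hUo hUD (by rw [f3, hs]; field_simp; ring) hH
    rw [f1, f2, hf] at key
    have e1 : s * (-Λ * volVar η e Ω) = Λ * (mvol U - a) := by rw [hs]; field_simp; ring
    have e2 : s ^ 2 ≤ (mvol U - a) ^ 2 / m ^ 2 := by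
      rw [← sq_abs s, ← sq_abs (mvol U - a), ← div_pow]; gcongr
    have e3 : 2 * (s ^ 2 * secondVar η G) ≤ Q * (mvol U - a) ^ 2 := by
      calc 2 * (s ^ 2 * secondVar η G) ≤
            2 * ((mvol U - a) ^ 2 / m ^ 2 * (secondVar η₁ G + secondVar η₂ G)) := by
            gcongr; exact secondVar_nonneg
        _ = (Q - 1) * (mvol U - a) ^ 2 := by simp only [Q]; ring
        _ ≤ _ := by nlinarith [sq_nonneg (mvol U - a)]
    rw [e1] at key
    simp only [zero_mul, ne_eq, OfNat.ofNat_ne_zero, not_false_eq_true, zero_pow, mul_zero,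
      add_zero] at key
    linarith
  · refine mul_left_cancel₀ (abs_pos.1 (hm0.trans_le hmv)) ?_
    have := h.firstVar_mul_volVar hη (hψ.mono inter_subset_left)
      (hS.mono_right (hψ.2.2.trans inter_subset_right)) he he'
    rw [hf] at this
    linarith

end OptState

/-! ### Essential boundary points -/

lemma kerK_pos (h : ‖z‖ < 1) : 0 < kerK z :=
  expNegInvGlue.pos_of_pos (by nlinarith [norm_nonneg z])

lemma bumpK_pos (h : dist y x < r) : 0 < bumpK x r y := by
  have hr : 0 < r := dist_nonneg.trans_lt h
  exact kerK_pos (by rw [norm_scale hr, inv_mul_lt_iff₀ hr]; linarith)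

lemma gradient_bumpK_eq_zero (hr : 0 < r) (h : r ≤ dist y x) : gradient (bumpK x r) y = 0 := by
  rw [gradient_bumpK, kerk_eq_zero (one_le_norm_scale hr h)]; simp

lemma exists_gradient_bumpK_bound : ∃ C, 0 < C ∧ ∀ (x : Euc d) (r : ℝ), 0 < r →
    ∀ y, ‖gradient (bumpK x r) y‖ ≤ C * r⁻¹ := by
  obtain ⟨C, hC0, hC⟩ := exists_kerk_bound (d := d)
  refine ⟨C, hC0, fun x r hr y => ?_⟩
  rcases le_or_gt r (dist y x) with h | h
  · rw [gradient_bumpK_eq_zero hr h, norm_zero]; positivity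
  · rw [gradient_bumpK, norm_smul, norm_neg, ← dist_eq_norm, Real.norm_of_nonneg
      (mul_nonneg (by positivity) (kerk_nonneg _))]
    calc r⁻¹ ^ 2 * kerk (r⁻¹ • (y - x)) * dist y x ≤ r⁻¹ ^ 2 * C * r := by
          gcongr
          exact hC _
      _ = C * r⁻¹ := by field_simp

lemma hasDerivAt_setIntegral_bumpK (Ω : Set (Euc d)) (z e : Euc d) (hr : 0 < r) (s : ℝ) :
    HasDerivAt (fun s : ℝ => ∫ y in Ω, bumpK (z + s • e) r y)
      (-volVar (bumpK (z + s • e) r) e Ω) s := by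
  obtain ⟨C, hC0, hC⟩ := exists_gradient_bumpK_bound (d := d)
  have T : ∀ s : ℝ, TestFun univ (bumpK (z + s • e) r) := fun s =>
    bumpK_testFun _ hr (subset_univ _)
  rw [volVar, ← integral_neg]
  refine (hasDerivAt_integral_of_dominated_loc_of_deriv_le (μ := volume.restrict Ω)
    (F := fun s y => bumpK (z + s • e) r y)
    (F' := fun s y => -⟪gradient (bumpK (z + s • e) r) y, e⟫) (ball_mem_nhds s one_pos)
    (bound := (closedBall (z + s • e) (r + ‖e‖)).indicator fun _ => C * r⁻¹ * ‖e‖)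
    (.of_forall fun s => (T s).continuous.aestronglyMeasurable)
    ((T s).integrable volume).integrableOn
    ((T s).continuous_gradient.inner continuous_const).neg.aestronglyMeasurable
    (.of_forall fun y t ht => ?_)
    ((integrable_indicator_iff measurableSet_closedBall).2 (integrableOn_const
      (measure_closedBall_lt_top.ne))).integrableOn
    (.of_forall fun y t _ => ?_)).2
  · rw [norm_neg]
    by_cases hy : y ∈ closedBall (z + s • e) (r + ‖e‖)
    · rw [indicator_of_mem hy]
      exact (norm_inner_le_norm _ _).trans (mul_le_mul_of_nonneg_right (hC _ _ hr y) (norm_nonneg _))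
    · rw [indicator_of_notMem hy, gradient_bumpK_eq_zero hr]
      · simp
      · rw [mem_closedBall, not_le] at hy
        have h1 := dist_triangle y (z + t • e) (z + s • e)
        have h2 : dist (z + t • e) (z + s • e) ≤ ‖e‖ := by
          rw [dist_add_left, dist_eq_norm, ← sub_smul, norm_smul]
          rw [mem_ball, Real.dist_eq] at ht
          exact mul_le_of_le_one_left (norm_nonneg _) ht.le
        linarith
  · have h1 : HasDerivAt (fun t : ℝ => r⁻¹ • (y - (z + t • e))) (r⁻¹ • (-((1 : ℝ) • e))) t := by
      have := (((hasDerivAt_id t).smul_const e).const_add z).const_sub y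
      exact this.const_smul r⁻¹
    have h2 := (smooth_differentiable contDiff_kerK (r⁻¹ • (y - (z + t • e)))).hasFDerivAt.comp_hasDerivAt
      t h1
    refine h2.congr_deriv ?_
    have h3 := gradient_comp_scale (smooth_differentiable contDiff_kerK) (z + t • e) r y
    rw [show gradient (bumpK (z + t • e) r) y = _ from h3, inner_smul_left, inner_gradient_left]
    simp

/-- Points of `D` near which both `Ω` and its complement have positive measure. -/
def EssBdry (D Ω : Set (Euc d)) (x : Euc d) : Prop :=
  x ∈ D ∧ ∀ r, 0 < r → volume (ball x r ∩ Ω) ≠ 0 ∧ volume (ball x r \ Ω) ≠ 0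

lemma EssBdry.exists_field (hx : EssBdry D Ω x) (hD : IsOpen D)
    (hΩ : IsOpen Ω) (hr : 0 < r) :
    ∃ η e, TestFun (D ∩ ball x r) η ∧ ‖e‖ ≤ 1 ∧ volVar η e Ω ≠ 0 := by
  obtain ⟨r₀, hr₀, hsub⟩ := Metric.isOpen_iff.1 (hD.inter (isOpen_ball (x := x) (ε := r))) x
    ⟨hx.1, mem_ball_self hr⟩
  set ρ := min r₀ 1
  have hρ : 0 < ρ := by positivity
  have hsub' : ball x ρ ⊆ D ∩ ball x r := (ball_subset_ball (min_le_left _ _)).trans hsub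
  obtain ⟨z, hz⟩ : (ball x (ρ / 2) ∩ Ω).Nonempty :=
    nonempty_of_measure_ne_zero (hx.2 (ρ / 2) (by positivity)).1
  obtain ⟨δ₀, hδ₀, hδΩ⟩ := Metric.isOpen_iff.1 hΩ z hz.2
  set δ := min (δ₀ / 2) (ρ / 4)
  have hδ : 0 < δ := by positivity
  by_contra! hcon
  have hez : ‖z - x‖ < ρ / 2 := by rw [← dist_eq_norm]; exact hz.1
  have he : ‖z - x‖ ≤ 1 := by linarith [min_le_right r₀ 1]
  have hder : ∀ s ∈ Icc (0 : ℝ) 1,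
      HasDerivAt (fun s : ℝ => ∫ y in Ω, bumpK (x + s • (z - x)) δ y) 0 s := fun s hs => by
    have h0 := hcon (bumpK (x + s • (z - x)) δ) (z - x)
      (bumpK_testFun _ hδ (Subset.trans (fun y hy => ?_) hsub')) he
    · have := hasDerivAt_setIntegral_bumpK Ω x (z - x) hδ s
      rwa [h0, neg_zero] at this
    · rw [mem_closedBall] at hy
      rw [mem_ball]
      have h1 := dist_triangle y (x + s • (z - x)) x
      have h2 : dist (x + s • (z - x)) x ≤ ‖z - x‖ := by
        rw [dist_eq_norm, add_sub_cancel_left, norm_smul, Real.norm_of_nonneg hs.1]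
        exact mul_le_of_le_one_left (norm_nonneg _) hs.2
      have := min_le_right (δ₀ / 2) (ρ / 4)
      linarith
  have hconst := constant_of_has_deriv_right_zero
    (fun s hs => (hder s hs).continuousAt.continuousWithinAt)
    (fun s hs => (hder s ⟨hs.1, hs.2.le⟩).hasDerivWithinAt) 1 (right_mem_Icc.2 zero_le_one)
  simp only [one_smul, add_sub_cancel, zero_smul, add_zero] at hconst
  have Tz := (bumpK_testFun z hδ (subset_univ _)).integrable volume
  have Tx := (bumpK_testFun x hδ (subset_univ _)).integrable volume
  have h1 : ∫ y in Ω, bumpK z δ y = ∫ y, bumpK z δ y := by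
    refine setIntegral_eq_integral_of_forall_compl_eq_zero fun y hy => ?_
    refine bumpK_eq_zero hδ (not_lt.1 fun hlt => hy (hδΩ ?_))
    rw [mem_ball]
    have := min_le_left (δ₀ / 2) (ρ / 4)
    linarith
  have h2 : ∫ y, bumpK z δ y = ∫ y, bumpK x δ y := by
    simp only [bumpK]
    rw [integral_comp_scale kerK z hδ, integral_comp_scale kerK x hδ]
  have h3 := integral_add_compl hΩ.measurableSet Tx
  have h4 : ∫ y in Ωᶜ, bumpK x δ y = 0 := by linarith
  rw [integral_eq_zero_iff_of_nonneg (fun y => bumpK_nonneg _ _ _) Tx.integrableOn] at h4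
  refine (hx.2 δ hδ).2 ?_
  rw [EventuallyEq, ae_restrict_iff' hΩ.measurableSet.compl] at h4
  refine measure_mono_null (fun y hy => ?_) h4
  simp only [mem_compl_iff, mem_ofPred_eq, Classical.not_imp]
  exact ⟨hy.2, (bumpK_pos hy.1).ne'⟩

lemma null_or_full_of_isPreconnected (hS : IsPreconnected S)
    (hne : ∀ x ∈ S, ∃ r > 0, volume (ball x r ∩ Ω) = 0 ∨ volume (ball x r \ Ω) = 0) :
    volume (S ∩ Ω) = 0 ∨ volume (S \ Ω) = 0 := by
  have op : ∀ W : Set (Euc d), IsOpen {x | ∃ r > 0, volume (ball x r ∩ W) = 0} := fun W => by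
    rw [Metric.isOpen_iff]
    rintro x ⟨r, hr, h0⟩
    refine ⟨r / 2, by positivity, fun y hy => ⟨r / 2, by positivity, measure_mono_null ?_ h0⟩⟩
    refine inter_subset_inter_left _ (ball_subset_ball' ?_)
    rw [mem_ball] at hy; linarith
  have loc : ∀ W : Set (Euc d), S ⊆ {x | ∃ r > 0, volume (ball x r ∩ W) = 0} →
      volume (S ∩ W) = 0 := fun W hW => by
    refine measure_null_of_locally_null _ fun x hx => ?_
    obtain ⟨r, hr, h0⟩ := hW hx.1
    exact ⟨ball x r ∩ W, inter_mem (mem_nhdsWithin_of_mem_nhds (ball_mem_nhds x hr))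
      (mem_of_superset self_mem_nhdsWithin inter_subset_right), h0⟩
  by_contra! hcon
  obtain ⟨x, hx, hxA⟩ := not_subset.1 fun hs => hcon.1 (loc Ω hs)
  obtain ⟨y, hy, hyB⟩ := not_subset.1 fun hs => hcon.2 (by rw [sdiff_eq]; exact loc Ωᶜ hs)
  have cover : S ⊆ {x | ∃ r > 0, volume (ball x r ∩ Ω) = 0} ∪
      {x | ∃ r > 0, volume (ball x r ∩ Ωᶜ) = 0} := fun z hz => by
    obtain ⟨r, hr, h | h⟩ := hne z hz
    · exact Or.inl ⟨r, hr, h⟩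
    · exact Or.inr ⟨r, hr, h⟩
  obtain ⟨z, -, ⟨r, hr, h1⟩, ⟨r', hr', h2⟩⟩ := hS _ _ (op Ω) (op Ωᶜ) cover
    ⟨y, hy, (cover hy).resolve_right hyB⟩ ⟨x, hx, (cover hx).resolve_left hxA⟩
  have : volume (ball z (min r r')) = 0 := by
    refine measure_mono_null (t := ball z r ∩ Ω ∪ ball z r' ∩ Ωᶜ) (fun w hw => ?_)
      (measure_union_null h1 h2)
    by_cases hwΩ : w ∈ Ω
    · exact Or.inl ⟨ball_subset_ball (min_le_left _ _) hw, hwΩ⟩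
    · exact Or.inr ⟨ball_subset_ball (min_le_right _ _) hw, hwΩ⟩
  exact (measure_ball_pos volume z (by positivity)).ne' this

lemma isPreconnected_punctured_ball (hd : 1 < d) (x : Euc d) (r : ℝ) :
    IsPreconnected (ball x r \ {x}) := by
  have h1 : IsPreconnected (sphere (0 : Euc d) 1) := isPreconnected_sphere
    (Module.one_lt_rank_of_one_lt_finrank (by simpa using hd)) 0 1
  have h2 : ball x r \ {x} = (fun p : Euc d × ℝ => x + p.2 • p.1) '' (sphere 0 1 ×ˢ Ioo 0 r) := by
    ext y
    constructor
    · rintro ⟨hy, hne⟩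
      have hn : 0 < ‖y - x‖ := norm_pos_iff.2 (sub_ne_zero.2 hne)
      refine ⟨(‖y - x‖⁻¹ • (y - x), ‖y - x‖), ⟨?_, hn, by rwa [← dist_eq_norm]⟩, ?_⟩
      · simp [norm_smul, hn.ne']
      · simp [smul_smul, hn.ne']
    · rintro ⟨⟨p, t⟩, ⟨hp, ht⟩, rfl⟩
      simp only [mem_sphere_iff_norm, sub_zero] at hp
      refine ⟨?_, ?_⟩
      · simp [mem_ball, dist_eq_norm, norm_smul, hp, abs_of_pos ht.1, ht.2]
      · simp only [mem_singleton_iff, add_eq_left, smul_eq_zero, not_or]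
        exact ⟨ht.1.ne', fun h0 => by simp [h0] at hp⟩
  rw [h2]
  exact (h1.prod isPreconnected_Ioo).image _ (by fun_prop)

namespace OptState

lemma volume_pos (h : 𝓞) : volume Ω ≠ 0 := fun h0 => by
  have h1 : ∀ᵐ x, x ∉ Ω := measure_eq_zero_iff_ae_notMem.1 h0
  have h2 : ∫ x, (u x) ^ 2 = 0 := by
    rw [← integral_zero (Euc d) ℝ (μ := volume)]
    refine integral_congr_ae ?_
    filter_upwards [h1, h.inH.ae_eq_zero] with x hx hx'
    simp [hx' hx]
  rw [h.norm_one] at h2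
  exact one_ne_zero h2

lemma diff_ne_zero (h : 𝓞) : volume (D \ Ω) ≠ 0 := fun h0 => by
  have h1 : volume D = volume Ω := by
    rw [← measure_sdiff_add_inter D h.openΩ.measurableSet, h0, zero_add, inter_eq_right.2 h.subset]
  have := h.lt_meas
  rw [← h.meas, mvol, mvol, h1] at this
  exact lt_irrefl _ this

lemma not_essBdry (hx : x ∈ D) (hn : ¬ EssBdry D Ω x) :
    ∃ r > 0, volume (ball x r ∩ Ω) = 0 ∨ volume (ball x r \ Ω) = 0 := by
  by_contra! hc
  exact hn ⟨hx, hc⟩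

lemma exists_essBdry (h : 𝓞) : ∃ x, EssBdry D Ω x := by
  by_contra! hcon
  rcases null_or_full_of_isPreconnected h.connD.isPreconnected
    (fun x hx => not_essBdry hx (hcon x)) with h0 | h0
  · rw [inter_eq_right.2 h.subset] at h0
    exact h.volume_pos h0
  · exact h.diff_ne_zero h0

lemma exists_two_essBdry (h : 𝓞) (hd : 1 < d) : ∃ x y, x ≠ y ∧ EssBdry D Ω x ∧ EssBdry D Ω y := by
  obtain ⟨x, hx⟩ := h.exists_essBdry
  by_contra! hcon
  obtain ⟨r, hr, hrD⟩ := isOpen_iff.1 h.openD x hx.1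
  have hnt : Nontrivial (Euc d) := Module.nontrivial_of_finrank_pos (R := ℝ) (by simp; omega)
  have key := null_or_full_of_isPreconnected (Ω := Ω) (isPreconnected_punctured_ball hd x r)
    (fun y hy => not_essBdry (hrD hy.1) (hcon x y (Ne.symm hy.2) hx))
  have null : ∀ W : Set (Euc d), volume ((ball x r \ {x}) ∩ W) = 0 → volume (ball x r ∩ W) = 0 :=
      fun W hW => by
    refine measure_mono_null (t := ((ball x r \ {x}) ∩ W) ∪ {x}) (fun y hy => ?_)
      (measure_union_null hW (measure_singleton x))
    by_cases hyx : y = x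
    · exact Or.inr hyx
    · exact Or.inl ⟨⟨hy.1, hyx⟩, hy.2⟩
  rcases key with h0 | h0
  · exact (hx.2 r hr).1 (null Ω h0)
  · exact (hx.2 r hr).2 (null Ωᶜ h0)

lemma dim_pos (h : 𝓞) : 0 < d := by
  obtain ⟨x, hx⟩ := h.exists_essBdry
  by_contra hd
  have hs : Subsingleton (Euc d) := by
    obtain rfl : d = 0 := by omega
    infer_instance
  obtain ⟨y, hy⟩ := nonempty_of_measure_ne_zero (hx.2 1 one_pos).1
  obtain ⟨z, hz⟩ := nonempty_of_measure_ne_zero (hx.2 1 one_pos).2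
  exact hz.2 (Subsingleton.elim y z ▸ hy.2)

/-- Either there is a Lagrange multiplier, or the dimension is one and there is exactly one
essential boundary point. -/
theorem exists_multiplier (h : 𝓞) :
    (∃ Λ ρ C, Multiplier D a Ω lam u G Λ ρ C) ∨
      d = 1 ∧ ∃ x, EssBdry D Ω x ∧ ∀ y, EssBdry D Ω y → y = x := by
  by_cases hp : ∃ x y, x ≠ y ∧ EssBdry D Ω x ∧ EssBdry D Ω y
  · left
    obtain ⟨x, y, hne, hx, hy⟩ := hp
    have h0 : 0 < dist x y / 4 := by have := dist_pos.2 hne; positivity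
    obtain ⟨η₁, e₁, t₁, n₁, v₁⟩ := hx.exists_field h.openD h.openΩ h0
    obtain ⟨η₂, e₂, t₂, n₂, v₂⟩ := hy.exists_field h.openD h.openΩ h0
    exact h.exists_multiplier_of_fields hne t₁ t₂ n₁ n₂ v₁ v₂
  · right
    refine ⟨?_, ?_⟩
    · by_contra hd
      exact hp (h.exists_two_essBdry (by have := h.dim_pos; omega))
    · obtain ⟨x, hx⟩ := h.exists_essBdry
      refine ⟨x, hx, fun y hy => ?_⟩
      by_contra hne
      exact hp ⟨y, x, hne, hy, hx⟩

end OptState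

/-! ### Outer perturbations, continuity and the positivity set -/

lemma nonpos_of_quadratic {p E : ℝ} (h : ∀ t : ℝ, 0 < t → 0 ≤ -2 * t * p + t ^ 2 * E) : p ≤ 0 := by
  by_contra! hp
  set t := p / (|E| + 1)
  have ht : 0 < t := by positivity
  have h1 := h t ht
  have h2 : t * E ≤ p := by calc t * E ≤ t * (|E| + 1) := by gcongr; linarith [le_abs_self E]
      _ = p := by simp only [t]; field_simp
  nlinarith

lemma gradient_one_sub (y : Euc d) :
    gradient (fun y => 1 - χ y) y = -gradient χ y := by
  refine ext_inner_right ℝ fun v => ?_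
  rw [inner_gradient_left, inner_neg_left, inner_gradient_left, fderiv_const_sub]; simp

/-- Cutting off near a ball. -/
lemma InH.mul_one_sub (h : InH U v G)
    (hχ : TestFun V χ) {w : Euc d} (hsr : s < r) (hχ1 : ∀ y ∈ ball w r, χ y = 1) :
    InH (U \ closedBall w s) (fun y => (1 - χ y) * v y)
      (fun y => (1 - χ y) • G y - v y • gradient χ y) := by
  obtain ⟨C, hC0, hC⟩ := hχ.bounded
  obtain ⟨C', hC'0, hC'⟩ := hχ.bounded_gradient
  have h1 := h.mul_smooth (V := U \ closedBall w s) (χ := fun y => 1 - χ y)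
    (contDiff_const.sub hχ.1) (C := 1 + C + C') (fun y => by
      refine (abs_sub _ _).trans ?_
      simp only [abs_one]; linarith [hC y]) (fun y => by
      rw [gradient_one_sub, norm_neg]; linarith [hC' y]) (fun φ hφ => by
      refine ⟨(contDiff_const.sub hχ.1).mul hφ.1, hφ.2.1.mul_left, fun y hy => ?_⟩
      refine ⟨hφ.2.2 (tsupport_mul_subset_right hy), fun hyb => ?_⟩
      have : y ∉ tsupport fun x => (1 - χ x) * φ x := by
        rw [notMem_tsupport_iff_eventuallyEq]
        filter_upwards [isOpen_ball.mem_nhds (closedBall_subset_ball hsr hyb)] with x hx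
        simp [hχ1 x hx]
      exact this hy)
  refine h1.congr (ae_eq_refl _) (.of_forall fun y => ?_)
  simp only
  rw [gradient_one_sub, smul_neg, ← sub_eq_add_neg]

namespace LapState

lemma energy_add (h : 𝓛) (hφ : TestFun univ φ) (t : ℝ) :
    energyJ lam (fun y => u y + t * φ y) (fun y => G y + t • gradient φ y) =
      energyJ lam u G - 2 * t * (∫ y, φ y ∂μ) + t ^ 2 * energyJ lam φ (fun y => gradient φ y) := by
  have iG := integrable_sq_of_memLp h.inH.memG
  have iu : Integrable fun y => (u y) ^ 2 := by simpa using integrable_sq_of_memLp h.inH.memV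
  have iφ : Integrable fun y => (φ y) ^ 2 := by
    simpa using integrable_sq_of_memLp (hφ.memLp 2 volume)
  have iF := integrable_sq_of_memLp (hφ.gradient_memLp 2)
  have i1 := h.integrable_mul (hφ.memLp 2 volume)
  have i2 := h.integrable_inner (hφ.gradient_memLp 2)
  have e1 : ∫ y, ‖G y + t • gradient φ y‖ ^ 2 = (∫ y, ‖G y‖ ^ 2) +
      (2 * t) * (∫ y, ⟪G y, gradient φ y⟫) + t ^ 2 * ∫ y, ‖gradient φ y‖ ^ 2 := by
    rw [← integral_const_mul, ← integral_const_mul, ← integral_add' iG (i2.const_mul _),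
      ← integral_add' (iG.add (i2.const_mul _)) (iF.const_mul _)]
    congr 1; ext y
    simp only [Pi.add_apply]
    rw [norm_add_sq_real, inner_smul_right, norm_smul, mul_pow, Real.norm_eq_abs, sq_abs]
    ring
  have e2 : ∫ y, (u y + t * φ y) ^ 2 = (∫ y, (u y) ^ 2) +
      (2 * t) * (∫ y, u y * φ y) + t ^ 2 * ∫ y, (φ y) ^ 2 := by
    rw [← integral_const_mul, ← integral_const_mul, ← integral_add' iu (i1.const_mul _),
      ← integral_add' (iu.add (i1.const_mul _)) (iφ.const_mul _)]
    congr 1; ext y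
    simp only [Pi.add_apply]
    ring
  rw [h.repr φ hφ, dist_lap, energyJ, energyJ, energyJ, e1, e2]
  ring

lemma inH_add (h : 𝓛) (hφ : TestFun V φ) (t : ℝ) :
    InH (Ω ∪ V) (fun y => u y + t * φ y) (fun y => G y + t • gradient φ y) :=
  (h.inH.mono subset_union_left).add ((hφ.inH.const_mul t).mono subset_union_right)

lemma null_of_integral_nonpos (h : 𝓛) (hr : 0 < r)
    (h0 : ∀ φ, TestFun (ball z r) φ → (∀ y, 0 ≤ φ y) → ∫ y, φ y ∂μ ≤ 0) :
    μ (ball z (r / 4)) = 0 := by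
  obtain ⟨c, hc0, -, hc⟩ := exists_kerK_lower (d := d)
  have := h.fin
  have h1 := h.le_integral_bumpK hc z (r := r / 2) (by positivity)
  have h2 := h0 (bumpK z (r / 2)) (bumpK_testFun z (by positivity)
    (closedBall_subset_ball (by linarith))) (bumpK_nonneg _ _)
  have h3 : μ.real (closedBall z (r / 2 / 2)) ≤ 0 := by nlinarith
  have h4 : μ.real (closedBall z (r / 2 / 2)) = 0 := le_antisymm h3 measureReal_nonneg
  rw [measureReal_eq_zero_iff (isCompact_closedBall _ _).measure_lt_top.ne] at h4
  refine measure_mono_null (ball_subset_closedBall.trans (closedBall_subset_closedBall ?_)) h4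
  linarith

lemma null_of_ae_zero (h : 𝓛) (hr : 0 < r)
    (h0 : ∀ᵐ y, y ∈ ball z r → u y = 0) : μ (ball z (r / 4)) = 0 := by
  refine h.null_of_integral_nonpos hr fun φ hφ _ => le_of_eq ?_
  rw [h.repr φ (hφ.mono (subset_univ _)), dist_lap]
  have e1 : ∫ x, u x * φ x = 0 := by
    refine integral_eq_zero_of_ae (h0.mono fun y hy => ?_)
    by_cases hb : y ∈ ball z r
    · simp [hy hb]
    · simp [image_eq_zero_of_notMem_tsupport fun h' => hb (hφ.2.2 h')]
  have e2 : ∫ x, ⟪G x, gradient φ x⟫ = 0 := by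
    refine integral_eq_zero_of_ae ?_
    filter_upwards [h0, h.grad_zero] with y hy hg
    by_cases hb : y ∈ ball z r
    · simp [hg (hy hb)]
    · simp [gradient_eq_zero_of_notMem_tsupport fun h' => hb (hφ.2.2 h')]
  rw [e1, e2]; simp

lemma null_of_pos (h : 𝓛) (hr : 0 < r) (hε : 0 < ε)
    (h0 : ∀ y ∈ ball z r, ε ≤ u y) : μ (ball z (r / 4)) = 0 := by
  refine h.null_of_integral_nonpos hr fun φ hφ _ => le_of_eq ?_
  rw [h.repr φ (hφ.mono (subset_univ _))]
  refine tendsto_nhds_unique (h.tendsto_trunc_integral (hφ.mono (subset_univ _))) ?_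
  refine tendsto_const_nhds.congr' ?_
  filter_upwards [Ioo_mem_nhdsGT hε] with ε' hε'
  refine (integral_eq_zero_of_ae (.of_forall fun y => ?_)).symm
  by_cases hb : y ∈ ball z r
  · simp [deriv_trunc_eq_zero hε'.1 (hε'.2.le.trans (h0 y hb))]
  · simp [image_eq_zero_of_notMem_tsupport fun h' => hb (hφ.2.2 h')]

lemma null_of_mem (h : 𝓛) (hΩ : IsOpen Ω) (hz : z ∈ Ω) :
    ∃ r > 0, μ (ball z r) = 0 := by
  obtain ⟨r, hr, hsub⟩ := Metric.isOpen_iff.1 hΩ z hz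
  refine ⟨r / 4, by positivity, h.null_of_integral_nonpos hr fun φ hφ _ => le_of_eq ?_⟩
  rw [h.repr φ (hφ.mono (subset_univ _)), dist_lap, h.weak φ (hφ.mono hsub), sub_self]

lemma eq_zero_of_ae (hp : Precise u)
    (h0 : ∀ᵐ y, y ∈ ball z r → u y = 0) (hy : y ∈ ball z r) : u y = 0 := by
  have hm := massk_pos (d := d)
  have h1 : Tendsto (avg u y) (𝓝[>] 0) (𝓝 0) := by
    refine tendsto_const_nhds.congr' ?_
    have hpos : (0 : ℝ) < r - dist y z := by rw [mem_ball] at hy; linarith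
    filter_upwards [Ioo_mem_nhdsGT hpos] with s hs
    refine (integral_eq_zero_of_ae (h0.mono fun w hw => ?_)).symm
    by_cases hb : w ∈ ball z r
    · simp [hw hb]
    · rw [kerk_eq_zero (one_le_norm_scale hs.1 ?_)]
      · simp
      · rw [mem_ball, not_lt] at hb
        have := dist_triangle w y z
        linarith [hs.2]
  have := tendsto_nhds_unique (hp y) h1
  exact (mul_eq_zero.1 this).resolve_left hm.ne'

/-- The strong minimum principle where the measure vanishes. -/
lemma eq_zero_near (h : 𝓛) (hp : Precise u) (hR : 0 < R)
    (hμ : μ (ball x R) = 0) (hx : u x = 0) : ∀ y ∈ ball x (R / 2), u y = 0 := by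
  obtain ⟨c, hc0, -, hc⟩ := exists_kerK_lower (d := d)
  have h1 := h.avg_le_of_null hp hμ (right_mem_Ioc.2 hR)
  rw [hx, mul_zero] at h1
  have h2 := (h.le_avg hc x hR).trans h1
  have h3 : ∫ y in closedBall x (R / 2), u y = 0 := by
    refine le_antisymm ?_ (integral_nonneg fun y => h.nonneg y)
    by_contra! hc
    have : 0 < c * R⁻¹ ^ d * ∫ y in closedBall x (R / 2), u y := by positivity
    linarith
  rw [integral_eq_zero_iff_of_nonneg (fun y => h.nonneg y) (h.integrableOn x _),
    EventuallyEq, ae_restrict_iff' measurableSet_closedBall] at h3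
  exact fun y hy => eq_zero_of_ae hp (h3.mono fun w hw hwb => hw (ball_subset_closedBall hwb)) hy

end LapState

/-- The positivity set. -/
def posSet (D : Set (Euc d)) (u : Euc d → ℝ) : Set (Euc d) := {x | x ∈ D ∧ 0 < u x}

local notation "𝓐" => posSet D u

/-- The free boundary. -/
def freeBdry (D : Set (Euc d)) (u : Euc d → ℝ) : Set (Euc d) :=
  {x | x ∈ D ∧ u x = 0 ∧ x ∈ closure (posSet D u)}

local notation "𝓕" => freeBdry D u

/-- An optimal state with a precise representative and linear growth of the measure. -/
structure RegState (D : Set (Euc d)) (a : ℝ) (Ω : Set (Euc d)) (lam : ℝ) (u : Euc d → ℝ)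
    (G : Euc d → Euc d) (μ : Measure (Euc d)) : Prop extends OptState D a Ω lam u G μ where
  precise : Precise u
  growth : ∀ x₀ ∈ D, ∃ R C : ℝ, 0 < R ∧ ∀ x ∈ ball x₀ R, ∀ r ∈ Ioc 0 R,
    r * r⁻¹ ^ d * μ.real (ball x r) ≤ C

local notation "𝓡" => RegState D a Ω lam u G μ

namespace OptState

lemma mvol_union (h : 𝓞) {B : Set (Euc d)} (hB : MeasurableSet B)
    (hBD : B ⊆ D) : mvol (Ω ∪ B) - a = mvol (B \ Ω) := by
  rw [← h.meas, ← union_sdiff_self, mvol, mvol, mvol,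
    measure_union disjoint_sdiff_right (hB.diff h.openΩ.measurableSet),
    ENNReal.toReal_add (h.volume_ne_top h.subset) (h.volume_ne_top (sdiff_subset.trans hBD))]
  ring

lemma out_ineq (h : 𝓞) (hM : Multiplier D a Ω lam u G Λ ρ C)
    (hD : ball z r ⊆ D) (hr : r ≤ ρ) (hV : mvol (ball z r \ Ω) ≤ ρ)
    (hφ : TestFun (ball z r) φ) (t : ℝ) :
    2 * t * ∫ y, φ y ∂μ ≤ t ^ 2 * energyJ lam φ (fun y => gradient φ y) +
      Λ * mvol (ball z r \ Ω) + C * mvol (ball z r \ Ω) ^ 2 := by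
  have hv := h.mvol_union measurableSet_ball hD
  have hb : ball z r ⊆ ball z ρ := ball_subset_ball hr
  have key := hM.cost z (Ω ∪ ball z r) _ _ (h.openΩ.union isOpen_ball)
    (union_subset h.subset hD) (by
      rw [union_sdiff_distrib, sdiff_eq_empty.2 hb, union_empty]) (by
      rw [hv, abs_of_nonneg (mvol_nonneg _)]; exact hV) (h.inH_add hφ t) (.of_forall
      fun y hy => by
        have : y ∉ tsupport φ := fun h' => hy (hb (hφ.2.2 h'))
        simp [image_eq_zero_of_notMem_tsupport this, gradient_eq_zero_of_notMem_tsupport this])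
  rw [h.energy_add (hφ.mono (subset_univ _)), h.energy_zero, hv] at key
  linarith

lemma energyJ_bump_le (h : 𝓞) : ∃ C, 0 < C ∧ ∀ (x : Euc d) (r : ℝ), 0 < r →
    r ^ 2 * energyJ lam (bumpK x r) (fun y => gradient (bumpK x r) y) ≤ C * r ^ d := by
  obtain ⟨C, hC0, hC⟩ := exists_gradient_bumpK_bound (d := d)
  have ho := omd_pos (d := d)
  refine ⟨C ^ 2 * omd d, by positivity, fun x r hr => ?_⟩
  have T := bumpK_testFun x hr (subset_univ _)
  have h1 : energyJ lam (bumpK x r) (fun y => gradient (bumpK x r) y) ≤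
      ∫ y, ‖gradient (bumpK x r) y‖ ^ 2 := by
    rw [energyJ]
    have : 0 ≤ lam * ∫ y, (bumpK x r y) ^ 2 := mul_nonneg h.lam_nonneg (by positivity)
    linarith
  have h2 : ∫ y, ‖gradient (bumpK x r) y‖ ^ 2 ≤ (C * r⁻¹) ^ 2 * (r ^ d * omd d) := by
    rw [← setIntegral_eq_integral_of_forall_compl_eq_zero (s := closedBall x r)]
    · refine (setIntegral_mono_on (integrable_sq_of_memLp (T.gradient_memLp 2)).integrableOn
        (integrableOn_const (C := (C * r⁻¹) ^ 2) measure_closedBall_lt_top.ne)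
        measurableSet_closedBall fun y _ => ?_).trans (le_of_eq ?_)
      · have := hC x r hr y
        gcongr
      · rw [setIntegral_const, smul_eq_mul, measureReal_def, ← mvol_closedBall x hr.le, mvol]
        ring
    · intro y hy
      rw [gradient_bumpK_eq_zero hr (not_le.1 (by simpa using hy)).le]; simp
  calc r ^ 2 * energyJ lam (bumpK x r) (fun y => gradient (bumpK x r) y)
      ≤ r ^ 2 * ((C * r⁻¹) ^ 2 * (r ^ d * omd d)) := by gcongr; exact h1.trans h2
    _ = C ^ 2 * omd d * r ^ d := by field_simp

/-- Linear growth of the measure. -/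
lemma exists_growth (h : 𝓞) (hM : Multiplier D a Ω lam u G Λ ρ C) :
    ∃ C₀ R₀, 0 < C₀ ∧ 0 < R₀ ∧ ∀ x r, 0 < r → r ≤ R₀ → ball x (4 * r) ⊆ D →
      r * r⁻¹ ^ d * μ.real (closedBall x r) ≤ C₀ := by
  obtain ⟨c, hc0, -, hc⟩ := exists_kerK_lower (d := d)
  obtain ⟨A, hA0, hA⟩ := h.energyJ_bump_le
  have ho := omd_pos (d := d)
  have hC0 := hM.C_pos
  have hρ := hM.ρ_pos
  set B := 4 ^ d * omd d with hB
  have hB0 : 0 < B := by positivity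
  refine ⟨(A * 2 ^ d + |Λ| * B + C * B ^ 2) / c, min (min (ρ / 4) 1) (ρ / B), by positivity,
    by positivity, fun x r hr hrR hD => ?_⟩
  simp only [le_min_iff, le_div_iff₀' hB0, le_div_iff₀' (zero_lt_four' ℝ)] at hrR
  obtain ⟨⟨hrρ, hr1⟩, hrB⟩ := hrR
  have hd := h.dim_pos
  have hrd : r ^ d ≤ r := pow_le_of_le_one hr.le hr1 hd.ne'
  set V := mvol (ball x (4 * r) \ Ω)
  have hV0 : 0 ≤ V := mvol_nonneg _
  have hV : V ≤ B * r ^ d := by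
    refine (mvol_mono sdiff_subset measure_ball_lt_top.ne).trans (le_of_eq ?_)
    rw [mvol_ball x (by positivity), mul_pow, hB]; ring
  have hVρ : V ≤ ρ := hV.trans ((mul_le_mul_of_nonneg_left hrd hB0.le).trans hrB)
  have hVB : V ≤ B := hV.trans (mul_le_of_le_one_right hB0.le (hrd.trans hr1))
  have key := h.out_ineq hM hD hrρ hVρ (bumpK_testFun x (r := 2 * r) (by positivity)
    (closedBall_subset_ball (by linarith))) (2 * r)
  have h1 := hA x (2 * r) (by positivity)
  have h2 := h.le_integral_bumpK hc x (r := 2 * r) (by positivity)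
  rw [mul_div_cancel_left₀ r two_ne_zero] at h2
  have h3 : Λ * V ≤ |Λ| * (B * r ^ d) := mul_le_mul (le_abs_self Λ) hV hV0 (abs_nonneg _)
  have h4 : C * V ^ 2 ≤ C * (B * (B * r ^ d)) := by rw [sq]; gcongr
  have hX := measureReal_nonneg (μ := μ) (s := closedBall x r)
  rw [mul_pow 2 r d] at h1
  have h5 : r * (c * μ.real (closedBall x r)) ≤ (A * 2 ^ d + |Λ| * B + C * B ^ 2) * r ^ d := by
    have : r * (c * μ.real (closedBall x r)) ≤ r * ∫ y, bumpK x (2 * r) y ∂μ := by gcongr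
    have h6 : 0 ≤ r * (c * μ.real (closedBall x r)) := by positivity
    linarith
  rw [le_div_iff₀ hc0]
  calc r * r⁻¹ ^ d * μ.real (closedBall x r) * c
      = r⁻¹ ^ d * (r * (c * μ.real (closedBall x r))) := by ring
    _ ≤ r⁻¹ ^ d * ((A * 2 ^ d + |Λ| * B + C * B ^ 2) * r ^ d) := by gcongr
    _ = _ := by rw [mul_comm, mul_assoc, ← mul_pow, mul_inv_cancel₀ hr.ne', one_pow, mul_one]

lemma regState_of_multiplier (h : 𝓞) (hp : Precise u)
    (hM : Multiplier D a Ω lam u G Λ ρ C) : 𝓡 := by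
  refine { h with precise := hp, growth := fun x₀ hx₀ => ?_ }
  obtain ⟨C₀, R₀, hC₀, hR₀, hg⟩ := h.exists_growth hM
  obtain ⟨s, hs, hsD⟩ := isOpen_iff.1 h.openD x₀ hx₀
  have := h.fin
  refine ⟨min R₀ (s / 5), C₀, by positivity, fun x hx r hr => ?_⟩
  have hr0 : 0 < r := hr.1
  have hrR := hr.2
  refine le_trans ?_ (hg x r hr.1 (hrR.trans (min_le_left _ _)) (Subset.trans
    (ball_subset_ball' ?_) hsD))
  · gcongr
    · exact (isCompact_closedBall x r).measure_lt_top.ne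
    · exact ball_subset_closedBall
  · rw [mem_ball] at hx
    have := min_le_right R₀ (s / 5)
    linarith

lemma regState_of_dim_one (h : 𝓞) (hp : Precise u) (hd : d = 1) : 𝓡 := by
  have := h.fin
  refine { h with precise := hp, growth := fun x₀ hx₀ => ?_ }
  refine ⟨1, μ.real (closedBall x₀ 2), one_pos, fun x hx r hr => ?_⟩
  have hr0 : 0 < r := hr.1
  have e1 : r⁻¹ ^ d = r⁻¹ := by simp [hd]
  rw [e1, mul_inv_cancel₀ hr.1.ne', one_mul]
  refine measureReal_mono (ball_subset_closedBall.trans (closedBall_subset_closedBall' ?_))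
    (isCompact_closedBall x₀ 2).measure_lt_top.ne
  rw [mem_ball] at hx
  linarith [hr.2]

/-- Optimality against open sets of smaller volume. -/
lemma energy_nonneg_of_le (h : 𝓞) (hUo : IsOpen U) (hUD : U ⊆ D)
    (hv : mvol U ≤ a) (hH : InH U v F) : 0 ≤ energyJ lam v F := by
  obtain ⟨R, hR⟩ := h.bddD.subset_ball (0 : Euc d)
  have ho := omd_pos (d := d)
  have hd := h.dim_pos
  set f : ℝ → ℝ := fun t => mvol (U ∪ (D ∩ ball 0 t)) with hf
  have hball : ∀ t, 0 ≤ t → mvol (ball (0 : Euc d) t) = t ^ d * omd d := fun t ht => by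
    rcases ht.eq_or_lt with rfl | ht
    · simp [mvol, hd.ne']
    · exact mvol_ball _ ht
  have sub : ∀ t, U ∪ (D ∩ ball 0 t) ⊆ D := fun t => union_subset hUD inter_subset_left
  have hmono : ∀ s t, 0 ≤ s → s ≤ t → 0 ≤ f t - f s ∧ f t - f s ≤ (t ^ d - s ^ d) * omd d :=
      fun s t hs hst => by
    constructor
    · exact sub_nonneg.2 (mvol_mono (union_subset_union_right _ (inter_subset_inter_right _
        (ball_subset_ball hst))) (h.volume_ne_top (sub t)))
    · have h1 : f t ≤ f s + mvol (ball (0 : Euc d) t \ ball 0 s) := by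
        have h2 : U ∪ (D ∩ ball 0 t) ⊆ (U ∪ (D ∩ ball 0 s)) ∪ (ball 0 t \ ball 0 s) := by
          rintro y (hy | hy)
          · exact Or.inl (Or.inl hy)
          · by_cases hys : y ∈ ball 0 s
            · exact Or.inl (Or.inr ⟨hy.1, hys⟩)
            · exact Or.inr ⟨hy.2, hys⟩
        have hn : volume (ball (0 : Euc d) t \ ball 0 s) ≠ ∞ :=
          ((measure_mono sdiff_subset).trans_lt measure_ball_lt_top).ne
        have h3 := measure_mono (μ := volume) h2 |>.trans (measure_union_le _ _)
        have h4 := ENNReal.toReal_mono (ENNReal.add_ne_top.2 ⟨h.volume_ne_top (sub s), hn⟩) h3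
        rwa [ENNReal.toReal_add (h.volume_ne_top (sub s)) hn] at h4
      have h5 : mvol (ball (0 : Euc d) t \ ball 0 s) = (t ^ d - s ^ d) * omd d := by
        rw [sub_mul, ← hball t (hs.trans hst), ← hball s hs, mvol, measure_sdiff
          (ball_subset_ball hst) measurableSet_ball.nullMeasurableSet measure_ball_lt_top.ne,
          ENNReal.toReal_sub_of_le (measure_mono (ball_subset_ball hst)) measure_ball_lt_top.ne]
        rfl
      linarith
  have hcont : ContinuousOn f (Icc 0 (max R 0)) := fun t ht => by
    have hg : ContinuousAt (fun s : ℝ => s ^ d * omd d) t := by fun_prop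
    refine Metric.continuousWithinAt_iff.2 fun ε hε => ?_
    obtain ⟨δ, hδ, hδ'⟩ := Metric.continuousAt_iff.1 hg ε hε
    refine ⟨δ, hδ, fun {s} hs hst => lt_of_le_of_lt ?_ (hδ' hst)⟩
    rw [Real.dist_eq, Real.dist_eq]
    rcases le_total s t with hle | hle
    · obtain ⟨h1, h2⟩ := hmono s t hs.1 hle
      rw [abs_sub_comm, abs_of_nonneg h1, abs_sub_comm]
      exact h2.trans ((le_of_eq (by ring)).trans (le_abs_self _))
    · obtain ⟨h1, h2⟩ := hmono t s ht.1 hle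
      rw [abs_of_nonneg h1]
      exact h2.trans ((le_of_eq (by ring)).trans (le_abs_self _))
  have h0 : f 0 ≤ a := by simpa [hf] using hv
  have h1 : a ≤ f (max R 0) := by
    refine h.lt_meas.le.trans (mvol_mono (fun y hy => Or.inr ⟨hy, ?_⟩) (h.volume_ne_top (sub _)))
    exact ball_subset_ball (le_max_left _ _) (hR hy)
  obtain ⟨t, ht, hta⟩ := intermediate_value_Icc (le_max_right R 0) hcont ⟨h0, h1⟩
  exact h.energy_nonneg (hUo.union (h.openD.inter isOpen_ball)) (sub t) hta
    (hH.mono subset_union_left)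

lemma null_of_full (h : 𝓞) (hr : 0 < r)
    (hD : ball z r ⊆ D) (h0 : volume (ball z r \ Ω) = 0) : μ (ball z (r / 4)) = 0 := by
  refine h.null_of_integral_nonpos hr fun φ hφ _ => nonpos_of_quadratic
    (E := energyJ lam φ (fun y => gradient φ y)) fun t _ => ?_
  have hv := h.mvol_union measurableSet_ball hD
  rw [show mvol (ball z r \ Ω) = 0 by simp [mvol, h0]] at hv
  have := h.energy_nonneg (h.openΩ.union isOpen_ball) (union_subset h.subset hD)
    (by linarith) (h.inH_add hφ t)
  rw [h.energy_add (hφ.mono (subset_univ _)), h.energy_zero] at this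
  exact this.trans_eq (by ring)

lemma null_of_not_essBdry (h : 𝓞) (hz : z ∈ D)
    (hn : ¬ EssBdry D Ω z) : ∃ r > 0, μ (ball z r) = 0 := by
  obtain ⟨r, hr, h0 | h0⟩ := not_essBdry hz hn
  · refine ⟨r / 4, by positivity, h.null_of_ae_zero hr ?_⟩
    filter_upwards [h.inH.ae_eq_zero, measure_eq_zero_iff_ae_notMem.1 h0] with y h1 h2 h3
    exact h1 fun h4 => h2 ⟨h3, h4⟩
  · obtain ⟨s, hs, hsD⟩ := isOpen_iff.1 h.openD z hz
    refine ⟨min r s / 4, by positivity, h.null_of_full (by positivity)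
      ((ball_subset_ball (min_le_right _ _)).trans hsD) (measure_mono_null ?_ h0)⟩
    exact sdiff_subset_sdiff_left (ball_subset_ball (min_le_left _ _))

end OptState

namespace RegState

lemma continuousAt (h : 𝓡) (hx : x ∈ D) : ContinuousAt u x := by
  obtain ⟨R, C, hR, hg⟩ := h.growth x hx
  exact h.continuousAt_of_growth h.precise hR hg

lemma isOpen_posSet (h : 𝓡) : IsOpen 𝓐 := by
  rw [isOpen_iff_mem_nhds]
  intro x hx
  exact inter_mem (h.openD.mem_nhds hx.1) ((h.continuousAt hx.1).eventually (lt_mem_nhds hx.2))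

lemma not_forall_null (h : 𝓡) {w : Euc d} (hw : w ∈ D) (hw0 : u w = 0) :
    ¬ ∀ z ∈ D, ∃ r > 0, μ (ball z r) = 0 := fun hall => by
  have o1 : IsOpen {x | x ∈ D ∧ u x = 0} := by
    rw [Metric.isOpen_iff]
    rintro x ⟨hx, hx0⟩
    obtain ⟨r, hr, h0⟩ := hall x hx
    obtain ⟨s, hs, hsD⟩ := Metric.isOpen_iff.1 h.openD x hx
    refine ⟨min (r / 2) s, by positivity, fun y hy => ⟨hsD (ball_subset_ball (min_le_right _ _) hy),
      h.eq_zero_near h.precise hr h0 hx0 y (ball_subset_ball (min_le_left _ _) hy)⟩⟩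
  have hsub : D ⊆ {x | x ∈ D ∧ u x = 0} := by
    refine h.connD.isPreconnected.subset_left_of_subset_union o1 h.isOpen_posSet ?_ ?_ ⟨w, hw, hw, hw0⟩
    · exact disjoint_left.2 fun x hx hx' => hx'.2.ne' hx.2
    · intro x hx
      rcases (h.nonneg x).eq_or_lt with h1 | h1
      · exact Or.inl ⟨hx, h1.symm⟩
      · exact Or.inr ⟨hx, h1⟩
  have h2 : ∫ x, (u x) ^ 2 = 0 := by
    rw [← integral_zero (Euc d) ℝ (μ := volume)]
    refine integral_congr_ae ?_
    filter_upwards [h.inH.ae_eq_zero] with x hx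
    by_cases hxΩ : x ∈ Ω
    · simp [(hsub (h.subset hxΩ)).2]
    · simp [hx hxΩ]
  rw [h.norm_one] at h2
  exact one_ne_zero h2

lemma volume_posSet_diff (h : 𝓡) : volume (𝓐 \ Ω) = 0 := by
  rw [measure_eq_zero_iff_ae_notMem]
  filter_upwards [h.inH.ae_eq_zero] with x hx hx'
  exact hx'.1.2.ne' (hx hx'.2)

lemma null_of_mem_posSet (h : 𝓡) (hz : z ∈ 𝓐) : ∃ r > 0, μ (ball z r) = 0 := by
  have h1 := (h.continuousAt hz.1).eventually (lt_mem_nhds (half_lt_self hz.2))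
  obtain ⟨r, hr, hsub⟩ := eventually_nhds_iff_ball.1 h1
  exact ⟨r / 4, by positivity, h.null_of_pos hr (half_pos hz.2) fun y hy => (hsub y hy).le⟩

lemma null_of_notMem_freeBdry (h : 𝓡) (hz : z ∈ D) (hn : z ∉ 𝓕) : ∃ r > 0, μ (ball z r) = 0 := by
  rcases (h.nonneg z).eq_or_lt with h1 | h1
  · have h2 : z ∉ closure 𝓐 := fun h' => hn ⟨hz, h1.symm, h'⟩
    obtain ⟨r, hr, hsub⟩ := isOpen_iff.1 (h.openD.inter isClosed_closure.isOpen_compl) z ⟨hz, h2⟩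
    refine ⟨r / 4, by positivity, h.null_of_ae_zero hr (.of_forall fun y hy => ?_)⟩
    by_contra hne
    exact (hsub hy).2 (subset_closure ⟨(hsub hy).1, (h.nonneg y).lt_of_ne' hne⟩)
  · exact h.null_of_mem_posSet ⟨hz, h1⟩

lemma measure_diff_freeBdry (h : 𝓡) : μ (D \ 𝓕) = 0 := by
  refine measure_null_of_locally_null _ fun x hx => ?_
  obtain ⟨r, hr, h0⟩ := h.null_of_notMem_freeBdry hx.1 hx.2
  exact ⟨_, mem_nhdsWithin_of_mem_nhds (ball_mem_nhds x hr), h0⟩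

/-- The optimal set is contained in the positivity set. -/
theorem subset_posSet (h : 𝓡) : Ω ⊆ 𝓐 := fun w hw => by
  refine ⟨h.subset hw, (h.nonneg w).lt_of_ne' fun hw0 => ?_⟩
  obtain ⟨r₁, hr₁, hnull⟩ := h.null_of_mem h.openΩ hw
  obtain ⟨r₂, hr₂, hr₂Ω⟩ := isOpen_iff.1 h.openΩ w hw
  set r := min (r₁ / 2) r₂ with hr
  have hr0 : 0 < r := by positivity
  have hz : ∀ y ∈ ball w r, u y = 0 := fun y hy =>
    h.eq_zero_near h.precise hr₁ hnull hw0 y (ball_subset_ball (min_le_left _ _) hy)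
  obtain ⟨χ, hχ1, hχs⟩ : ∃ f : Euc d → ℝ, (∀ y ∈ closedBall w (r / 4), f y = 1) ∧
      TestFun (ball w r) f := by
    let f : ContDiffBump w := ⟨r / 4, r / 2, by positivity, by linarith⟩
    refine ⟨f, fun y hy => f.one_of_mem_closedBall hy, ⟨f.contDiff, f.hasCompactSupport, ?_⟩⟩
    rw [f.tsupport_eq]; exact closedBall_subset_ball (by simp only [f]; linarith)
  set Ω' := Ω \ closedBall w (r / 8) with hΩ'
  have hin : InH Ω' u G := by
    have h1 := h.inH.mul_one_sub (w := w) (s := r / 8) (r := r / 4) hχs (by linarith)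
      (fun y hy => hχ1 y (ball_subset_closedBall hy))
    refine h1.congr ?_ ?_
    · refine .of_forall fun y => ?_
      by_cases hy : y ∈ ball w r
      · simp [hz y hy]
      · simp [image_eq_zero_of_notMem_tsupport fun h' => hy (hχs.2.2 h')]
    · filter_upwards [h.grad_zero] with y hg
      by_cases hy : y ∈ ball w r
      · simp [hz y hy, hg (hz y hy)]
      · rw [image_eq_zero_of_notMem_tsupport fun h' => hy (hχs.2.2 h'),
          gradient_eq_zero_of_notMem_tsupport fun h' => hy (hχs.2.2 h')]
        simp
  set m := mvol (closedBall w (r / 8)) with hm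
  have hm0 : 0 < m := by
    have := omd_pos (d := d)
    rw [hm, mvol_closedBall _ (by positivity)]; positivity
  have hΩ'v : mvol Ω' = a - m := by
    have hsub : closedBall w (r / 8) ⊆ Ω := (closedBall_subset_ball
      (by linarith [min_le_right (r₁ / 2) r₂])).trans hr₂Ω
    rw [← h.meas, hm, hΩ', mvol, measure_sdiff hsub measurableSet_closedBall.nullMeasurableSet
      measure_closedBall_lt_top.ne, ENNReal.toReal_sub_of_le (measure_mono hsub)
      (h.volume_ne_top h.subset)]
    rfl
  have ho' : IsOpen Ω' := h.openΩ.sdiff isClosed_closedBall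
  refine h.not_forall_null (h.subset hw) hw0 fun z hzD => ?_
  obtain ⟨s₁, hs₁, hsD⟩ := Metric.isOpen_iff.1 h.openD z hzD
  have ho := omd_pos (d := d)
  set s := min (min s₁ 1) (m / omd d)
  have hs : 0 < s := by positivity
  have hsD' : ball z s ⊆ D :=
    (ball_subset_ball ((min_le_left _ _).trans (min_le_left _ _))).trans hsD
  refine ⟨s / 4, by positivity, h.null_of_integral_nonpos hs fun φ hφ _ =>
    nonpos_of_quadratic (E := energyJ lam φ (fun y => gradient φ y)) fun t _ => ?_⟩
  have hvol : mvol (Ω' ∪ ball z s) ≤ a := by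
    have h1 : mvol (Ω' ∪ ball z s) ≤ mvol Ω' + mvol (ball z s) := by
      have hf : volume Ω' ≠ ∞ := h.volume_ne_top (sdiff_subset.trans h.subset)
      have := ENNReal.toReal_mono (ENNReal.add_ne_top.2 ⟨hf, measure_ball_lt_top.ne⟩)
        (measure_union_le (μ := volume) Ω' (ball z s))
      rwa [ENNReal.toReal_add hf measure_ball_lt_top.ne] at this
    have h2 : mvol (ball z s) ≤ m := by
      rw [mvol_ball _ hs]
      calc s ^ d * omd d ≤ s * omd d := by
            gcongr
            exact pow_le_of_le_one hs.le ((min_le_left _ _).trans (min_le_right _ _)) h.dim_pos.ne'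
        _ ≤ m / omd d * omd d := by gcongr; exact min_le_right _ _
        _ = m := by field_simp
    linarith
  have := h.energy_nonneg_of_le (ho'.union isOpen_ball)
    (union_subset (sdiff_subset.trans h.subset) hsD') hvol
    ((hin.mono subset_union_left).add ((hφ.inH.const_mul t).mono subset_union_right))
  rw [h.energy_add (hφ.mono (subset_univ _)), h.energy_zero] at this
  exact this.trans_eq (by ring)

end RegState

local notation "𝓜" => OptState.Multiplier D a Ω lam u G Λ ρ C

/-! ### Positivity of the multiplier -/

/-- A Gaussian barrier, vanishing on the sphere of centre `p` and radius `s`. -/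
def barrier (α s : ℝ) (p y : Euc d) : ℝ := Real.exp (-(α * ‖y - p‖ ^ 2)) - Real.exp (-(α * s ^ 2))

lemma contDiff_barrier (α s : ℝ) (p : Euc d) : Smooth (barrier α s p) :=
  (Real.contDiff_exp.comp ((contDiff_const.mul ((contDiff_norm_sq ℝ).comp
    (contDiff_id.sub contDiff_const))).neg)).sub contDiff_const

lemma gradient_barrier (α s : ℝ) (p y : Euc d) :
    gradient (barrier α s p) y = (-(2 * α) * Real.exp (-(α * ‖y - p‖ ^ 2))) • (y - p) := by
  refine ext_inner_right ℝ fun v => ?_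
  have h1 : HasFDerivAt (fun y : Euc d => ‖y - p‖ ^ 2) (2 • (innerSL ℝ (y - p))) y := by
    have := (hasStrictFDerivAt_norm_sq (y - p)).hasFDerivAt.comp y ((hasFDerivAt_id y).sub_const p)
    refine this.congr_fderiv ?_
    ext v; simp
  have h2 := (((h1.const_mul α).neg).exp).sub_const (Real.exp (-(α * s ^ 2)))
  rw [inner_gradient_left, show fderiv ℝ (barrier α s p) y = _ from h2.fderiv, inner_smul_left]
  simp
  rw [inner_sub_left]
  ring

lemma divg_sub_const (p y : Euc d) : divg (fun y => y - p) y = d := by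
  have : fderiv ℝ (fun y : Euc d => y - p) y = ContinuousLinearMap.id ℝ _ :=
    ((hasFDerivAt_id y).sub_const p).fderiv
  simp [divg, this]

lemma divg_gradient_barrier (α s : ℝ) (p y : Euc d) : divg (fun y => gradient (barrier α s p) y) y =
      2 * α * Real.exp (-(α * ‖y - p‖ ^ 2)) * (2 * α * ‖y - p‖ ^ 2 - d) := by
  have e : (fun y => gradient (barrier α s p) y) =
      fun y => (-(2 * α) * Real.exp (-(α * ‖y - p‖ ^ 2))) • (y - p) :=
    funext fun y => gradient_barrier α s p y
  have e2 : (fun y => -(2 * α) * Real.exp (-(α * ‖y - p‖ ^ 2))) =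
      fun y => -(2 * α) * (barrier α s p y + Real.exp (-(α * s ^ 2))) := by
    ext y; simp [barrier]
  have hb := smooth_differentiable (contDiff_barrier α s p)
  rw [e, divg_smul, divg_sub_const]
  · rw [e2, gradient_const_mul _ ((hb y).add_const _), gradient_add (hb y)
      (differentiableAt_const _), gradient_fun_const, add_zero, gradient_barrier]
    rw [inner_smul_left, inner_smul_left, real_inner_self_eq_norm_sq]
    simp only [conj_trivial]; ring
  · rw [e2]; exact ((hb y).add_const _).const_mul _
  · fun_prop

lemma lt_avg_of_divg_pos (hw : Smooth w)
    (hR : 0 < R) (hpos : ∀ y ∈ ball x R, 0 < divg (fun y => gradient w y) y) :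
    massk d * w x < avg w x R := by
  have hd : ∀ r ∈ Ioc 0 R, HasDerivAt (avg w x)
      (r * r⁻¹ ^ d * ∫ y, bumpK x r y * divg (fun y => gradient w y) y) r := fun r hr => by
    refine (hasDerivAt_avg (weakGrad_of_contDiff hw) x hr.1).congr_deriv ?_
    have T := bumpK_testFun x hr.1 (subset_univ _)
    rw [integral_mul_divg T.1 (contDiff_gradient hw) (Or.inl T.2.1)]
    simp_rw [real_inner_comm]
    ring
  have hp : ∀ r ∈ Ioc 0 R,
      0 < r * r⁻¹ ^ d * ∫ y, bumpK x r y * divg (fun y => gradient w y) y := fun r hr => by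
    have hr0 : 0 < r := hr.1
    have T := bumpK_testFun x hr.1 (subset_univ _)
    have hnn : ∀ y, 0 ≤ bumpK x r y * divg (fun y => gradient w y) y := fun y => by
      rcases le_or_gt r (dist y x) with h | h
      · rw [bumpK_eq_zero hr0 h, zero_mul]
      · exact mul_nonneg (bumpK_nonneg _ _ _) (hpos y (lt_of_lt_of_le h hr.2)).le
    have hi : Integrable fun y => bumpK x r y * divg (fun y => gradient w y) y :=
      (T.continuous.mul (continuous_divg (contDiff_gradient hw))).integrable_of_hasCompactSupport
        T.2.1.mul_right
    have : 0 < ∫ y, bumpK x r y * divg (fun y => gradient w y) y := by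
      rw [integral_pos_iff_support_of_nonneg hnn hi]
      refine lt_of_lt_of_le (measure_ball_pos volume x hr0) (measure_mono fun y hy => ?_)
      exact (mul_pos (bumpK_pos hy) (hpos y (ball_subset_ball hr.2 hy))).ne'
    positivity
  have hmono : StrictMonoOn (avg w x) (Ioc 0 R) := by
    refine strictMonoOn_of_deriv_pos (convex_Ioc 0 R)
      (fun r hr => (hd r hr).continuousAt.continuousWithinAt) fun r hr => ?_
    have hr' := interior_subset hr
    rw [(hd r hr').deriv]; exact hp r hr'
  have hlim := tendsto_avg_of_continuousAt hw.continuous.locallyIntegrable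
    (hw.continuous.continuousAt (x := x))
  have h1 : massk d * w x ≤ avg w x (R / 2) := by
    refine le_of_tendsto hlim ?_
    filter_upwards [Ioo_mem_nhdsGT (half_pos hR)] with s hs
    exact (hmono ⟨hs.1, by linarith [hs.2]⟩ ⟨by positivity, by linarith⟩ hs.2).le
  exact h1.trans_lt (hmono ⟨by positivity, by linarith⟩ ⟨hR, le_rfl⟩ (by linarith))

namespace LapState

/-- A comparison principle with strictly subharmonic functions. -/
lemma comparison (h : 𝓛) (hp : Precise u) {K : Set (Euc d)} (hK : IsCompact K)
    (hu : ContinuousOn u K) (hw : Smooth w) {η : ℝ} (hη : 0 < η)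
    (hcase : ∀ x ∈ K, η * w x ≤ u x ∨ ∃ R > 0, ball x R ⊆ K ∧ μ (ball x R) = 0 ∧
      ∀ y ∈ ball x R, 0 < divg (fun y => gradient w y) y) : ∀ x ∈ K, η * w x ≤ u x := by
  by_contra! hcon
  obtain ⟨x₀, hx₀, hlt₀⟩ := hcon
  obtain ⟨x, hx, hmin⟩ := hK.exists_isMinOn ⟨x₀, hx₀⟩
    (hu.sub (hw.continuous.continuousOn.const_smul η))
  have hmin' : ∀ y ∈ K, u x - η * w x ≤ u y - η * w y := fun y hy => hmin hy
  have hlt : u x < η * w x := by linarith [hmin' x₀ hx₀]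
  obtain ⟨R, hR, hRK, hμ, hpos⟩ := (hcase x hx).resolve_left (not_le.2 hlt)
  have h1 := h.avg_le_of_null hp hμ (right_mem_Ioc.2 hR)
  have h2 := lt_avg_of_divg_pos hw hR hpos
  have iu := integrable_avg h.loc x hR
  have iw := integrable_avg hw.continuous.locallyIntegrable x hR
  have h3 : massk d * (u x - η * w x) ≤ avg u x R - η * avg w x R := by
    rw [avg, avg, ← integral_const_mul, ← integral_sub iu (iw.const_mul η), ← avg_const_one x hR,
      ← integral_mul_const]
    refine integral_mono_ae ?_ (iu.sub (iw.const_mul η)) (.of_forall fun y => ?_)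
    · exact ((((continuous_const.mul (continuous_kerk_scale x R)).integrable_of_hasCompactSupport
        (hasCompactSupport_of_scale (fun _ => kerk_eq_zero) x hR).mul_left)).mul_const _)
    · simp only
      rcases le_or_gt R (dist y x) with hy | hy
      · rw [kerk_eq_zero (one_le_norm_scale hR hy)]; simp
      · have h4 := hmin' y (hRK hy)
        have h5 : 0 ≤ R⁻¹ ^ d * kerk (R⁻¹ • (y - x)) := mul_nonneg (by positivity) (kerk_nonneg _)
        nlinarith
  nlinarith

/-- Values are controlled by averages on larger balls. -/
lemma exists_le_avg (h : 𝓛) (hp : Precise u) : ∃ C, 0 < C ∧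
    ∀ (z : Euc d) (r : ℝ), 0 < r → r ≤ 1 → ∀ y ∈ closedBall z r, u y ≤ C * avg u z (4 * r) := by
  obtain ⟨C, hC0, hC⟩ := h.exists_sup_bound hp
  obtain ⟨c, hc0, -, hc⟩ := exists_kerK_lower (d := d)
  refine ⟨C * 4 ^ d / c, by positivity, fun z r hr hr1 y hy => ?_⟩
  have h1 := hC y r hr hr1
  have h2 := h.le_avg hc z (r := 4 * r) (by positivity)
  have h3 : ∫ w in closedBall y r, u w ≤ ∫ w in closedBall z (4 * r / 2), u w := by
    refine setIntegral_mono_set (h.integrableOn z _) (.of_forall fun w => h.nonneg w)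
      (closedBall_subset_closedBall' ?_).eventuallyLE
    rw [mem_closedBall] at hy; linarith
  have h4 : c * (((4 * r)⁻¹) ^ d * ∫ w in closedBall y r, u w) ≤ avg u z (4 * r) := by
    refine le_trans ?_ h2
    rw [mul_assoc]; gcongr
  have h5 : C * r⁻¹ ^ d * ∫ w in closedBall y r, u w =
      C * 4 ^ d / c * (c * (((4 * r)⁻¹) ^ d * ∫ w in closedBall y r, u w)) := by
    have h6 : (4 : ℝ) ^ d * 4⁻¹ ^ d = 1 := by rw [← mul_pow]; norm_num
    rw [mul_inv, mul_pow, div_mul_eq_mul_div, eq_div_iff hc0.ne']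
    linear_combination (-(C * r⁻¹ ^ d * (∫ w in closedBall y r, u w) * c)) * h6
  rw [h5] at h1
  exact h1.trans (mul_le_mul_of_nonneg_left h4 (by positivity))

end LapState

namespace RegState

lemma exists_freeBdry (h : 𝓡) : ∃ x, x ∈ 𝓕 := by
  obtain ⟨x, hx⟩ := h.exists_essBdry
  obtain ⟨r, hr, hrD⟩ := isOpen_iff.1 h.openD x hx.1
  by_contra! hno
  have hz : ∃ w ∈ D, u w = 0 := by
    obtain ⟨w, hw⟩ := nonempty_of_measure_ne_zero (μ := volume) (s := (ball x r \ Ω) \ 𝓐) (by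
      intro h0
      refine (hx.2 r hr).2 (measure_mono_null (t := ((ball x r \ Ω) \ 𝓐) ∪
        (𝓐 \ Ω)) (fun y hy => ?_) (measure_union_null h0 h.volume_posSet_diff))
      by_cases hy' : y ∈ 𝓐
      · exact Or.inr ⟨hy', hy.2⟩
      · exact Or.inl ⟨hy, hy'⟩)
    refine ⟨w, hrD hw.1.1, ?_⟩
    by_contra hne
    exact hw.2 ⟨hrD hw.1.1, (h.nonneg w).lt_of_ne' hne⟩
  obtain ⟨w, hw, hw0⟩ := hz
  exact h.not_forall_null hw hw0 fun z hz => h.null_of_notMem_freeBdry hz (hno z)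

/-- A ball in the positivity set touching the free boundary. -/
lemma exists_touching (h : 𝓡) : ∃ (p z : Euc d) (s : ℝ), 0 < s ∧
    closedBall p s ⊆ D ∧ ball p s ⊆ 𝓐 ∧ z ∈ 𝓕 ∧ dist z p = s := by
  obtain ⟨x, hx⟩ := h.exists_freeBdry
  obtain ⟨R, hR, hRD⟩ := isOpen_iff.1 h.openD x hx.1
  obtain ⟨p, hp, hpx⟩ := mem_closure_iff.1 hx.2.2 (R / 4) (by positivity)
  have hsub : closedBall x (R / 2) ⊆ D := (closedBall_subset_ball (by linarith)).trans hRD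
  have hcont : ContinuousOn u (closedBall x (R / 2)) := fun y hy =>
    (h.continuousAt (hsub hy)).continuousWithinAt
  set Z := closedBall x (R / 2) ∩ u ⁻¹' {0}
  have hZ : IsCompact Z := (isCompact_closedBall x (R / 2)).of_isClosed_subset
    (hcont.preimage_isClosed_of_isClosed isClosed_closedBall isClosed_singleton) inter_subset_left
  obtain ⟨z, hz, hzd⟩ := hZ.exists_infDist_eq_dist ⟨x, mem_closedBall_self (by positivity), hx.2.1⟩ p
  have hle : dist p z ≤ dist p x := by
    rw [← hzd]; exact infDist_le_dist_of_mem ⟨mem_closedBall_self (by positivity), hx.2.1⟩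
  have hpx' : dist p x < R / 4 := by rwa [dist_comm]
  have hball : ∀ y, dist y p ≤ dist p z → y ∈ closedBall x (R / 2) := fun y hy => by
    have := dist_triangle y p x
    rw [mem_closedBall]; linarith
  have hs : 0 < dist p z := by
    rw [dist_pos]; rintro rfl
    exact hp.2.ne' hz.2
  have hpos : ball p (dist p z) ⊆ 𝓐 := fun y hy => by
    have hyb := hball y (mem_ball.1 hy).le
    refine ⟨hsub hyb, (h.nonneg y).lt_of_ne' fun hy0 => ?_⟩
    have := infDist_le_dist_of_mem (x := p) (s := Z) ⟨hyb, hy0⟩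
    rw [hzd, dist_comm p y] at this
    exact absurd (mem_ball.1 hy) (not_lt.2 this)
  refine ⟨p, z, dist p z, hs, fun y hy => hsub (hball y hy), hpos, ⟨hsub hz.1, hz.2, ?_⟩,
    dist_comm _ _⟩
  refine closure_mono hpos ?_
  rw [closure_ball _ hs.ne', mem_closedBall, dist_comm]

/-- The Hopf lemma: linear growth at a touching ball. -/
lemma hopf (h : 𝓡) {p : Euc d} (hs : 0 < s)
    (hD : closedBall p s ⊆ D) (hpos : ball p s ⊆ 𝓐) (hz : dist z p = s) :
    ∃ c > 0, ∀ τ ∈ Ioc (0 : ℝ) (1 / 2), c * τ ≤ u (z + τ • (p - z)) := by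
  have hd := h.dim_pos
  set α := 4 * d / s ^ 2 with hα
  have hd' : (0 : ℝ) < d := by exact_mod_cast hd
  have hα0 : 0 < α := by positivity
  have hsub : closedBall p (s / 2) ⊆ ball p s := closedBall_subset_ball (by linarith)
  obtain ⟨y₀, hy₀, hmin⟩ := (isCompact_closedBall p (s / 2)).exists_isMinOn
    ⟨p, mem_closedBall_self (by positivity)⟩ (fun y hy =>
      (h.continuousAt (hpos (hsub hy)).1).continuousWithinAt)
  set η := u y₀
  have hη : 0 < η := (hpos (hsub hy₀)).2
  have hwle : ∀ y : Euc d, barrier α s p y ≤ 1 := fun y => by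
    have h1 : Real.exp (-(α * ‖y - p‖ ^ 2)) ≤ 1 := Real.exp_le_one_iff.2 (by
      have : 0 ≤ α * ‖y - p‖ ^ 2 := by positivity
      linarith)
    have h2 := Real.exp_pos (-(α * s ^ 2))
    unfold barrier; linarith
  have comp := h.comparison h.precise (isCompact_closedBall p s)
    (fun y hy => (h.continuousAt (hD hy)).continuousWithinAt) (contDiff_barrier α s p) hη
    (fun x hx => ?_)
  · refine ⟨η * (Real.exp (-(α * s ^ 2)) * (α * s ^ 2)), by positivity, fun τ hτ => ?_⟩
    have e1 : z + τ • (p - z) - p = (1 - τ) • (z - p) := by module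
    have hn : ‖z + τ • (p - z) - p‖ = (1 - τ) * s := by
      rw [e1, norm_smul, ← dist_eq_norm z p, hz, Real.norm_of_nonneg (by linarith [hτ.2])]
    have hmem : z + τ • (p - z) ∈ closedBall p s := by
      rw [mem_closedBall, dist_eq_norm, hn]; nlinarith [hτ.1]
    refine le_trans ?_ (comp _ hmem)
    rw [mul_assoc]
    refine mul_le_mul_of_nonneg_left ?_ hη.le
    rw [barrier, hn]
    have e2 : Real.exp (-(α * ((1 - τ) * s) ^ 2)) =
        Real.exp (-(α * s ^ 2)) * Real.exp (α * s ^ 2 * (2 * τ - τ ^ 2)) := by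
      rw [← Real.exp_add]; congr 1; ring
    have e3 := Real.add_one_le_exp (α * s ^ 2 * (2 * τ - τ ^ 2))
    have e4 : α * s ^ 2 * τ ≤ α * s ^ 2 * (2 * τ - τ ^ 2) := by
      refine mul_le_mul_of_nonneg_left ?_ (by positivity)
      nlinarith [hτ.1, hτ.2]
    rw [e2]
    have := Real.exp_pos (-(α * s ^ 2))
    nlinarith
  · rcases le_or_gt (dist x p) (s / 2) with h1 | h1
    · left
      have h2 : η ≤ u x := hmin h1
      calc η * barrier α s p x ≤ η * 1 := mul_le_mul_of_nonneg_left (hwle x) hη.le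
        _ ≤ u x := by linarith
    · rcases (mem_closedBall.1 hx).eq_or_lt with h2 | h2
      · left
        rw [barrier, ← dist_eq_norm, h2, sub_self, mul_zero]
        exact h.nonneg x
      · right
        obtain ⟨R₁, hR₁, hnull⟩ := h.null_of_mem_posSet (hpos h2)
        set R := min R₁ (min (dist x p - s / 2) (s - dist x p))
        have hR : 0 < R := lt_min hR₁ (lt_min (by linarith) (by linarith))
        refine ⟨R, hR, ?_, measure_mono_null (ball_subset_ball (min_le_left _ _)) hnull, ?_⟩
        · intro y hy
          have := dist_triangle y x p
          have h3 : R ≤ s - dist x p := (min_le_right _ _).trans (min_le_right _ _)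
          rw [mem_ball] at hy
          rw [mem_closedBall]; linarith
        · intro y hy
          have h3 : R ≤ dist x p - s / 2 := (min_le_right _ _).trans (min_le_left _ _)
          have h4 : s / 2 < ‖y - p‖ := by
            rw [← dist_eq_norm]
            have := dist_triangle_left x p y
            rw [mem_ball] at hy
            linarith
          rw [divg_gradient_barrier]
          have h5 : (d : ℝ) < 2 * α * ‖y - p‖ ^ 2 := by
            have : s ^ 2 / 4 ≤ ‖y - p‖ ^ 2 := by nlinarith
            calc (d : ℝ) < 2 * d := by linarith
              _ = 2 * α * (s ^ 2 / 4) := by rw [hα]; field_simp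
              _ ≤ _ := by gcongr
          have := Real.exp_pos (-(α * ‖y - p‖ ^ 2))
          have h6 : 0 < 2 * α * ‖y - p‖ ^ 2 - d := by linarith
          positivity

/-- The Lagrange multiplier is positive. -/
theorem multiplier_pos (h : 𝓡) (hM : 𝓜) :
    0 < Λ := by
  by_contra! hΛ
  obtain ⟨p, z, s, hs, hD, hpos, hz, hzs⟩ := h.exists_touching
  obtain ⟨c, hc, hlow⟩ := h.hopf hs hD hpos hzs
  obtain ⟨A, hA0, hA⟩ := h.energyJ_bump_le
  obtain ⟨C₁, hC₁, hsup⟩ := h.exists_le_avg h.precise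
  obtain ⟨k, hk0, -, hk⟩ := exists_kerK_lower (d := d)
  have ho := omd_pos (d := d)
  have hC0 := hM.C_pos
  have hρ := hM.ρ_pos
  have hd := h.dim_pos
  set B := 4 ^ d * omd d with hB
  have hB0 : 0 < B := by positivity
  obtain ⟨R₁, hR₁, hR₁D⟩ := Metric.isOpen_iff.1 h.openD z hz.1
  have small : ∀ ε > 0, ∃ R > 0, ∀ r ∈ Ioc 0 R, r * r⁻¹ ^ d * μ.real (ball z r) ≤ ε := fun ε hε => by
    set θ := ε * k / (2 * (A * 2 ^ d)) with hθ
    have hθ0 : 0 < θ := by positivity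
    set Q := C * B ^ 2
    have hQ : 0 < Q := by positivity
    set R := min (min (min (ρ / 4) 1) (ρ / B)) (min (R₁ / 4) (θ * ε * k / Q)) with hR
    have hR0 : 0 < R := by positivity
    refine ⟨R, hR0, fun r hr => ?_⟩
    have hr0 : 0 < r := hr.1
    have hrR := hr.2
    simp only [R, le_min_iff, le_div_iff₀' hB0, le_div_iff₀' hQ, le_div_iff₀' (zero_lt_four' ℝ)] at hrR
    obtain ⟨⟨⟨hrρ, hr1⟩, hrB⟩, hrR₁, hrQ⟩ := hrR
    have hrd : r ^ d ≤ r := pow_le_of_le_one hr0.le hr1 hd.ne'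
    set V := mvol (ball z (4 * r) \ Ω)
    have hV0 : 0 ≤ V := mvol_nonneg _
    have hV : V ≤ B * r ^ d := by
      refine (mvol_mono sdiff_subset measure_ball_lt_top.ne).trans (le_of_eq ?_)
      rw [mvol_ball z (by positivity), mul_pow, hB]; ring
    have hVρ : V ≤ ρ := hV.trans ((mul_le_mul_of_nonneg_left hrd hB0.le).trans hrB)
    have key := h.out_ineq hM ((ball_subset_ball hrR₁).trans hR₁D) hrρ hVρ
      (bumpK_testFun z (r := 2 * r) (by positivity) (closedBall_subset_ball (by linarith)))
      (θ * (2 * r))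
    have h1 := hA z (2 * r) (by positivity)
    rw [mul_pow 2 r d] at h1
    have h2 := h.le_integral_bumpK hk z (r := 2 * r) (by positivity)
    rw [mul_div_cancel_left₀ r two_ne_zero] at h2
    have h2' : k * μ.real (ball z r) ≤ ∫ y, bumpK z (2 * r) y ∂μ := by
      have := h.fin
      refine le_trans ?_ h2
      gcongr
      · exact (isCompact_closedBall z r).measure_lt_top.ne
      · exact ball_subset_closedBall
    have h3 : Λ * V ≤ 0 := mul_nonpos_of_nonpos_of_nonneg hΛ hV0
    have h4 : C * V ^ 2 ≤ Q * r * r ^ d := by calc C * V ^ 2 ≤ C * (B * r ^ d) ^ 2 := by gcongr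
        _ = Q * (r ^ d * r ^ d) := by ring
        _ ≤ Q * (r * r ^ d) := by gcongr
        _ = _ := by ring
    have h5 : 4 * θ * (r * (k * μ.real (ball z r))) ≤
        θ ^ 2 * (A * (2 ^ d * r ^ d)) + θ * ε * k * r ^ d := by
      calc 4 * θ * (r * (k * μ.real (ball z r)))
          ≤ 4 * θ * (r * ∫ y, bumpK z (2 * r) y ∂μ) := by gcongr
        _ = 2 * (θ * (2 * r)) * ∫ y, bumpK z (2 * r) y ∂μ := by ring
        _ ≤ _ := key
        _ = θ ^ 2 * ((2 * r) ^ 2 * energyJ lam (bumpK z (2 * r))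
              (fun y => gradient (bumpK z (2 * r)) y)) + (Λ * V + C * V ^ 2) := by
            rw [mul_pow θ]; ring
        _ ≤ _ := by
            refine add_le_add (mul_le_mul_of_nonneg_left h1 (by positivity)) ?_
            calc Λ * V + C * V ^ 2 ≤ Q * r * r ^ d := by linarith
              _ ≤ _ := by gcongr
    have h6 : θ * (A * 2 ^ d) = ε * k / 2 := by rw [hθ]; field_simp
    have h7 : 4 * θ * (r * (k * μ.real (ball z r))) ≤ 4 * θ * (k * (ε * r ^ d)) := by
      refine h5.trans ?_
      have : θ ^ 2 * (A * (2 ^ d * r ^ d)) = θ * (ε * k / 2) * r ^ d := by rw [← h6]; ring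
      rw [this]
      have : 0 ≤ θ * ε * k * r ^ d := by positivity
      nlinarith
    have h8 : r * (k * μ.real (ball z r)) ≤ k * (ε * r ^ d) :=
      le_of_mul_le_mul_left h7 (by positivity)
    have h9 : r * μ.real (ball z r) ≤ ε * r ^ d := by
      refine le_of_mul_le_mul_left (a := k) ?_ hk0
      calc k * (r * μ.real (ball z r)) = r * (k * μ.real (ball z r)) := by ring
        _ ≤ _ := h8
    calc r * r⁻¹ ^ d * μ.real (ball z r) = r⁻¹ ^ d * (r * μ.real (ball z r)) := by ring
      _ ≤ r⁻¹ ^ d * (ε * r ^ d) := by gcongr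
      _ = ε * (r⁻¹ * r) ^ d := by rw [mul_pow]; ring
      _ = ε := by rw [inv_mul_cancel₀ hr0.ne', one_pow, mul_one]
  obtain ⟨R, hR, hg⟩ := small (c / (8 * C₁ * s)) (by positivity)
  set τ := min (1 / 2) (min (R / (4 * s)) (1 / s)) with hτ
  have hτ0 : 0 < τ := by positivity
  obtain ⟨-, hτR, hτ1⟩ : _ ∧ _ ∧ _ := by
    simpa only [le_min_iff, le_div_iff₀ hs, le_div_iff₀ (by positivity : 0 < 4 * s)] using hτ.le
  rw [mul_left_comm] at hτR
  have h1 := hlow τ ⟨hτ0, min_le_left _ _⟩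
  have h2 := hsup z (τ * s) (by positivity) hτ1 (z + τ • (p - z)) (by
    rw [mem_closedBall, dist_eq_norm, add_sub_cancel_left, norm_smul, Real.norm_of_nonneg hτ0.le,
      ← dist_eq_norm, dist_comm, hzs])
  have h3 := h.avg_le_of_growth h.precise hg (r := 4 * (τ * s)) ⟨by positivity, hτR⟩
  rw [hz.2.1, mul_zero, zero_add] at h3
  have h4 : C₁ * avg u z (4 * (τ * s)) ≤ C₁ * (c / (8 * C₁ * s) * (4 * (τ * s))) := by gcongr
  have h5 : C₁ * (c / (8 * C₁ * s) * (4 * (τ * s))) = c * τ / 2 := by field_simp; norm_num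
  have : 0 < c * τ := by positivity
  linarith

end RegState

/-! ### Inner perturbations and nondegeneracy -/

lemma tendsto_nhdsGT_zero {f : ℝ → ℝ} (hf : Continuous f) (h0 : f 0 = 0) :
    Tendsto f (𝓝[>] 0) (𝓝 0) := by
  simpa [h0] using tendsto_nhdsWithin_of_tendsto_nhds (hf.tendsto 0)

/-- A smooth cutoff equal to one on the unit ball and vanishing outside the ball of radius two. -/
def cutZero : Euc d → ℝ := ((⟨1, 2, one_pos, one_lt_two⟩ : ContDiffBump (0 : Euc d)) : Euc d → ℝ)

/-- A smooth cutoff between the balls of centre `x` and radii `r` and `2 r`. -/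
def cutB (x : Euc d) (r : ℝ) (y : Euc d) : ℝ := cutZero (r⁻¹ • (y - x))

lemma contDiff_cutZero : Smooth (cutZero : Euc d → ℝ) := ContDiffBump.contDiff _

lemma cutB_eq_one (hr : 0 < r) (h : dist y x ≤ r) : cutB x r y = 1 := by
  refine ContDiffBump.one_of_mem_closedBall _ ?_
  rw [mem_closedBall_zero_iff, norm_scale hr, inv_mul_le_iff₀ hr]
  simpa using h

lemma cutB_eq_zero (hr : 0 < r) (h : 2 * r ≤ dist y x) : cutB x r y = 0 := by
  refine ContDiffBump.zero_of_le_dist _ ?_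
  rw [dist_zero_right, norm_scale hr, le_inv_mul_iff₀ hr]
  simpa [mul_comm] using h

lemma cutB_nonneg (x : Euc d) (r : ℝ) (y : Euc d) : 0 ≤ cutB x r y := ContDiffBump.nonneg _

lemma cutB_le_one (x : Euc d) (r : ℝ) (y : Euc d) : cutB x r y ≤ 1 := ContDiffBump.le_one _

lemma cutB_testFun (x : Euc d) (hr : 0 < r)
    (hU : closedBall x (2 * r) ⊆ U) : TestFun U (cutB x r) := by
  have hs : tsupport (cutB x r) ⊆ closedBall x (2 * r) :=
    closure_minimal (fun y hy => by
      by_contra hc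
      exact hy (cutB_eq_zero hr (not_le.1 (by simpa using hc)).le)) isClosed_closedBall
  exact ⟨contDiff_cutZero.comp (contDiff_scale x r), (isCompact_closedBall x _).of_isClosed_subset
    (isClosed_tsupport _) hs, hs.trans hU⟩

lemma exists_gradient_cutB_bound : ∃ C, 0 < C ∧ ∀ (x : Euc d) (r : ℝ), 0 < r →
    ∀ y, ‖gradient (cutB x r) y‖ ≤ C * r⁻¹ := by
  have h0 : HasCompactSupport (cutZero : Euc d → ℝ) := ContDiffBump.hasCompactSupport _
  obtain ⟨C, hC⟩ := (contDiff_gradient contDiff_cutZero).continuous.bounded_above_of_compact_support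
    (h0.gradient (d := d))
  refine ⟨max C 1, by positivity, fun x r hr y => ?_⟩
  have h1 := gradient_comp_scale (smooth_differentiable contDiff_cutZero) x r y
  rw [show gradient (cutB x r) y = _ from h1, norm_smul, Real.norm_of_nonneg (inv_nonneg.2 hr.le),
    mul_comm]
  exact mul_le_mul_of_nonneg_right ((hC _).trans (le_max_left _ _)) (inv_nonneg.2 hr.le)

lemma gradient_cutB_eq_zero (hr : 0 < r) (h : 2 * r < dist y x) : gradient (cutB x r) y = 0 :=
  gradient_eq_zero_of_notMem_tsupport fun hy => (not_le.2 h) ((cutB_testFun x hr Subset.rfl).2.2 hy)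

namespace LapState

lemma energy_cut (h : 𝓛) (hχ : TestFun univ χ) :
    energyJ lam (fun y => (1 - χ y) * u y) (fun y => (1 - χ y) • G y - u y • gradient χ y) =
      ∫ y, (u y) ^ 2 * ‖gradient χ y‖ ^ 2 := by
  have hχ' : TestFun univ (fun y => χ y * (χ y - 2)) := hχ.mul_right (hχ.1.sub contDiff_const)
  have gr : ∀ y, gradient (fun y => χ y * (χ y - 2)) y = (-2 * (1 - χ y)) • gradient χ y := fun y => by
    have e : (fun y => χ y - 2) = fun y => χ y + (-2) := by ext; ring
    have e2 : gradient (fun y => χ y - 2) y = gradient χ y := by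
      rw [e, gradient_add (hχ.differentiable y) (differentiableAt_const _), gradient_fun_const,
        add_zero]
    rw [gradient_mul (hχ.differentiable y) ((hχ.differentiable y).sub_const 2), e2, ← add_smul]
    congr 1; ring
  have hw := h.weakH (h.inH.add (h.inH.mul_test hχ'))
  obtain ⟨C, hC0, hC⟩ := hχ.bounded
  obtain ⟨C', hC'0, hC'⟩ := hχ.bounded_gradient
  have mF := (h.inH.add (h.inH.mul_test hχ')).memG
  have mw := (h.inH.add (h.inH.mul_test hχ')).memV
  have i1 := h.integrable_inner mF
  have iu : Integrable fun y => (u y) ^ 2 := by simpa using integrable_sq_of_memLp h.inH.memV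
  have i2 : Integrable fun y => ‖gradient χ y‖ ^ 2 * (u y) ^ 2 :=
    integrable_bdd_mul iu (hχ.continuous_gradient.norm.pow 2) (C := C' ^ 2) fun y => by
      rw [abs_of_nonneg (by positivity)]; have := hC' y; gcongr
  have e1 : ∫ y, ‖(1 - χ y) • G y - u y • gradient χ y‖ ^ 2 = (∫ y, ⟪G y, G y +
      ((χ y * (χ y - 2)) • G y + u y • gradient (fun y => χ y * (χ y - 2)) y)⟫) +
      ∫ y, ‖gradient χ y‖ ^ 2 * (u y) ^ 2 := by
    rw [← integral_add i1 i2]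
    congr 1; ext y
    rw [gr, norm_sub_sq_real, norm_smul, norm_smul, mul_pow, mul_pow, Real.norm_eq_abs, sq_abs,
      Real.norm_eq_abs, sq_abs, inner_add_right, inner_add_right, inner_smul_right, inner_smul_right,
      inner_smul_left, inner_smul_right, inner_smul_right, real_inner_self_eq_norm_sq]
    simp only [conj_trivial]; ring
  have e2 : ∫ y, ((1 - χ y) * u y) ^ 2 = ∫ y, u y * (u y + χ y * (χ y - 2) * u y) := by
    congr 1; ext y; ring
  rw [energyJ, e1, e2, hw, add_sub_cancel_left]
  congr 1; ext y; ring

end LapState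

/-- The quantitative estimates at the free boundary. -/
structure FreeBdryEst (D Ω : Set (Euc d)) (u : Euc d → ℝ) (μ : Measure (Euc d)) (C R : ℝ) :
    Prop where
  C_pos : 0 < C
  R_pos : 0 < R
  up_measure : ∀ x r, 0 < r → r ≤ R → ball x (8 * r) ⊆ D → r * μ.real (closedBall x r) ≤ C * r ^ d
  up_fun : ∀ x ∈ freeBdry D u, ∀ r, 0 < r → r ≤ R → ball x (32 * r) ⊆ D →
    ∀ y ∈ closedBall x r, u y ≤ C * r
  lo_measure : ∀ x ∈ freeBdry D u, ∀ r, 0 < r → r ≤ R → ball x (8 * r) ⊆ D →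
    r ^ d ≤ C * (r * μ.real (ball x r))
  lo_vol : ∀ x ∈ freeBdry D u, ∀ r, 0 < r → r ≤ R → ball x (32 * r) ⊆ D →
    r ^ d ≤ C * mvol (ball x r ∩ Ω)
  lo_compl : ∀ x ∈ freeBdry D u, ∀ r, 0 < r → r ≤ R → ball x (8 * r) ⊆ D →
    r ^ d ≤ C * mvol (ball x r \ Ω)
  lo_fun : ∀ y ∈ posSet D u, ∀ s, 0 < s → s ≤ R → ball y s ⊆ posSet D u → s ≤ C * u y

local notation "𝓔" => FreeBdryEst D Ω u μ C R

namespace RegState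

lemma integral_le_mvol (h : 𝓡) (hS : IsCompact S)
    (hM : ∀ y ∈ S, u y ≤ M) : ∫ y in S, u y ≤ M * mvol (S ∩ Ω) := by
  have hm := hS.measurableSet
  have h1 : ∫ y in S, u y = ∫ y in S ∩ Ω, u y := by
    rw [← integral_indicator hm, ← integral_indicator (hm.inter h.openΩ.measurableSet)]
    refine integral_congr_ae ?_
    filter_upwards [h.inH.ae_eq_zero] with y hy
    by_cases hyS : y ∈ S <;> by_cases hyΩ : y ∈ Ω <;> simp [hyS, hyΩ]
    exact hy hyΩ
  have hfin : volume (S ∩ Ω) ≠ ∞ := h.volume_ne_top (inter_subset_right.trans h.subset)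
  rw [h1]
  refine (setIntegral_mono_on ((h.loc.integrableOn_isCompact hS).mono_set inter_subset_left)
    (integrableOn_const (C := M) hfin) (hm.inter h.openΩ.measurableSet)
    fun y hy => hM y hy.1).trans (le_of_eq ?_)
  rw [setIntegral_const, smul_eq_mul, mul_comm]; rfl

lemma exists_in_ineq (h : 𝓡) (hM : 𝓜) :
    ∃ C₁ R₁, 0 < C₁ ∧ 0 < R₁ ∧ ∀ (x : Euc d) (r M : ℝ), 0 < r → r ≤ R₁ →
      (∀ y ∈ closedBall x (2 * r), u y ≤ M) →
      r ^ 2 * mvol (closedBall x (r / 2) ∩ Ω) ≤ C₁ * M ^ 2 * r ^ d := by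
  have hΛ := h.multiplier_pos hM
  obtain ⟨c, hc0, hc⟩ := exists_gradient_cutB_bound (d := d)
  have ho := omd_pos (d := d)
  have hC0 := hM.C_pos
  have hρ := hM.ρ_pos
  refine ⟨2 / Λ * (c ^ 2 * 2 ^ d * omd d), min (min (ρ / 4) 1) (min (ρ / omd d) (Λ / (2 * C) / omd d)),
    by positivity, by positivity, fun x r M hr hrR hu => ?_⟩
  simp only [le_min_iff, le_div_iff₀ ho, le_div_iff₀' (zero_lt_four' ℝ)] at hrR
  obtain ⟨⟨hrρ, hr1⟩, hrω, hrΛ⟩ := hrR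
  have hrd : r ^ d ≤ r := pow_le_of_le_one hr.le hr1 h.dim_pos.ne'
  set W := mvol (closedBall x (r / 2) ∩ Ω)
  have hW0 : 0 ≤ W := mvol_nonneg _
  have hW : W ≤ r * omd d := by
    refine (mvol_mono inter_subset_left measure_closedBall_lt_top.ne).trans ?_
    rw [mvol_closedBall _ (by positivity)]
    refine mul_le_mul_of_nonneg_right (le_trans ?_ hrd) ho.le
    gcongr; linarith
  have T : TestFun univ (cutB x r) := cutB_testFun x hr (subset_univ _)
  have hv : mvol (Ω \ closedBall x (r / 2)) - a = -W := by
    rw [← h.meas, ← sdiff_inter_self_eq_sdiff, mvol, measure_sdiff inter_subset_right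
      (measurableSet_closedBall.inter h.openΩ.measurableSet).nullMeasurableSet
      (h.volume_ne_top (inter_subset_right.trans h.subset)), ENNReal.toReal_sub_of_le
      (measure_mono inter_subset_right) (h.volume_ne_top h.subset)]
    simp only [W, mvol]; ring
  have key := hM.cost x (Ω \ closedBall x (r / 2)) _ _ (h.openΩ.sdiff isClosed_closedBall)
    (sdiff_subset.trans h.subset) (by
      refine Subset.antisymm (sdiff_subset_sdiff_left sdiff_subset) fun y hy => ⟨⟨hy.1, fun hy' =>
        hy.2 (closedBall_subset_ball (by linarith) hy')⟩, hy.2⟩) (by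
      rw [hv, abs_neg, abs_of_nonneg hW0]; exact hW.trans hrω)
    (h.inH.mul_one_sub (w := x) (s := r / 2) (r := r) T (by linarith)
      fun y hy => cutB_eq_one hr (mem_ball.1 hy).le) (.of_forall fun y hy => by
      have hy' : 2 * r < dist y x := by rw [mem_ball, not_lt] at hy; linarith
      rw [cutB_eq_zero hr hy'.le, gradient_cutB_eq_zero hr hy']; simp)
  rw [h.energy_cut T, hv] at key
  have h1 : ∫ y, (u y) ^ 2 * ‖gradient (cutB x r) y‖ ^ 2 ≤
      M ^ 2 * (c * r⁻¹) ^ 2 * ((2 * r) ^ d * omd d) := by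
    rw [← setIntegral_eq_integral_of_forall_compl_eq_zero (s := closedBall x (2 * r)),
      ← mvol_closedBall x (by positivity : (0 : ℝ) ≤ 2 * r)]
    · calc ∫ y in closedBall x (2 * r), (u y) ^ 2 * ‖gradient (cutB x r) y‖ ^ 2
          ≤ ∫ y in closedBall x (2 * r), M ^ 2 * (c * r⁻¹) ^ 2 := by
            refine integral_mono_of_nonneg (.of_forall fun y => by positivity)
              (integrableOn_const measure_closedBall_lt_top.ne) ?_
            refine (ae_restrict_iff' measurableSet_closedBall).2 (.of_forall fun y hy => ?_)
            have h2 := hu y hy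
            have h3 := hc x r hr y
            have h4 := h.nonneg y
            show (u y) ^ 2 * ‖gradient (cutB x r) y‖ ^ 2 ≤ M ^ 2 * (c * r⁻¹) ^ 2
            gcongr
        _ = _ := by rw [setIntegral_const, smul_eq_mul, mul_comm]; rfl
    · intro y hy
      rw [gradient_cutB_eq_zero hr (not_le.1 (by simpa using hy))]; simp
  have h2 : C * W ^ 2 ≤ Λ / 2 * W := by calc C * W ^ 2 = C * W * W := by ring
      _ ≤ C * (Λ / (2 * C)) * W := by gcongr; exact hW.trans hrΛ
      _ = Λ / 2 * W := by field_simp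
  have h3 : Λ / 2 * W ≤ M ^ 2 * (c * r⁻¹) ^ 2 * ((2 * r) ^ d * omd d) := by nlinarith
  calc r ^ 2 * W = 2 / Λ * r ^ 2 * (Λ / 2 * W) := by field_simp
    _ ≤ 2 / Λ * r ^ 2 * (M ^ 2 * (c * r⁻¹) ^ 2 * ((2 * r) ^ d * omd d)) := by gcongr
    _ = 2 / Λ * (c ^ 2 * 2 ^ d * omd d) * M ^ 2 * r ^ d := by rw [mul_pow 2 r d]; field_simp

/-- Nondegeneracy: the solution grows at least linearly from the positivity set. -/
theorem exists_nondegeneracy (h : 𝓡) (hM : 𝓜) :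
    ∃ c R₁, 0 < c ∧ 0 < R₁ ∧ ∀ x ∈ closure 𝓐, ∀ r, 0 < r → r ≤ R₁ →
      ∃ y ∈ closedBall x r, c * r < u y := by
  obtain ⟨C₁, R₁, hC₁, hR₁, hin⟩ := h.exists_in_ineq hM
  obtain ⟨C₂, hC₂, hsup⟩ := h.exists_sup_bound h.precise
  have ho := omd_pos (d := d)
  set K := C₂ * 8 ^ d * (4 * C₁ * 2⁻¹ ^ d) with hK
  have hK0 : 0 < K := by positivity
  obtain ⟨c, hc0, hcK, hcω⟩ : ∃ c : ℝ, 0 < c ∧ K * c ^ 2 ≤ 1 / 8 ∧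
      4 * C₁ * 2⁻¹ ^ d * c ^ 2 < 4⁻¹ ^ d * omd d := by
    have t1 : Tendsto (fun c : ℝ => K * c ^ 2) (𝓝[>] 0) (𝓝 0) :=
      tendsto_nhdsGT_zero (by fun_prop) (by simp)
    have t2 : Tendsto (fun c : ℝ => 4 * C₁ * 2⁻¹ ^ d * c ^ 2) (𝓝[>] 0) (𝓝 0) :=
      tendsto_nhdsGT_zero (by fun_prop) (by simp)
    have e1 := t1.eventually (gt_mem_nhds (by norm_num : (0 : ℝ) < 1 / 8))
    have e2 := t2.eventually (gt_mem_nhds (by positivity : (0 : ℝ) < 4⁻¹ ^ d * omd d))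
    obtain ⟨c, h1, h2, h3⟩ := (e1.and (e2.and self_mem_nhdsWithin)).exists
    exact ⟨c, h3, h1.le, h2⟩
  set R := min R₁ 1
  have hR : 0 < R := by positivity
  have vol : ∀ (x : Euc d) (r : ℝ), 0 < r → r ≤ R → (∀ y ∈ closedBall x r, u y ≤ c * r) →
      mvol (closedBall x (r / 4) ∩ Ω) ≤ 4 * C₁ * 2⁻¹ ^ d * c ^ 2 * r ^ d := fun x r hr hrR hu => by
    have h1 := hin x (r / 2) (c * r) (by positivity) (by linarith [hrR.trans (min_le_left R₁ 1)])
      (by rwa [mul_div_cancel₀ r two_ne_zero])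
    rw [show r / 2 / 2 = r / 4 by ring, div_eq_mul_inv r 2, mul_pow, mul_pow, mul_pow] at h1
    refine le_of_mul_le_mul_left (a := r ^ 2 * 2⁻¹ ^ 2) ?_ (by positivity)
    refine h1.trans (le_of_eq ?_)
    ring
  have step : ∀ (x : Euc d) (r : ℝ), 0 < r → r ≤ R → (∀ y ∈ closedBall x r, u y ≤ c * r) →
      ∀ y ∈ closedBall x (r / 8), u y ≤ c * (r / 8) := fun x r hr hrR hu y hy => by
    have hr1 : r ≤ 1 := hrR.trans (min_le_right _ _)
    have h1 := hsup y (r / 8) (by positivity) (by linarith)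
    have hsub : closedBall y (r / 8) ⊆ closedBall x (r / 4) :=
      closedBall_subset_closedBall' (by rw [mem_closedBall] at hy; linarith)
    have h2 : ∫ w in closedBall y (r / 8), u w ≤ c * r * mvol (closedBall x (r / 4) ∩ Ω) := by
      refine (setIntegral_mono_set (h.integrableOn x _) (.of_forall fun w => h.nonneg w)
        hsub.eventuallyLE).trans (h.integral_le_mvol (isCompact_closedBall _ _) fun w hw =>
          hu w (closedBall_subset_closedBall (by linarith) hw))
    have h3 := vol x r hr hrR hu
    calc u y ≤ C₂ * ((r / 8)⁻¹) ^ d * ∫ w in closedBall y (r / 8), u w := h1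
      _ ≤ C₂ * ((r / 8)⁻¹) ^ d * (c * r * (4 * C₁ * 2⁻¹ ^ d * c ^ 2 * r ^ d)) := by
          gcongr; exact h2.trans (by gcongr)
      _ = K * c ^ 2 * (c * r) * (r⁻¹ * r) ^ d := by
          rw [hK, inv_div, div_eq_mul_inv, mul_pow, mul_pow]; ring
      _ ≤ 1 / 8 * (c * r) * 1 := by rw [inv_mul_cancel₀ hr.ne', one_pow]; gcongr
      _ = _ := by ring
  have main : ∀ x ∈ 𝓐, ∀ r, 0 < r → r ≤ R → ∃ y ∈ closedBall x r, c * r < u y := fun x hx r hr hrR => by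
    by_contra! hcon
    have iter : ∀ n : ℕ, ∀ y ∈ closedBall x (r / 8 ^ n), u y ≤ c * (r / 8 ^ n) := fun n => by
      induction n with
      | zero => simpa using hcon
      | succ n ih =>
        have h1 : r / 8 ^ n ≤ R := (div_le_self hr.le (one_le_pow₀ (by norm_num))).trans hrR
        have := step x (r / 8 ^ n) (by positivity) h1 ih
        rwa [div_div, ← pow_succ] at this
    obtain ⟨s, hs, hsP⟩ := isOpen_iff.1 h.isOpen_posSet x hx
    obtain ⟨n, hn⟩ : ∃ n : ℕ, r / 8 ^ n < s := by
      have : Tendsto (fun n : ℕ => r / (8 : ℝ) ^ n) atTop (𝓝 0) :=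
        tendsto_const_nhds.div_atTop (tendsto_pow_atTop_atTop_of_one_lt (by norm_num))
      exact (this.eventually (gt_mem_nhds hs)).exists
    set t := r / 8 ^ n
    have ht : 0 < t := by positivity
    have htR : t ≤ R := (div_le_self hr.le (one_le_pow₀ (by norm_num))).trans hrR
    have h1 := vol x t ht htR (iter n)
    have h2 : mvol (closedBall x (t / 4)) ≤ mvol (closedBall x (t / 4) ∩ Ω) := by
      refine ENNReal.toReal_mono (h.volume_ne_top (inter_subset_right.trans h.subset)) ?_
      refine measure_mono_ae ?_
      have := measure_eq_zero_iff_ae_notMem.1 h.volume_posSet_diff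
      filter_upwards [this] with y hy hyb
      refine ⟨hyb, ?_⟩
      by_contra hyΩ
      exact hy ⟨hsP (closedBall_subset_ball (by linarith) hyb), hyΩ⟩
    rw [mvol_closedBall x (by positivity)] at h2
    have h3 := h2.trans h1
    have : 4 * C₁ * 2⁻¹ ^ d * c ^ 2 * t ^ d < 4⁻¹ ^ d * omd d * t ^ d := by gcongr
    rw [div_eq_mul_inv, mul_pow] at h3
    linarith
  refine ⟨c / 2, R, by positivity, hR, fun x hx r hr hrR => ?_⟩
  obtain ⟨x', hx', hxx'⟩ := mem_closure_iff.1 hx (r / 2) (by positivity)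
  obtain ⟨y, hy, hcy⟩ := main x' hx' (r / 2) (by positivity) (by linarith)
  refine ⟨y, ?_, by linarith⟩
  rw [mem_closedBall] at hy ⊢
  have := dist_triangle y x' x
  rw [dist_comm x' x] at this
  linarith

end RegState

/-! ### Estimates at the free boundary -/

namespace RegState

lemma measure_posSet (h : 𝓡) : μ 𝓐 = 0 := by
  refine measure_null_of_locally_null _ fun x hx => ?_
  obtain ⟨r, hr, h0⟩ := h.null_of_mem_posSet hx
  exact ⟨_, mem_nhdsWithin_of_mem_nhds (ball_mem_nhds x hr), h0⟩

lemma exists_growth_avg (h : 𝓡) (hM : 𝓜) : ∃ C₁ R₁, 0 < C₁ ∧ 0 < R₁ ∧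
      (∀ x r, 0 < r → r ≤ R₁ → ball x (4 * r) ⊆ D → r * μ.real (closedBall x r) ≤ C₁ * r ^ d) ∧
      ∀ x r, 0 < r → r ≤ R₁ → ball x (4 * r) ⊆ D → avg u x r ≤ massk d * u x + C₁ * r := by
  obtain ⟨C₁, R₁, hC₁, hR₁, hg⟩ := h.exists_growth hM
  have := h.fin
  refine ⟨C₁, R₁, hC₁, hR₁, fun x r hr hrR hD => ?_, fun x r hr hrR hD => ?_⟩
  · have := mul_le_mul_of_nonneg_right (hg x r hr hrR hD) (pow_nonneg hr.le d)
    refine le_trans (le_of_eq ?_) this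
    have e : r⁻¹ ^ d * r ^ d = 1 := by rw [← mul_pow, inv_mul_cancel₀ hr.ne', one_pow]
    linear_combination (-(r * μ.real (closedBall x r))) * e
  · refine h.avg_le_of_growth h.precise (R := r) (fun s hs => ?_) (right_mem_Ioc.2 hr)
    have hs0 : 0 < s := hs.1
    refine le_trans ?_ (hg x s hs.1 (hs.2.trans hrR) ((ball_subset_ball (by linarith [hs.2])).trans hD))
    gcongr
    · exact (isCompact_closedBall x s).measure_lt_top.ne
    · exact ball_subset_closedBall

lemma exists_lo_avg (h : 𝓡) (hM : 𝓜) : ∃ c R₁, 0 < c ∧ 0 < R₁ ∧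
      ∀ x ∈ closure 𝓐, ∀ r, 0 < r → r ≤ R₁ → c * r ≤ avg u x r := by
  obtain ⟨c, R₁, hc, hR₁, hnd⟩ := h.exists_nondegeneracy hM
  obtain ⟨C₁, hC₁, hsup⟩ := h.exists_le_avg h.precise
  refine ⟨c / (4 * C₁), min R₁ 1, by positivity, by positivity, fun x hx r hr hrR => ?_⟩
  have hr1 := hrR.trans (min_le_right _ _)
  obtain ⟨y, hy, hcy⟩ := hnd x hx (r / 4) (by positivity) (by linarith [hrR.trans (min_le_left _ _)])
  have h1 := hsup x (r / 4) (by positivity) (by linarith) y hy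
  rw [mul_div_cancel₀ r four_ne_zero] at h1
  rw [div_mul_eq_mul_div, div_le_iff₀ (by positivity)]
  linarith

lemma exists_lo_fun (h : 𝓡) (hM : 𝓜) : ∃ C₁ R₁, 0 < C₁ ∧ 0 < R₁ ∧
      ∀ y ∈ 𝓐, ∀ s, 0 < s → s ≤ R₁ → ball y s ⊆ 𝓐 → s ≤ C₁ * u y := by
  obtain ⟨c, R₁, hc, hR₁, hlo⟩ := h.exists_lo_avg hM
  have hm := massk_pos (d := d)
  refine ⟨massk d / c, R₁, by positivity, hR₁, fun y hy s hs hsR hsub => ?_⟩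
  have h1 := hlo y (subset_closure hy) s hs hsR
  have h2 := h.avg_le_of_null h.precise (measure_mono_null hsub h.measure_posSet)
    (right_mem_Ioc.2 hs)
  rw [div_mul_eq_mul_div, le_div_iff₀ hc]
  linarith

lemma exists_lo_measure (h : 𝓡)
    (hM : 𝓜) : ∃ C₁ R₁, 0 < C₁ ∧ 0 < R₁ ∧
      ∀ x ∈ 𝓕, ∀ r, 0 < r → r ≤ R₁ → ball x (4 * r) ⊆ D →
        r ^ d ≤ C₁ * (r * μ.real (ball x r)) := by
  obtain ⟨c, R₁, hc, hR₁, hlo⟩ := h.exists_lo_avg hM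
  obtain ⟨C₂, R₂, hC₂, hR₂, -, hup⟩ := h.exists_growth_avg hM
  have hfin := h.fin
  set κ := min (1 / 2) (c / (2 * C₂))
  have hκ : 0 < κ := by positivity
  have hκ1 : κ ≤ 1 / 2 := min_le_left _ _
  have hκc : C₂ * κ ≤ c / 2 := by
    have : κ ≤ c / (2 * C₂) := min_le_right _ _
    rw [le_div_iff₀ (by positivity)] at this; linarith
  refine ⟨2 / c * κ⁻¹ ^ d, min R₁ R₂, by positivity, by positivity, fun x hx r hr hrR hD => ?_⟩
  have h1 := hlo x hx.2.2 r hr (hrR.trans (min_le_left _ _))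
  have hκr : κ * r < r := by nlinarith
  have h2 := hup x (κ * r) (by positivity) (hκr.le.trans (hrR.trans (min_le_right _ _)))
    ((ball_subset_ball (by linarith)).trans hD)
  rw [hx.2.1, mul_zero, zero_add] at h2
  obtain ⟨s, hs, hslope⟩ := exists_hasDerivAt_eq_slope (avg u x) _ hκr
    (fun s hs => (h.hasDerivAt x (lt_of_lt_of_le (by positivity : 0 < κ * r)
      hs.1)).continuousAt.continuousWithinAt)
    (fun s hs => h.hasDerivAt x (lt_trans (by positivity : 0 < κ * r) hs.1))
  have hs0 : 0 < s := lt_trans (by positivity : 0 < κ * r) hs.1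
  set m := μ.real (ball x r)
  have h3 : s * s⁻¹ ^ d * ((∫ y, bumpK x s y ∂μ) - lam * ∫ y, u y * bumpK x s y) ≤
      r * ((κ * r)⁻¹) ^ d * m := by
    have h4 : (∫ y, bumpK x s y ∂μ) - lam * ∫ y, u y * bumpK x s y ≤ m := by
      have := mul_nonneg h.lam_nonneg (h.integral_bump_nonneg x s)
      have h5 := h.integral_bumpK_le x hs0
      have h6 : μ.real (ball x s) ≤ m := measureReal_mono (ball_subset_ball hs.2.le)
        ((measure_mono ball_subset_closedBall).trans_lt (isCompact_closedBall x r).measure_lt_top).ne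
      linarith
    calc _ ≤ s * s⁻¹ ^ d * m := mul_le_mul_of_nonneg_left h4 (by positivity)
      _ ≤ r * ((κ * r)⁻¹) ^ d * m := by
        have := hs.1.le
        have := hs.2.le
        gcongr
  rw [hslope, div_le_iff₀ (by linarith)] at h3
  have h5 : c / 2 * r ≤ avg u x r - avg u x (κ * r) := by nlinarith
  have hm : 0 ≤ m := measureReal_nonneg
  have h6 : c / 2 * r ≤ r * ((κ * r)⁻¹) ^ d * m * r := by
    refine (h5.trans h3).trans (mul_le_mul_of_nonneg_left ?_ (by positivity))
    have : 0 < κ * r := by positivity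
    linarith
  have h7 : c / 2 ≤ r * ((κ * r)⁻¹) ^ d * m := le_of_mul_le_mul_right h6 hr
  have e : r⁻¹ ^ d * r ^ d = 1 := by rw [← mul_pow, inv_mul_cancel₀ hr.ne', one_pow]
  have h8 := mul_le_mul_of_nonneg_left h7 (by positivity : 0 ≤ 2 / c * r ^ d)
  rw [mul_inv, mul_pow] at h8
  calc r ^ d = 2 / c * r ^ d * (c / 2) := by field_simp
    _ ≤ _ := h8
    _ = 2 / c * κ⁻¹ ^ d * (r * m) * (r⁻¹ ^ d * r ^ d) := by ring
    _ = _ := by rw [e, mul_one]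

lemma exists_up_fun (h : 𝓡) (hM : 𝓜) : ∃ C₁ R₁, 0 < C₁ ∧ 0 < R₁ ∧
    ∀ x ∈ 𝓕, ∀ r, 0 < r → r ≤ R₁ → ball x (16 * r) ⊆ D → ∀ y ∈ closedBall x r, u y ≤ C₁ * r := by
  obtain ⟨C₂, R₂, hC₂, hR₂, -, hup⟩ := h.exists_growth_avg hM
  obtain ⟨C₁, hC₁, hsup⟩ := h.exists_le_avg h.precise
  refine ⟨C₁ * (C₂ * 4), min (R₂ / 4) 1, by positivity, by positivity,
    fun x hx r hr hrR hD y hy => ?_⟩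
  have h1 := hsup x r hr (hrR.trans (min_le_right _ _)) y hy
  have h2 := hup x (4 * r) (by positivity) (by linarith [hrR.trans (min_le_left _ _)])
    ((ball_subset_ball (by linarith)).trans hD)
  rw [hx.2.1, mul_zero, zero_add] at h2
  calc u y ≤ C₁ * avg u x (4 * r) := h1
    _ ≤ C₁ * (C₂ * (4 * r)) := by gcongr
    _ = _ := by ring

lemma exists_lo_vol (h : 𝓡)
    (hM : 𝓜) : ∃ C₁ R₁, 0 < C₁ ∧ 0 < R₁ ∧
      ∀ x ∈ 𝓕, ∀ r, 0 < r → r ≤ R₁ → ball x (16 * r) ⊆ D →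
        r ^ d ≤ C₁ * mvol (ball x r ∩ Ω) := by
  obtain ⟨c, R₁, hc, hR₁, hnd⟩ := h.exists_nondegeneracy hM
  obtain ⟨C₂, R₂, hC₂, hR₂, hup⟩ := h.exists_up_fun hM
  obtain ⟨C₃, hC₃, hsup⟩ := h.exists_sup_bound h.precise
  refine ⟨2 / c * (C₃ * 4 ^ d * C₂), min (min R₁ R₂) 1, by positivity, by positivity,
    fun x hx r hr hrR hD => ?_⟩
  obtain ⟨y, hy, hcy⟩ := hnd x hx.2.2 (r / 2) (by positivity)
    (by linarith [hrR.trans ((min_le_left _ _).trans (min_le_left _ _))])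
  have h1 := hsup y (r / 4) (by positivity) (by linarith [hrR.trans (min_le_right _ _)])
  rw [mem_closedBall] at hy
  have hsub : closedBall y (r / 4) ⊆ ball x r := fun w hw => by
    rw [mem_closedBall] at hw
    have := dist_triangle w y x
    rw [mem_ball]; linarith
  have h2 := h.integral_le_mvol (isCompact_closedBall y (r / 4)) (M := C₂ * r) fun w hw =>
    hup x hx r hr (hrR.trans ((min_le_left _ _).trans (min_le_right _ _))) hD w
      (ball_subset_closedBall (hsub hw))
  set m := mvol (ball x r ∩ Ω)
  have h3 : mvol (closedBall y (r / 4) ∩ Ω) ≤ m := mvol_mono (inter_subset_inter_left _ hsub)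
    (h.volume_ne_top (inter_subset_right.trans h.subset))
  have h4 : c * (r / 2) ≤ C₃ * ((r / 4)⁻¹) ^ d * (C₂ * r * m) := by
    refine hcy.le.trans (h1.trans ?_)
    gcongr
    exact h2.trans (by gcongr)
  have e : r⁻¹ ^ d * r ^ d = 1 := by rw [← mul_pow, inv_mul_cancel₀ hr.ne', one_pow]
  have h5 : c / 2 ≤ C₃ * ((r / 4)⁻¹) ^ d * (C₂ * m) := by
    refine le_of_mul_le_mul_right (a := r) ?_ hr
    linarith
  have h6 := mul_le_mul_of_nonneg_left h5 (by positivity : 0 ≤ 2 / c * r ^ d)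
  rw [inv_div, div_eq_mul_inv 4 r, mul_pow] at h6
  calc r ^ d = 2 / c * r ^ d * (c / 2) := by field_simp
    _ ≤ _ := h6
    _ = 2 / c * (C₃ * 4 ^ d * C₂) * m * (r⁻¹ ^ d * r ^ d) := by ring
    _ = _ := by rw [e, mul_one]

lemma exists_lo_compl (h : 𝓡)
    (hM : 𝓜) : ∃ C₁ R₁, 0 < C₁ ∧ 0 < R₁ ∧
      ∀ x ∈ 𝓕, ∀ r, 0 < r → r ≤ R₁ → ball x r ⊆ D →
        r ^ d ≤ C₁ * mvol (ball x r \ Ω) := by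
  have hΛ := h.multiplier_pos hM
  obtain ⟨A, hA0, hA⟩ := h.energyJ_bump_le
  obtain ⟨C₃, R₃, hC₃, hR₃, hlo⟩ := h.exists_lo_measure hM
  obtain ⟨k, hk0, -, hk⟩ := exists_kerK_lower (d := d)
  have hfin := h.fin
  have ho := omd_pos (d := d)
  have hC0 := hM.C_pos
  have hρ := hM.ρ_pos
  set q := 2 * k * 2⁻¹ ^ d / C₃ with hq
  have hq0 : 0 < q := by positivity
  refine ⟨A / q ^ 2 * 2 ^ d * (Λ + C * ρ), min (min ρ 1) (min (ρ / omd d) R₃), by positivity,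
    by positivity, fun x hx r hr hrR hD => ?_⟩
  simp only [le_min_iff, le_div_iff₀ ho] at hrR
  obtain ⟨⟨hrρ, hr1⟩, hrω, hrR₃⟩ := hrR
  set V := mvol (ball x r \ Ω)
  have hV0 : 0 ≤ V := mvol_nonneg _
  have hV : V ≤ ρ := by
    refine (mvol_mono sdiff_subset measure_ball_lt_top.ne).trans (le_trans ?_ hrω)
    rw [mvol_ball x hr]
    exact mul_le_mul_of_nonneg_right (pow_le_of_le_one hr.le hr1 h.dim_pos.ne') ho.le
  set θ := q / A
  have hθ : 0 < θ := by positivity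
  have key := h.out_ineq hM hD hrρ hV (bumpK_testFun x (r := r / 2) (by positivity)
    (closedBall_subset_ball (by linarith))) (θ * (r / 2))
  have h1 := hA x (r / 2) (by positivity)
  have h2 := h.le_integral_bumpK hk x (r := r / 2) (by positivity)
  have h3 := hlo x hx (r / 4) (by positivity)
    (by linarith)
    ((ball_subset_ball (by linarith)).trans hD)
  set I := ∫ y, bumpK x (r / 2) y ∂μ
  have h4 : k * μ.real (ball x (r / 4)) ≤ I := by
    refine le_trans ?_ h2
    rw [show r / 2 / 2 = r / 4 by ring]
    gcongr
    · exact (isCompact_closedBall x _).measure_lt_top.ne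
    · exact ball_subset_closedBall
  have h5 : 2 * q * (r / 2) ^ d ≤ r * I := by
    have e : r / 4 = 2⁻¹ * (r / 2) := by ring
    have h6 : 2⁻¹ ^ d * (r / 2) ^ d ≤ C₃ * (r / 4 * μ.real (ball x (r / 4))) := by
      rw [← mul_pow, ← e]; exact h3
    calc 2 * q * (r / 2) ^ d = 4 * k / C₃ * (2⁻¹ ^ d * (r / 2) ^ d) := by rw [hq]; ring
      _ ≤ 4 * k / C₃ * (C₃ * (r / 4 * μ.real (ball x (r / 4)))) := by gcongr
      _ = r * (k * μ.real (ball x (r / 4))) := by field_simp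
      _ ≤ _ := by gcongr
  have h6 : θ * (2 * q * (r / 2) ^ d) ≤ θ ^ 2 * (A * (r / 2) ^ d) + (Λ * V + C * V ^ 2) := by
    calc θ * (2 * q * (r / 2) ^ d) ≤ θ * (r * I) := by gcongr
      _ = 2 * (θ * (r / 2)) * I := by ring
      _ ≤ _ := key
      _ = θ ^ 2 * ((r / 2) ^ 2 * energyJ lam (bumpK x (r / 2))
            (fun y => gradient (bumpK x (r / 2)) y)) + (Λ * V + C * V ^ 2) := by
          rw [mul_pow θ]; ring
      _ ≤ _ := by gcongr
  have h7 : C * V ^ 2 ≤ C * ρ * V := by rw [sq, mul_assoc]; gcongr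
  have e1 : θ * (2 * q * (r / 2) ^ d) - θ ^ 2 * (A * (r / 2) ^ d) = q ^ 2 / A * (r / 2) ^ d := by
    simp only [θ]; field_simp; ring
  have h8 : q ^ 2 / A * (r / 2) ^ d ≤ (Λ + C * ρ) * V := by rw [← e1]; linarith
  have e2 : r ^ d = 2 ^ d * (r / 2) ^ d := by rw [← mul_pow]; congr 1; ring
  calc r ^ d = A / q ^ 2 * 2 ^ d * (q ^ 2 / A * (r / 2) ^ d) := by rw [e2]; field_simp
    _ ≤ A / q ^ 2 * 2 ^ d * ((Λ + C * ρ) * V) := by gcongr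
    _ = _ := by ring

theorem exists_freeBdryEst (h : 𝓡) (hM : 𝓜) : ∃ C₀ R₀, FreeBdryEst D Ω u μ C₀ R₀ := by
  obtain ⟨C₁, R₁, hC₁, hR₁, f₁, -⟩ := h.exists_growth_avg hM
  obtain ⟨C₂, R₂, hC₂, hR₂, f₂⟩ := h.exists_up_fun hM
  obtain ⟨C₃, R₃, hC₃, hR₃, f₃⟩ := h.exists_lo_measure hM
  obtain ⟨C₄, R₄, hC₄, hR₄, f₄⟩ := h.exists_lo_vol hM
  obtain ⟨C₅, R₅, hC₅, hR₅, f₅⟩ := h.exists_lo_compl hM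
  obtain ⟨C₆, R₆, hC₆, hR₆, f₆⟩ := h.exists_lo_fun hM
  obtain ⟨R, hR, l₁, l₂, l₃, l₄, l₅, l₆⟩ : ∃ R > 0, R ≤ R₁ ∧ R ≤ R₂ ∧ R ≤ R₃ ∧ R ≤ R₄ ∧ R ≤ R₅ ∧
      R ≤ R₆ := ⟨min (min R₁ R₂) (min (min R₃ R₄) (min R₅ R₆)), by positivity, by simp⟩
  have bs : ∀ {x : Euc d} {s t : ℝ}, s ≤ t → ball x t ⊆ D → ball x s ⊆ D := fun hst hD =>
    (ball_subset_ball hst).trans hD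
  refine ⟨C₁ + C₂ + C₃ + C₄ + C₅ + C₆, R, by positivity, by positivity, ?_, ?_, ?_, ?_, ?_, ?_⟩
  · intro x r hr hrR hD
    refine (f₁ x r hr (hrR.trans l₁) (bs (by linarith) hD)).trans ?_
    gcongr; linarith
  · intro x hx r hr hrR hD y hy
    refine (f₂ x hx r hr (hrR.trans l₂) (bs (by linarith) hD) y hy).trans ?_
    gcongr; linarith
  · intro x hx r hr hrR hD
    refine (f₃ x hx r hr (hrR.trans l₃) (bs (by linarith) hD)).trans ?_
    have := measureReal_nonneg (μ := μ) (s := ball x r)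
    gcongr; linarith
  · intro x hx r hr hrR hD
    refine (f₄ x hx r hr (hrR.trans l₄) (bs (by linarith) hD)).trans ?_
    have := mvol_nonneg (ball x r ∩ Ω)
    gcongr; linarith
  · intro x hx r hr hrR hD
    refine (f₅ x hx r hr (hrR.trans l₅) (bs (by linarith) hD)).trans ?_
    have := mvol_nonneg (ball x r \ Ω)
    gcongr; linarith
  · intro y hy s hs hsR hsub
    refine (f₆ y hy s hs (hsR.trans l₆) hsub).trans ?_
    have := h.nonneg y
    gcongr; linarith

end RegState

/-! ### The distributional gradient of the optimal set -/

lemma lintegral_mul_measure_closedBall (μ : Measure (Euc d)) [SFinite μ] {h : Euc d → ℝ≥0∞}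
    (hh : Measurable h) (r : ℝ) :
    ∫⁻ y, h y * μ (closedBall y r) = ∫⁻ x, (∫⁻ y in closedBall x r, h y) ∂μ := by
  have hS : MeasurableSet {p : Euc d × Euc d | dist p.1 p.2 ≤ r} :=
    measurableSet_le (by fun_prop) measurable_const
  have hm : Measurable (fun p : Euc d × Euc d =>
      ({p : Euc d × Euc d | dist p.1 p.2 ≤ r}).indicator (fun p => h p.1) p) :=
    (hh.comp measurable_fst).indicator hS
  have := lintegral_lintegral_swap (μ := (volume : Measure (Euc d))) (ν := μ)
    (f := fun y x => ({p : Euc d × Euc d | dist p.1 p.2 ≤ r}).indicator (fun p => h p.1) (y, x))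
    hm.aemeasurable
  convert this using 2
  · ext y
    rw [← lintegral_indicator_const (measurableSet_closedBall)]
    refine lintegral_congr fun x => ?_
    simp only [indicator, mem_closedBall, mem_ofPred_eq, dist_comm x y]
  · ext x
    rw [← lintegral_indicator measurableSet_closedBall]
    refine lintegral_congr fun y => ?_
    simp only [indicator, mem_closedBall, mem_ofPred_eq]

lemma exists_inner_of_bound {V H : Type*} [AddCommGroup V] [Module ℝ V] [NormedAddCommGroup H]
    [InnerProductSpace ℝ H] [CompleteSpace H] (A : V →ₗ[ℝ] H) (T : V →ₗ[ℝ] ℝ)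
    (hC : ∀ v, |T v| ≤ C * ‖A v‖) : ∃ g : H, ∀ v, T v = ⟪g, A v⟫ := by
  obtain ⟨s, hs⟩ := A.rangeRestrict.exists_rightInverse_of_surjective A.range_rangeRestrict
  have hs' : ∀ y : LinearMap.range A, A (s y) = y := fun y => by
    have := congrArg Subtype.val (LinearMap.congr_fun hs y)
    simpa using this
  let f : LinearMap.range A →L[ℝ] ℝ := (T.comp s).mkContinuous C fun y => by
    rw [LinearMap.comp_apply, Real.norm_eq_abs]
    exact (hC _).trans_eq (by rw [hs']; rfl)
  obtain ⟨g, hg, -⟩ := exists_extension_norm_eq (𝕜 := ℝ) (LinearMap.range A) f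
  refine ⟨(InnerProductSpace.toDual ℝ H).symm g, fun v => ?_⟩
  rw [InnerProductSpace.toDual_symm_apply]
  have h1 := hg ⟨A v, LinearMap.mem_range_self A v⟩
  have h2 := hC (v - s ⟨A v, LinearMap.mem_range_self A v⟩)
  rw [map_sub, map_sub, hs', sub_self, norm_zero, mul_zero] at h2
  have h3 := abs_nonpos_iff.1 h2
  simp only at h1
  rw [h1]
  exact sub_eq_zero.1 h3

namespace RegState

lemma exists_freeBdry_mem_ball (h : 𝓡) {w : Euc d}
    (hD : ball y s ⊆ D) (hz : z ∈ ball y s) (hzP : z ∈ 𝓐) (hw : w ∈ ball y s)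
    (hwP : w ∉ 𝓐) : ∃ x ∈ 𝓕, x ∈ ball y s := by
  by_contra! hcon
  refine hwP ((convex_ball y s).isPreconnected.subset_of_closure_inter_subset h.isOpen_posSet
    ⟨z, hz, hzP⟩ (fun x hx => ?_) hw)
  refine ⟨hD hx.2, ?_⟩
  by_contra hx0
  exact hcon x ⟨hD hx.2, le_antisymm (not_lt.1 hx0) (h.nonneg x), hx.1⟩ hx.2

lemma deriv_trunc_le (h : 𝓡) (hE : 𝓔) :
    ∃ C', 0 < C' ∧ ∀ ε y, 0 < ε → 2 * C * ε ≤ R → ball y (9 * (2 * C * ε)) ⊆ D →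
      deriv (trunc ε) (u y) ≤ C' * ((2 * C * ε)⁻¹) ^ d * μ.real (closedBall y (2 * (2 * C * ε))) := by
  obtain ⟨C₁, hC₁, hb⟩ := exists_deriv_trunc_bound
  have hC := hE.C_pos
  have := h.fin
  refine ⟨2 * (C₁ + 1) * C ^ 2, by positivity, fun ε y hε hεR hD => ?_⟩
  set s := 2 * C * ε with hs
  have hs0 : 0 < s := by positivity
  have key : 0 < u y → u y < ε → deriv (trunc ε) (u y) ≤
      2 * (C₁ + 1) * C ^ 2 * s⁻¹ ^ d * μ.real (closedBall y (2 * s)) := fun h0 h1 => by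
    have hyD : y ∈ D := hD (mem_ball_self (by positivity))
    have hsD : ball y s ⊆ D := (ball_subset_ball (by linarith)).trans hD
    obtain ⟨w, hw, hwP⟩ : ∃ w ∈ ball y s, w ∉ 𝓐 := by
      by_contra! hcon
      have := hE.lo_fun y ⟨hyD, h0⟩ s hs0 hεR hcon
      nlinarith
    obtain ⟨x, hxE, hx⟩ := h.exists_freeBdry_mem_ball hsD (mem_ball_self hs0) ⟨hyD, h0⟩ hw hwP
    rw [mem_ball] at hx
    have h2 := hE.lo_measure x hxE s hs0 hεR ((ball_subset_ball' (by linarith)).trans hD)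
    have h3 : μ.real (ball x s) ≤ μ.real (closedBall y (2 * s)) :=
      measureReal_mono (ball_subset_closedBall.trans (closedBall_subset_closedBall' (by linarith)))
        (isCompact_closedBall y _).measure_lt_top.ne
    have h4 : (1 : ℝ) ≤ C * s * s⁻¹ ^ d * μ.real (closedBall y (2 * s)) := by
      calc (1 : ℝ) = s⁻¹ ^ d * s ^ d := by rw [← mul_pow, inv_mul_cancel₀ hs0.ne', one_pow]
        _ ≤ s⁻¹ ^ d * (C * (s * μ.real (closedBall y (2 * s)))) := by
          gcongr; exact h2.trans (by gcongr)
        _ = _ := by ring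
    calc deriv (trunc ε) (u y) ≤ C₁ / ε := (le_abs_self _).trans (hb ε hε _)
      _ ≤ (C₁ + 1) / ε * 1 := by rw [mul_one]; gcongr; linarith
      _ ≤ (C₁ + 1) / ε * (C * s * s⁻¹ ^ d * μ.real (closedBall y (2 * s))) := by gcongr
      _ = _ := by rw [hs]; field_simp
  have hpos : 0 ≤ 2 * (C₁ + 1) * C ^ 2 * s⁻¹ ^ d * μ.real (closedBall y (2 * s)) := by positivity
  rcases (h.nonneg y).eq_or_lt with h0 | h0
  · rw [← h0, deriv_trunc_zero]; exact hpos
  · rcases lt_or_ge (u y) ε with h1 | h1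
    · exact key h0 h1
    · rw [deriv_trunc_eq_zero hε h1]; exact hpos

lemma exists_layer_bound (h : 𝓡) (hE : 𝓔)
    (hr₀ : 0 < r₀) (hD : ball x₀ (4 * r₀) ⊆ D) :
    ∃ C', 0 < C' ∧ ∀ φ, TestFun (ball x₀ r₀) φ → ∀ τ, 0 < τ → ∀ᶠ ε in 𝓝[>] (0 : ℝ),
      ∫ y, deriv (trunc ε) (u y) * φ y ^ 2 ≤ C' * (∫ y, φ y ^ 2 ∂μ + τ) := by
  obtain ⟨C', hC', hder⟩ := h.deriv_trunc_le hE
  have hC := hE.C_pos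
  have hR := hE.R_pos
  have := h.fin
  have ho := omd_pos (d := d)
  set M := μ.real (closedBall x₀ (2 * r₀)) with hM
  refine ⟨C' * 2 ^ d * omd d * (M + 1), by positivity, fun φ hφ τ hτ => ?_⟩
  have hψc : Continuous fun y => φ y ^ 2 := hφ.continuous.pow 2
  have hψs : HasCompactSupport fun y => φ y ^ 2 :=
    hφ.2.1.comp_left (g := fun t : ℝ => t ^ 2) (by simp)
  have hψz : ∀ y, r₀ ≤ dist y x₀ → φ y = 0 := fun y hy =>
    image_eq_zero_of_notMem_tsupport fun hy' => by
      have := hφ.2.2 hy'; rw [mem_ball] at this; linarith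
  obtain ⟨δ, hδ, hunif⟩ := uniformContinuous_iff.1 (hψs.uniformContinuous_of_continuous hψc) τ hτ
  have e1 : ∀ᶠ ε in 𝓝[>] (0 : ℝ), 9 * (2 * C * ε) < min R (min δ r₀) := by
    have : Tendsto (fun ε : ℝ => 9 * (2 * C * ε)) (𝓝[>] 0) (𝓝 0) :=
      tendsto_nhdsGT_zero (by fun_prop) (by simp)
    exact this.eventually (gt_mem_nhds (by positivity))
  filter_upwards [e1, self_mem_nhdsWithin] with ε hε (hε0 : 0 < ε)
  set s := 2 * C * ε with hs
  have hs0 : 0 < s := by positivity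
  obtain ⟨hsR, hsδ, hsr⟩ : 9 * s < R ∧ 9 * s < δ ∧ 9 * s < r₀ := by simpa only [lt_min_iff] using hε
  set K := closedBall x₀ (2 * r₀)
  have hKm : MeasurableSet K := measurableSet_closedBall
  have iφ : Integrable (fun y => φ y ^ 2) μ := hψc.integrable_of_hasCompactSupport hψs
  have iτ : Integrable (K.indicator fun _ => τ) μ := (integrable_indicator_iff hKm).2
    (continuous_const.continuousOn.integrableOn_compact (isCompact_closedBall x₀ _))
  have iK : Integrable (fun x => (φ x ^ 2 + K.indicator (fun _ => τ) x)) μ := iφ.add iτ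
  have inner : ∀ x, ∫⁻ y in closedBall x (2 * s), ofReal (φ y ^ 2) ≤
      ofReal ((2 * s) ^ d * omd d * (φ x ^ 2 + K.indicator (fun _ => τ) x)) := fun x => by
    by_cases hx : x ∈ K
    · calc ∫⁻ y in closedBall x (2 * s), ofReal (φ y ^ 2)
          ≤ ∫⁻ y in closedBall x (2 * s), ofReal (φ x ^ 2 + τ) := by
            refine setLIntegral_mono measurable_const fun y hy => ENNReal.ofReal_le_ofReal ?_
            have := hunif (a := y) (b := x) (by rw [mem_closedBall] at hy; linarith)
            rw [Real.dist_eq] at this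
            linarith [le_abs_self (φ y ^ 2 - φ x ^ 2)]
        _ = ofReal (φ x ^ 2 + τ) * ofReal (mvol (closedBall x (2 * s))) := by
            rw [setLIntegral_const, mvol, ENNReal.ofReal_toReal
              (isCompact_closedBall x _).measure_lt_top.ne]
        _ = _ := by
            rw [← ENNReal.ofReal_mul (by positivity), mvol_closedBall _ (by positivity),
              indicator_of_mem hx, mul_comm]
    · rw [setLIntegral_congr_fun (g := fun _ => 0) measurableSet_closedBall]
      · simp
      · intro y hy
        rw [mem_closedBall] at hy
        have hx' : 2 * r₀ < dist x x₀ := not_le.1 hx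
        have := dist_triangle x y x₀
        rw [dist_comm x y] at this
        simp only [hψz y (by linarith)]
        simp
  have hle : ∫⁻ y, ofReal (deriv (trunc ε) (u y) * φ y ^ 2) ≤
      ofReal (C' * 2 ^ d * omd d * (M + 1) * (∫ y, φ y ^ 2 ∂μ + τ)) := by
    calc ∫⁻ y, ofReal (deriv (trunc ε) (u y) * φ y ^ 2) ≤ ∫⁻ y, ofReal (C' * s⁻¹ ^ d) *
        (ofReal (φ y ^ 2) * μ (closedBall y (2 * s))) := by
          refine lintegral_mono fun y => ?_
          rcases lt_or_ge (dist y x₀) r₀ with hy | hy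
          · have := hder ε y hε0 (by linarith) ((ball_subset_ball' (by linarith)).trans hD)
            rw [← ENNReal.ofReal_toReal (isCompact_closedBall y (2 * s)).measure_lt_top.ne,
              ← ENNReal.ofReal_mul (by positivity), ← ENNReal.ofReal_mul (by positivity)]
            refine ENNReal.ofReal_le_ofReal ?_
            calc _ ≤ C' * s⁻¹ ^ d * μ.real (closedBall y (2 * s)) * φ y ^ 2 := by gcongr
              _ = _ := by rw [measureReal_def]; ring
          · simp [hψz y hy]
      _ = ofReal (C' * s⁻¹ ^ d) * ∫⁻ x, (∫⁻ y in closedBall x (2 * s), ofReal (φ y ^ 2)) ∂μ := by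
          rw [lintegral_const_mul' _ _ ENNReal.ofReal_ne_top, lintegral_mul_measure_closedBall μ
            hψc.measurable.ennreal_ofReal]
      _ ≤ ofReal (C' * s⁻¹ ^ d) * ∫⁻ x, ofReal ((2 * s) ^ d * omd d *
            (φ x ^ 2 + K.indicator (fun _ => τ) x)) ∂μ := by
          gcongr with x; exact inner x
      _ = ofReal (C' * 2 ^ d * omd d * (∫ y, φ y ^ 2 ∂μ + τ * M)) := by
          rw [← ofReal_integral_eq_lintegral_ofReal (iK.const_mul _), integral_const_mul,
            integral_add iφ iτ, integral_indicator hKm, setIntegral_const, ← ENNReal.ofReal_mul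
            (by positivity), smul_eq_mul]
          · congr 1
            have : s⁻¹ ^ d * s ^ d = 1 := by rw [← mul_pow, inv_mul_cancel₀ hs0.ne', one_pow]
            rw [mul_pow]
            linear_combination (C' * 2 ^ d * omd d * (∫ y, φ y ^ 2 ∂μ + τ * M)) * this
          · refine .of_forall fun x => ?_
            have : 0 ≤ K.indicator (fun _ => τ) x := indicator_nonneg (fun _ _ => hτ.le) _
            simp only [Pi.zero_apply]
            positivity
      _ ≤ _ := by
          refine ENNReal.ofReal_le_ofReal ?_
          have h1 : 0 ≤ ∫ y, φ y ^ 2 ∂μ := by positivity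
          have h2 : 0 ≤ M := measureReal_nonneg
          have : ∫ y, φ y ^ 2 ∂μ + τ * M ≤ (M + 1) * (∫ y, φ y ^ 2 ∂μ + τ) := by nlinarith
          calc _ ≤ C' * 2 ^ d * omd d * ((M + 1) * (∫ y, φ y ^ 2 ∂μ + τ)) := by gcongr
            _ = _ := by ring
  have h1 : 0 ≤ ∫ y, φ y ^ 2 ∂μ := by positivity
  rw [integral_eq_lintegral_of_nonneg_ae
    (.of_forall fun y => mul_nonneg (deriv_trunc_nonneg hε0 _) (sq_nonneg _))]
  · exact ENNReal.toReal_le_of_le_ofReal (by positivity) hle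
  · exact (((contDiff_trunc ε).continuous_deriv (by simp)).comp_aestronglyMeasurable
      h.inH.memV.1).mul hψc.aestronglyMeasurable


lemma tendsto_trunc_volVar (h : 𝓡) (hφ : TestFun univ φ)
    (w : Euc d) : Tendsto (fun ε => ∫ y, trunc ε (u y) * ⟪gradient φ y, w⟫) (𝓝[>] 0)
      (𝓝 (volVar φ w Ω)) := by
  rw [volVar, ← integral_indicator h.openΩ.measurableSet]
  refine tendsto_integral_filter_of_dominated_convergence (fun y => ‖⟪gradient φ y, w⟫‖)
    (.of_forall fun ε => ?_) (.of_forall fun ε => .of_forall fun y => ?_)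
    (integrable_volVar hφ w).norm ?_
  · exact ((contDiff_trunc ε).continuous.comp_aestronglyMeasurable h.inH.memV.1).mul
      (integrable_volVar hφ w).1
  · rw [norm_mul, Real.norm_of_nonneg (trunc_nonneg _ _)]
    exact mul_le_of_le_one_left (norm_nonneg _) (trunc_le_one _ _)
  · filter_upwards [h.inH.ae_eq_zero] with y hy
    by_cases hyΩ : y ∈ Ω
    · rw [indicator_of_mem hyΩ]
      simpa using (tendsto_trunc (h.subset_posSet hyΩ).2).mul_const ⟪gradient φ y, w⟫
    · simp [indicator_of_notMem hyΩ, hy hyΩ, trunc_zero]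

lemma exists_volVar_bound (h : 𝓡) (hE : 𝓔) (hr₀ : 0 < r₀) (hD : ball x₀ (4 * r₀) ⊆ D) :
    ∃ K, 0 ≤ K ∧ ∀ φ, TestFun (ball x₀ r₀) φ → ∀ w : Euc d, ‖w‖ ≤ 1 →
      (volVar φ w Ω) ^ 2 ≤ K * ∫ y, φ y ^ 2 ∂μ := by
  obtain ⟨C', hC', hlay⟩ := h.exists_layer_bound hE hr₀ hD
  set χ := cutB x₀ r₀
  have hχ : TestFun univ χ := cutB_testFun x₀ hr₀ (subset_univ _)
  set K₀ := ∫ y, χ y ∂μ with hK₀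
  have hK0 : 0 ≤ K₀ := integral_nonneg fun y => cutB_nonneg _ _ _
  have key : ∀ φ, TestFun (ball x₀ r₀) φ → ∀ w : Euc d, ‖w‖ ≤ 1 →
      volVar φ w Ω ≤ K₀ + 1 + C' * (∫ y, φ y ^ 2 ∂μ + 1) := fun φ hφ w hw => by
    have hφu := hφ.mono (subset_univ _)
    have t1 := h.tendsto_trunc_volVar hφu w
    have t2 := h.tendsto_trunc_integral hχ
    rw [← h.repr χ hχ, ← hK₀] at t2
    refine le_of_tendsto t1 ?_
    filter_upwards [hlay φ hφ 1 one_pos, t2.eventually (gt_mem_nhds (lt_add_one K₀)),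
      self_mem_nhdsWithin] with ε h1 h2 hε
    obtain ⟨C₁, -, hb⟩ := exists_deriv_trunc_bound
    have hc := h.inH.comp (contDiff_trunc ε) (trunc_zero ε) (hb ε hε)
    have e1 := hc.integral_mul_divg (X := fun y => φ y • w) (hφ.1.smul contDiff_const)
      (hφ.2.1.smul_right)
    simp_rw [fun y => divg_smul_const (hφ.differentiable y) w] at e1
    have hdm : AEStronglyMeasurable (fun y => deriv (trunc ε) (u y)) volume :=
      ((contDiff_trunc ε).continuous_deriv (by simp)).comp_aestronglyMeasurable h.inH.memV.1
    have i1 : Integrable fun y => deriv (trunc ε) (u y) * ‖G y‖ ^ 2 * χ y := by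
      have := Integrable.bdd_mul (c := C₁ / ε) (integrable_bdd_mul (integrable_sq_of_memLp
        h.inH.memG) hχ.continuous (C := 1) fun y => by
          rw [abs_of_nonneg (cutB_nonneg _ _ _)]; exact cutB_le_one _ _ _)
        hdm (.of_forall fun y => hb ε hε _)
      exact this.congr (.of_forall fun y => by ring)
    have i2 : Integrable fun y => deriv (trunc ε) (u y) * φ y ^ 2 :=
      Integrable.bdd_mul (c := C₁ / ε) (integrable_sq_of_memLp (hφ.memLp 2 volume) |>.congr
        (by simp)) hdm (.of_forall fun y => hb ε hε _)
    rw [e1, ← integral_neg]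
    calc ∫ y, -⟪deriv (trunc ε) (u y) • G y, φ y • w⟫
        ≤ ∫ y, (deriv (trunc ε) (u y) * ‖G y‖ ^ 2 * χ y + deriv (trunc ε) (u y) * φ y ^ 2) := by
          refine integral_mono (integrable_inner_of_memLp_two hc.memG
            ((hφ.continuous.smul continuous_const).memLp_of_hasCompactSupport
              hφ.2.1.smul_right)).neg (i1.add i2) fun y => ?_
          simp only [inner_smul_left, inner_smul_right, conj_trivial]
          have hd := deriv_trunc_nonneg hε (u y)
          by_cases hy : φ y = 0
          · simp only [hy]
            have := mul_nonneg (mul_nonneg hd (sq_nonneg ‖G y‖)) (cutB_nonneg x₀ r₀ y)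
            simp only [χ]; linarith
          · have hyb : y ∈ ball x₀ r₀ := hφ.2.2 (subset_tsupport _ hy)
            rw [show χ y = 1 from cutB_eq_one hr₀ (mem_ball.1 hyb).le, mul_one]
            have h3 : |⟪G y, w⟫| ≤ ‖G y‖ :=
              (abs_real_inner_le_norm _ _).trans (mul_le_of_le_one_right (norm_nonneg _) hw)
            have h4 : -(φ y * ⟪G y, w⟫) ≤ ‖G y‖ ^ 2 + φ y ^ 2 := by
              have := abs_le_abs_of_nonneg (abs_nonneg ⟪G y, w⟫) h3 
              nlinarith [sq_abs ⟪G y, w⟫, sq_nonneg (φ y + ⟪G y, w⟫), abs_nonneg ⟪G y, w⟫]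
            nlinarith
      _ ≤ _ := by rw [integral_add i1 i2]; linarith
  refine ⟨4 * C' * (K₀ + 1 + C'), by positivity, fun φ hφ w hw => ?_⟩
  have quad : ∀ t : ℝ, 0 ≤ (C' * ∫ y, φ y ^ 2 ∂μ) * (t * t) + (-volVar φ w Ω) * t + (K₀ + 1 + C') :=
      fun t => by
    have := key _ (hφ.const_mul t) w hw
    rw [volVar_const_mul hφ] at this
    simp_rw [mul_pow] at this
    rw [integral_const_mul] at this
    linarith
  have := discrim_le_zero quad
  rw [discrim] at this
  linarith

lemma exists_density (h : 𝓡) (hE : 𝓔)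
    (hr₀ : 0 < r₀) (hD : ball x₀ (4 * r₀) ⊆ D) {w : Euc d} (hw : ‖w‖ ≤ 1) :
    ∃ g : Euc d → ℝ, LocallyIntegrable g μ ∧ ∀ φ, TestFun (ball x₀ r₀) φ →
      volVar φ w Ω = ∫ y, g y * φ y ∂μ := by
  obtain ⟨K, hK, hb⟩ := h.exists_volVar_bound hE hr₀ hD
  have := h.fin
  let V : Submodule ℝ (Euc d → ℝ) :=
    { carrier := {φ | TestFun (ball x₀ r₀) φ}
      add_mem' := fun ha hb => TestFun.add ha hb
      zero_mem' := TestFun.zero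
      smul_mem' := fun c f hf => TestFun.const_mul hf c }
  let A : V →ₗ[ℝ] Lp ℝ 2 μ :=
    { toFun := fun φ => (TestFun.memLp φ.2 2 μ).toLp φ.1
      map_add' := fun φ ψ => MemLp.toLp_add _ _
      map_smul' := fun c φ => MemLp.toLp_const_smul c _ }
  let T : V →ₗ[ℝ] ℝ :=
    { toFun := fun φ => volVar φ.1 w Ω
      map_add' := fun φ ψ => by
        rw [volVar, volVar, volVar, ← integral_add (integrable_volVar φ.2 w).integrableOn
          (integrable_volVar ψ.2 w).integrableOn]
        refine integral_congr_ae (.of_forall fun y => ?_)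
        simp only
        rw [← inner_add_left, ← gradient_add (TestFun.differentiable φ.2 y)
          (TestFun.differentiable ψ.2 y)]
        rfl
      map_smul' := fun c φ => volVar_const_mul φ.2 c }
  have hA : ∀ φ : V, ‖A φ‖ ^ 2 = ∫ y, φ.1 y ^ 2 ∂μ := fun φ => by
    rw [← real_inner_self_eq_norm_sq, L2.inner_def]
    refine integral_congr_ae ?_
    filter_upwards [(TestFun.memLp φ.2 2 μ).coeFn_toLp] with y hy
    simp only [A, LinearMap.coe_mk, AddHom.coe_mk, hy, real_inner_self_eq_norm_sq,
      Real.norm_eq_abs, sq_abs]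
  obtain ⟨g, hg⟩ := exists_inner_of_bound A T (C := √K) fun φ => by
    refine abs_le_of_sq_le_sq ?_ (by positivity)
    rw [mul_pow, Real.sq_sqrt hK, hA]
    exact hb φ.1 φ.2 w hw
  refine ⟨g, (Lp.memLp g).locallyIntegrable (by norm_num), fun φ hφ => ?_⟩
  refine (hg ⟨φ, hφ⟩).trans ?_
  rw [L2.inner_def]
  refine integral_congr_ae ?_
  filter_upwards [(TestFun.memLp hφ 2 μ).coeFn_toLp] with y hy
  simp only [A, LinearMap.coe_mk, AddHom.coe_mk, hy]
  simp [mul_comm]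

end RegState

/-- At small scales around `x`, the distributional gradient of `1_Ω` is close to `g₀ μ`. -/
def AlmostNormal (Ω : Set (Euc d)) (μ : Measure (Euc d)) (x g₀ : Euc d) : Prop :=
  ∀ ε, 0 < ε → ∀ᶠ r in 𝓝[>] (0 : ℝ), ∀ φ, TestFun (ball x r) φ → (∀ y, |φ y| ≤ 1) →
    ∀ w : Euc d, ‖w‖ ≤ 1 → r * |volVar φ w Ω + ⟪g₀, w⟫ * ∫ y, φ y ∂μ| ≤ ε * r ^ d

lemma RegState.ae_almostNormal
    (h : 𝓡) (hE : 𝓔)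
    (hx₀ : x₀ ∈ D) :
    ∃ r, 0 < r ∧ ∀ᵐ x ∂μ, x ∈ ball x₀ r → ∃ g₀, AlmostNormal Ω μ x g₀ := by
  have := h.fin
  obtain ⟨r₁, hr₁, hr₁D⟩ := isOpen_iff.1 h.openD x₀ hx₀
  set r₀ := r₁ / 4
  have hr₀ : 0 < r₀ := by positivity
  have hD : ball x₀ (4 * r₀) ⊆ D := by rwa [mul_div_cancel₀ _ four_ne_zero]
  have hb : ∀ i, ‖EuclideanSpace.single i (1 : ℝ)‖ ≤ (1 : ℝ) := fun i : Fin d => by simp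
  choose g hg hgr using fun i => h.exists_density hE hr₀ hD (hb i)
  have hleb : ∀ᵐ x ∂μ, ∀ i, Tendsto (fun r => ⨍ y in closedBall x r, ‖g i y - g i x‖ ∂μ)
      (𝓝[>] 0) (𝓝 0) := by
    rw [ae_all_iff]
    intro i
    filter_upwards [(Besicovitch.vitaliFamily μ).ae_tendsto_average_norm_sub (hg i)] with x hx
    exact hx.comp (Besicovitch.tendsto_filterAt μ x)
  refine ⟨r₀, hr₀, hleb.mono fun x hx hxb => ⟨-(WithLp.toLp 2 fun i => g i x), fun ε hε => ?_⟩⟩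
  have hC := hE.C_pos
  have e1 : ∀ᶠ r in 𝓝[>] (0 : ℝ), ∀ i, ⨍ y in closedBall x r, ‖g i y - g i x‖ ∂μ <
      ε / (C * (d + 1)) := eventually_all.2 fun i => (hx i).eventually (gt_mem_nhds (by positivity))
  obtain ⟨s, hs, hsb⟩ := isOpen_iff.1 isOpen_ball x hxb
  have e2 : ∀ᶠ r in 𝓝[>] (0 : ℝ), r < min s (min (r₀ / 4) R) :=
    (gt_mem_nhds (by have := hE.R_pos; positivity)).filter_mono nhdsWithin_le_nhds
  filter_upwards [e1, e2, self_mem_nhdsWithin] with r h1 h2 (hr0 : 0 < r) φ hφ hφ1 w hw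
  obtain ⟨hrs, hrr, hrR⟩ : r < s ∧ r < r₀ / 4 ∧ r < R := by simpa only [lt_min_iff] using h2
  have hφW : TestFun (ball x₀ r₀) φ := hφ.mono ((ball_subset_ball hrs.le).trans hsb)
  have hB := isCompact_closedBall x r
  have hup := hE.up_measure x r hr0 hrR.le ((ball_subset_ball' (by
    rw [mem_ball] at hxb; linarith)).trans hD)
  have hφz : ∀ y, y ∉ closedBall x r → φ y = 0 := fun y hy =>
    image_eq_zero_of_notMem_tsupport fun hy' => hy (ball_subset_closedBall (hφ.2.2 hy'))
  set I := ∫ y, φ y ∂μ with hI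
  have coord : ∀ i, r * |volVar φ (EuclideanSpace.single i 1) Ω - g i x * I| ≤
      ε / (d + 1) * r ^ d := fun i => by
    have ig : IntegrableOn (fun y => g i y - g i x) (closedBall x r) μ :=
      ((hg i).sub (locallyIntegrable_const _)).integrableOn_isCompact hB
    have h3 : volVar φ (EuclideanSpace.single i 1) Ω - g i x * I =
        ∫ y in closedBall x r, (g i y - g i x) * φ y ∂μ := by
      rw [hgr i φ hφW, hI, ← integral_const_mul, ← integral_sub,
          setIntegral_eq_integral_of_forall_compl_eq_zero
        fun y hy => by rw [hφz y hy, mul_zero]]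
      · congr 1; ext y; ring
      · simpa [mul_comm] using (hg i).integrable_smul_left_of_hasCompactSupport hφ.continuous hφ.2.1
      · exact (hφ.integrable μ).const_mul _
    have h4 : |volVar φ (EuclideanSpace.single i 1) Ω - g i x * I| ≤
        ∫ y in closedBall x r, ‖g i y - g i x‖ ∂μ := by
      rw [h3, ← Real.norm_eq_abs]
      refine norm_integral_le_of_norm_le ig.norm (.of_forall fun y => ?_)
      rw [norm_mul]
      exact mul_le_of_le_one_right (norm_nonneg _) (hφ1 y)
    have h5 := h1 i
    have h6 : ∫ y in closedBall x r, ‖g i y - g i x‖ ∂μ =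
        μ.real (closedBall x r) * ⨍ y in closedBall x r, ‖g i y - g i x‖ ∂μ := by
      have : Fact (μ (closedBall x r) < ∞) := ⟨hB.measure_lt_top⟩
      rw [← measureReal_restrict_apply_univ, ← smul_eq_mul, measure_smul_average]
    calc r * |volVar φ (EuclideanSpace.single i 1) Ω - g i x * I|
        ≤ r * (μ.real (closedBall x r) * (ε / (C * (d + 1)))) := by
          gcongr
          rw [h6] at h4
          exact h4.trans (by gcongr)
      _ = r * μ.real (closedBall x r) * (ε / (C * (d + 1))) := by ring
      _ ≤ C * r ^ d * (ε / (C * (d + 1))) := by gcongr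
      _ = _ := by field_simp
  have hsum : volVar φ w Ω + ⟪-(WithLp.toLp 2 fun i => g i x), w⟫ * I =
      ∑ i, w i * (volVar φ (EuclideanSpace.single i 1) Ω - g i x * I) := by
    have e3 : volVar φ w Ω = ∑ i, w i * volVar φ (EuclideanSpace.single i 1) Ω := by
      simp_rw [volVar, ← integral_const_mul]
      rw [← integral_finsetSum _ fun i _ => ((integrable_volVar hφ _).const_mul _).integrableOn]
      refine integral_congr_ae (.of_forall fun y => ?_)
      simp only
      rw [PiLp.inner_apply]
      refine Finset.sum_congr rfl fun i _ => ?_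
      rw [EuclideanSpace.inner_single_right]
      simp only [RCLike.inner_apply, conj_trivial, one_mul]
    rw [e3, inner_neg_left]
    simp only [PiLp.inner_apply, mul_sub, Finset.sum_sub_distrib]
    rw [sub_eq_add_neg, neg_mul, Finset.sum_mul]
    congr 2
    refine Finset.sum_congr rfl fun i _ => ?_
    simp only [RCLike.inner_apply, conj_trivial]
    ring
  rw [hsum]
  calc r * |∑ i, w i * (volVar φ (EuclideanSpace.single i 1) Ω - g i x * I)|
      ≤ r * ∑ i, |w i * (volVar φ (EuclideanSpace.single i 1) Ω - g i x * I)| := by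
        gcongr; exact Finset.abs_sum_le_sum_abs _ _
    _ ≤ ∑ i : Fin d, ε / (d + 1) * r ^ d := by
        rw [Finset.mul_sum]
        refine Finset.sum_le_sum fun i _ => le_trans ?_ (coord i)
        rw [abs_mul]
        gcongr
        refine mul_le_of_le_one_left (abs_nonneg _) ?_
        exact (PiLp.norm_apply_le w i).trans hw
    _ = (d / (d + 1)) * (ε * r ^ d) := by simp; ring
    _ ≤ ε * r ^ d := by
        refine mul_le_of_le_one_left (by positivity) ?_
        rw [div_le_one (by positivity)]; linarith

/-! ### Flatness of the free boundary -/

lemma tendsto_const_mul_nhdsGT_zero (hc : 0 < c) :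
    Tendsto (fun r : ℝ => c * r) (𝓝[>] 0) (𝓝[>] 0) := by
  refine tendsto_nhdsWithin_iff.2 ⟨?_, ?_⟩
  · exact tendsto_nhdsGT_zero (by fun_prop) (by simp)
  · filter_upwards [self_mem_nhdsWithin] with r hr
    exact mul_pos hc hr

lemma le_setIntegral_bumpK (hc : ∀ z : Euc d, ‖z‖ ≤ 1 / 2 → c ≤ kerK z) (x : Euc d)
    (hr : 0 < r) (hS : MeasurableSet S) :
    c * mvol (ball x (r / 2) ∩ S) ≤ ∫ y in S, bumpK x r y := by
  have hi : Integrable (bumpK x r) := (bumpK_testFun x hr (subset_univ _)).integrable volume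
  have hfin : volume (ball x (r / 2) ∩ S) ≠ ∞ :=
    (measure_mono inter_subset_left).trans_lt measure_ball_lt_top |>.ne
  calc c * mvol (ball x (r / 2) ∩ S) = ∫ y in ball x (r / 2) ∩ S, c := by
        rw [setIntegral_const, smul_eq_mul, mul_comm]; rfl
    _ ≤ ∫ y in ball x (r / 2) ∩ S, bumpK x r y := by
        refine setIntegral_mono_on (integrableOn_const hfin) hi.integrableOn
          (measurableSet_ball.inter hS) fun y hy => hc _ ?_
        rw [norm_scale hr, inv_mul_le_iff₀ hr]
        linarith [mem_ball.1 hy.1]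
    _ ≤ _ := setIntegral_mono_set hi.integrableOn
        (.of_forall fun y => bumpK_nonneg _ _ _) inter_subset_right.eventuallyLE

lemma AlmostNormal.bump_le
    (hN : AlmostNormal Ω μ x g₀) {κ η : ℝ} (hκ : 0 < κ) (hκ1 : κ ≤ 1) (hη : 0 < η) :
    ∀ᶠ R in 𝓝[>] (0 : ℝ), ∀ z ∈ closedBall x (2 * R), ∀ z' ∈ closedBall x (2 * R),
      0 ≤ ⟪g₀, z' - z⟫ →
      (∫ y in Ω, bumpK z (κ * R) y) - η * (κ * R) ^ d ≤ ∫ y in Ω, bumpK z' (κ * R) y := by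
  have h1 := (tendsto_const_mul_nhdsGT_zero four_pos).eventually
    (hN (η * (κ / 4) ^ d) (by positivity))
  filter_upwards [h1, self_mem_nhdsWithin] with R h1 (hR : 0 < R) z hz z' hz' hzz
  have hδ : 0 < κ * R := by positivity
  have hδR : κ * R ≤ R := mul_le_of_le_one_left hR.le hκ1
  set v := z' - z with hv
  have hder := fun s => hasDerivAt_setIntegral_bumpK Ω z v hδ s
  obtain ⟨s, hs, hslope⟩ := exists_hasDerivAt_eq_slope _ _ zero_lt_one
    (fun s _ => (hder s).continuousAt.continuousWithinAt) fun s _ => hder s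
  simp only [zero_smul, one_smul, add_zero, sub_zero, div_one] at hslope
  rw [show z + v = z' by rw [hv]; abel] at hslope
  have hzs : z + s • v ∈ closedBall x (2 * R) := by
    have := (convex_closedBall x (2 * R)).add_smul_sub_mem hz hz' ⟨hs.1.le, hs.2.le⟩
    exact this
  have hT : TestFun (ball x (4 * R)) (bumpK (z + s • v) (κ * R)) :=
    bumpK_testFun _ hδ (closedBall_subset_ball' (by rw [mem_closedBall] at hzs; linarith))
  have hvn : ‖(4 * R)⁻¹ • v‖ ≤ 1 := by
    rw [norm_smul, norm_inv, Real.norm_of_nonneg (by positivity), inv_mul_le_iff₀ (by positivity),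
      mul_one, hv, ← dist_eq_norm]
    rw [mem_closedBall] at hz hz'
    linarith [dist_triangle_right z' z x]
  have h2 := h1 _ hT (fun y => by
    rw [abs_of_nonneg (bumpK_nonneg _ _ _)]; exact bumpK_le_one _ _ _) _ hvn
  set I := ∫ y, bumpK (z + s • v) (κ * R) y ∂μ
  have hI : 0 ≤ I := integral_nonneg fun y => bumpK_nonneg _ _ _
  have h3 : volVar (bumpK (z + s • v) (κ * R)) ((4 * R)⁻¹ • v) Ω =
      (4 * R)⁻¹ * volVar (bumpK (z + s • v) (κ * R)) v Ω := by
    simp_rw [volVar, inner_smul_right, integral_const_mul]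
  rw [h3, inner_smul_right, mul_assoc (4 * R)⁻¹, ← mul_add, abs_mul,
    abs_of_pos (by positivity : 0 < (4 * R)⁻¹), ← mul_assoc, mul_inv_cancel₀ (by positivity), one_mul,
    mul_assoc, ← mul_pow, show κ / 4 * (4 * R) = κ * R by ring] at h2
  have h4 := (le_abs_self _).trans h2
  have h5 : 0 ≤ ⟪g₀, v⟫ * I := mul_nonneg hzz hI
  linarith

namespace RegState

lemma exists_mem_of_bump (h : 𝓡) (hδ : 0 < δ)
    (h1 : 0 < ∫ w in Ω, bumpK y δ w) : ∃ z ∈ ball y δ, z ∈ 𝓐 := by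
  by_contra! hcon
  refine h1.ne' (setIntegral_eq_zero_of_forall_eq_zero fun w hw => bumpK_eq_zero hδ ?_)
  by_contra hd
  exact hcon w (not_le.1 hd) (h.subset_posSet hw)

lemma exists_notMem_of_bump (h : 𝓡) (hδ : 0 < δ)
    (h2 : ∫ w in Ω, bumpK y δ w < ∫ w, bumpK y δ w) : ∃ z ∈ ball y δ, z ∉ 𝓐 := by
  by_contra! hcon
  refine h2.ne ?_
  rw [← integral_indicator h.openΩ.measurableSet]
  refine integral_congr_ae ?_
  filter_upwards [measure_eq_zero_iff_ae_notMem.1 h.volume_posSet_diff] with w hw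
  by_cases hwΩ : w ∈ Ω
  · rw [indicator_of_mem hwΩ]
  · rw [indicator_of_notMem hwΩ, bumpK_eq_zero hδ]
    by_contra hd
    exact hw ⟨hcon w (not_le.1 hd), hwΩ⟩

lemma exists_bump_bounds (h : 𝓡) (hE : 𝓔) :
    ∃ c, 0 < c ∧ ∀ x ∈ 𝓕, ∀ δ, 0 < δ → δ ≤ R → ball x (16 * δ) ⊆ D →
      c * δ ^ d ≤ ∫ w in Ω, bumpK x δ w ∧
      ∀ y : Euc d, c * δ ^ d ≤ (∫ w, bumpK y δ w) - ∫ w in Ω, bumpK x δ w := by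
  obtain ⟨c, hc0, -, hc⟩ := exists_kerK_lower (d := d)
  have hC := hE.C_pos
  refine ⟨c * (C⁻¹ * 2⁻¹ ^ d), by positivity, fun x hx δ hδ hδR hD => ?_⟩
  have hpow : c * (C⁻¹ * 2⁻¹ ^ d) * δ ^ d = c * (C⁻¹ * (δ / 2) ^ d) := by
    rw [div_eq_mul_inv δ, mul_pow δ]; ring
  rw [hpow]
  refine ⟨(mul_le_mul_of_nonneg_left ?_ hc0.le).trans
    (le_setIntegral_bumpK hc x hδ h.openΩ.measurableSet), fun y => ?_⟩
  · rw [inv_mul_le_iff₀ hC]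
    exact hE.lo_vol x hx _ (by positivity) (by linarith)
      (by rwa [show 32 * (δ / 2) = 16 * δ by ring])
  · have tot : ∀ z : Euc d, ∫ w, bumpK z δ w = δ ^ d • ∫ w : Euc d, kerK w := fun z =>
      integral_comp_scale kerK z hδ
    rw [tot y, ← tot x, ← integral_add_compl h.openΩ.measurableSet
      ((bumpK_testFun x hδ (subset_univ _)).integrable volume), add_sub_cancel_left]
    refine (mul_le_mul_of_nonneg_left ?_ hc0.le).trans
      (le_setIntegral_bumpK hc x hδ h.openΩ.measurableSet.compl)
    rw [inv_mul_le_iff₀ hC]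
    exact hE.lo_compl x hx _ (by positivity) (by linarith)
      ((ball_subset_ball (by linarith)).trans hD)

lemma not_thick (h : 𝓡) (hE : 𝓔) {m : Euc d}
    {σ κ : ℝ} (hσ : 0 < σ) (hκ : 0 < κ) (hκ1 : κ ≤ 1) (hr : 0 < r) (hrR : 4 * r ≤ R)
    (hD : ball x (32 * r) ⊆ D) (hm : closedBall m (σ * r) ⊆ closedBall x (2 * r))
    (hmeet : ∀ y ∈ closedBall m (σ * r), ∃ z ∈ 𝓕, z ∈ ball y (κ * r)) :
    σ ^ d ≤ C ^ 2 * 8 ^ d * κ := by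
  have := h.fin
  have hC := hE.C_pos
  set δ := κ * r with hδ
  have hδ0 : 0 < δ := by positivity
  have hδr : δ ≤ r := mul_le_of_le_one_left hr.le hκ1
  set B := closedBall m (σ * r)
  have hBm : MeasurableSet B := measurableSet_closedBall
  have low : ∀ y ∈ B, δ ^ d ≤ C * δ * μ.real (closedBall y (2 * δ)) := fun y hy => by
    obtain ⟨z, hz, hzy⟩ := hmeet y hy
    have hy2 := hm hy
    rw [mem_ball] at hzy
    rw [mem_closedBall] at hy2
    have hzx := dist_triangle z y x
    have h1 := hE.lo_measure z hz δ hδ0 (by linarith) ((ball_subset_ball' (by linarith)).trans hD)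
    rw [← mul_assoc] at h1
    refine h1.trans (mul_le_mul_of_nonneg_left ?_ (by positivity))
    exact measureReal_mono (ball_subset_closedBall.trans (closedBall_subset_closedBall'
      (by linarith))) (isCompact_closedBall y _).measure_lt_top.ne
  have key : ofReal (δ ^ d * mvol B) ≤
      ofReal (C * δ * ((2 * δ) ^ d * omd d * μ.real (closedBall x (4 * r)))) := by
    have fB : volume B ≠ ∞ := (isCompact_closedBall m _).measure_lt_top.ne
    have ho := omd_pos (d := d)
    calc ofReal (δ ^ d * mvol B) = ∫⁻ y in B, ofReal (δ ^ d) := by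
          rw [setLIntegral_const, ENNReal.ofReal_mul (by positivity), mvol, ENNReal.ofReal_toReal fB]
      _ ≤ ∫⁻ y in B, ofReal (C * δ) * μ (closedBall y (2 * δ)) := by
          refine setLIntegral_mono' hBm fun y hy => ?_
          rw [← ENNReal.ofReal_toReal (isCompact_closedBall y (2 * δ)).measure_lt_top.ne,
            ← ENNReal.ofReal_mul (by positivity)]
          exact ENNReal.ofReal_le_ofReal (low y hy)
      _ = ofReal (C * δ) * ∫⁻ y, B.indicator 1 y * μ (closedBall y (2 * δ)) := by
          rw [lintegral_const_mul' _ _ ENNReal.ofReal_ne_top, ← lintegral_indicator hBm]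
          congr 1
          refine lintegral_congr fun y => ?_
          by_cases hy : y ∈ B <;> simp [hy]
      _ = ofReal (C * δ) * ∫⁻ z, volume (B ∩ closedBall z (2 * δ)) ∂μ := by
          rw [lintegral_mul_measure_closedBall μ (measurable_one.indicator hBm)]
          congr 1
          refine lintegral_congr fun z => ?_
          rw [lintegral_indicator_one hBm, Measure.restrict_apply hBm]
      _ ≤ ENNReal.ofReal (C * δ) * ∫⁻ z in closedBall x (4 * r),
            ENNReal.ofReal ((2 * δ) ^ d * omd d) ∂μ := by
          rw [← lintegral_indicator measurableSet_closedBall]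
          refine mul_le_mul_right (lintegral_mono fun z => ?_) _
          by_cases hz : z ∈ closedBall x (4 * r)
          · rw [indicator_of_mem hz, ← mvol_closedBall z (by positivity), mvol,
              ENNReal.ofReal_toReal (isCompact_closedBall z _).measure_lt_top.ne]
            exact measure_mono inter_subset_right
          · have : B ∩ closedBall z (2 * δ) = ∅ := by
              rw [eq_empty_iff_forall_notMem]
              intro y hy
              have h1 := hm hy.1
              have h2 := hy.2
              rw [mem_closedBall] at h1 h2 hz
              have := dist_triangle_left z x y
              linarith
            rw [this, measure_empty]; exact zero_le
      _ = _ := by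
          rw [setLIntegral_const, ENNReal.ofReal_mul (p := C * δ) (by positivity), ENNReal.ofReal_mul
            (p := (2 * δ) ^ d * omd d) (by positivity), measureReal_def,
            ENNReal.ofReal_toReal (isCompact_closedBall x _).measure_lt_top.ne]
  have hup := hE.up_measure x (4 * r) (by positivity) hrR (by
    rwa [show (8 : ℝ) * (4 * r) = 32 * r by ring])
  rw [ENNReal.ofReal_le_ofReal_iff (by have := omd_pos (d := d); positivity),
    mvol_closedBall _ (by positivity), mul_pow σ, mul_pow 2 δ] at key
  have ho := omd_pos (d := d)
  have h1 : δ ^ d * omd d * r ^ d * σ ^ d ≤ δ ^ d * omd d * r ^ d * (C ^ 2 * 8 ^ d * κ) := by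
    calc δ ^ d * omd d * r ^ d * σ ^ d = δ ^ d * (σ ^ d * r ^ d * omd d) := by ring
      _ ≤ _ := key
      _ = C * κ * 2 ^ d * δ ^ d * omd d * (r * μ.real (closedBall x (4 * r))) := by
          generalize δ ^ d = b; rw [hδ]; ring
      _ ≤ C * κ * 2 ^ d * δ ^ d * omd d * (C * (4 * r) ^ d) := by
          refine mul_le_mul_of_nonneg_left (le_trans ?_ hup) (by positivity)
          have : 0 ≤ μ.real (closedBall x (4 * r)) := measureReal_nonneg
          nlinarith
      _ = _ := by rw [mul_pow 4 r, show (8 : ℝ) = 2 * 4 by norm_num, mul_pow (2 : ℝ) 4]; ring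
  exact le_of_mul_le_mul_left h1 (by positivity)

lemma eventually_not_slab (h : 𝓡) (hE : 𝓔)
    (hx : x ∈ D) (hN : AlmostNormal Ω μ x g₀) {σ : ℝ} (hσ : 0 < σ) :
    ∀ᶠ r in 𝓝[>] (0 : ℝ), ∀ x₁ ∈ 𝓕, ∀ x₂ ∈ 𝓕, ∀ m,
      x₁ ∈ closedBall x (2 * r) → x₂ ∈ closedBall x (2 * r) →
      closedBall m (σ * r) ⊆ closedBall x (2 * r) →
      (∀ y ∈ closedBall m (σ * r), 0 ≤ ⟪g₀, y - x₁⟫ ∧ 0 ≤ ⟪g₀, x₂ - y⟫) → False := by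
  obtain ⟨c₁, hc₁, hbd⟩ := h.exists_bump_bounds hE
  have hC := hE.C_pos
  have hR := hE.R_pos
  obtain ⟨κ, hκ, hκ1, hκσ⟩ : ∃ κ, 0 < κ ∧ κ ≤ 1 ∧ C ^ 2 * 8 ^ d * κ < σ ^ d := by
    refine ⟨min 1 (σ ^ d / (2 * (C ^ 2 * 8 ^ d))), by positivity, min_le_left _ _, ?_⟩
    calc C ^ 2 * 8 ^ d * min 1 (σ ^ d / (2 * (C ^ 2 * 8 ^ d)))
        ≤ C ^ 2 * 8 ^ d * (σ ^ d / (2 * (C ^ 2 * 8 ^ d))) := by gcongr; exact min_le_right _ _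
      _ = σ ^ d / 2 := by field_simp
      _ < σ ^ d := half_lt_self (by positivity)
  obtain ⟨s, hs, hsD⟩ := isOpen_iff.1 h.openD x hx
  have e1 : ∀ᶠ r in 𝓝[>] (0 : ℝ), r < min (s / 64) (R / 4) :=
    (gt_mem_nhds (by positivity)).filter_mono nhdsWithin_le_nhds
  filter_upwards [e1, hN.bump_le hκ hκ1 (half_pos hc₁), self_mem_nhdsWithin]
    with r hr hb (hr0 : 0 < r) x₁ hx₁ x₂ hx₂ m hx₁r hx₂r hm hslab
  have hrs : r < s / 64 := hr.trans_le (min_le_left _ _)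
  have hrR : r < R / 4 := hr.trans_le (min_le_right _ _)
  have hδ : 0 < κ * r := by positivity
  have hδr : κ * r ≤ r := mul_le_of_le_one_left hr0.le hκ1
  refine (h.not_thick hE hσ hκ hκ1 hr0 (by linarith) ((ball_subset_ball (by linarith)).trans hsD) hm
    fun y hy => ?_).not_gt hκσ
  have hy2 := hm hy
  have hsub : ∀ z ∈ closedBall x (2 * r), ball z (16 * (κ * r)) ⊆ D := fun z hz =>
    (ball_subset_ball' (by rw [mem_closedBall] at hz; linarith)).trans hsD
  have hpos : 0 < c₁ * (κ * r) ^ d := by positivity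
  have f1 := (hbd x₁ hx₁ _ hδ (by linarith) (hsub x₁ hx₁r)).1
  have f2 := (hbd x₂ hx₂ _ hδ (by linarith) (hsub x₂ hx₂r)).2 y
  have g1 := hb x₁ hx₁r y hy2 (hslab y hy).1
  have g2 := hb y hy2 x₂ hx₂r (hslab y hy).2
  obtain ⟨z, hz, hzP⟩ := h.exists_mem_of_bump hδ (y := y) (by linarith)
  obtain ⟨w, hw, hwP⟩ := h.exists_notMem_of_bump hδ (y := y) (by linarith)
  exact h.exists_freeBdry_mem_ball ((ball_subset_ball (by linarith)).trans (hsub y hy2)) hz hzP hw hwP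

lemma normal_ne_zero (h : 𝓡) (hE : 𝓔) (hx : x ∈ 𝓕) (hN : AlmostNormal Ω μ x g₀) : g₀ ≠ 0 := by
  rintro rfl
  obtain ⟨r, hr, hr0⟩ := ((h.eventually_not_slab hE hx.1 hN one_pos).and self_mem_nhdsWithin).exists
  have hr0 : 0 < r := hr0
  exact hr x hx x hx x (mem_closedBall_self (by positivity)) (mem_closedBall_self (by positivity))
    (closedBall_subset_closedBall (by linarith)) (by simp)

lemma eventually_no_freeBdry_pair (h : 𝓡) (hE : 𝓔)
    (hx : x ∈ 𝓕) (hN : AlmostNormal Ω μ x g₀) {τ : ℝ} (hτ : 0 < τ) :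
    ∀ᶠ r in 𝓝[>] (0 : ℝ), ∀ z ∈ 𝓕, z ∈ closedBall x r → |⟪g₀, z - x⟫| ≤ τ * r := by
  set σ := min 1 (τ / (2 * (‖g₀‖ + 1)))
  have hσ : 0 < σ := by positivity
  have hσg : ‖g₀‖ * σ ≤ τ / 2 := by
    calc ‖g₀‖ * σ ≤ (‖g₀‖ + 1) * (τ / (2 * (‖g₀‖ + 1))) := by
          gcongr
          · linarith
          · exact min_le_right _ _
      _ = τ / 2 := by field_simp
  filter_upwards [h.eventually_not_slab hE hx.1 hN hσ, self_mem_nhdsWithin] with r hr (hr0 : 0 < r) z hz hzr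
  have key : ∀ x₁ ∈ 𝓕, ∀ x₂ ∈ 𝓕, x₁ ∈ closedBall x r → x₂ ∈ closedBall x r →
      ⟪g₀, x₂ - x₁⟫ ≤ τ * r := fun x₁ hx₁ x₂ hx₂ hx₁r hx₂r => by
    by_contra! hcon
    have hmem := (convex_closedBall x r).add_smul_sub_mem hx₁r hx₂r
      (t := 1 / 2) ⟨by norm_num, by norm_num⟩
    refine hr x₁ hx₁ x₂ hx₂ (x₁ + (1 / 2 : ℝ) • (x₂ - x₁))
      (closedBall_subset_closedBall (by linarith) hx₁r)
      (closedBall_subset_closedBall (by linarith) hx₂r) (closedBall_subset_closedBall' ?_) ?_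
    · rw [mem_closedBall] at hmem
      have : σ ≤ 1 := min_le_left _ _
      nlinarith
    · intro y hy
      set m := x₁ + (1 / 2 : ℝ) • (x₂ - x₁) with hm
      have h1 : |⟪g₀, y - m⟫| ≤ τ / 2 * r := by
        refine (abs_real_inner_le_norm _ _).trans ?_
        rw [mem_closedBall, dist_eq_norm] at hy
        calc ‖g₀‖ * ‖y - m‖ ≤ ‖g₀‖ * (σ * r) := by gcongr
          _ = ‖g₀‖ * σ * r := by ring
          _ ≤ _ := by gcongr
      have e1 : ⟪g₀, y - x₁⟫ = ⟪g₀, y - m⟫ + 1 / 2 * ⟪g₀, x₂ - x₁⟫ := by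
        rw [← inner_smul_right, ← inner_add_right]; congr 1; rw [hm]; module
      have e2 : ⟪g₀, x₂ - y⟫ = -⟪g₀, y - m⟫ + 1 / 2 * ⟪g₀, x₂ - x₁⟫ := by
        rw [← inner_smul_right, ← inner_neg_right, ← inner_add_right]; congr 1; rw [hm]; module
      rw [abs_le] at h1
      rw [e1, e2]
      constructor <;> linarith [h1.1, h1.2]
  have hxr : x ∈ closedBall x r := mem_closedBall_self hr0.le
  refine abs_le.2 ⟨?_, key x hx z hz hxr hzr⟩
  have := key z hz x hx hzr hxr
  rw [← neg_sub, inner_neg_right] at this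
  linarith

/-- In the blow-up limit the positivity set is a half space. -/
lemma eventually_flat (h : 𝓡) (hE : 𝓔)
    (hx : x ∈ 𝓕) (hN : AlmostNormal Ω μ x g₀) {p : Euc d}
    (hp : ⟪g₀, p⟫ ≠ 0) :
    ∀ᶠ r in 𝓝[>] (0 : ℝ), (0 < ⟪g₀, p⟫ → x + r • p ∈ 𝓐) ∧
      (⟪g₀, p⟫ < 0 → u (x + r • p) = 0) := by
  obtain ⟨c₁, hc₁, hbd⟩ := h.exists_bump_bounds hE
  have hR := hE.R_pos
  set M := ‖p‖ + 1
  have hM : 0 < M := by positivity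
  have hM1 : 1 ≤ M := by simp [M]
  set b := |⟪g₀, p⟫|
  have hb : 0 < b := abs_pos.2 hp
  set s := min 1 (b / (4 * (‖g₀‖ + 1)))
  have hs : 0 < s := by positivity
  have hs1 : s ≤ 1 := min_le_left _ _
  have hsg : ‖g₀‖ * s ≤ b / 4 := by
    calc ‖g₀‖ * s ≤ (‖g₀‖ + 1) * (b / (4 * (‖g₀‖ + 1))) := by
          gcongr
          · linarith
          · exact min_le_right _ _
      _ = b / 4 := by field_simp
  obtain ⟨t, ht, htD⟩ := isOpen_iff.1 h.openD x hx.1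
  have e1 : ∀ᶠ r in 𝓝[>] (0 : ℝ), M * r < min (t / 32) R :=
    (tendsto_nhdsWithin_iff.1 (tendsto_const_mul_nhdsGT_zero hM)).1.eventually
      (gt_mem_nhds (by positivity))
  filter_upwards [e1, (tendsto_const_mul_nhdsGT_zero hM).eventually
      (h.eventually_no_freeBdry_pair hE hx hN (τ := b / (4 * M)) (by positivity)),
    (tendsto_const_mul_nhdsGT_zero hM).eventually (hN.bump_le (κ := s / M) (η := c₁ / 2)
      (by positivity) ((div_le_one hM).2 (hs1.trans hM1)) (by positivity)),
    self_mem_nhdsWithin] with r hr hfree hmono (hr0 : 0 < r)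
  have hMt : M * r < t / 32 := hr.trans_le (min_le_left _ _)
  have hMR : M * r < R := hr.trans_le (min_le_right _ _)
  have hδ : 0 < s * r := by positivity
  have hδr : s * r ≤ M * r := by gcongr; exact hs1.trans hM1
  have hsM : s / M * (M * r) = s * r := by field_simp
  rw [hsM] at hmono
  set z := x + r • p with hz
  have hzx : dist z x = r * ‖p‖ := by
    rw [hz, dist_eq_norm, add_sub_cancel_left, norm_smul, Real.norm_of_nonneg hr0.le]
  have hMr : M * r = r * ‖p‖ + r := by simp only [M]; ring
  have hsr : s * r ≤ r := mul_le_of_le_one_left hr0.le hs1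
  have hBD : ball z (s * r) ⊆ D := (ball_subset_ball' (by linarith)).trans htD
  have hnoE : ∀ y ∈ ball z (s * r), y ∉ 𝓕 := fun y hy hyE => by
    rw [mem_ball] at hy
    have h1 := hfree y hyE (by rw [mem_closedBall]; linarith [dist_triangle y z x])
    have h2 : |⟪g₀, y - z⟫| ≤ b / 4 * r := by
      refine (abs_real_inner_le_norm _ _).trans ?_
      rw [← dist_eq_norm]
      calc ‖g₀‖ * dist y z ≤ ‖g₀‖ * (s * r) := by gcongr
        _ = ‖g₀‖ * s * r := by ring
        _ ≤ _ := by gcongr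
    have h3 : r * ⟪g₀, p⟫ = ⟪g₀, y - x⟫ - ⟪g₀, y - z⟫ := by
      rw [← inner_sub_right, ← inner_smul_right]; congr 1; rw [hz]; abel
    have h4 : r * b ≤ |⟪g₀, y - x⟫| + |⟪g₀, y - z⟫| := by
      rw [← abs_of_pos hr0, ← abs_mul, h3]; exact abs_sub _ _
    have h5 : b / (4 * M) * (M * r) = b / 4 * r := by field_simp
    nlinarith
  have hpos : 0 < c₁ * (s * r) ^ d := by positivity
  have hball : ball x (16 * (s * r)) ⊆ D := (ball_subset_ball (by linarith)).trans htD
  obtain ⟨f1, f2⟩ := hbd x hx (s * r) hδ (by linarith) hball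
  have hxm : x ∈ closedBall x (2 * (M * r)) := mem_closedBall_self (by positivity)
  have hzm : z ∈ closedBall x (2 * (M * r)) := by rw [mem_closedBall]; linarith [mul_pos hM hr0]
  have hzz : ⟪g₀, z - x⟫ = r * ⟪g₀, p⟫ := by rw [hz, add_sub_cancel_left, inner_smul_right]
  constructor
  · intro h0
    by_contra hzP
    have := hmono x hxm z hzm (by rw [hzz]; positivity)
    obtain ⟨w, hw, hwP⟩ := h.exists_mem_of_bump hδ (y := z) (by linarith)
    obtain ⟨y, hyE, hy⟩ := h.exists_freeBdry_mem_ball hBD hw hwP (mem_ball_self hδ) hzP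
    exact hnoE y hy hyE
  · intro h0
    by_contra hz0
    have hzP : z ∈ 𝓐 := ⟨hBD (mem_ball_self hδ), (h.nonneg z).lt_of_ne' hz0⟩
    have := hmono z hzm x hxm (by rw [← neg_sub, inner_neg_right, hzz]; nlinarith)
    have := f2 z
    obtain ⟨w, hw, hwP⟩ := h.exists_notMem_of_bump hδ (y := z) (by linarith)
    obtain ⟨y, hyE, hy⟩ := h.exists_freeBdry_mem_ball hBD (mem_ball_self hδ) hzP hw hwP
    exact hnoE y hy hyE

end RegState

/-! ### Half spaces -/

/-- The distribution `φ ↦ -∫_{⟪e, y⟫ > 0} ⟪∇φ, e⟫`, that is, the surface measure of the hyperplane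
orthogonal to the unit vector `e`. -/
def planeInt (e : Euc d) (φ : Euc d → ℝ) : ℝ := -volVar φ e {y | 0 < ⟪e, y⟫}

lemma measurableSet_halfspace (e : Euc d) : MeasurableSet {y : Euc d | 0 < ⟪e, y⟫} :=
  (isOpen_lt continuous_const (continuous_const.inner continuous_id)).measurableSet

lemma ae_inner_ne_zero (he : e ≠ 0) : ∀ᵐ y : Euc d, ⟪e, y⟫ ≠ 0 := by
  have h1 : LinearMap.ker (innerSL ℝ e : Euc d →L[ℝ] ℝ).toLinearMap ≠ ⊤ := fun htop => by
    have : e ∈ LinearMap.ker (innerSL ℝ e : Euc d →L[ℝ] ℝ).toLinearMap := htop ▸ Submodule.mem_top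
    simp at this
    exact he this
  exact measure_eq_zero_iff_ae_notMem.1 (Measure.addHaar_submodule volume _ h1)

/-- The weak gradient of the positive part of a linear form. -/
lemma weakGrad_posPart (e : Euc d) : WeakGrad (fun y => max ⟪e, y⟫ 0)
    ({y | 0 < ⟪e, y⟫}.indicator fun _ => e) := by
  have hf : LipschitzWith ‖innerSL ℝ e‖₊ fun y : Euc d => max ⟪e, y⟫ 0 :=
    (innerSL ℝ e).lipschitz.max_const 0
  refine ⟨hf.continuous.locallyIntegrable, (locallyIntegrable_const e).indicator
    (measurableSet_halfspace e), fun X => hf.integral_mul_divg fun w => ?_⟩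
  rcases eq_or_ne e 0 with rfl | he
  · simp [lineDeriv]
  filter_upwards [ae_inner_ne_zero he] with y hy
  have hl : Continuous fun y : Euc d => ⟪e, y⟫ := continuous_const.inner continuous_id
  rcases hy.lt_or_gt with hy | hy
  · rw [indicator_of_notMem (by simpa using hy.le), inner_zero_left]
    exact (((hasFDerivAt_const (0 : ℝ) y).hasLineDerivAt w).congr_of_eventuallyEq
      ((hl.continuousAt.eventually_lt continuousAt_const hy).mono fun z hz => max_eq_right hz.le)).lineDeriv
  · rw [indicator_of_mem (by simpa using hy)]
    exact (((innerSL ℝ e).hasFDerivAt.hasLineDerivAt w).congr_of_eventuallyEq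
      ((continuousAt_const.eventually_lt hl.continuousAt hy).mono fun z hz => max_eq_left hz.le)).lineDeriv

lemma integral_inner_halfspace (e : Euc d) (X : Euc d → Euc d) :
    ∫ y, ⟪({y | 0 < ⟪e, y⟫}.indicator (fun _ => e) y), X y⟫ = ∫ y in {y | 0 < ⟪e, y⟫}, ⟪X y, e⟫ := by
  rw [← integral_indicator (measurableSet_halfspace e)]
  refine integral_congr_ae (.of_forall fun y => ?_)
  by_cases hy : y ∈ {y : Euc d | 0 < ⟪e, y⟫} <;>
    simp only [indicator, hy, if_true, if_false, inner_zero_left, real_inner_comm]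

/-! ### Blow-up -/

lemma integral_comp_affine {E : Type*} [NormedAddCommGroup E] [NormedSpace ℝ E] (f : Euc d → E)
    (x : Euc d) (hr : 0 < r) : ∫ p, f (x + r • p) = r⁻¹ ^ d • ∫ y, f y := by
  have h1 := integral_comp_scale (fun p => f (x + r • p)) x hr
  simp_rw [smul_inv_smul₀ hr.ne', add_sub_cancel] at h1
  rw [h1, smul_smul, ← mul_pow, inv_mul_cancel₀ hr.ne', one_pow, one_smul]

lemma integral_scale (F : Euc d → Euc d → ℝ) (x : Euc d) (hr : 0 < r) :
    r⁻¹ ^ d * ∫ y, F y (r⁻¹ • (y - x)) = ∫ p, F (x + r • p) p := by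
  have h1 := integral_comp_affine (fun y => F y (r⁻¹ • (y - x))) x hr
  simp only [add_sub_cancel_left, inv_smul_smul₀ hr.ne'] at h1
  exact h1.symm

lemma TestFun.scale (hφ : TestFun univ φ) (hM : ∀ z, M ≤ ‖z‖ → φ z = 0)
    (x : Euc d) (hr : 0 < r) (hU : closedBall x (M * r) ⊆ U) :
    TestFun U (fun y => φ (r⁻¹ • (y - x))) := by
  have hs : tsupport (fun y => φ (r⁻¹ • (y - x))) ⊆ closedBall x (M * r) := by
    refine closure_minimal (fun y hy => ?_) isClosed_closedBall
    by_contra hc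
    refine hy (hM _ ?_)
    rw [mem_closedBall, not_le] at hc
    rw [norm_scale hr, le_inv_mul_iff₀ hr]
    linarith
  exact ⟨hφ.1.comp (contDiff_scale x r), (isCompact_closedBall _ _).of_isClosed_subset
    (isClosed_tsupport _) hs, hs.trans hU⟩

lemma TestFun.exists_radius (hφ : TestFun univ φ) : ∃ M, 1 ≤ M ∧ ∀ z, M ≤ ‖z‖ → φ z = 0 := by
  obtain ⟨M, hM⟩ := hφ.2.1.isCompact.isBounded.subset_closedBall 0
  refine ⟨max 1 (M + 1), le_max_left _ _, fun z hz => image_eq_zero_of_notMem_tsupport fun hz' => ?_⟩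
  have h1 := mem_closedBall_zero_iff.1 (hM hz')
  linarith [le_max_right 1 (M + 1)]

/-- The rescaled measure around `x`, as a distribution. -/
def mScale (μ : Measure (Euc d)) (x : Euc d) (r : ℝ) (φ : Euc d → ℝ) : ℝ :=
  r * r⁻¹ ^ d * ∫ y, φ (r⁻¹ • (y - x)) ∂μ

/-- `x` is a free boundary point where the blow-ups of the positivity set and of `μ` are those of the
half space `⟪e, ·⟫ > 0` and of `q` times the surface measure of its boundary. -/
structure RegPt (D : Set (Euc d)) (u : Euc d → ℝ) (μ : Measure (Euc d)) (x e : Euc d) (q : ℝ) :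
    Prop where
  mem : x ∈ freeBdry D u
  unit : ‖e‖ = 1
  q_pos : 0 < q
  flat_pos : ∀ p, 0 < ⟪e, p⟫ → ∀ᶠ r in 𝓝[>] (0 : ℝ), x + r • p ∈ posSet D u
  flat_neg : ∀ p, ⟪e, p⟫ < 0 → ∀ᶠ r in 𝓝[>] (0 : ℝ), u (x + r • p) = 0
  lim : ∀ φ, TestFun univ φ → Tendsto (fun r => mScale μ x r φ) (𝓝[>] 0) (𝓝 (q * planeInt e φ))

lemma RegPt.ne_zero (h : RegPt D u μ x e q) : e ≠ 0 := norm_pos_iff.1 (by simp [h.unit])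

lemma RegPt.inner_self (h : RegPt D u μ x e q) : ⟪e, e⟫ = (1 : ℝ) := by
  rw [real_inner_self_eq_norm_sq, h.unit, one_pow]

namespace RegState

lemma tendsto_indicator_scale (h : 𝓡) (he : e ≠ 0)
    (hpos : ∀ p, 0 < ⟪e, p⟫ → ∀ᶠ r in 𝓝[>] (0 : ℝ), x + r • p ∈ 𝓐)
    (hneg : ∀ p, ⟪e, p⟫ < 0 → ∀ᶠ r in 𝓝[>] (0 : ℝ), u (x + r • p) = 0) (hf : Integrable f) :
    Tendsto (fun r => r⁻¹ ^ d * ∫ y in 𝓐, f (r⁻¹ • (y - x))) (𝓝[>] 0)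
      (𝓝 (∫ y in {y | 0 < ⟪e, y⟫}, f y)) := by
  have hPm := h.isOpen_posSet.measurableSet
  rw [← integral_indicator (measurableSet_halfspace e)]
  simp_rw [← integral_indicator hPm]
  refine Tendsto.congr' (f₁ := fun r => ∫ p, (𝓐).indicator (fun _ => f p) (x + r • p)) ?_ ?_
  · filter_upwards [self_mem_nhdsWithin] with r hr
    exact (integral_scale (fun y p => (𝓐).indicator (fun _ => f p) y) x hr).symm
  refine tendsto_integral_filter_of_dominated_convergence (fun p => ‖f p‖) (.of_forall fun r => ?_)
    (.of_forall fun r => .of_forall fun p => norm_indicator_le_norm_self _ _) hf.norm ?_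
  · exact (hf.indicator ((by fun_prop : Measurable fun p : Euc d => x + r • p) hPm)).1
  · filter_upwards [ae_inner_ne_zero he] with p hp
    refine tendsto_const_nhds.congr' ?_
    rcases hp.lt_or_gt with hp | hp
    · filter_upwards [hneg p hp] with r hr
      rw [indicator_of_notMem (by simpa using hp.le), indicator_of_notMem fun hh => hh.2.ne' hr]
    · filter_upwards [hpos p hp] with r hr
      rw [indicator_of_mem hr, indicator_of_mem (by simpa using hp)]

lemma tendsto_volVar_scale (h : 𝓡) (he : e ≠ 0)
    (hpos : ∀ p, 0 < ⟪e, p⟫ → ∀ᶠ r in 𝓝[>] (0 : ℝ), x + r • p ∈ 𝓐)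
    (hneg : ∀ p, ⟪e, p⟫ < 0 → ∀ᶠ r in 𝓝[>] (0 : ℝ), u (x + r • p) = 0)
    (hφ : TestFun univ φ) (w : Euc d) :
    Tendsto (fun r => r * r⁻¹ ^ d * volVar (fun y => φ (r⁻¹ • (y - x))) w Ω) (𝓝[>] 0)
      (𝓝 (volVar φ w {y | 0 < ⟪e, y⟫})) := by
  refine (h.tendsto_indicator_scale he hpos hneg (integrable_volVar hφ w)).congr' ?_
  filter_upwards [self_mem_nhdsWithin] with r hr
  have hr : r ≠ 0 := ne_of_gt hr
  rw [mul_right_comm, mul_comm, volVar, ← integral_const_mul, setIntegral_congr_set (s := Ω) (t := 𝓐)]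
  · simp_rw [gradient_comp_scale hφ.differentiable, inner_smul_left, conj_trivial,
      mul_inv_cancel_left₀ hr]
  · refine (h.subset_posSet.eventuallyLE).antisymm ?_
    filter_upwards [measure_eq_zero_iff_ae_notMem.1 h.volume_posSet_diff] with y hy hyP
    by_contra hyΩ
    exact hy ⟨hyP, hyΩ⟩

lemma regPt_of_almostNormal (h : 𝓡) (hE : 𝓔)
    (hx : x ∈ 𝓕) (hN : AlmostNormal Ω μ x g₀) :
    ∃ e q, RegPt D u μ x e q := by
  have hg := norm_pos_iff.2 (h.normal_ne_zero hE hx hN)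
  set e := ‖g₀‖⁻¹ • g₀ with he
  have hge : ∀ p, ⟪g₀, p⟫ = ‖g₀‖ * ⟪e, p⟫ := fun p => by
    rw [he, inner_smul_left, conj_trivial, mul_inv_cancel_left₀ hg.ne']
  have heu : ‖e‖ = 1 := by rw [he, norm_smul, norm_inv, norm_norm, inv_mul_cancel₀ hg.ne']
  have he0 : e ≠ 0 := norm_ne_zero_iff.1 (by rw [heu]; exact one_ne_zero)
  have hpos : ∀ p, 0 < ⟪e, p⟫ → ∀ᶠ r in 𝓝[>] (0 : ℝ), x + r • p ∈ 𝓐 := fun p hp => by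
    have h1 : 0 < ⟪g₀, p⟫ := by rw [hge]; positivity
    exact (h.eventually_flat hE hx hN h1.ne').mono fun r hr => hr.1 h1
  have hneg : ∀ p, ⟪e, p⟫ < 0 → ∀ᶠ r in 𝓝[>] (0 : ℝ), u (x + r • p) = 0 := fun p hp => by
    have h1 : ⟪g₀, p⟫ < 0 := by rw [hge]; exact mul_neg_of_pos_of_neg hg hp
    exact (h.eventually_flat hE hx hN h1.ne).mono fun r hr => hr.2 h1
  refine ⟨e, ‖g₀‖⁻¹, hx, heu, by positivity, hpos, hneg, fun φ hφ => ?_⟩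
  obtain ⟨M, hM1, hM⟩ := hφ.exists_radius
  obtain ⟨B, hB0, hB⟩ := hφ.bounded
  have t1 := h.tendsto_volVar_scale he0 hpos hneg hφ e
  have t2 : Tendsto (fun r => r * r⁻¹ ^ d * volVar (fun y => φ (r⁻¹ • (y - x))) e Ω +
      ‖g₀‖ * mScale μ x r φ) (𝓝[>] 0) (𝓝 0) := by
    rw [Metric.tendsto_nhds]
    intro ε hε
    have hcpos : 0 < 2 * M := by linarith
    filter_upwards [(tendsto_const_mul_nhdsGT_zero hcpos).eventually
      (hN (ε / ((B + 1) * (2 * M) ^ d)) (by positivity)), self_mem_nhdsWithin] with r hr (hr0 : 0 < r)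
    have hT : TestFun (ball x (2 * M * r)) (fun y => φ (r⁻¹ • (y - x))) :=
      hφ.scale hM x hr0 (closedBall_subset_ball (by nlinarith))
    have h1 := hr _ (hT.const_mul (B + 1)⁻¹) (fun y => by
      rw [abs_mul, abs_of_pos (by positivity : 0 < (B + 1)⁻¹), inv_mul_le_iff₀ (by positivity)]
      linarith [hB (r⁻¹ • (y - x))]) e heu.le
    rw [volVar_const_mul hT, hge, real_inner_self_eq_norm_sq, heu, integral_const_mul, one_pow,
      mul_one] at h1
    set V := volVar (fun y => φ (r⁻¹ • (y - x))) e Ω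
    set I := ∫ y, φ (r⁻¹ • (y - x)) ∂μ with hI
    have e1 : (B + 1)⁻¹ * V + ‖g₀‖ * ((B + 1)⁻¹ * I) = (B + 1)⁻¹ * (V + ‖g₀‖ * I) := by ring
    rw [e1, abs_mul, abs_of_pos (by positivity : 0 < (B + 1)⁻¹)] at h1
    have e2 : r * r⁻¹ ^ d * V + ‖g₀‖ * mScale μ x r φ = r * r⁻¹ ^ d * (V + ‖g₀‖ * I) := by
      rw [mScale, ← hI]; ring
    rw [Real.dist_eq, sub_zero, e2, abs_mul, abs_of_pos (by positivity : 0 < r * r⁻¹ ^ d)]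
    have h2 : 2 * M * (r * r⁻¹ ^ d * |V + ‖g₀‖ * I|) ≤ ε := by
      calc _ = r⁻¹ ^ d * (B + 1) * (2 * M * r * ((B + 1)⁻¹ * |V + ‖g₀‖ * I|)) := by field_simp
        _ ≤ r⁻¹ ^ d * (B + 1) * (ε / ((B + 1) * (2 * M) ^ d) * (2 * M * r) ^ d) := by gcongr
        _ = ε * (r⁻¹ * r) ^ d := by rw [mul_pow (2 * M) r, mul_pow r⁻¹]; field_simp
        _ = ε := by rw [inv_mul_cancel₀ hr0.ne', one_pow, mul_one]
    have h3 : 0 ≤ r * r⁻¹ ^ d * |V + ‖g₀‖ * I| := by positivity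
    nlinarith
  have t3 := (t2.sub t1).const_mul ‖g₀‖⁻¹
  simp only [add_sub_cancel_left, zero_sub, inv_mul_cancel_left₀ hg.ne'] at t3
  exact t3

end RegState

lemma tendsto_sub_of_deriv {l : Filter ℝ} [l.IsCountablyGenerated] {f : ℝ → ℝ → ℝ} {f₀ : ℝ → ℝ}
    {f' : ℝ → ℝ → ℝ} {K : ℝ} (hM : 0 < M)
    (hd : ∀ᶠ r in l, ∀ s, 0 < s → HasDerivAt (f r) (f' r s) s)
    (hb : ∀ᶠ r in l, ∀ s ∈ Ioc 0 M, |f' r s| ≤ K)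
    (h0 : ∀ᶠ r in l, Tendsto (f r) (𝓝[>] 0) (𝓝 (f₀ r)))
    (hlim : ∀ s ∈ Ioc 0 M, Tendsto (fun r => f' r s) l (𝓝 0)) :
    Tendsto (fun r => f r M - f₀ r) l (𝓝 0) := by
  have hmeas : ∀ r, AEStronglyMeasurable (deriv (f r)) (volume.restrict (uIoc 0 M)) := fun r =>
    (measurable_deriv (f r)).aestronglyMeasurable
  have huIoc : uIoc (0 : ℝ) M = Ioc 0 M := uIoc_of_le hM.le
  have t1 : Tendsto (fun r => ∫ s in (0 : ℝ)..M, deriv (f r) s) l (𝓝 (∫ s in (0 : ℝ)..M, (0 : ℝ))) := by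
    refine intervalIntegral.tendsto_integral_filter_of_dominated_convergence (fun _ => K)
      (.of_forall hmeas) ?_ intervalIntegrable_const ?_
    · filter_upwards [hd, hb] with r hd hb
      refine .of_forall fun s hs => ?_
      rw [huIoc] at hs
      rw [(hd s hs.1).deriv]; exact hb s hs
    · refine .of_forall fun s hs => ?_
      rw [huIoc] at hs
      refine (hlim s hs).congr' ?_
      filter_upwards [hd] with r hd
      rw [(hd s hs.1).deriv]
  rw [intervalIntegral.integral_zero] at t1
  refine t1.congr' ?_
  filter_upwards [hd, hb, h0] with r hd hb h0
  have hd' : ∀ s, 0 < s → HasDerivAt (f r) (deriv (f r) s) s := fun s hs => by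
    rw [(hd s hs).deriv]; exact hd s hs
  refine intervalIntegral.integral_eq_sub_of_hasDerivAt_of_tendsto hM (fun s hs => hd' s hs.1) ?_ h0
    ((hd' M hM).continuousAt.tendsto.mono_left nhdsWithin_le_nhds)
  refine (intervalIntegrable_const (c := K)).mono_fun (hmeas r) ?_
  refine (ae_restrict_iff' measurableSet_uIoc).2 (.of_forall fun s hs => ?_)
  rw [huIoc] at hs
  simp only [(hd s hs.1).deriv]
  exact (hb s hs).trans (le_abs_self K)

lemma exists_kerk_second_diff : ∃ L, 0 < L ∧ ∀ z h : Euc d,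
    |kerk z - 2 * kerk (z + h) + kerk (z + (2 : ℝ) • h)| ≤ L * ‖h‖ ^ 2 := by
  obtain ⟨L, hL⟩ := ContDiff.lipschitzWith_of_hasCompactSupport (𝕂 := ℝ) (n := (⊤ : ℕ∞))
    ((hasCompactSupport_kerk (d := d)).fderiv ℝ) (contDiff_kerk.fderiv_right (by simp)) (by simp)
  refine ⟨L + 1, by positivity, fun z h => ?_⟩
  have hdf : Differentiable ℝ (kerk : Euc d → ℝ) := smooth_differentiable contDiff_kerk
  have hg : ∀ y, HasFDerivAt (fun y => kerk (y + h) - kerk y) (fderiv ℝ kerk (y + h) - fderiv ℝ kerk y) y :=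
    fun y => ((hasFDerivAt_comp_add_right h).2 (hdf (y + h)).hasFDerivAt).sub (hdf y).hasFDerivAt
  have h1 := convex_univ.norm_image_sub_le_of_norm_hasFDerivWithin_le (C := (L : ℝ) * ‖h‖)
    (fun y _ => (hg y).hasFDerivWithinAt) (fun y _ => by
      have := hL.dist_le_mul (y + h) y
      rwa [dist_eq_norm, dist_eq_norm, add_sub_cancel_left] at this) (mem_univ z) (mem_univ (z + h))
  rw [add_sub_cancel_left, Real.norm_eq_abs, add_assoc, ← two_smul ℝ h] at h1
  rw [show kerk z - 2 * kerk (z + h) + kerk (z + (2 : ℝ) • h) =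
    kerk (z + (2 : ℝ) • h) - kerk (z + h) - (kerk (z + h) - kerk z) by ring]
  nlinarith [norm_nonneg h]

lemma exists_avg_second_diff : ∃ L, 0 < L ∧ ∀ (f : Euc d → ℝ), LocallyIntegrable f → ∀ (p k : Euc d)
    (M B : ℝ), 0 < M → ‖k‖ ≤ M → (∀ y ∈ closedBall p (3 * M), |f y| ≤ B) →
    |avg f p M - 2 * avg f (p - k) M + avg f (p - (2 : ℝ) • k) M| ≤ L * B * (‖k‖ / M) ^ 2 := by
  obtain ⟨L, hL0, hL⟩ := exists_kerk_second_diff (d := d)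
  have ho := omd_pos (d := d)
  refine ⟨L * 3 ^ d * omd d, by positivity, fun f hf p k M B hM hk hB => ?_⟩
  set h := M⁻¹ • k
  have hh : ‖h‖ = ‖k‖ / M := by rw [norm_smul, norm_inv, Real.norm_of_nonneg hM.le, inv_mul_eq_div]
  have hh1 : ‖h‖ ≤ 1 := by rw [hh, div_le_one hM]; exact hk
  have hB0 : 0 ≤ B := (abs_nonneg _).trans (hB p (mem_closedBall_self (by positivity)))
  set κ : Euc d → ℝ := fun y => kerk (M⁻¹ • (y - p)) - 2 * kerk (M⁻¹ • (y - p) + h) +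
    kerk (M⁻¹ • (y - p) + (2 : ℝ) • h)
  have e1 : avg f p M - 2 * avg f (p - k) M + avg f (p - (2 : ℝ) • k) M =
      ∫ y, f y * (M⁻¹ ^ d * κ y) := by
    have i1 := integrable_avg hf p hM
    have i2 := (integrable_avg hf (p - k) hM).const_mul 2
    rw [avg, avg, avg, ← integral_const_mul, ← integral_sub' i1 i2,
      ← integral_add' (i1.sub i2) (integrable_avg hf _ hM)]
    refine integral_congr_ae (.of_forall fun y => ?_)
    have a1 : M⁻¹ • (y - (p - k)) = M⁻¹ • (y - p) + h := by simp only [h]; module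
    have a2 : M⁻¹ • (y - (p - (2 : ℝ) • k)) = M⁻¹ • (y - p) + (2 : ℝ) • h := by simp only [h]; module
    simp only [Pi.add_apply, Pi.sub_apply, κ, a1, a2]
    ring
  have e2 : ∀ y, y ∉ closedBall p (3 * M) → κ y = 0 := fun y hy => by
    rw [mem_closedBall, not_le] at hy
    have hz : 3 < ‖M⁻¹ • (y - p)‖ := by rw [norm_scale hM, lt_inv_mul_iff₀ hM]; linarith
    have b1 := norm_sub_le_norm_add (M⁻¹ • (y - p)) h
    have b2 := norm_sub_le_norm_add (M⁻¹ • (y - p)) ((2 : ℝ) • h)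
    rw [norm_smul (2 : ℝ), Real.norm_two] at b2
    simp only [κ]
    rw [kerk_eq_zero (by linarith), kerk_eq_zero (by linarith), kerk_eq_zero (by linarith)]
    ring
  rw [e1, ← setIntegral_eq_integral_of_forall_compl_eq_zero (s := closedBall p (3 * M))
    fun y hy => by rw [e2 y hy]; simp, ← Real.norm_eq_abs]
  refine (norm_setIntegral_le_of_norm_le_const (C := B * (M⁻¹ ^ d * (L * ‖h‖ ^ 2)))
    (isCompact_closedBall _ _).measure_lt_top fun y hy => ?_).trans (le_of_eq ?_)
  · rw [norm_mul, norm_mul, Real.norm_of_nonneg (by positivity : 0 ≤ M⁻¹ ^ d)]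
    gcongr
    · exact hB y hy
    · exact hL _ _
  · have : volume.real (closedBall p (3 * M)) = (3 * M) ^ d * omd d := mvol_closedBall p (by positivity)
    have e3 : M⁻¹ ^ d * M ^ d = 1 := by rw [← mul_pow, inv_mul_cancel₀ hM.ne', one_pow]
    rw [this, hh, mul_pow 3 M]
    linear_combination (B * L * (‖k‖ / M) ^ 2 * 3 ^ d * omd d) * e3

/-- The rescaling of `u` around `x`. -/
def uScale (u : Euc d → ℝ) (x : Euc d) (r : ℝ) (p : Euc d) : ℝ := r⁻¹ * u (x + r • p)

lemma avg_uScale (u : Euc d → ℝ) (x p : Euc d) (hr : 0 < r) (s : ℝ) :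
    avg (uScale u x r) p s = r⁻¹ * avg u (x + r • p) (r * s) := by
  have h1 := integral_comp_affine (fun y => r⁻¹ * u y *
    (s⁻¹ ^ d * kerk (s⁻¹ • (r⁻¹ • (y - x) - p)))) x hr
  simp only [add_sub_cancel_left, inv_smul_smul₀ hr.ne'] at h1
  rw [avg, avg, ← integral_const_mul]
  refine h1.trans ?_
  rw [smul_eq_mul, ← integral_const_mul]
  refine integral_congr_ae (.of_forall fun y => ?_)
  have : (r * s)⁻¹ • (y - (x + r • p)) = s⁻¹ • (r⁻¹ • (y - x) - p) := by
    rw [mul_inv, mul_comm, mul_smul, ← sub_sub, smul_sub r⁻¹ (y - x), inv_smul_smul₀ hr.ne']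
  simp only [this]
  rw [mul_inv, mul_pow]
  ring

lemma bumpK_scale (x p : Euc d) (hr : 0 < r) (s : ℝ) (y : Euc d) :
    bumpK (x + r • p) (r * s) y = bumpK p s (r⁻¹ • (y - x)) := by
  rw [bumpK, bumpK, mul_inv, mul_comm, mul_smul, ← sub_sub, smul_sub r⁻¹ (y - x), inv_smul_smul₀ hr.ne']

namespace RegState

lemma integrable (h : 𝓡) : Integrable u := by
  obtain ⟨M, hM⟩ := h.bddD.subset_closedBall 0
  refine (h.integrableOn 0 M).integrable_of_ae_notMem_eq_zero ?_
  filter_upwards [h.inH.ae_eq_zero] with y hy hyM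
  exact hy fun hyΩ => hyM (hM (h.subset hyΩ))

lemma hasDerivAt_avg_uScale (h : 𝓡) (x p : Euc d) (hr : 0 < r)
    (hs : 0 < s) : HasDerivAt (avg (uScale u x r) p) (s * s⁻¹ ^ d * (mScale μ x r (bumpK p s) -
      lam * (r * r⁻¹ ^ d * ∫ y, u y * bumpK p s (r⁻¹ • (y - x))))) s := by
  have h1 : avg (uScale u x r) p = fun s => r⁻¹ * avg u (x + r • p) (r * s) :=
    funext fun s => avg_uScale u x p hr s
  rw [h1]
  have h2 := (HasDerivAt.comp s (h.hasDerivAt (x + r • p) (mul_pos hr hs))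
    ((hasDerivAt_id s).const_mul r)).const_mul r⁻¹
  refine h2.congr_deriv ?_
  simp_rw [bumpK_scale x p hr s, mScale, mul_inv, mul_pow]
  field_simp

lemma mScale_bumpK_le (h : 𝓡) (hE : 𝓔)
    (hx : x ∈ D) (p : Euc d) (hM : 0 < M) : ∀ᶠ r in 𝓝[>] (0 : ℝ), ∀ s ∈ Ioc 0 M,
      0 ≤ s * s⁻¹ ^ d * mScale μ x r (bumpK p s) ∧ s * s⁻¹ ^ d * mScale μ x r (bumpK p s) ≤ C := by
  obtain ⟨t, ht, htD⟩ := isOpen_iff.1 h.openD x hx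
  have := h.fin
  have hR := hE.R_pos
  have hcpos : 0 < ‖p‖ + 8 * M := by positivity
  filter_upwards [(tendsto_nhdsWithin_iff.1 (tendsto_const_mul_nhdsGT_zero hcpos)).1.eventually
    (gt_mem_nhds (by positivity : 0 < min R t)), self_mem_nhdsWithin] with r hr (hr0 : 0 < r) s hs
  have hrR := hr.trans_le (min_le_left _ _)
  have hrt := hr.trans_le (min_le_right _ _)
  have hs0 : 0 < s := hs.1
  have hsM : s * r ≤ M * r := by gcongr; exact hs.2
  have hp0 : 0 ≤ ‖p‖ * r := by positivity
  have hMr : 0 < M * r := by positivity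
  have h1 : ∫ y, bumpK p s (r⁻¹ • (y - x)) ∂μ ≤ μ.real (closedBall (x + r • p) (r * s)) := by
    simp_rw [← bumpK_scale x p hr0 s]
    exact (h.integral_bumpK_le (x + r • p) (mul_pos hr0 hs0)).trans (measureReal_mono
      ball_subset_closedBall (isCompact_closedBall _ _).measure_lt_top.ne)
  have h2 := hE.up_measure (x + r • p) (r * s) (by positivity) (by nlinarith)
    ((ball_subset_ball' (by
      rw [dist_eq_norm, add_sub_cancel_left, norm_smul, Real.norm_of_nonneg hr0.le]; linarith)).trans htD)
  rw [mScale]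
  have h0 : 0 ≤ ∫ y, bumpK p s (r⁻¹ • (y - x)) ∂μ := integral_nonneg fun y => bumpK_nonneg _ _ _
  refine ⟨by positivity, ?_⟩
  calc _ ≤ s * s⁻¹ ^ d * (r * r⁻¹ ^ d * μ.real (closedBall (x + r • p) (r * s))) := by gcongr
    _ = ((r * s)⁻¹) ^ d * (r * s * μ.real (closedBall (x + r • p) (r * s))) := by
        rw [mul_inv, mul_pow]; ring
    _ ≤ ((r * s)⁻¹) ^ d * (C * (r * s) ^ d) := by gcongr
    _ = C * ((r * s)⁻¹ * (r * s)) ^ d := by rw [mul_pow]; ring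
    _ = C := by rw [inv_mul_cancel₀ (by positivity), one_pow, mul_one]

lemma hasDerivAt_avg_posPart (e p : Euc d) (hs : 0 < s) :
    HasDerivAt (avg (fun y => max ⟪e, y⟫ 0) p) (s * s⁻¹ ^ d * planeInt e (bumpK p s)) s := by
  refine (hasDerivAt_avg (weakGrad_posPart e) p hs).congr_deriv ?_
  rw [integral_inner_halfspace, planeInt, volVar]
  ring

lemma tendsto_avg_sub (h : 𝓡) (hE : 𝓔)
    (hp : RegPt D u μ x e q) (p : Euc d) (hM : 0 < M) :
    Tendsto (fun r => (avg (uScale u x r) p M - q * avg (fun y => max ⟪e, y⟫ 0) p M) -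
      massk d * (uScale u x r p - q * max ⟪e, p⟫ 0)) (𝓝[>] 0) (𝓝 0) := by
  have hpl := h.mScale_bumpK_le hE hp.mem.1 p hM
  obtain ⟨B, hB0, hB⟩ := h.exists_bound h.precise
  have hlam := h.lam_nonneg
  set κ := ∫ z : Euc d, kerK z
  have hκ : 0 ≤ κ := integral_nonneg kerK_nonneg
  have hTK : ∀ s, 0 < s → TestFun univ (bumpK p s) := fun s hs => bumpK_testFun p hs (subset_univ _)
  have rest : ∀ r, 0 < r → ∀ s, 0 < s →
      |s * s⁻¹ ^ d * (lam * (r * r⁻¹ ^ d * ∫ y, u y * bumpK p s (r⁻¹ • (y - x))))| ≤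
        s * (lam * (r * (B * κ))) := fun r hr s hs => by
    have h0 : 0 ≤ ∫ y, u y * bumpK p s (r⁻¹ • (y - x)) :=
      integral_nonneg fun y => mul_nonneg (h.nonneg y) (bumpK_nonneg _ _ _)
    have h1 : ∫ y, u y * bumpK p s (r⁻¹ • (y - x)) ≤ B * ((r * s) ^ d * κ) := by
      simp_rw [← bumpK_scale x p hr s]
      have hT : TestFun univ (bumpK (x + r • p) (r * s)) :=
        bumpK_testFun _ (mul_pos hr hs) (subset_univ _)
      rw [← smul_eq_mul (a := (r * s) ^ d), ← integral_comp_scale kerK (x + r • p) (mul_pos hr hs),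
        ← integral_const_mul]
      exact integral_mono (h.integrable_mul (hT.memLp 2 volume)) ((hT.integrable volume).const_mul B)
        fun y => mul_le_mul_of_nonneg_right (hB y) (bumpK_nonneg _ _ _)
    rw [abs_of_nonneg (by positivity)]
    calc _ ≤ s * s⁻¹ ^ d * (lam * (r * r⁻¹ ^ d * (B * ((r * s) ^ d * κ)))) := by gcongr
      _ = s * (lam * (r * (B * κ))) * ((r⁻¹ * r) ^ d * (s⁻¹ * s) ^ d) := by
          rw [mul_pow r s, mul_pow r⁻¹, mul_pow s⁻¹]; ring
      _ = _ := by rw [inv_mul_cancel₀ hr.ne', inv_mul_cancel₀ hs.ne', one_pow]; ring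
  have lim1 : ∀ s, 0 < s → Tendsto (fun r => s * s⁻¹ ^ d * mScale μ x r (bumpK p s)) (𝓝[>] 0)
      (𝓝 (q * (s * s⁻¹ ^ d * planeInt e (bumpK p s)))) := fun s hs => by
    have := (hp.lim _ (hTK s hs)).const_mul (s * s⁻¹ ^ d)
    rwa [mul_left_comm] at this
  have hplane : ∀ s ∈ Ioc 0 M, 0 ≤ q * (s * s⁻¹ ^ d * planeInt e (bumpK p s)) ∧
      q * (s * s⁻¹ ^ d * planeInt e (bumpK p s)) ≤ C := fun s hs =>
    ⟨ge_of_tendsto (lim1 s hs.1) (hpl.mono fun r hr => (hr s hs).1),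
      le_of_tendsto (lim1 s hs.1) (hpl.mono fun r hr => (hr s hs).2)⟩
  refine tendsto_sub_of_deriv (f := fun r s => avg (uScale u x r) p s -
    q * avg (fun y => max ⟪e, y⟫ 0) p s) (K := C + M * (lam * (1 * (B * κ)))) hM
    (f' := fun r s => s * s⁻¹ ^ d * (mScale μ x r (bumpK p s) -
      lam * (r * r⁻¹ ^ d * ∫ y, u y * bumpK p s (r⁻¹ • (y - x)))) -
      q * (s * s⁻¹ ^ d * planeInt e (bumpK p s))) ?_ ?_ ?_ ?_
  · filter_upwards [self_mem_nhdsWithin] with r hr s hs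
    exact (h.hasDerivAt_avg_uScale x p hr hs).sub ((hasDerivAt_avg_posPart e p hs).const_mul q)
  · filter_upwards [hpl, self_mem_nhdsWithin, (gt_mem_nhds one_pos).filter_mono nhdsWithin_le_nhds]
      with r hr hr0 hr1 s hs
    have hs0 : 0 < s := hs.1
    have h1 := hr s hs
    have h2 := hplane s hs
    have h3 := rest r hr0 s hs.1
    have h4 : s * (lam * (r * (B * κ))) ≤ M * (lam * (1 * (B * κ))) := by
      have : (0 : ℝ) < r := hr0
      gcongr
      exact hs.2
    rw [mul_sub, abs_le] 
    rw [abs_le] at h3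
    constructor <;> linarith [h1.1, h1.2, h2.1, h2.2, h3.1, h3.2]
  · filter_upwards [self_mem_nhdsWithin] with r (hr : 0 < r)
    have t1 : Tendsto (avg (uScale u x r) p) (𝓝[>] 0) (𝓝 (massk d * uScale u x r p)) := by
      have := ((h.precise (x + r • p)).comp (tendsto_const_mul_nhdsGT_zero hr)).const_mul r⁻¹
      rw [mul_left_comm] at this
      exact this.congr fun s => (avg_uScale u x p hr s).symm
    have hc : Continuous fun y : Euc d => max ⟪e, y⟫ 0 :=
      (continuous_const.inner continuous_id).max continuous_const
    have t2 := tendsto_avg_of_continuousAt hc.locallyIntegrable (hc.continuousAt (x := p))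
    rw [mul_sub, mul_left_comm]
    exact t1.sub (t2.const_mul q)
  · intro s hs
    have t1 := lim1 s hs.1
    have t2 : Tendsto (fun r => s * s⁻¹ ^ d * (lam * (r * r⁻¹ ^ d *
        ∫ y, u y * bumpK p s (r⁻¹ • (y - x))))) (𝓝[>] 0) (𝓝 0) := by
      refine squeeze_zero_norm' (a := fun r => s * (lam * (r * (B * κ)))) ?_ ?_
      · filter_upwards [self_mem_nhdsWithin] with r hr
        exact rest r hr s hs.1
      · exact tendsto_nhdsGT_zero (by fun_prop) (by simp)
    have := (t1.sub t2).sub_const (q * (s * s⁻¹ ^ d * planeInt e (bumpK p s)))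
    simpa [mul_sub] using this

lemma uScale_le (h : 𝓡) (hE : 𝓔)
    (hx : x ∈ 𝓕) (hM : 0 < M) :
    ∀ᶠ r in 𝓝[>] (0 : ℝ), ∀ p ∈ closedBall 0 M, |uScale u x r p| ≤ C * M := by
  obtain ⟨t, ht, htD⟩ := isOpen_iff.1 h.openD x hx.1
  have hR := hE.R_pos
  filter_upwards [(tendsto_nhdsWithin_iff.1 (tendsto_const_mul_nhdsGT_zero hM)).1.eventually
    (gt_mem_nhds (by positivity : 0 < min R (t / 32))), self_mem_nhdsWithin] with r hr (hr0 : 0 < r) p hpM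
  have h1 := hE.up_fun x hx (M * r) (by positivity) (hr.le.trans (min_le_left _ _))
    ((ball_subset_ball (by linarith [hr.trans_le (min_le_right _ _)])).trans htD) (x + r • p) (by
      rw [mem_closedBall, dist_eq_norm, add_sub_cancel_left, norm_smul, Real.norm_of_nonneg hr0.le,
        mul_comm]
      gcongr
      exact mem_closedBall_zero_iff.1 hpM)
  rw [uScale, abs_of_nonneg (mul_nonneg (by positivity) (h.nonneg _)), inv_mul_le_iff₀ hr0]
  linarith

/-- The blow-up of `u` at a regular point is a multiple of the positive part of a linear form. -/
theorem tendsto_uScale (h : 𝓡) (hE : 𝓔)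
    (hp : RegPt D u μ x e q) {p : Euc d} (hep : ⟪e, p⟫ ≠ 0) :
    Tendsto (fun r => uScale u x r p) (𝓝[>] 0) (𝓝 (q * max ⟪e, p⟫ 0)) := by
  have hzero : ∀ p, ⟪e, p⟫ < 0 → ∀ᶠ r in 𝓝[>] (0 : ℝ), uScale u x r p = 0 := fun p hp' =>
    (hp.flat_neg p hp').mono fun r hr => by rw [uScale, hr, mul_zero]
  rcases hep.lt_or_gt with hneg | hpos
  · rw [max_eq_right hneg.le, mul_zero]
    exact tendsto_const_nhds.congr' ((hzero p hneg).mono fun r hr => hr.symm)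
  obtain ⟨L, hL0, hL⟩ := exists_avg_second_diff (d := d)
  have hq := hp.q_pos
  have hC := hE.C_pos
  have hm := massk_pos (d := d)
  set k := (2 * ⟪e, p⟫) • e
  have hee := hp.inner_self
  have n1 : ⟪e, p - k⟫ < 0 := by rw [inner_sub_right, inner_smul_right, hee]; linarith
  have n2 : ⟪e, p - (2 : ℝ) • k⟫ < 0 := by
    rw [inner_sub_right, inner_smul_right, inner_smul_right, hee]; linarith
  suffices H : Tendsto (fun r => massk d * (uScale u x r p - q * max ⟪e, p⟫ 0)) (𝓝[>] 0) (𝓝 0) by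
    have := (H.const_mul (massk d)⁻¹).add_const (q * max ⟪e, p⟫ 0)
    simpa [hm.ne'] using this
  rw [Metric.tendsto_nhds]
  intro ε hε
  obtain ⟨M, hMk, hMp, hM1, hMε⟩ : ∃ M : ℝ, ‖k‖ ≤ M ∧ ‖p‖ ≤ M ∧ 1 ≤ M ∧
      4 * (L * (C + q) * ‖k‖ ^ 2) / M < ε / 2 :=
    ((eventually_ge_atTop ‖k‖).and ((eventually_ge_atTop ‖p‖).and ((eventually_ge_atTop 1).and
      ((tendsto_const_nhds.div_atTop tendsto_id).eventually (gt_mem_nhds (half_pos hε)))))).exists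
  have hM0 : 0 < M := by linarith
  have t := ((h.tendsto_avg_sub hE hp p hM0).sub ((h.tendsto_avg_sub hE hp (p - k) hM0).const_mul 2)).add
    (h.tendsto_avg_sub hE hp (p - (2 : ℝ) • k) hM0)
  rw [mul_zero, sub_zero, add_zero] at t
  filter_upwards [t.eventually (ball_mem_nhds 0 (half_pos hε)), hzero _ n1, hzero _ n2,
    h.uScale_le hE hp.mem (by positivity : 0 < 4 * M), self_mem_nhdsWithin] with r hr z1 z2 hu (hr0 : 0 < r)
  rw [z1, z2, max_eq_right n1.le, max_eq_right n2.le] at hr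
  have hsub : closedBall p (3 * M) ⊆ closedBall 0 (4 * M) :=
    closedBall_subset_closedBall' (by rw [dist_zero_right]; linarith)
  have hlu : LocallyIntegrable (uScale u x r) :=
    (((h.integrable.comp_add_left x).comp_smul hr0.ne').const_mul r⁻¹).locallyIntegrable
  have hlv : Continuous fun y : Euc d => max ⟪e, y⟫ 0 :=
    (continuous_const.inner continuous_id).max continuous_const
  have d1 := hL _ hlu p k M (C * (4 * M)) hM0 hMk fun y hy => hu y (hsub hy)
  have d2 := hL _ hlv.locallyIntegrable p k M (4 * M) hM0 hMk fun y hy => by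
    rw [abs_of_nonneg (le_max_right _ _)]
    refine max_le ?_ (by positivity)
    have := real_inner_le_norm e y
    rw [hp.unit, one_mul] at this
    exact this.trans (mem_closedBall_zero_iff.1 (hsub hy))
  have e1 : L * (C * (4 * M)) * (‖k‖ / M) ^ 2 + q * (L * (4 * M) * (‖k‖ / M) ^ 2) =
      4 * (L * (C + q) * ‖k‖ ^ 2) / M := by field_simp
  rw [Real.dist_eq, sub_zero, abs_lt] at hr
  rw [abs_le] at d1 d2
  rw [Real.dist_eq, sub_zero, abs_lt]
  have d3 := mul_le_mul_of_nonneg_left d2.1 hq.le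
  have d4 := mul_le_mul_of_nonneg_left d2.2 hq.le
  constructor <;> linarith [hr.1, hr.2, d1.1, d1.2]

end RegState

lemma divg_gradient_scale (hχ : Smooth χ) (x : Euc d) (r : ℝ)
    (y : Euc d) : divg (fun y => gradient (fun y => χ (r⁻¹ • (y - x))) y) y =
      r⁻¹ ^ 2 * divg (fun y => gradient χ y) (r⁻¹ • (y - x)) := by
  have h1 : HasFDerivAt (fun y : Euc d => r⁻¹ • (y - x)) (r⁻¹ • ContinuousLinearMap.id ℝ (Euc d)) y :=
    ((hasFDerivAt_id y).sub_const x).const_smul r⁻¹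
  have h2 := (((smooth_differentiable (contDiff_gradient hχ) _).hasFDerivAt).comp y h1).const_smul r⁻¹
  have h3 : (fun y => gradient (fun y => χ (r⁻¹ • (y - x))) y) =
      r⁻¹ • ((fun y => gradient χ y) ∘ fun y => r⁻¹ • (y - x)) :=
    funext fun y => gradient_comp_scale (smooth_differentiable hχ) x r y
  rw [divg, h3, h2.fderiv, divg, Finset.mul_sum]
  exact Finset.sum_congr rfl fun i _ => by simp [pow_two, mul_assoc]

namespace RegState

lemma tendsto_integral_uScale (h : 𝓡) (hE : 𝓔)
    (hp : RegPt D u μ x e q) (k : ℕ) {ξ : Euc d → ℝ} (hξ : Continuous ξ) (hc : HasCompactSupport ξ) :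
    Tendsto (fun r => ∫ p, uScale u x r p ^ k * ξ p) (𝓝[>] 0)
      (𝓝 (q ^ k * ∫ p, max ⟪e, p⟫ 0 ^ k * ξ p)) := by
  have he0 := hp.ne_zero
  obtain ⟨M, hM⟩ := hc.isCompact.isBounded.subset_closedBall 0
  have hM' : tsupport ξ ⊆ closedBall 0 (max M 1) :=
    hM.trans (closedBall_subset_closedBall (le_max_left _ _))
  rw [← integral_const_mul]
  refine tendsto_integral_filter_of_dominated_convergence
    (fun p => (C * max M 1) ^ k * ‖ξ p‖) ?_ ?_ ((hξ.integrable_of_hasCompactSupport hc).norm.const_mul _) ?_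
  · filter_upwards [self_mem_nhdsWithin] with r hr
    have := (((h.integrable.comp_add_left x).comp_smul (ne_of_gt hr)).const_mul r⁻¹).1
    exact (this.pow k).mul hξ.aestronglyMeasurable
  · filter_upwards [h.uScale_le hE hp.mem (by positivity : 0 < max M 1)] with r hr
    refine .of_forall fun p => ?_
    rw [norm_mul, norm_pow]
    by_cases hpξ : p ∈ tsupport ξ
    · gcongr
      exact hr p (hM' hpξ)
    · simp [image_eq_zero_of_notMem_tsupport hpξ]
  · filter_upwards [ae_inner_ne_zero he0] with p hep
    have := ((h.tendsto_uScale hE hp hep).pow k).mul_const (ξ p)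
    rwa [mul_pow, mul_assoc] at this

lemma ae_grad_zero (h : 𝓡) : ∀ᵐ y, y ∉ 𝓐 → G y = 0 := by
  filter_upwards [h.grad_zero, h.inH.ae_eq_zero] with y h1 h2 hy
  refine h1 ?_
  by_cases hyΩ : y ∈ Ω
  · exact absurd (h.subset_posSet hyΩ) hy
  · exact h2 hyΩ

/-- Strong convergence of the blow-ups of the gradient. -/
lemma tendsto_grad_scale (h : 𝓡) (hE : 𝓔)
    (hp : RegPt D u μ x e q) (hχ : TestFun univ χ) :
    Tendsto (fun r => r⁻¹ ^ d * ∫ y, χ (r⁻¹ • (y - x)) *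
      ‖G y - (𝓐).indicator (fun _ => q • e) y‖ ^ 2) (𝓝[>] 0) (𝓝 0) := by
  have he0 := hp.ne_zero
  have hee := hp.inner_self
  obtain ⟨M, hM1, hM⟩ := hχ.exists_radius
  have hT : ∀ r : ℝ, 0 < r → TestFun univ (fun y => χ (r⁻¹ • (y - x))) := fun r hr =>
    hχ.scale hM x hr (subset_univ _)
  have hgc : HasCompactSupport fun y => gradient χ y := hχ.2.1.gradient
  have hgs := contDiff_gradient hχ.1
  have hP : MeasurableSet 𝓐 := h.isOpen_posSet.measurableSet
  set m := ∫ y in {y | 0 < ⟪e, y⟫}, χ y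
  have iG : ∀ r : ℝ, 0 < r → Integrable fun y => χ (r⁻¹ • (y - x)) * ‖G y‖ ^ 2 := fun r hr => by
    obtain ⟨B, -, hB⟩ := (hT r hr).bounded
    exact integrable_bdd_mul (integrable_sq_of_memLp h.inH.memG) (hT r hr).continuous hB
  have ibp1 : ∫ p, max ⟪e, p⟫ 0 * ⟪gradient χ p, e⟫ = -m := by
    have h1 := (weakGrad_posPart e).ibp (fun y => χ y • e) (hχ.1.smul contDiff_const) hχ.2.1.smul_right
    simp_rw [fun y => divg_smul_const (hχ.differentiable y) e] at h1
    rw [h1, integral_inner_halfspace]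
    simp_rw [inner_smul_left, hee, conj_trivial, mul_one]
    rfl
  have ibp2 : ∫ p, max ⟪e, p⟫ 0 ^ 2 * divg (fun y => gradient χ y) p = 2 * m := by
    have hl : ∀ y, HasGradientAt (fun y : Euc d => ⟪e, y⟫) e y := fun y =>
      hasGradientAt_iff_hasFDerivAt.2 (innerSL ℝ e).hasFDerivAt
    have hsl : Smooth fun y : Euc d => ⟪e, y⟫ := (innerSL ℝ e).contDiff
    have h1 := (weakGrad_posPart e).ibp _ (hsl.smul hgs) hgc.smul_left
    have hm : Continuous fun y : Euc d => max ⟪e, y⟫ 0 := hsl.continuous.max continuous_const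
    have h2 : ∀ y, divg ((fun y => ⟪e, y⟫) • fun y => gradient χ y) y = _ := fun y =>
      divg_smul (hl y).differentiableAt (smooth_differentiable hgs y)
    have h3 : ∀ y, max ⟪e, y⟫ 0 * divg ((fun y => ⟪e, y⟫) • fun y => gradient χ y) y =
        max ⟪e, y⟫ 0 ^ 2 * divg (fun y => gradient χ y) y + max ⟪e, y⟫ 0 * ⟪gradient χ y, e⟫ := fun y => by
      rw [h2, (hl y).gradient, real_inner_comm e]
      rcases le_total ⟪e, y⟫ 0 with hy | hy
      · simp [max_eq_right hy]
      · rw [max_eq_left hy]; ring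
    have h4 : ∀ y, ⟪{y | 0 < ⟪e, y⟫}.indicator (fun _ => e) y, ((fun y => ⟪e, y⟫) • fun y =>
        gradient χ y) y⟫ = max ⟪e, y⟫ 0 * ⟪gradient χ y, e⟫ := fun y => by
      rcases le_or_gt ⟪e, y⟫ 0 with hy | hy
      · rw [indicator_of_notMem (by simpa using hy), max_eq_right hy]; simp
      · rw [indicator_of_mem (by simpa using hy), max_eq_left hy.le, Pi.smul_apply', inner_smul_right,
          real_inner_comm e]
    simp_rw [h3, h4] at h1
    rw [integral_add, ibp1] at h1
    · linarith
    · exact ((hm.pow 2).mul (continuous_divg hgs)).integrable_of_hasCompactSupport hgc.divg.mul_left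
    · exact (hm.mul (hgs.continuous.inner continuous_const)).integrable_of_hasCompactSupport
        (hgc.comp_left (g := fun v => ⟪v, e⟫) (by simp)).mul_left
  have E1 : Tendsto (fun r => r⁻¹ ^ d * ∫ y, χ (r⁻¹ • (y - x)) * ‖G y‖ ^ 2) (𝓝[>] 0)
      (𝓝 (q ^ 2 * m)) := by
    have t1 := h.tendsto_integral_uScale hE hp 2 hχ.continuous hχ.2.1
    have t2 := h.tendsto_integral_uScale hE hp 2 (continuous_divg hgs) hgc.divg
    have t0 : Tendsto (fun r : ℝ => lam * r ^ 2) (𝓝[>] 0) (𝓝 0) :=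
      tendsto_nhdsGT_zero (by fun_prop) (by simp)
    have t3 := (t0.mul t1).add (t2.const_mul (1 / 2))
    rw [ibp2, zero_mul, zero_add, show 1 / 2 * (q ^ 2 * (2 * m)) = q ^ 2 * m by ring] at t3
    refine t3.congr' ?_
    filter_upwards [self_mem_nhdsWithin] with r (hr : 0 < r)
    have w1 := h.weakH (h.inH.mul_test (hT r hr))
    have w2 := h.inH.integral_sq_mul_divg (contDiff_gradient (hT r hr).1) (hT r hr).2.1.gradient
    simp_rw [divg_gradient_scale hχ.1] at w2
    have i1 := iG r hr
    have w3 : ∫ y, u y * ⟪G y, gradient (fun y => χ (r⁻¹ • (y - x))) y⟫ =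
        lam * (∫ y, u y * (χ (r⁻¹ • (y - x)) * u y)) - ∫ y, χ (r⁻¹ • (y - x)) * ‖G y‖ ^ 2 := by
      rw [← w1, ← integral_sub (h.integrable_inner (h.inH.mul_test (hT r hr)).memG) i1]
      refine integral_congr_ae (.of_forall fun y => ?_)
      simp only [inner_add_right, inner_smul_right, real_inner_self_eq_norm_sq]
      ring
    rw [w3] at w2
    have s1 := integral_scale (fun y p => (r⁻¹ * u y) ^ 2 * χ p) x hr
    have s2 := integral_scale (fun y p => (r⁻¹ * u y) ^ 2 * divg (fun y => gradient χ y) p) x hr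
    simp only [uScale]
    rw [← s1, ← s2]
    have f1 : ∫ y, (r⁻¹ * u y) ^ 2 * χ (r⁻¹ • (y - x)) =
        r⁻¹ ^ 2 * ∫ y, u y * (χ (r⁻¹ • (y - x)) * u y) := by
      rw [← integral_const_mul]; congr 1; ext y; ring
    have f2 : ∫ y, (r⁻¹ * u y) ^ 2 * divg (fun y => gradient χ y) (r⁻¹ • (y - x)) =
        ∫ y, u y ^ 2 * (r⁻¹ ^ 2 * divg (fun y => gradient χ y) (r⁻¹ • (y - x))) := by
      congr 1; ext y; ring
    rw [f1, f2, w2]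
    field_simp
    ring
  have E2 : Tendsto (fun r => r⁻¹ ^ d * ∫ y, χ (r⁻¹ • (y - x)) * ⟪G y, e⟫) (𝓝[>] 0)
      (𝓝 (q * m)) := by
    have t1 := (h.tendsto_integral_uScale hE hp 1 (hχ.continuous_gradient.inner continuous_const)
      (hgc.comp_left (g := fun v => ⟪v, e⟫) (by simp))).neg
    simp only [pow_one] at t1
    rw [ibp1, mul_neg, neg_neg] at t1
    refine t1.congr' ?_
    filter_upwards [self_mem_nhdsWithin] with r (hr : 0 < r)
    have w1 := h.inH.integral_mul_divg (X := fun y => χ (r⁻¹ • (y - x)) • e)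
      ((hT r hr).1.smul contDiff_const) (hT r hr).2.1.smul_right
    simp_rw [fun y => divg_smul_const ((hT r hr).differentiable y) e,
      gradient_comp_scale hχ.differentiable, inner_smul_left, inner_smul_right, conj_trivial] at w1
    have s1 := integral_scale (fun y p => r⁻¹ * u y * ⟪gradient χ p, e⟫) x hr
    simp only [uScale]
    rw [← s1, ← mul_neg]
    congr 1
    rw [← neg_eq_iff_eq_neg.2 w1, neg_inj]
    congr 1; ext y; ring
  have E3 := h.tendsto_indicator_scale he0 hp.flat_pos hp.flat_neg (hχ.integrable volume)
  have t := (E1.sub (E2.const_mul (2 * q))).add (E3.const_mul (q ^ 2))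
  rw [show q ^ 2 * m - 2 * q * (q * m) + q ^ 2 * m = 0 by ring] at t
  refine t.congr' ?_
  filter_upwards [self_mem_nhdsWithin] with r hr
  have i2 : Integrable fun y => χ (r⁻¹ • (y - x)) * ⟪G y, e⟫ := by
    have := integrable_inner_of_memLp_two h.inH.memG (((hT r hr).continuous.smul
      (continuous_const (y := e))).memLp_of_hasCompactSupport (hT r hr).2.1.smul_right)
    exact this.congr (.of_forall fun y => inner_smul_right _ _ _)
  have e1 : ∫ y, χ (r⁻¹ • (y - x)) * ‖G y - (𝓐).indicator (fun _ => q • e) y‖ ^ 2 =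
      (∫ y, χ (r⁻¹ • (y - x)) * ‖G y‖ ^ 2) - 2 * q * (∫ y, χ (r⁻¹ • (y - x)) * ⟪G y, e⟫) +
      q ^ 2 * ∫ y in 𝓐, χ (r⁻¹ • (y - x)) := by
    rw [← integral_indicator hP, ← integral_const_mul, ← integral_const_mul,
      ← integral_sub' (iG r hr) (i2.const_mul _), ← integral_add' ((iG r hr).sub (i2.const_mul _))
        ((((hT r hr).integrable volume).indicator hP).const_mul _)]
    refine integral_congr_ae ?_
    filter_upwards [h.ae_grad_zero] with y hy
    simp only [Pi.add_apply, Pi.sub_apply]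
    by_cases hyP : y ∈ 𝓐
    · rw [indicator_of_mem hyP, indicator_of_mem hyP, norm_sub_sq_real, inner_smul_right, norm_smul,
        hp.unit, mul_one, Real.norm_eq_abs, sq_abs]
      ring
    · rw [indicator_of_notMem hyP, indicator_of_notMem hyP, hy hyP]; simp
  rw [e1]; ring

lemma planeInt_bumpK_pos (h : 𝓡) (hE : 𝓔)
    (hp : RegPt D u μ x e q) : 0 < planeInt e (bumpK 0 1) := by
  obtain ⟨c, hc0, -, hc⟩ := exists_kerK_lower (d := d)
  have hC := hE.C_pos
  have hR := hE.R_pos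
  obtain ⟨t, ht, htD⟩ := Metric.isOpen_iff.1 h.openD x hp.mem.1
  have h1 : 2 * c / (C * 2 ^ d) ≤ q * planeInt e (bumpK 0 1) := by
    refine ge_of_tendsto (hp.lim _ (bumpK_testFun 0 one_pos (subset_univ _))) ?_
    filter_upwards [Ioo_mem_nhdsGT (lt_min (by positivity : 0 < t / 8) hR)] with r hr
    have hr0 := hr.1
    have hr1 := hr.2.trans_le (min_le_left _ _)
    have hr2 := hr.2.trans_le (min_le_right _ _)
    have h2 := hE.lo_measure x hp.mem (r / 2) (half_pos hr0) (by linarith)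
      ((ball_subset_ball (by linarith)).trans htD)
    have h3 := h.le_integral_bumpK hc x hr0
    have h4 : c * μ.real (ball x (r / 2)) ≤ c * μ.real (closedBall x (r / 2)) := by
      have := h.fin
      exact mul_le_mul_of_nonneg_left (measureReal_mono ball_subset_closedBall
        (isCompact_closedBall _ _).measure_lt_top.ne) hc0.le
    have e1 : mScale μ x r (bumpK 0 1) = r * r⁻¹ ^ d * ∫ y, bumpK x r y ∂μ := by
      simp only [mScale, bumpK, sub_zero, inv_one, one_smul]
    rw [e1]
    refine le_trans ?_ (mul_le_mul_of_nonneg_left (h4.trans h3) (by positivity))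
    rw [inv_pow, div_le_iff₀ (by positivity)]
    rw [div_pow] at h2
    field_simp at h2 ⊢
    nlinarith
  exact (mul_pos_iff_of_pos_left hp.q_pos).1 (lt_of_lt_of_le (by positivity) h1)

/-- The blow-up slope is the square root of the Lagrange multiplier. -/
theorem sq_slope (h : 𝓡) (hM : OptState.Multiplier D a Ω lam u G Λ ρ C')
    (hE : 𝓔) (hp : RegPt D u μ x e q) : q ^ 2 = Λ := by
  have he0 := hp.ne_zero
  have hee := hp.inner_self
  set ψ : Euc d → ℝ := bumpK 0 1
  have hψ : TestFun univ ψ := bumpK_testFun 0 one_pos (subset_univ _)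
  set χ : Euc d → ℝ := cutB 0 1
  have hχ : TestFun univ χ := cutB_testFun 0 one_pos (subset_univ _)
  obtain ⟨K, hK0, hK⟩ := hψ.bounded_gradient
  have hψ0 : ∀ z : Euc d, 1 ≤ ‖z‖ → ψ z = 0 := fun z hz => bumpK_eq_zero one_pos (by simpa using hz)
  have hAχ : ∀ p, ‖gradient ψ p‖ ≤ K * χ p := fun p => by
    rcases le_or_gt ‖p‖ 1 with h1 | h1
    · rw [show χ p = 1 from cutB_eq_one one_pos (by simpa using h1), mul_one]; exact hK p
    · have : gradient ψ p = 0 := by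
        refine gradient_eq_zero_of_notMem_tsupport fun hh => ?_
        have : tsupport ψ ⊆ closedBall 0 1 :=
          (bumpK_testFun (0 : Euc d) one_pos (subset_refl _)).2.2
        exact h1.not_ge (by simpa using this hh)
      rw [this, norm_zero]; exact mul_nonneg hK0 (cutB_nonneg _ _ _)
  have hT : ∀ r : ℝ, 0 < r → TestFun univ (fun y => ψ (r⁻¹ • (y - x))) := fun r hr =>
    hψ.scale hψ0 x hr (subset_univ _)
  set I := planeInt e ψ
  have hq := hp.q_pos
  have hI : 0 < I := h.planeInt_bumpK_pos hE hp
  set J := ∫ p, χ p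
  have hPfin : volume 𝓐 ≠ ∞ :=
    ((measure_mono fun y hy => hy.1).trans_lt h.bddD.measure_lt_top).ne
  have key : ∀ τ : ℝ, 0 < τ → |(Λ - q ^ 2) * I| ≤ 3 * q * K * J * τ := fun τ hτ => by
    have t1 := h.tendsto_volVar_scale he0 hp.flat_pos hp.flat_neg hψ e
    have t2 := h.tendsto_integral_uScale hE hp 2 (hψ.continuous_gradient.inner (continuous_const (y := e)))
      (hψ.2.1.gradient.comp_left (g := fun v => ⟪v, e⟫) (by simp))
    have t0 : Tendsto (fun r : ℝ => lam * r ^ 2) (𝓝[>] 0) (𝓝 0) :=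
      tendsto_nhdsGT_zero (by fun_prop) (by simp)
    have t3 := ((t1.const_mul (q ^ 2 - Λ)).add (t0.mul t2)).abs
    rw [show volVar ψ e {y | 0 < ⟪e, y⟫} = -I from (neg_neg _).symm, zero_mul, add_zero,
      show (q ^ 2 - Λ) * -I = (Λ - q ^ 2) * I by ring] at t3
    have t4 := ((h.tendsto_grad_scale hE hp hχ).const_mul (K * (3 + 3 * q / τ))).add_const
      (3 * q * K * J * τ)
    rw [mul_zero, zero_add] at t4
    refine le_of_tendsto_of_tendsto t3 t4 ?_
    obtain ⟨t, ht, htD⟩ := Metric.isOpen_iff.1 h.openD x hp.mem.1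
    filter_upwards [self_mem_nhdsWithin, Ioo_mem_nhdsGT (lt_min ht hM.ρ_pos)] with r (hr : 0 < r) hrt
    have hTr : TestFun (D ∩ ball x ρ) (fun y => ψ (r⁻¹ • (y - x))) :=
      hψ.scale hψ0 x hr (by
        rw [one_mul]
        exact subset_inter ((closedBall_subset_ball (hrt.2.trans_le (min_le_left _ _))).trans htD)
          (closedBall_subset_ball (hrt.2.trans_le (min_le_right _ _))))
    have hst := hM.stationary x _ e hTr hp.unit.le
    set η := fun y => ψ (r⁻¹ • (y - x))
    have i0 := integrable_firstVar 0 (hT r hr) e h.inH.memV h.inH.memG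
    have i1 := ((integrable_volVar (hT r hr) e).indicator h.openΩ.measurableSet).const_mul (q ^ 2)
    have hB : ∀ y, gradient η y = r⁻¹ • gradient ψ (r⁻¹ • (y - x)) :=
      gradient_comp_scale hψ.differentiable x r
    have i2 : Integrable fun y => ⟪gradient η y, e⟫ * u y ^ 2 :=
      integrable_bdd_mul (by simpa using integrable_sq_of_memLp h.inH.memV)
        ((hT r hr).continuous_gradient.inner continuous_const) (C := r⁻¹ * K) fun y => by
          refine (abs_real_inner_le_norm _ _).trans ?_
          rw [hp.unit, mul_one, hB, norm_smul, Real.norm_of_nonneg (by positivity)]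
          exact mul_le_mul_of_nonneg_left (hK _) (by positivity)
    have e1 : firstVar lam η e u G = firstVar 0 η e u G - lam * ∫ y, ⟪gradient η y, e⟫ * u y ^ 2 := by
      rw [firstVar, firstVar, ← integral_const_mul, ← integral_sub i0 (i2.const_mul _)]
      congr 1; ext y; ring
    have e2 := integral_scale (fun y p => (r⁻¹ * u y) ^ 2 * ⟪gradient ψ p, e⟫) x hr
    have e3 : ∫ y, ⟪gradient η y, e⟫ * u y ^ 2 =
        r * ∫ y, (r⁻¹ * u y) ^ 2 * ⟪gradient ψ (r⁻¹ • (y - x)), e⟫ := by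
      rw [← integral_const_mul]; congr 1; ext y
      rw [hB, inner_smul_left, conj_trivial]; field_simp
    have e4 : (q ^ 2 - Λ) * (r * r⁻¹ ^ d * volVar η e Ω) +
        lam * r ^ 2 * ∫ p, uScale u x r p ^ 2 * ⟪gradient ψ p, e⟫ =
        r * r⁻¹ ^ d * (firstVar 0 η e u G + q ^ 2 * volVar η e Ω) := by
      simp only [uScale]
      rw [← e2]
      rw [e1, e3] at hst
      linear_combination (r * r⁻¹ ^ d) * (-hst)
    rw [e4, firstVar, volVar, ← integral_indicator h.openΩ.measurableSet, ← integral_const_mul,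
      ← integral_add i0 i1, abs_mul, abs_of_pos (by positivity : 0 < r * r⁻¹ ^ d)]
    obtain ⟨M, -, hMχ⟩ := hχ.exists_radius
    have hχr : TestFun univ (fun y => χ (r⁻¹ • (y - x))) := hχ.scale hMχ x hr (subset_univ _)
    have iH : Integrable fun y => χ (r⁻¹ • (y - x)) *
        ‖G y - (𝓐).indicator (fun _ => q • e) y‖ ^ 2 := by
      obtain ⟨B, -, hB⟩ := hχr.bounded
      exact integrable_bdd_mul (integrable_sq_of_memLp (h.inH.memG.sub (memLp_indicator_const 2
        h.isOpen_posSet.measurableSet _ (Or.inr hPfin)))) hχr.continuous hB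
    have s1 := integral_scale (fun _ p => χ p) x hr
    calc _ ≤ r * r⁻¹ ^ d * ∫ y, r⁻¹ * (K * (3 + 3 * q / τ) * (χ (r⁻¹ • (y - x)) *
          ‖G y - (𝓐).indicator (fun _ => q • e) y‖ ^ 2) +
            3 * q * K * τ * χ (r⁻¹ • (y - x))) := by
          refine mul_le_mul_of_nonneg_left ?_ (by positivity)
          rw [← Real.norm_eq_abs]
          refine norm_integral_le_of_norm_le (((iH.const_mul _).add
            ((hχr.integrable volume).const_mul _)).const_mul _) ?_
          filter_upwards [h.ae_grad_zero, measure_eq_zero_iff_ae_notMem.1 h.volume_posSet_diff]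
            with y hy1 hy2
          have hBχ : ‖gradient η y‖ ≤ r⁻¹ * (K * χ (r⁻¹ • (y - x))) := by
            rw [hB, norm_smul, Real.norm_of_nonneg (by positivity)]
            exact mul_le_mul_of_nonneg_left (hAχ _) (by positivity)
          have hχ0 : 0 ≤ χ (r⁻¹ • (y - x)) := cutB_nonneg _ _ _
          by_cases hyP : y ∈ 𝓐
          · have hyΩ : y ∈ Ω := by by_contra hc; exact hy2 ⟨hyP, hc⟩
            rw [indicator_of_mem hyΩ, indicator_of_mem hyP]
            obtain ⟨H, hH⟩ : ∃ H, G y = q • e + H := ⟨G y - q • e, by abel⟩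
            rw [hH, add_sub_cancel_left, norm_add_sq_real, norm_smul, hp.unit, inner_add_right,
              inner_add_right, inner_smul_right, inner_smul_right, inner_smul_left, hee,
              Real.norm_of_nonneg hq.le, conj_trivial]
            have b1 := abs_real_inner_le_norm (gradient η y) e
            have b2 := abs_real_inner_le_norm (gradient η y) H
            have b3 := abs_real_inner_le_norm e H
            rw [hp.unit] at b1 b3
            have hn := norm_nonneg H
            calc _ = |⟪gradient η y, e⟫ * ‖H‖ ^ 2 - 2 * q * ⟪gradient η y, H⟫ -
                  2 * (⟪gradient η y, H⟫ * ⟪e, H⟫)| := by rw [Real.norm_eq_abs]; congr 1; ring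
              _ ≤ |⟪gradient η y, e⟫| * ‖H‖ ^ 2 + 2 * q * |⟪gradient η y, H⟫| +
                  2 * (|⟪gradient η y, H⟫| * |⟪e, H⟫|) := by
                refine (abs_sub _ _).trans (add_le_add ((abs_sub _ _).trans (add_le_add ?_ ?_)) ?_)
                all_goals simp [abs_mul, abs_of_pos hq]
              _ ≤ ‖gradient η y‖ * 1 * ‖H‖ ^ 2 + 2 * q * (‖gradient η y‖ * ‖H‖) +
                  2 * (‖gradient η y‖ * ‖H‖ * (1 * ‖H‖)) := by gcongr
              _ = ‖gradient η y‖ * (3 * ‖H‖ ^ 2 + q * (2 * ‖H‖)) := by ring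
              _ ≤ r⁻¹ * (K * χ (r⁻¹ • (y - x))) * (3 * ‖H‖ ^ 2 + q * (3 * (‖H‖ ^ 2 / τ + τ))) := by
                have : 2 * ‖H‖ ≤ 3 * (‖H‖ ^ 2 / τ + τ) := by
                  have : ‖H‖ ^ 2 / τ + τ = (‖H‖ ^ 2 + τ ^ 2) / τ := by field_simp
                  rw [this, ← mul_div_assoc, le_div_iff₀ hτ]
                  nlinarith [sq_nonneg (‖H‖ - τ), sq_nonneg ‖H‖, sq_nonneg τ]
                gcongr
              _ = _ := by field_simp; ring
          · have hyΩ : y ∉ Ω := fun hc => hyP (h.subset_posSet hc)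
            rw [indicator_of_notMem hyΩ, indicator_of_notMem hyP, hy1 hyP]
            simp only [norm_zero, inner_zero_right, sub_zero]
            norm_num
            positivity
      _ = _ := by
          rw [integral_const_mul, integral_add (iH.const_mul _) ((hχr.integrable volume).const_mul _),
            integral_const_mul, integral_const_mul, show J = _ from s1.symm]
          field_simp
  have h0 : |(Λ - q ^ 2) * I| ≤ 0 := by
    refine ge_of_tendsto (f := fun τ => 3 * q * K * J * τ) (x := 𝓝[>] 0) ?_
      (eventually_nhdsWithin_of_forall key)
    exact tendsto_nhdsGT_zero (by fun_prop) (by simp)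
  have h1 := (mul_eq_zero.1 (abs_nonpos_iff.1 h0)).resolve_right hI.ne'
  linarith

end RegState

lemma hausdorffMeasure_le_of_covers {b : ℕ → ℝ≥0∞} {L : ℝ≥0∞}
    (hb : Tendsto b atTop (𝓝 L)) {δ : ℕ → ℝ} (hδ : Tendsto δ atTop (𝓝 0))
    (h : ∀ n, ∃ (v : Set (Euc d × ℝ)) (B : Euc d × ℝ → Set (Euc d)), v.Countable ∧
      (∀ i ∈ v, ediam (B i) ≤ ofReal (δ n)) ∧ S ⊆ ⋃ i ∈ v, B i ∧
      ∑' i : v, ediam (B i) ^ k ≤ b n) : μH[(k : ℝ)] S ≤ L := by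
  choose v B hv hB hS hs using h
  have := fun n => (hv n).to_subtype
  have h1 := Measure.hausdorffMeasure_le_liminf_tsum (k : ℝ) S (l := atTop) _
    (by simpa using ENNReal.tendsto_ofReal hδ) (fun n (i : v n) => B n i)
    (.of_forall fun n i => hB n i i.2)
    (.of_forall fun n => (hS n).trans_eq (biUnion_eq_iUnion _ _))
  simp only [ENNReal.rpow_natCast] at h1
  exact h1.trans ((liminf_le_liminf (.of_forall hs)).trans_eq hb.liminf_eq)

/-- A set is null for the Hausdorff measure if its points are centers of small balls of large
measure, for measures of small total mass. -/
lemma hausdorffMeasure_eq_zero {C : ℝ≥0∞} (hC : C ≠ ∞)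
    {ν : ℕ → Measure (Euc d)} (hν : Tendsto (fun n => ν n univ) atTop (𝓝 0))
    (h : ∀ n, ∀ z ∈ S, ∃ r : ℝ, 0 < r ∧ r ≤ (1 / 2) ^ n ∧
      ofReal r ^ k ≤ C * ν n (closedBall z r)) : μH[(k : ℝ)] S = 0 := by
  refine le_antisymm (hausdorffMeasure_le_of_covers (b := fun n => 10 ^ k * C * ν n univ)
    (δ := fun n => 10 * (1 / 2) ^ n) ?_ ?_ fun n => ?_) zero_le
  · simpa using ENNReal.Tendsto.const_mul hν (Or.inr (by finiteness))
  · simpa using (tendsto_pow_atTop_nhds_zero_of_lt_one (by norm_num) (by norm_num :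
      (1 / 2 : ℝ) < 1)).const_mul 10
  · choose! r hr0 hr1 hr using h n
    obtain ⟨v, hvt, hvd, hv⟩ := Vitali.exists_disjoint_subfamily_covering_enlargement_closedBall
      ((fun z => (z, r z)) '' S) (fun i => i.1) (fun i => i.2) ((1 / 2) ^ n)
      (by rintro _ ⟨z, hz, rfl⟩; exact hr1 z hz) 5 (by norm_num)
    have hv' : ∀ i ∈ v, 0 < i.2 ∧ i.2 ≤ (1 / 2) ^ n ∧
        ofReal i.2 ^ k ≤ C * ν n (closedBall i.1 i.2) := fun i hi => by
      obtain ⟨z, hz, rfl⟩ := hvt hi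
      exact ⟨hr0 z hz, hr1 z hz, hr z hz⟩
    have hd : ∀ i ∈ v, ediam (closedBall i.1 (5 * i.2)) ≤ ofReal (10 * i.2) := fun i hi => by
      have h5 := (hv' i hi).1
      refine ediam_le_of_forall_dist_le fun y hy z hz => ?_
      rw [mem_closedBall] at hy hz
      linarith [dist_triangle_right y z i.1]
    refine ⟨v, fun i => closedBall i.1 (5 * i.2), hvd.countable_of_nonempty_interior fun i hi =>
      ⟨i.1, mem_interior_iff_mem_nhds.2 (closedBall_mem_nhds _ (hv' i hi).1)⟩, fun i hi =>
      (hd i hi).trans (ENNReal.ofReal_le_ofReal (by linarith [(hv' i hi).2.1])), fun z hz => ?_, ?_⟩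
    · obtain ⟨i, hi, hzi⟩ := hv _ (mem_image_of_mem _ hz)
      exact mem_biUnion hi (hzi (mem_closedBall_self (hr0 z hz).le))
    · calc _ ≤ ∑' i : v, 10 ^ k * C * ν n (closedBall i.1.1 i.1.2) := by
            refine ENNReal.tsum_le_tsum fun i => (pow_le_pow_left' (hd i i.2) k).trans ?_
            rw [ENNReal.ofReal_mul (by norm_num), mul_pow, mul_assoc]
            simpa using mul_le_mul_right (hv' i i.2).2.2 _
        _ ≤ _ := by
            rw [ENNReal.tsum_mul_left]
            refine mul_le_mul_right (tsum_measure_le_measure_univ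
              (fun i => isClosed_closedBall.nullMeasurableSet) fun i j hij => ?_) _
            exact (hvd i.2 j.2 (Subtype.coe_ne_coe.2 hij)).aedisjoint

/-- A measure with small upper density with respect to sets of given diameter is controlled by the
Hausdorff measure. -/
lemma measure_le_hausdorffMeasure {A B : Set (Euc d)} (hc : 0 < c)
    (hA : ∀ x ∈ A, ∀ᶠ ρ in 𝓝[>] (0 : ℝ), ∀ S, x ∈ S → ediam S ≤ ofReal ρ →
      μ S ≤ ofReal (c * ρ ^ k)) (hB : MeasurableSet B) (hBA : μ (B \ A) = 0) :
    μ B ≤ ofReal c * μH[(k : ℝ)] B := by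
  have hc' : ofReal c ≠ 0 := by simpa using hc
  set A' : ℕ → Set (Euc d) := fun n => {x | ∀ ρ : ℝ, 0 < ρ → ρ < 1 / (n + 1) → ∀ S, x ∈ S →
    ediam S ≤ ofReal ρ → μ S ≤ ofReal (c * ρ ^ k)}
  have hmono : Monotone A' := fun n m hnm x hx ρ h0 h1 => hx ρ h0
    (h1.trans_le (one_div_le_one_div_of_le (by positivity) (by exact_mod_cast Nat.succ_le_succ hnm)))
  have hAA : A ⊆ ⋃ n, A' n := fun x hx => by
    obtain ⟨ε, hε, h1⟩ := mem_nhdsGT_iff_exists_Ioo_subset.1 (hA x hx)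
    obtain ⟨n, hn⟩ := exists_nat_one_div_lt (mem_Ioi.1 hε)
    exact mem_iUnion.2 ⟨n, fun ρ h0 h2 => h1 ⟨h0, h2.trans hn⟩⟩
  have key : ∀ n, μ (B ∩ A' n) ≤ ofReal c * μH[(k : ℝ)] B := fun n => by
    have h1 : (ofReal c)⁻¹ • μ.restrict (A' n) ≤ μH[(k : ℝ)] := by
      refine Measure.le_hausdorffMeasure _ _ (ofReal (1 / (2 * (n + 1)))) (by simp; positivity)
        fun s hs => ?_
      rw [ENNReal.rpow_natCast, Measure.smul_apply, smul_eq_mul, ENNReal.inv_mul_le_iff hc' (by simp)]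
      refine (measure_mono subset_closure).trans ?_
      rw [Measure.restrict_apply isClosed_closure.measurableSet]
      rcases (closure s ∩ A' n).eq_empty_or_nonempty with h0 | ⟨x, hxs, hx⟩
      · simp [h0]
      refine (measure_mono inter_subset_left).trans ?_
      lift ediam s to ℝ≥0 using ne_top_of_le_ne_top ENNReal.ofReal_ne_top hs with t ht
      have ht1 : (t : ℝ) ≤ 1 / (2 * (n + 1)) := by
        rw [ENNReal.le_ofReal_iff_toReal_le (by simp) (by positivity)] at hs; simpa using hs
      have ht2 : (1 : ℝ) / (2 * (n + 1)) < 1 / (n + 1) := by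
        refine one_div_lt_one_div_of_lt (by positivity) (by linarith [n.cast_nonneg (α := ℝ)])
      have : Tendsto (fun ρ : ℝ => ofReal (c * ρ ^ k)) (𝓝[>] (t : ℝ))
          (𝓝 (ofReal (c * t ^ k))) := by
        have : Continuous fun ρ : ℝ => c * ρ ^ k := by fun_prop
        exact ENNReal.tendsto_ofReal (tendsto_nhdsWithin_of_tendsto_nhds (this.tendsto _))
      rw [show ofReal c * (t : ℝ≥0∞) ^ k = ofReal (c * t ^ k) by
        rw [ENNReal.ofReal_mul hc.le, ENNReal.ofReal_pow t.coe_nonneg, ENNReal.ofReal_coe_nnreal]]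
      refine ge_of_tendsto this ?_
      filter_upwards [Ioo_mem_nhdsGT (ht1.trans_lt ht2)] with ρ hρ
      refine hx ρ (t.2.trans_lt hρ.1) hρ.2 _ hxs ?_
      rw [ediam_closure, ← ht, ← ENNReal.ofReal_coe_nnreal]
      exact ENNReal.ofReal_le_ofReal hρ.1.le
    have h2 := h1 B
    rwa [Measure.smul_apply, Measure.restrict_apply hB, smul_eq_mul,
      ENNReal.inv_mul_le_iff hc' (by simp)] at h2
  calc μ B ≤ μ (⋃ n, B ∩ A' n) := by
        rw [← inter_iUnion]
        refine (measure_mono (t := B ∩ (⋃ n, A' n) ∪ B \ A) fun x hx => ?_).trans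
          ((measure_union_le _ _).trans_eq (by rw [hBA, add_zero]))
        by_cases hxA : x ∈ A
        · exact Or.inl ⟨hx, hAA hxA⟩
        · exact Or.inr ⟨hx, hxA⟩
    _ ≤ _ := by
        rw [Monotone.measure_iUnion fun n m hnm => inter_subset_inter_right _ (hmono hnm)]
        exact iSup_le key

lemma planeInt_comp_isometry (e : Euc d) (hφ : TestFun univ φ) (Q : Euc d ≃ₗᵢ[ℝ] Euc d) :
    planeInt (Q.symm e) (φ ∘ Q) = planeInt e φ := by
  have hg : ∀ y, ⟪gradient (φ ∘ Q) y, Q.symm e⟫ = ⟪gradient φ (Q y), e⟫ := fun y => by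
    have hQ : HasFDerivAt Q (Q.toContinuousLinearEquiv : Euc d →L[ℝ] Euc d) y :=
      Q.toContinuousLinearEquiv.hasFDerivAt
    rw [inner_gradient_left, inner_gradient_left, ((hφ.differentiable _).hasFDerivAt.comp y hQ).fderiv]
    simp
  have hs : ({y | 0 < ⟪Q.symm e, y⟫} : Set (Euc d)) = Q ⁻¹' {y | 0 < ⟪e, y⟫} := by
    ext y; simp [← Q.inner_map_map (Q.symm e) y]
  simp only [planeInt, volVar, hg, hs]
  rw [Q.measurePreserving.setIntegral_preimage_emb Q.toHomeomorph.measurableEmbedding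
    (fun y => ⟪gradient φ y, e⟫)]

/-- The functions whose plane integrals approximate the measure of sets of diameter at most `2`. -/
structure Shape (φ : Euc d → ℝ) : Prop where
  test : TestFun univ φ
  nonneg : ∀ y, 0 ≤ φ y
  le_one : ∀ y, φ y ≤ 1
  dist_le : ∀ y ∈ tsupport φ, ∀ z ∈ tsupport φ, dist y z ≤ 2

lemma exists_shape_comp (he : ‖e‖ = ‖e'‖) (hφ : Shape φ) :
    ∃ φ', Shape φ' ∧ planeInt e' φ' = planeInt e φ ∧
      ∀ M, tsupport φ ⊆ closedBall 0 M → tsupport φ' ⊆ closedBall 0 M := by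
  set Q : Euc d ≃ₗᵢ[ℝ] Euc d := (ℝ ∙ (e - e'))ᗮ.reflection
  have hQ : Q.symm e = e' := Submodule.reflection_sub he
  have hs : tsupport (φ ∘ Q) = Q ⁻¹' tsupport φ := tsupport_comp_eq_preimage φ Q.toHomeomorph
  refine ⟨φ ∘ Q, ⟨⟨hφ.test.1.comp Q.toContinuousLinearEquiv.contDiff, hφ.test.2.1.comp_homeomorph
      Q.toHomeomorph, subset_univ _⟩,
    fun _ => hφ.nonneg _, fun _ => hφ.le_one _, fun y hy z hz => ?_⟩, ?_, fun M hM y hy => ?_⟩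
  · rw [hs] at hy hz
    rw [← Q.dist_map]
    exact hφ.dist_le _ hy _ hz
  · rw [← hQ, planeInt_comp_isometry e hφ.test]
  · rw [hs] at hy
    simpa using hM hy

/-- Finitely many test functions suffice to approximate all sets of a given diameter. -/
lemma exists_shapes (hδ : 0 < δ) : ∃ Φ : Set (Euc d → ℝ), Φ.Finite ∧
    (∀ φ ∈ Φ, TestFun univ φ) ∧ ∀ S ⊆ closedBall (0 : Euc d) 2,
      (∀ y ∈ S, ∀ z ∈ S, dist y z ≤ 2 - 6 * δ) → ∃ φ ∈ Φ, Shape φ ∧ ∀ y ∈ S, φ y = 1 := by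
  classical
  obtain ⟨N, -, hN⟩ := (isCompact_closedBall (0 : Euc d) 2).elim_nhds_subcover (ball · δ)
    fun y _ => ball_mem_nhds y hδ
  set f : Finset (Euc d) → Euc d → ℝ := fun F y => 1 - ∏ z ∈ F, (1 - cutB z δ y)
  have hf0 : ∀ F, tsupport (f F) ⊆ ⋃ z ∈ F, closedBall z (2 * δ) := fun F => by
    refine closure_minimal (fun y hy => ?_)
      (F.finite_toSet.isClosed_biUnion fun _ _ => isClosed_closedBall)
    by_contra hc
    simp only [mem_iUnion, not_exists, mem_closedBall, not_le] at hc
    refine hy (sub_eq_zero.2 (Finset.prod_eq_one fun z hz => ?_).symm)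
    rw [cutB_eq_zero hδ (hc z hz).le, sub_zero]
  have hfT : ∀ F, TestFun univ (f F) := fun F =>
    ⟨contDiff_const.sub (contDiff_prod fun z _ => contDiff_const.sub
      (cutB_testFun z hδ (subset_univ _)).1), HasCompactSupport.of_support_subset_isCompact
        (F.isCompact_biUnion fun z _ => isCompact_closedBall z (2 * δ))
        ((subset_tsupport _).trans (hf0 F)), subset_univ _⟩
  have hc1 : ∀ z y : Euc d, 0 ≤ 1 - cutB z δ y ∧ 1 - cutB z δ y ≤ 1 := fun z y =>
    ⟨by linarith [cutB_le_one z δ y], by linarith [cutB_nonneg z δ y]⟩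
  refine ⟨f '' (N.powerset : Set (Finset (Euc d))), N.powerset.finite_toSet.image _,
    by rintro _ ⟨F, -, rfl⟩; exact hfT F, fun S hS hSd => ?_⟩
  set F := N.filter fun z => ∃ y ∈ S, dist y z < δ
  have hF : ∀ z ∈ F, ∃ y ∈ S, dist y z < δ := fun z hz => (Finset.mem_filter.1 hz).2
  refine ⟨f F, ⟨F, Finset.mem_coe.2 (Finset.mem_powerset.2 (Finset.filter_subset _ _)), rfl⟩,
      ⟨hfT F, fun y => ?_, fun y => ?_, fun y hy z hz => ?_⟩,
    fun y hy => ?_⟩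
  · exact sub_nonneg.2 (Finset.prod_le_one (fun z _ => (hc1 z y).1) fun z _ => (hc1 z y).2)
  · exact sub_le_self _ (Finset.prod_nonneg fun z _ => (hc1 z y).1)
  · obtain ⟨y', hy', hyy⟩ := mem_iUnion₂.1 (hf0 F hy)
    obtain ⟨z', hz', hzz⟩ := mem_iUnion₂.1 (hf0 F hz)
    obtain ⟨p, hp, hpy⟩ := hF y' hy'
    obtain ⟨q, hq, hqz⟩ := hF z' hz'
    rw [mem_closedBall] at hyy hzz
    linarith [hSd p hp q hq, dist_triangle4 y y' p z, dist_triangle4 p q z' z, dist_comm p y',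
      dist_comm z z']
  · obtain ⟨z, hz, hyz⟩ := mem_iUnion₂.1 (hN (hS hy))
    refine sub_eq_self.2 (Finset.prod_eq_zero (i := z) (Finset.mem_filter.2 ⟨hz, y, hy, hyz⟩) ?_)
    rw [cutB_eq_one hδ (mem_ball.1 hyz).le, sub_self]

/-- A measure of large lower density with respect to rescalings of a fixed shape controls the
Hausdorff measure. -/
lemma hausdorffMeasure_le_measure [IsLocallyFiniteMeasure μ] {A : Set (Euc d)}
    {K : Euc d → Set (Euc d)}     (hU : IsOpen U) (hAU : A ⊆ U) (hc : 0 < c) (hM : 0 < M) {C : ℝ≥0}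
    (hK : ∀ x, IsClosed (K x)) (hKM : ∀ x, K x ⊆ closedBall 0 M)
    (hKd : ∀ x, ∀ y ∈ K x, ∀ z ∈ K x, dist y z ≤ 2) (hKi : ∀ x ∈ A, (interior (K x)).Nonempty)
      (h : ∀ x ∈ A, ∀ᶠ ρ in 𝓝[>] (0 : ℝ),
      ENNReal.ofReal (c * (2 * ρ) ^ k) ≤ μ {y | ρ⁻¹ • (y - x) ∈ K x} ∧
      μ (closedBall x (3 * (M * ρ))) ≤ C * μ {y | ρ⁻¹ • (y - x) ∈ K x})
    (h0 : ∀ S ⊆ A, μ S = 0 → μH[(k : ℝ)] S = 0) : ENNReal.ofReal c * μH[(k : ℝ)] A ≤ μ U := by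
  set B : Euc d × ℝ → Set (Euc d) := fun i => {y | i.2⁻¹ • (y - i.1) ∈ K i.1}
  have hBM : ∀ i : Euc d × ℝ, 0 < i.2 → B i ⊆ closedBall i.1 (M * i.2) := fun i hi y hy => by
    have := hKM _ hy
    rwa [mem_closedBall_zero_iff, norm_scale hi, inv_mul_le_iff₀ hi, mul_comm] at this
  have hcl : ∀ i, IsClosed (B i) := fun i => (hK _).preimage (by fun_prop)
  have key : ∀ n : ℕ, ∃ v : Set (Euc d × ℝ), v.Countable ∧ v.PairwiseDisjoint B ∧
      (∀ i ∈ v, 0 < i.2 ∧ 2 * i.2 ≤ (1 / 2) ^ n ∧ B i ⊆ U ∧ ofReal (c * (2 * i.2) ^ k) ≤ μ (B i)) ∧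
      μ (A \ ⋃ i ∈ v, B i) = 0 := fun n => by
    refine (Vitali.exists_disjoint_covering_ae μ A
      {i | i.1 ∈ A ∧ (0 < i.2 ∧ 2 * i.2 ≤ (1 / 2) ^ n ∧ B i ⊆ U ∧ ofReal (c * (2 * i.2) ^ k) ≤ μ (B i)) ∧
        μ (closedBall i.1 (3 * (M * i.2))) ≤ C * μ (B i)} C (fun i => M * i.2) (fun i => i.1) B
      (fun i hi => hBM i hi.2.1.1) (fun i hi => hi.2.2) (fun i hi => ?_) (fun i _ => hcl i) fun x
        hx ε hε => ?_).imp
      fun v hv => ⟨hv.2.1, hv.2.2.1, fun i hi => (hv.1 hi).2.1, hv.2.2.2⟩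
    · obtain ⟨p, hp⟩ := hKi i.1 hi.1
      refine ⟨i.1 + i.2 • p, interior_maximal (s := B i) (t := {y | i.2⁻¹ • (y - i.1) ∈ interior (K i.1)})
        (fun y hy => interior_subset (s := K i.1) hy) (isOpen_interior.preimage (by fun_prop)) ?_⟩
      simpa [inv_smul_smul₀ hi.2.1.1.ne'] using hp
    · obtain ⟨t, ht, htU⟩ := isOpen_iff.1 hU x (hAU hx)
      obtain ⟨ρ, ⟨h1, h2⟩, h3⟩ := ((h x hx).and (Ioo_mem_nhdsGT (lt_min (lt_min
        (by positivity : 0 < (1 / 2 : ℝ) ^ n / 2) (div_pos ht hM)) (div_pos hε hM)))).exists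
      rw [lt_min_iff, lt_min_iff, lt_div_iff₀ hM, lt_div_iff₀ hM] at h3
      exact ⟨(x, ρ), ⟨hx, ⟨h3.1, by linarith [h3.2.1.1], (hBM (x, ρ) h3.1).trans
        ((closedBall_subset_ball (by linarith [h3.2.1.2])).trans htU), h1⟩, h2⟩,
        by linarith [h3.2.2], rfl⟩
  choose v hv1 hv2 hv3 hv4 using key
  set L := ⋃ n, A \ ⋃ i ∈ v n, B i
  have hL : μH[(k : ℝ)] L = 0 :=
    h0 _ (iUnion_subset fun n => sdiff_subset) (measure_iUnion_null hv4)
  have hc' : ofReal c ≠ 0 := by simpa using hc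
  have hd : ∀ n, ∀ i ∈ v n, ediam (B i) ≤ ofReal (2 * i.2) := fun n i hi => by
    refine ediam_le_of_forall_dist_le fun y hy z hz => ?_
    have h1 := (hv3 n i hi).1
    have := hKd _ _ hy _ hz
    rwa [dist_smul₀, dist_sub_right, Real.norm_of_nonneg (by positivity), inv_mul_le_iff₀ h1,
      mul_comm] at this
  have h1 : μH[(k : ℝ)] (A \ L) ≤ (ENNReal.ofReal c)⁻¹ * μ U := by
    refine hausdorffMeasure_le_of_covers tendsto_const_nhds (δ := fun n => (1 / 2) ^ n)
      (tendsto_pow_atTop_nhds_zero_of_lt_one (by norm_num) (by norm_num)) fun n =>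
      ⟨v n, B, hv1 n, fun i hi => (hd n i hi).trans (ENNReal.ofReal_le_ofReal (hv3 n i hi).2.1),
        fun x hx => ?_, ?_⟩
    · by_contra hc
      exact hx.2 (mem_iUnion.2 ⟨n, hx.1, hc⟩)
    · calc _ ≤ ∑' i : v n, (ENNReal.ofReal c)⁻¹ * μ (B i) := by
            refine ENNReal.tsum_le_tsum fun i => (pow_le_pow_left' (hd n i i.2) k).trans ?_
            rw [← ENNReal.ofReal_pow (by linarith [(hv3 n i i.2).1]),
              ← ENNReal.mul_le_iff_le_inv hc' (by simp), ← ENNReal.ofReal_mul hc.le]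
            exact (hv3 n i i.2).2.2.2
        _ ≤ _ := by
            rw [ENNReal.tsum_mul_left]
            have := (hv1 n).to_subtype
            refine mul_le_mul_right ((tsum_meas_le_meas_iUnion_of_disjoint μ
              (fun i : v n => (hcl i).measurableSet) fun i j hij => hv2 n i.2 j.2
              (Subtype.coe_ne_coe.2 hij)).trans (measure_mono (iUnion_subset fun i =>
                (hv3 n i i.2).2.2.1))) _
  rw [ENNReal.mul_le_iff_le_inv hc' (by simp)]
  refine le_trans ?_ h1
  rw [measure_sdiff_null hL]

namespace RegPt

lemma integral_scale_eq (hk : d = k + 1) (μ : Measure (Euc d)) (x : Euc d) (φ : Euc d → ℝ)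
    (hr : 0 < r) : ∫ y, φ (r⁻¹ • (y - x)) ∂μ = r ^ k * mScale μ x r φ := by
  subst hk
  rw [mScale, pow_succ, inv_pow]
  field_simp

lemma upper [IsFiniteMeasureOnCompacts μ] (hp : RegPt D u μ x e q) (hk : d = k + 1)
    (hT : ∀ φ, Shape φ → planeInt e φ ≤ T) (hc : q * T < c * 2 ^ k) :
    ∀ᶠ ρ in 𝓝[>] (0 : ℝ), ∀ S, x ∈ S → ediam S ≤ ofReal ρ → μ S ≤ ofReal (c * ρ ^ k) := by
  obtain ⟨δ, hδ, hδ3, hδc⟩ : ∃ δ > 0, δ < 1 / 3 ∧ q * T + δ < c * (2 - 6 * δ) ^ k := by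
    have h1 : Continuous fun δ : ℝ => q * T + δ - c * (2 - 6 * δ) ^ k := by fun_prop
    have h2 : ∀ᶠ δ in 𝓝[>] (0 : ℝ), q * T + δ - c * (2 - 6 * δ) ^ k < 0 :=
      (tendsto_nhdsWithin_of_tendsto_nhds (h1.tendsto 0)).eventually_lt_const (by simpa using hc)
    obtain ⟨δ, h3, h4⟩ := (h2.and (Ioo_mem_nhdsGT (by norm_num : (0 : ℝ) < 1 / 3))).exists
    exact ⟨δ, h4.1, h4.2, by linarith⟩
  have ht : 0 < 2 - 6 * δ := by linarith
  obtain ⟨Φ, hΦ, hΦT, hΦS⟩ := exists_shapes (d := d) hδ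
  have h1 := (eventually_all_finite hΦ).2 fun φ hφ => (hp.lim φ (hΦT φ hφ)).eventually_lt_const
    (lt_add_of_pos_right (q * planeInt e φ) hδ)
  filter_upwards [(tendsto_const_mul_nhdsGT_zero (inv_pos.2 ht)).eventually h1, self_mem_nhdsWithin]
    with ρ hρ (hρ0 : 0 < ρ) S hxS hS
  obtain ⟨σ, hσ⟩ : ∃ σ, σ = (2 - 6 * δ)⁻¹ * ρ := ⟨_, rfl⟩
  rw [← hσ] at hρ
  have hσ0 : 0 < σ := by rw [hσ]; positivity
  have hρσ : ρ = σ * (2 - 6 * δ) := by rw [hσ]; field_simp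
  have hd : ∀ y ∈ S, ∀ z ∈ S, dist (σ⁻¹ • (y - x)) (σ⁻¹ • (z - x)) ≤ 2 - 6 * δ := fun y hy z hz => by
    rw [dist_smul₀, dist_sub_right, Real.norm_of_nonneg (by positivity), inv_mul_le_iff₀ hσ0, ← hρσ]
    have := (edist_le_ediam_of_mem hy hz).trans hS
    rwa [edist_dist, ENNReal.ofReal_le_ofReal_iff hρ0.le] at this
  obtain ⟨φ, hφΦ, hφ, hφ1⟩ := hΦS ((fun y => σ⁻¹ • (y - x)) '' S)
    (by rintro _ ⟨y, hy, rfl⟩; have := hd y hy x hxS; simp at this ⊢; linarith)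
    (by rintro _ ⟨y, hy, rfl⟩ _ ⟨z, hz, rfl⟩; exact hd y hy z hz)
  obtain ⟨M, -, hM⟩ := hφ.test.exists_radius
  have hi := (hφ.test.scale hM x hσ0 (subset_univ _)).integrable μ
  have h2 := mul_meas_ge_le_integral_of_nonneg (.of_forall fun y => hφ.nonneg _) hi 1
  rw [one_mul, integral_scale_eq hk μ x φ hσ0] at h2
  calc μ S ≤ μ {y | 1 ≤ φ (σ⁻¹ • (y - x))} := measure_mono fun y hy => (hφ1 _ ⟨y, hy, rfl⟩).ge
    _ = ofReal (μ.real _) := (ENNReal.ofReal_toReal (hi.measure_ge_lt_top one_pos).ne).symm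
    _ ≤ _ := ENNReal.ofReal_le_ofReal (h2.trans ?_)
  rw [hρσ, mul_pow, mul_left_comm]
  refine mul_le_mul_of_nonneg_left ((hρ φ hφΦ).le.trans (le_trans ?_ hδc.le)) (by positivity)
  gcongr
  · exact hp.q_pos.le
  · exact hT φ hφ

lemma lower [IsFiniteMeasureOnCompacts μ] (hp : RegPt D u μ x e q) (hk : d = k + 1) (hφ : Shape φ)
    (hc : c * 2 ^ k < q * planeInt e φ) : ∀ᶠ ρ in 𝓝[>] (0 : ℝ),
      ofReal (c * (2 * ρ) ^ k) ≤ μ {y | ρ⁻¹ • (y - x) ∈ tsupport φ} := by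
  filter_upwards [(hp.lim φ hφ.test).eventually_const_lt hc, self_mem_nhdsWithin] with ρ hρ (hρ0 : 0 < ρ)
  refine (ENNReal.ofReal_le_ofReal ?_).trans (integral_le_measure (f := fun y => φ (ρ⁻¹ • (y - x)))
    (fun y _ => hφ.le_one _) fun y hy => (image_eq_zero_of_notMem_tsupport hy).le)
  rw [integral_scale_eq hk μ x φ hρ0, mul_pow, ← mul_assoc, mul_comm]
  gcongr

end RegPt

namespace RegState

lemma measurableSet_freeBdry (h : 𝓡) : MeasurableSet 𝓕 := by
  have : 𝓕 = (D \ 𝓐) ∩ closure 𝓐 := by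
    ext x
    refine ⟨fun hx => ⟨⟨hx.1, fun hP => hP.2.ne' hx.2.1⟩, hx.2.2⟩, fun hx => ⟨hx.1.1, ?_, hx.2⟩⟩
    exact le_antisymm (not_lt.1 fun h0 => hx.1.2 ⟨hx.1.1, h0⟩) (h.nonneg x)
  rw [this]
  exact (h.openD.measurableSet.diff h.isOpen_posSet.measurableSet).inter isClosed_closure.measurableSet

lemma measure_diff_regPt (h : 𝓡) (hE : 𝓔) :
    μ (𝓕 \ {x | ∃ e q, RegPt D u μ x e q}) = 0 := by
  refine measure_null_of_locally_null _ fun x hx => ?_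
  obtain ⟨r, hr, hae⟩ := h.ae_almostNormal hE hx.1.1
  refine ⟨_, inter_mem_nhdsWithin _ (ball_mem_nhds x hr), ?_⟩
  refine measure_eq_zero_iff_ae_notMem.2 (hae.mono fun y hy hyb => hyb.1.2 ?_)
  obtain ⟨g₀, hg⟩ := hy hyb.2
  exact h.regPt_of_almostNormal hE hyb.1.1 hg

lemma hausdorffMeasure_null (h : 𝓡) (hE : 𝓔)
    (hk : d = k + 1) (hS : S ⊆ 𝓕) (hμ : μ S = 0) : μH[(k : ℝ)] S = 0 := by
  have := h.fin
  have hV : ∀ n : ℕ, ∃ V ⊇ S, IsOpen V ∧ μ V < (1 / 2) ^ n := fun n =>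
    S.exists_isOpen_lt_of_lt _ (by rw [hμ]; exact ENNReal.pow_pos (by simp) n)
  choose V hSV hVo hV using hV
  refine hausdorffMeasure_eq_zero (C := ofReal C) (by simp) (ν := fun n => μ.restrict (V n))
    ?_ fun n z hz => ?_
  · simp only [Measure.restrict_apply_univ]
    exact tendsto_of_tendsto_of_tendsto_of_le_of_le tendsto_const_nhds
      (ENNReal.tendsto_pow_atTop_nhds_zero_of_lt_one (by simp)) (fun _ => zero_le) fun n => (hV n).le
  · obtain ⟨t, ht, htD⟩ := isOpen_iff.1 (h.openD.inter (hVo n)) z ⟨(hS hz).1, hSV n hz⟩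
    set r := min (t / 8) (min R ((1 / 2) ^ n))
    have hr : 0 < r := by have := hE.R_pos; positivity
    have hr8 : 8 * r ≤ t := by linarith [min_le_left (t / 8) (min R ((1 / 2) ^ n))]
    have h1 := hE.lo_measure z (hS hz) r hr ((min_le_right _ _).trans (min_le_left _ _))
      ((ball_subset_ball hr8).trans (htD.trans inter_subset_left))
    refine ⟨r, hr, (min_le_right _ _).trans (min_le_right _ _), ?_⟩
    rw [Measure.restrict_eq_self _ ((closedBall_subset_ball (by linarith)).trans
      (htD.trans inter_subset_right))]
    subst hk
    rw [pow_succ, mul_left_comm, mul_comm, mul_le_mul_iff_right₀ hr] at h1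
    rw [← ENNReal.ofReal_pow hr.le]
    refine (ENNReal.ofReal_le_ofReal h1).trans ?_
    rw [ENNReal.ofReal_mul hE.C_pos.le]
    gcongr
    exact (ENNReal.ofReal_toReal (measure_lt_top_mono ball_subset_closedBall
        (isCompact_closedBall z r).measure_lt_top).ne).trans_le
      (measure_mono ball_subset_closedBall)

lemma measure_closedBall_le (h : 𝓡) (hE : 𝓔)
    (hk : d = k + 1) (hr : 0 < r) (hrR : r ≤ R) (hD : ball x (8 * r) ⊆ D) :
    μ (closedBall x r) ≤ ofReal (C * r ^ k) := by
  have := h.fin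
  have h1 := hE.up_measure x r hr hrR hD
  subst hk
  rw [pow_succ, ← mul_assoc, mul_comm, mul_le_mul_iff_left₀ hr] at h1
  exact (ENNReal.ofReal_toReal (isCompact_closedBall x r).measure_lt_top.ne).symm.trans_le
    (ENNReal.ofReal_le_ofReal h1)

lemma planeInt_le (h : 𝓡) (hE : 𝓔)
    (hk : d = k + 1) (hp : RegPt D u μ x e q) (hφ : Shape φ) :
    q * planeInt e φ ≤ C * 2 ^ k := by
  obtain ⟨p, hpφ⟩ : ∃ p, tsupport φ ⊆ closedBall p 2 := by
    rcases (tsupport φ).eq_empty_or_nonempty with h0 | ⟨p, hp⟩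
    · exact ⟨0, h0 ▸ empty_subset _⟩
    · exact ⟨p, fun y hy => hφ.dist_le y hy p hp⟩
  have := h.fin
  obtain ⟨t, ht, htD⟩ := isOpen_iff.1 h.openD x hp.mem.1
  refine le_of_tendsto (hp.lim φ hφ.test) ?_
  filter_upwards [Ioo_mem_nhdsGT (lt_min (half_pos hE.R_pos)
    (by positivity : 0 < t / (‖p‖ + 16)))] with r hr
  have hr0 := hr.1
  obtain ⟨hr1, hr2⟩ := lt_min_iff.1 hr.2
  rw [lt_div_iff₀ (by positivity)] at hr2
  have h1 := (integral_le_measure (μ := μ) (f := fun y => φ (r⁻¹ • (y - x)))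
    (s := closedBall (x + r • p) (2 * r)) (fun y _ => hφ.le_one _) fun y hy =>
      (image_eq_zero_of_notMem_tsupport fun hc => hy ?_).le).trans
    (h.measure_closedBall_le hE hk (by positivity) (by linarith) ((ball_subset_ball' ?_).trans htD))
  · rw [RegPt.integral_scale_eq hk μ x φ hr0, ENNReal.ofReal_le_ofReal_iff
      (by have := hE.C_pos; positivity),
      mul_pow, ← mul_assoc, mul_comm, mul_le_mul_iff_left₀ (by positivity)] at h1
    exact h1
  · have := hpφ hc
    rw [mem_closedBall, dist_eq_norm] at this ⊢
    rw [show y - (x + r • p) = r • (r⁻¹ • (y - x) - p) by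
      rw [smul_sub, smul_inv_smul₀ hr0.ne']; abel, norm_smul, Real.norm_of_nonneg hr0.le]
    nlinarith
  · rw [dist_eq_norm, add_sub_cancel_left, norm_smul, Real.norm_of_nonneg hr0.le]
    nlinarith

/-- On the free boundary, the measure is a multiple of the Hausdorff measure. -/
theorem exists_measure_eq (h : 𝓡) (hM : OptState.Multiplier D a Ω lam u G Λ ρ C')
    (hE : 𝓔) (hk : d = k + 1) : ∃ c : ℝ, 0 < c ∧
      ∀ B ⊆ 𝓕, MeasurableSet B → μ B = ENNReal.ofReal c * μH[(k : ℝ)] B := by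
  have := h.fin
  have hloc : IsLocallyFiniteMeasure μ := isLocallyFiniteMeasure_of_isFiniteMeasureOnCompacts
  have hCp := hE.C_pos
  set A := {x | ∃ e q, RegPt D u μ x e q}
  have hAE : μ (𝓕 \ A) = 0 := h.measure_diff_regPt hE
  obtain ⟨x₀, e₀, q, hp₀⟩ : A.Nonempty := by
    by_contra! h0
    rw [h0, sdiff_empty] at hAE
    obtain ⟨x, hx⟩ := h.exists_freeBdry
    obtain ⟨t, ht, htD⟩ := isOpen_iff.1 h.openD x hx.1
    have hr : 0 < min (t / 8) R := lt_min (by positivity) hE.R_pos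
    have h1 := hE.lo_measure x hx _ hr (min_le_right _ _) ((ball_subset_ball
      (by linarith [min_le_left (t / 8) R])).trans htD)
    have h2 : μ (ball x (min (t / 8) R)) = 0 := by
      refine measure_mono_null (fun y hy => ?_) (measure_union_null hAE h.measure_diff_freeBdry)
      by_cases hyE : y ∈ 𝓕
      · exact Or.inl hyE
      · exact Or.inr ⟨htD (ball_subset_ball (by linarith [min_le_left (t / 8) R]) hy), hyE⟩
    rw [measureReal_def, h2, ENNReal.toReal_zero, mul_zero, mul_zero] at h1
    exact absurd h1 (not_le.2 (by positivity))
  have hqq : ∀ x, ∃ e, ‖e₀‖ = ‖e‖ ∧ (x ∈ A → RegPt D u μ x e q) := fun x => by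
    by_cases hx : x ∈ A
    · obtain ⟨e, q', hp⟩ := hx
      refine ⟨e, hp₀.unit.trans hp.unit.symm, fun _ => ?_⟩
      rwa [← (pow_left_inj₀ hp.q_pos.le hp₀.q_pos.le two_ne_zero).1
        ((h.sq_slope hM hE hp).trans (h.sq_slope hM hE hp₀).symm)]
    · exact ⟨e₀, rfl, fun h => absurd h hx⟩
  choose e hee he using hqq
  have hq := hp₀.q_pos
  have hψ : Shape (bumpK (0 : Euc d) 1) := ⟨bumpK_testFun 0 one_pos (subset_univ _), bumpK_nonneg _ _,
    bumpK_le_one _ _, fun y hy z hz => by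
      have hs := (bumpK_testFun (0 : Euc d) one_pos (subset_refl _)).2.2
      linarith [dist_triangle_right y z 0, mem_closedBall.1 (hs hy), mem_closedBall.1 (hs hz)]⟩
  obtain ⟨T, hT⟩ : ∃ T, IsLUB {t | ∃ φ, Shape φ ∧ planeInt e₀ φ = t} T := by
    refine Real.exists_isLUB ⟨_, _, hψ, rfl⟩ ⟨C * 2 ^ k / q, ?_⟩
    rintro _ ⟨φ, hφ, rfl⟩
    rw [le_div_iff₀' hq]
    exact h.planeInt_le hE hk hp₀ hφ
  have hT0 : 0 < T := (h.planeInt_bumpK_pos hE hp₀).trans_le (hT.1 ⟨_, hψ, rfl⟩)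
  have t1 : ∀ (B : Set (Euc d)) s, Tendsto (fun c => ofReal c * μH[(k : ℝ)] B) (𝓝[s] (q * T / 2 ^ k))
      (𝓝 (ofReal (q * T / 2 ^ k) * μH[(k : ℝ)] B)) := fun B s =>
    ENNReal.Tendsto.mul_const (ENNReal.tendsto_ofReal (tendsto_id.mono_left nhdsWithin_le_nhds))
      (Or.inl (by simp; positivity))
  refine ⟨q * T / 2 ^ k, by positivity, fun B hBE hB => le_antisymm ?_ ?_⟩
  · refine ge_of_tendsto (t1 B (Ioi (q * T / 2 ^ k))) (eventually_nhdsWithin_of_forall fun c hc => ?_)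
    rw [mem_Ioi, div_lt_iff₀ (by positivity)] at hc
    have hc0 : 0 < c := pos_of_mul_pos_left ((by positivity : 0 < q * T).trans hc) (by positivity)
    refine measure_le_hausdorffMeasure (A := A) hc0 (fun x hx => (he x hx).upper hk (fun φ hφ => ?_) hc) hB
      (measure_mono_null (sdiff_subset_sdiff_left hBE) hAE)
    obtain ⟨φ', hφ', h1, -⟩ := exists_shape_comp (hee x).symm hφ
    exact h1 ▸ hT.1 ⟨φ', hφ', rfl⟩
  · have hBA : μH[(k : ℝ)] B ≤ μH[(k : ℝ)] (B ∩ A) := by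
      refine (measure_mono (inter_union_sdiff B A).ge).trans ((measure_union_le _ _).trans_eq ?_)
      rw [h.hausdorffMeasure_null hE hk (sdiff_subset.trans hBE)
        (measure_mono_null (sdiff_subset_sdiff_left hBE) hAE), add_zero]
    refine le_of_forall_gt_imp_ge_of_dense fun m hm => ?_
    obtain ⟨U, hBU, hU, hUm⟩ := B.exists_isOpen_lt_of_lt _ hm
    refine le_trans ?_ ((measure_mono inter_subset_left : μ (U ∩ D) ≤ μ U).trans hUm.le)
    refine le_of_tendsto (t1 B (Iio (q * T / 2 ^ k))) ?_
    filter_upwards [Ioo_mem_nhdsLT (by positivity : 0 < q * T / 2 ^ k)] with c ⟨hc0, hc⟩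
    rw [lt_div_iff₀ (by positivity), ← div_lt_iff₀' hq] at hc
    obtain ⟨_, ⟨φ, hφ, rfl⟩, hφT⟩ := (lt_isLUB_iff hT).1 hc
    rw [div_lt_iff₀' hq] at hφT
    obtain ⟨M, hM0, hMφ⟩ : ∃ M, 0 < M ∧ tsupport φ ⊆ closedBall 0 M := by
      obtain ⟨M, hM⟩ := hφ.test.2.1.isCompact.isBounded.subset_closedBall 0
      exact ⟨max M 1, by positivity, hM.trans (closedBall_subset_closedBall (le_max_left _ _))⟩
    choose ψ hψ hψe hψM using fun x => exists_shape_comp (hee x) hφ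
    refine (mul_le_mul_right hBA _).trans (hausdorffMeasure_le_measure (hU.inter h.openD)
      (fun x hx => ⟨hBU hx.1, (hBE hx.1).1⟩) hc0 hM0 (K := fun x => tsupport (ψ x))
      (C := (C * (3 * M) ^ k / (c * 2 ^ k)).toNNReal) (fun _ => isClosed_tsupport _)
      (fun x => hψM x M hMφ) (fun x => (hψ x).dist_le) (fun x hx => ?_) (fun x hx => ?_)
      fun S hS hS0 => h.hausdorffMeasure_null hE hk (hS.trans (inter_subset_left.trans hBE)) hS0)
    · have h1 : (Function.support (ψ x)).Nonempty := by
        rw [Function.support_nonempty_iff]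
        intro h0
        have h2 : planeInt (e x) (0 : Euc d → ℝ) = 0 := by simp [planeInt, volVar, gradient]
        rw [← hψe x, h0, h2, mul_zero] at hφT
        exact hφT.not_ge (by positivity)
      exact h1.mono (interior_maximal (subset_tsupport _)
        (isOpen_ne_fun (hψ x).test.continuous continuous_const))
    · obtain ⟨t, ht, htD⟩ := isOpen_iff.1 h.openD x (hBE hx.1).1
      filter_upwards [(he x hx.2).lower hk (hψ x) (hψe x ▸ hφT), self_mem_nhdsWithin,
        Ioo_mem_nhdsGT (lt_min (div_pos hE.R_pos (by positivity : 0 < 3 * M))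
          (div_pos ht (by positivity : 0 < 24 * M)))] with r h1 (hr : 0 < r) ⟨_, hrt⟩
      rw [lt_min_iff, lt_div_iff₀ (by positivity), lt_div_iff₀ (by positivity)] at hrt
      refine ⟨h1, (h.measure_closedBall_le hE hk (by positivity) (by linarith)
        ((ball_subset_ball (by linarith)).trans htD)).trans ?_⟩
      refine le_trans (le_of_eq ?_) (mul_le_mul_right h1 _)
      refine Eq.trans (congr_arg _ ?_) (ENNReal.ofReal_mul (by positivity))
      field_simp
      ring

end RegState

lemma setIntegral_norm_le {E : Type*} [NormedAddCommGroup E] {f : Euc d → E}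
    (hf : MemLp f 2) (z : Euc d) {τ : ℝ} (hr : 0 < r) (hτ : 0 < τ) :
    ∫ y in closedBall z r, ‖f y‖ ≤ (τ * (r ^ d * omd d) + τ⁻¹ * ∫ y in closedBall z r, ‖f y‖ ^ 2) / 2 := by
  have hfin : volume (closedBall z r) ≠ ∞ := (isCompact_closedBall z r).measure_lt_top.ne
  have i2 := (integrable_sq_of_memLp hf).integrableOn (s := closedBall z r)
  have i1 : IntegrableOn (fun _ : Euc d => τ) (closedBall z r) := integrableOn_const hfin
  have h1 : ∫ y in closedBall z r, ‖f y‖ ≤ ∫ y in closedBall z r, (τ + τ⁻¹ * ‖f y‖ ^ 2) / 2 := by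
    refine integral_mono_of_nonneg (.of_forall fun _ => norm_nonneg _)
      ((i1.add (i2.const_mul _)).div_const 2) (.of_forall fun y => ?_)
    have : 0 ≤ τ⁻¹ * (‖f y‖ - τ) ^ 2 := by positivity
    have h2 : τ⁻¹ * (‖f y‖ - τ) ^ 2 = τ + τ⁻¹ * ‖f y‖ ^ 2 - 2 * ‖f y‖ := by field_simp; ring
    simp only
    linarith
  rwa [integral_div, integral_add i1 (i2.const_mul _), integral_const_mul, setIntegral_const,
    smul_eq_mul, mul_comm, show volume.real (closedBall z r) = r ^ d * omd d from
      mvol_closedBall z hr.le] at h1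

/-- A Sobolev function whose means vary must have large energy in some ball. -/
lemma InH.exists_ball_energy {H : Euc d → Euc d} (hw : InH U w H)
    (hk : d = k + 1) {K : ℝ} (hK0 : 0 < K) (hK : ∀ z : Euc d, kerk z ≤ K)
    (hr₀ : 0 < r₀) (hc : ContinuousAt w z)
    (hA : avg w z r₀ - massk d * w z > K * (omd d + 1) * √r₀) :
    ∃ r, 0 < r ∧ r ≤ r₀ ∧ r ^ k < ∫ y in closedBall z r, ‖H y‖ ^ 2 := by
  by_contra! hcon
  have hd : ∀ s, 0 < s → s ≤ r₀ → |deriv (avg w z) s| ≤ K * (omd d + 1) / (2 * √s) := fun s hs hsr => by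
    rw [(hasDerivAt_avg hw.weakGrad z hs).deriv, abs_neg, abs_mul, abs_of_pos (by positivity)]
    have i1 : IntegrableOn (fun y => ‖H y‖) (closedBall z s) :=
      (hw.weakGrad.locG.integrableOn_isCompact (isCompact_closedBall z s)).norm
    have h1 : |∫ y, ⟪H y, gradient (bumpK z s) y⟫| ≤ ∫ y in closedBall z s, ‖H y‖ * (s⁻¹ * K) := by
      rw [← integral_indicator isClosed_closedBall.measurableSet, ← Real.norm_eq_abs]
      refine norm_integral_le_of_norm_le (IntegrableOn.integrable_indicator (i1.mul_const _)
        isClosed_closedBall.measurableSet) (.of_forall fun y => ?_)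
      refine (norm_inner_le_norm _ _).trans ?_
      rw [gradient_bumpK]
      by_cases hy : y ∈ closedBall z s
      · rw [indicator_of_mem hy, norm_smul, norm_neg, Real.norm_of_nonneg
          (mul_nonneg (by positivity) (kerk_nonneg _))]
        rw [mem_closedBall, dist_eq_norm] at hy
        calc _ ≤ ‖H y‖ * (s⁻¹ ^ 2 * K * s) := by gcongr; exact hK _
          _ = _ := by field_simp
      · rw [indicator_of_notMem hy, kerk_eq_zero (one_le_norm_scale hs (not_le.1 hy).le)]
        simp
    rw [integral_mul_const] at h1
    have h2 := setIntegral_norm_le hw.memG z hs (inv_pos.2 (Real.sqrt_pos.2 hs))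
    have h3 := hcon s hs hsr
    have hs' : 0 < √s := Real.sqrt_pos.2 hs
    have h4 : ∫ y in closedBall z s, ‖H y‖ ≤ (√s)⁻¹ * s ^ d * (omd d + 1) / 2 := by
      refine h2.trans ?_
      rw [inv_inv]
      have : √s * s ^ k = (√s)⁻¹ * s ^ d := by
        rw [hk, pow_succ]; field_simp; rw [Real.sq_sqrt hs.le]
      nlinarith
    calc _ ≤ s * s⁻¹ ^ d * ((√s)⁻¹ * s ^ d * (omd d + 1) / 2 * (s⁻¹ * K)) := by
          refine mul_le_mul_of_nonneg_left (h1.trans ?_) (by positivity)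
          gcongr
      _ = _ := by rw [inv_pow]; field_simp
  have hmono : AntitoneOn (fun s => avg w z s - K * (omd d + 1) * √s) (Ioc 0 r₀) := by
    refine antitoneOn_of_deriv_nonpos (convex_Ioc _ _) (fun s hs => ?_) (fun s hs => ?_) fun s hs => ?_
    · exact ((hasDerivAt_avg hw.weakGrad z hs.1).continuousAt.sub
        (Real.continuous_sqrt.continuousAt.const_mul _)).continuousWithinAt
    all_goals
      rw [interior_Ioc] at hs
      have h1 := (hasDerivAt_avg hw.weakGrad z hs.1).differentiableAt.hasDerivAt.sub
        ((Real.hasDerivAt_sqrt hs.1.ne').const_mul (K * (omd d + 1)))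
    · exact h1.differentiableAt.differentiableWithinAt
    · have h2 := (abs_le.1 (hd s hs.1 hs.2.le)).2
      rw [show (fun s => avg w z s - K * (omd d + 1) * √s) = avg w z - fun s => K * (omd d + 1) *
          √s from rfl,
        h1.deriv]
      rw [mul_one_div]
      linarith
  have t1 : Tendsto (fun s => avg w z s - K * (omd d + 1) * √s) (𝓝[>] 0) (𝓝 (massk d * w z)) := by
    have := (tendsto_avg_of_continuousAt hw.weakGrad.locV hc).sub ((tendsto_nhdsWithin_of_tendsto_nhds
      (Real.continuous_sqrt.tendsto 0)).const_mul (K * (omd d + 1)))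
    simpa using this
  have h1 := ge_of_tendsto t1 (b := avg w z r₀ - K * (omd d + 1) * √r₀) (by
    filter_upwards [Ioo_mem_nhdsGT hr₀] with s hs
    exact hmono ⟨hs.1, hs.2.le⟩ (right_mem_Ioc.2 hr₀) hs.2.le)
  linarith

/-- The positivity set differs from `Ω` by a set of null Hausdorff measure. -/
lemma RegState.hausdorffMeasure_posSet_diff (h : 𝓡) (hk : d = k + 1) :
    μH[(k : ℝ)] (𝓐 \ Ω) = 0 := by
  obtain ⟨φ, hφ, h1, h2⟩ := h.inH.approx
  have t1 := h1.tendsto_integral_sq (fun n => ((hφ n).inH).memV) h.inH.memV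
  have t2 := h2.tendsto_integral_sq (fun n => ((hφ n).inH).memG) h.inH.memG
  obtain ⟨K, hK0, hK⟩ := exists_kerk_bound (d := d)
  have hm := massk_pos (d := d)
  have ho := omd_pos (d := d)
  have hsub : 𝓐 \ Ω ⊆ ⋃ m : ℕ, {z ∈ D \ Ω | 1 / ((m : ℝ) + 1) < u z} := fun z hz => by
    obtain ⟨m, hm⟩ := exists_nat_one_div_lt hz.1.2
    exact mem_iUnion.2 ⟨m, ⟨hz.1.1, hz.2⟩, hm⟩
  refine measure_mono_null hsub (measure_iUnion_null fun m => ?_)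
  obtain ⟨ε, hε⟩ : ∃ ε : ℝ, ε = 1 / ((m : ℝ) + 1) := ⟨_, rfl⟩
  have hε0 : 0 < ε := by rw [hε]; positivity
  rw [← hε]
  have hw : ∀ n, InH Ω (fun y => φ n y + (-1) * u y) (fun y => gradient (φ n) y + (-1 : ℝ) • G y) :=
    fun n => (hφ n).inH.add (h.inH.const_mul (-1))
  simp only [neg_one_mul, neg_one_smul, ← sub_eq_add_neg] at hw
  have key : ∀ j : ℕ, ∃ n, ∫ y, ‖gradient (φ n) y - G y‖ ^ 2 ≤ (1 / 2) ^ j ∧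
      ∀ z ∈ {z ∈ D \ Ω | ε < u z}, ∃ r, 0 < r ∧ r ≤ (1 / 2) ^ j ∧
        r ^ k < ∫ y in closedBall z r, ‖gradient (φ n) y - G y‖ ^ 2 := fun j => by
    have hs : Tendsto (fun r => K * (omd d + 1) * √r) (𝓝[>] 0) (𝓝 0) := by
      simpa using (tendsto_nhdsWithin_of_tendsto_nhds
        (Real.continuous_sqrt.tendsto 0)).const_mul (K * (omd d + 1))
    obtain ⟨r₀, hr1, hr0, hrj⟩ := ((hs.eventually_lt_const (by positivity : 0 < massk d * ε / 2)).and
      (Ioo_mem_nhdsGT (by positivity : (0 : ℝ) < (1 / 2) ^ j))).exists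
    set τ := massk d * ε / (2 * K * omd d)
    have hτ : 0 < τ := by positivity
    have t3 := t1.const_mul (K * r₀⁻¹ ^ d * τ⁻¹)
    rw [mul_zero] at t3
    obtain ⟨n, hn1, hn2⟩ := ((t3.eventually_lt_const (by positivity : 0 < massk d * ε / 2)).and
      (t2.eventually_lt_const (by positivity : (0 : ℝ) < (1 / 2) ^ j))).exists
    refine ⟨n, hn2.le, fun z hz => ?_⟩
    have hφz : φ n z = 0 := image_eq_zero_of_notMem_tsupport fun hc => hz.1.2 ((hφ n).2.2 hc)
    have hA : |avg (fun y => φ n y - u y) z r₀| ≤ massk d * ε / 2 := by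
      have h3 := abs_avg_sub_le hK (hw n).weakGrad.locV z 0 hr0
      simp only [mul_zero, sub_zero] at h3
      refine h3.trans ((mul_le_mul_of_nonneg_left (setIntegral_norm_le (hw n).memV z hr0 hτ)
        (by positivity)).trans ?_)
      have h4 : ∫ y in closedBall z r₀, ‖φ n y - u y‖ ^ 2 ≤ ∫ y, ‖φ n y - u y‖ ^ 2 :=
        setIntegral_le_integral (integrable_sq_of_memLp (hw n).memV)
          (.of_forall fun _ => by positivity)
      have h5 := mul_le_mul_of_nonneg_left h4 (by positivity : 0 ≤ K * r₀⁻¹ ^ d * τ⁻¹)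
      have h6 : K * r₀⁻¹ ^ d * (τ * (r₀ ^ d * omd d)) = massk d * ε / 2 := by
        simp only [τ, inv_pow]; field_simp
      linarith
    obtain ⟨r, hr, hrr, h7⟩ := (hw n).exists_ball_energy hk hK0 hK hr0
      ((hφ n).continuous.continuousAt.sub (h.continuousAt hz.1.1)) (by
        have h8 := mul_lt_mul_of_pos_left hz.2 hm
        rw [hφz]
        linarith [(abs_le.1 hA).1])
    exact ⟨r, hr, hrr.trans hrj.le, h7⟩
  choose n hn1 hn2 using key
  have hi : ∀ j, Integrable fun y => ‖gradient (φ (n j)) y - G y‖ ^ 2 := fun j =>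
    integrable_sq_of_memLp (hw (n j)).memG
  have hν : ∀ j (S : Set (Euc d)), MeasurableSet S → (volume.withDensity fun y =>
      ofReal (‖gradient (φ (n j)) y - G y‖ ^ 2)) S =
      ofReal (∫ y in S, ‖gradient (φ (n j)) y - G y‖ ^ 2) := fun j S hS => by
    rw [withDensity_apply _ hS, ofReal_integral_eq_lintegral_ofReal (hi j).integrableOn
      (.of_forall fun _ => by positivity)]
  refine hausdorffMeasure_eq_zero (C := 1) ENNReal.one_ne_top (ν := fun j => volume.withDensity fun y =>
    ENNReal.ofReal (‖gradient (φ (n j)) y - G y‖ ^ 2)) ?_ fun j z hz => ?_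
  · simp only [hν _ _ MeasurableSet.univ, setIntegral_univ]
    have : Tendsto (fun j => ∫ y, ‖gradient (φ (n j)) y - G y‖ ^ 2) atTop (𝓝 0) :=
      squeeze_zero (fun _ => by positivity) hn1
        (tendsto_pow_atTop_nhds_zero_of_lt_one (by norm_num) (by norm_num))
    simpa using ENNReal.tendsto_ofReal this
  · obtain ⟨r, hr, hrj, h3⟩ := hn2 j z hz
    refine ⟨r, hr, hrj, ?_⟩
    rw [one_mul, hν _ _ isClosed_closedBall.measurableSet, ← ENNReal.ofReal_pow hr.le]
    exact ENNReal.ofReal_le_ofReal h3.le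

namespace RegState

lemma subset_frontier (h : 𝓡) : 𝓕 ⊆ frontier Ω := by
  have hP : 𝓐 ⊆ closure Ω := fun y hy => by
    by_contra hyc
    exact ((h.isOpen_posSet.sdiff isClosed_closure).measure_pos volume ⟨y, hy, hyc⟩).ne'
      (measure_mono_null (sdiff_subset_sdiff_right subset_closure) h.volume_posSet_diff)
  intro x hx
  rw [h.openΩ.frontier_eq]
  exact ⟨closure_minimal hP isClosed_closure hx.2.2, fun hxΩ => (h.subset_posSet hxΩ).2.ne' hx.2.1⟩

lemma integral_eq (h : 𝓡) (hk : d = k + 1) (hc : 0 < c)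
    (hμ : ∀ B ⊆ 𝓕, MeasurableSet B → μ B = ofReal c * μH[(k : ℝ)] B)
    (hφ : TestFun D φ) :
    ∫ x, φ x ∂μ = c * ∫ x in frontier Ω, φ x ∂μH[(k : ℝ)] := by
  have hφ0 : ∀ x, x ∉ D → φ x = 0 := fun x hx => image_eq_zero_of_notMem_tsupport fun hc => hx (hφ.2.2 hc)
  have hEm := h.measurableSet_freeBdry
  have e1 : μ.restrict 𝓕 = ofReal c • (μH[(k : ℝ)]).restrict 𝓕 :=
    Measure.ext fun B hB => by
      rw [Measure.smul_apply, Measure.restrict_apply hB, Measure.restrict_apply hB, smul_eq_mul,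
        hμ _ inter_subset_right (hB.inter hEm)]
  have e2 : ∫ x in 𝓕, φ x ∂μ = ∫ x, φ x ∂μ := by
    refine setIntegral_eq_integral_of_ae_compl_eq_zero ?_
    filter_upwards [measure_eq_zero_iff_ae_notMem.1 h.measure_diff_freeBdry] with x hx hxE
    exact hφ0 x fun hxD => hx ⟨hxD, hxE⟩
  have e3 : ∫ x in frontier Ω, φ x ∂μH[(k : ℝ)] = ∫ x in 𝓕, φ x ∂μH[(k : ℝ)] := by
    refine setIntegral_eq_of_subset_of_ae_sdiff_eq_zero isClosed_frontier.nullMeasurableSet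
      h.subset_frontier ?_
    filter_upwards [measure_eq_zero_iff_ae_notMem.1 (h.hausdorffMeasure_posSet_diff hk)] with x hx hxE
    refine hφ0 x fun hxD => ?_
    rw [h.openΩ.frontier_eq] at hxE
    rcases (h.nonneg x).eq_or_lt with h1 | h1
    · exact hxE.2 ⟨hxD, h1.symm, closure_mono h.subset_posSet hxE.1.1⟩
    · exact hx ⟨⟨hxD, h1⟩, hxE.1.2⟩
  rw [← e2, e1, integral_smul_measure, e3, ENNReal.toReal_ofReal hc.le, smul_eq_mul]

/-- In dimension one, if the boundary is essentially a single point, so is the measure. -/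
lemma exists_measure_eq_of_unique (h : 𝓡) {x₁ : Euc d}
    (hx₁ : ∀ y, EssBdry D Ω y → y = x₁) : ∃ c : ℝ, 0 < c ∧
      ∀ B ⊆ 𝓕, MeasurableSet B → μ B = ENNReal.ofReal c * μH[((0 : ℕ) : ℝ)] B := by
  have := h.fin
  have hne : ∀ x ∈ 𝓕, ∀ r > 0, μ (ball x r) ≠ 0 := fun x hx r hr h0 => by
    obtain ⟨y, hy, hyP⟩ := mem_closure_iff.1 hx.2.2 _ isOpen_ball (mem_ball_self (half_pos hr))
    exact hyP.2.ne' (h.eq_zero_near h.precise hr h0 hx.2.1 y hy)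
  have hE : 𝓕 ⊆ {x₁} := fun x hx => hx₁ x <| by
    by_contra hn
    obtain ⟨r, hr, h0⟩ := h.null_of_not_essBdry hx.1 hn
    exact hne x hx r hr h0
  obtain ⟨x, hx⟩ := h.exists_freeBdry
  obtain rfl : x = x₁ := hE hx
  obtain ⟨t, ht, htD⟩ := isOpen_iff.1 h.openD x hx.1
  have hfin : μ {x} ≠ ∞ := isCompact_singleton.measure_lt_top.ne
  have hpos : μ {x} ≠ 0 := fun h0 => hne x hx t ht <| by
    refine measure_mono_null (fun y hy => ?_) (measure_union_null h0 h.measure_diff_freeBdry)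
    by_cases hyE : y ∈ 𝓕
    · exact Or.inl (hE hyE)
    · exact Or.inr ⟨htD hy, hyE⟩
  refine ⟨μ.real {x}, ENNReal.toReal_pos hpos hfin, fun B hB _ => ?_⟩
  rcases subset_singleton_iff_eq.1 (hB.trans hE) with rfl | rfl
  · simp
  · rw [Nat.cast_zero, Measure.hausdorffMeasure_zero_singleton, mul_one]
    exact (ENNReal.ofReal_toReal hfin).symm

end RegState

/-- If `D` is open, bounded and connected, for any optimal shape `Ω*` there is a
constant `Λ > 0` with `Δu_{Ω*} + λ₁(Ω*) u_{Ω*} = √Λ · H^{d-1}⌊∂Ω*` in the sense of distributions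
in `D`. -/
theorem measure_representation_of_laplacian
    {d : ℕ} (D : Set (Euc d)) (a : ℝ) (Ωstar : Set (Euc d)) (u : Euc d → ℝ)
    (hD : IsOpen D) (hDb : Bornology.IsBounded D) (hDc : IsConnected D)
    (ha : 0 < a) (ha' : a < mvol D)
    (hopt : IsOptimalShape D a Ωstar)
    (hu : IsFirstEigenfun Ωstar u) (hnn : ∀ x, 0 ≤ u x) :
    ∃ Λ : ℝ, 0 < Λ ∧ ∀ φ : Euc d → ℝ, TestFun D φ →
      lam1 Ωstar * (∫ x, u x * φ x) - (∫ x, ⟪gradient u x, gradient φ x⟫)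
        = Real.sqrt Λ * ∫ x in frontier Ωstar, φ x ∂(μH[(d : ℝ) - 1]) := by
  obtain ⟨μ, hfin, hμ⟩ := (hu.groundState hnn).exists_measure
  obtain ⟨w, -, hw, hwp⟩ := (LapState.mk (hu.groundState hnn) hfin hμ).exists_precise
  have ho : OptState D a Ωstar (lam1 Ωstar) w (fun x => gradient u x) μ :=
    ⟨hw, hD, hDb, hDc, hopt.isOpen, hopt.subset, hopt.meas, ha', hopt.minim⟩
  obtain ⟨k, hk⟩ : ∃ k, d = k + 1 := ⟨d - 1, (Nat.succ_pred_eq_of_pos ho.dim_pos).symm⟩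
  obtain ⟨c, hc, h⟩ : ∃ c : ℝ, 0 < c ∧ ∀ φ : Euc d → ℝ, TestFun D φ →
      ∫ x, φ x ∂μ = c * ∫ x in frontier Ωstar, φ x ∂μH[(k : ℝ)] := by
    rcases ho.exists_multiplier with ⟨Λ, ρ, C, hM⟩ | ⟨hd, x₁, -, hx₁⟩
    · have hr := ho.regState_of_multiplier hwp hM
      obtain ⟨C₀, R₀, hE⟩ := hr.exists_freeBdryEst hM
      obtain ⟨c, hc, h⟩ := hr.exists_measure_eq hM hE hk
      exact ⟨c, hc, fun φ hφ => hr.integral_eq hk hc h hφ⟩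
    · have hr := ho.regState_of_dim_one hwp hd
      obtain rfl : k = 0 := by omega
      obtain ⟨c, hc, h⟩ := hr.exists_measure_eq_of_unique hx₁
      exact ⟨c, hc, fun φ hφ => hr.integral_eq hk hc h hφ⟩
  refine ⟨c ^ 2, by positivity, fun φ hφ => ?_⟩
  rw [Real.sqrt_sq hc.le, show (d : ℝ) - 1 = k by rw [hk]; push_cast; ring, ← h φ hφ,
    hμ φ ⟨hφ.1, hφ.2.1, subset_univ _⟩, dist_lap]

end
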